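/- Let Σ be an affine algebraic variety and X an algebraically elliptic manifold. Given a morphism f: Σ → X, a compact holomorphically convex set K ⊂ Σ, an open neighbourhood U ⊂ Σ of K, and a homotopy of holomorphic maps f_t: U → X for t ∈ [0,1]ⁿ with f_0 = f|_U, there exist algebraic morphisms F: Σ × ℂⁿ → X with F(·, 0) = f such that F(·, t) approximates f_t as closely as desired uniformly for (x, t) ∈ K × [0,1]ⁿ. If in addition the homotopy f_t is fixed on a closed algebraic subvariety Σ′ ⊂ Σ, then F can be chosen with F(x, t) = f(x) for all x ∈ Σ′ and t ∈ ℂⁿ. -/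

import Mathlib

open scoped Manifold Topology LinearAlgebra.Projectivization
open Set Asymptotics

noncomputable section

/-- The quotient topology on projective space. -/
instance {V : Type*} [AddCommGroup V] [Module ℂ V] [TopologicalSpace V] :
    TopologicalSpace (ℙ ℂ V) :=
  inferInstanceAs (TopologicalSpace (Quotient (projectivizationSetoid ℂ V)))

/-- Complex projective `N`-space. -/
abbrev ProjSp (N : ℕ) := ℙ ℂ (Fin (N + 1) → ℂ)

/-- The ratio of the `j`-th and `i`-th homogeneous coordinates of a point of `ℙ^N`
(independent of the chosen representative). -/
def projRatio {N : ℕ} (i j : Fin (N + 1)) (q : ProjSp N) : ℂ := q.rep j / q.rep i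

/-- The `ℓ`-th affine chart of `ℙ^N`. -/
def affChart {N : ℕ} (ℓ : Fin (N + 1)) (q : ProjSp N) : Fin N → ℂ :=
  fun j => q.rep (ℓ.succAbove j) / q.rep ℓ

/-- The common zero set of a family of polynomials in affine space `ℂ^ι`. -/
def AffZeroLocus {ι : Type*} (s : Set (MvPolynomial ι ℂ)) : Set (ι → ℂ) :=
  {x | ∀ P ∈ s, MvPolynomial.eval x P = 0}

/-- An affine algebraic variety: the common zero set of finitely many polynomials. -/
def IsAffineVariety {ι : Type*} (V : Set (ι → ℂ)) : Prop :=
  ∃ s : Finset (MvPolynomial ι ℂ), V = AffZeroLocus (↑s : Set (MvPolynomial ι ℂ))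

/-- A function on a subvariety `S` of affine space is holomorphic on `U ⊆ S` if it locally
extends to a holomorphic function of the ambient space. -/
def HolomorphicOnSubvariety {ι : Type*} [Fintype ι] (S : Set (ι → ℂ)) (h : ↥S → ℂ)
    (U : Set ↥S) : Prop :=
  ∀ p ∈ U, ∃ W : Set (ι → ℂ), IsOpen W ∧ (↑p : ι → ℂ) ∈ W ∧
    (Subtype.val ⁻¹' W : Set ↥S) ⊆ U ∧
    ∃ Hf : (ι → ℂ) → ℂ, DifferentiableOn ℂ Hf W ∧ ∀ q : ↥S, (↑q : ι → ℂ) ∈ W → h q = Hf ↑q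

/-- A map from a subvariety `S` of affine space to `ℙ^N` is holomorphic on `U ⊆ S` if it
locally lifts to a nonvanishing holomorphic map into `ℂ^{N+1} ∖ {0}`. -/
def HoloToProjOn {ι : Type*} [Fintype ι] {N : ℕ} (S : Set (ι → ℂ)) (f : ↥S → ProjSp N)
    (U : Set ↥S) : Prop :=
  ∀ p ∈ U, ∃ W : Set (ι → ℂ), IsOpen W ∧ (↑p : ι → ℂ) ∈ W ∧
    (Subtype.val ⁻¹' W : Set ↥S) ⊆ U ∧
    ∃ G : (ι → ℂ) → (Fin (N + 1) → ℂ), DifferentiableOn ℂ G W ∧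
      ∀ q : ↥S, (↑q : ι → ℂ) ∈ W →
        ∃ hG : G ↑q ≠ 0, f q = Projectivization.mk ℂ (G ↑q) hG

/-- An algebraic morphism (regular map) from a subvariety `S` of affine space to `ℙ^N`:
Zariski-locally it is given by a tuple of polynomials without common zeros. -/
def MorphismToProjOf {ι : Type*} [Fintype ι] {N : ℕ} (S : Set (ι → ℂ))
    (f : ↥S → ProjSp N) : Prop :=
  ∀ p : ↥S, ∃ g : Fin (N + 1) → MvPolynomial ι ℂ,
    (fun j => MvPolynomial.eval (↑p : ι → ℂ) (g j)) ≠ 0 ∧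
    ∀ q : ↥S, ∀ hq : (fun j => MvPolynomial.eval (↑q : ι → ℂ) (g j)) ≠ 0,
      f q = Projectivization.mk ℂ _ hq

/-- An affine algebraic Riemann surface: a smooth connected closed affine algebraic curve
(equivalently, the complement of finitely many points in a compact Riemann surface). -/
def IsAffineAlgebraicRiemannSurface {ι : Type*} [Fintype ι] (R : Set (ι → ℂ)) : Prop :=
  IsAffineVariety R ∧ IsConnected R ∧
  ∀ p ∈ R, ∃ (W : Set (ι → ℂ)) (V : Set ℂ) (φ : ℂ → ι → ℂ),
    IsOpen W ∧ p ∈ W ∧ IsOpen V ∧ DifferentiableOn ℂ φ V ∧ InjOn φ V ∧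
    (∀ z ∈ V, fderiv ℂ φ z ≠ 0) ∧ R ∩ W = φ '' V

/-- A Runge (that is, `𝒪(S)`-convex) compact set in an affine variety `S`. -/
def IsRungeCompactIn {ι : Type*} [Fintype ι] (S : Set (ι → ℂ)) (K : Set ↥S) : Prop :=
  IsCompact K ∧ ∀ x : ↥S, x ∉ K →
    ∃ h : ↥S → ℂ, HolomorphicOnSubvariety S h univ ∧ (⨆ y ∈ K, ‖h y‖) < ‖h x‖

/-- Two maps from a curve `R` to `ℙ^N` agree to order `k` at the point `a`:
in every local holomorphic parametrisation of `R` at `a` and every affine chart of `ℙ^N` at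
the common value, the difference of the two maps vanishes to order `k`. -/
def AgreeToOrderOnCurveAt {ι : Type*} [Fintype ι] {N : ℕ} (R : Set (ι → ℂ))
    (F f : ↥R → ProjSp N) (k : ℕ) (a : ↥R) : Prop :=
  F a = f a ∧
  ∀ (V : Set ℂ) (φ : ℂ → ι → ℂ) (z₀ : ℂ), IsOpen V → z₀ ∈ V →
    DifferentiableOn ℂ φ V → ∀ hφR : ∀ z ∈ V, φ z ∈ R, φ z₀ = (↑a : ι → ℂ) →
    fderiv ℂ φ z₀ ≠ 0 →
    ∀ i j : Fin (N + 1), (f a).rep i ≠ 0 →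
      (fun z => @dite _ (z ∈ V) (Classical.propDecidable _)
          (fun hz => projRatio i j (F ⟨φ z, hφR z hz⟩) - projRatio i j (f ⟨φ z, hφR z hz⟩))
          (fun _ => 0)) =o[𝓝 z₀] fun z => ‖z - z₀‖ ^ k

/-- A complex algebraic manifold `X ⊆ ℙ^N` is algebraically Oka-1 (aOka-1) if for every
affine algebraic Riemann surface `R`, every Runge compact `K ⊆ R`, every finite `A ⊆ K`,
every continuous map `f : R → X` holomorphic on a neighbourhood of `K`, every `ε > 0` and
every `k ∈ ℕ`, there is an algebraic morphism `F : R → X` homotopic to `f`, with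
`dist (F p) (f p) < ε` for `p ∈ K` (for any metric inducing the topology of `X`), which
agrees with `f` to order `k` at every point of `A`. -/
def IsAOka1 {N : ℕ} (X : Set (ProjSp N)) : Prop :=
  ∀ (M : ℕ) (R : Set (Fin M → ℂ)), IsAffineAlgebraicRiemannSurface R →
  ∀ K : Set ↥R, IsRungeCompactIn R K →
  ∀ A : Set ↥R, A.Finite → A ⊆ K →
  ∀ (f : C(↥R, ↥X)) (U : Set ↥R), IsOpen U → K ⊆ U →
    HoloToProjOn R (fun p => (↑(f p) : ProjSp N)) U →
  ∀ ε : ℝ, 0 < ε → ∀ k : ℕ,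
  ∀ dX : MetricSpace ↥X,
    dX.toPseudoMetricSpace.toUniformSpace.toTopologicalSpace
      = (inferInstance : TopologicalSpace ↥X) →
  ∃ F : C(↥R, ↥X), MorphismToProjOf R (fun p => (↑(F p) : ProjSp N)) ∧ F.Homotopic f ∧
    (∀ p ∈ K, @dist _ dX.toPseudoMetricSpace.toDist (F p) (f p) < ε) ∧
    ∀ a ∈ A, AgreeToOrderOnCurveAt R (fun p => (↑(F p) : ProjSp N))
      (fun p => (↑(f p) : ProjSp N)) k a

/-- The zero set in `ℙ^N` of a family of (homogeneous) polynomials. -/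
def ProjZeroLocus {N : ℕ} (s : Set (MvPolynomial (Fin (N + 1)) ℂ)) : Set (ProjSp N) :=
  {q | ∀ P ∈ s, MvPolynomial.eval q.rep P = 0}

/-- A projective algebraic variety in `ℙ^N`. -/
def IsProjectiveVariety {N : ℕ} (X : Set (ProjSp N)) : Prop :=
  ∃ s : Finset (MvPolynomial (Fin (N + 1)) ℂ),
    (∀ P ∈ s, ∃ d, P.IsHomogeneous d) ∧ X = ProjZeroLocus (↑s : Set _)

/-- The affine cone (without the origin) over a subset of `ℙ^N`. -/
def projCone {N : ℕ} (X : Set (ProjSp N)) : Set (Fin (N + 1) → ℂ) :=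
  {v | ∃ hv : v ≠ 0, Projectivization.mk ℂ v hv ∈ X}

/-- `X ⊆ ℙ^N` is a complex submanifold of dimension `n`: its affine cone is locally cut out
by holomorphic submersions with `N - n` components. -/
def IsSmoothOfDim {N : ℕ} (X : Set (ProjSp N)) (n : ℕ) : Prop :=
  ∀ v ∈ projCone X, ∃ (W : Set (Fin (N + 1) → ℂ)) (g : (Fin (N + 1) → ℂ) → Fin (N - n) → ℂ),
    IsOpen W ∧ v ∈ W ∧ DifferentiableOn ℂ g W ∧
    (∀ w ∈ W, Function.Surjective (fderiv ℂ g w)) ∧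
    projCone X ∩ W = {w ∈ W | g w = 0}

/-- A complex algebraic manifold: a smooth quasi-projective subvariety of `ℙ^N`. -/
def IsAlgebraicManifold {N : ℕ} (X : Set (ProjSp N)) (n : ℕ) : Prop :=
  (∃ Y Z : Set (ProjSp N), IsProjectiveVariety Y ∧ IsProjectiveVariety Z ∧ X = Y \ Z) ∧
  IsSmoothOfDim X n

/-- A projective manifold: a smooth projective subvariety of `ℙ^N`. -/
def IsProjectiveManifold {N : ℕ} (X : Set (ProjSp N)) (n : ℕ) : Prop :=
  IsProjectiveVariety X ∧ IsSmoothOfDim X n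



/-- An algebraic morphism between (quasi-)projective varieties `X ⊆ ℙ^N` and `Y ⊆ ℙ^{N'}`:
at every point it is given by a tuple of homogeneous polynomials of the same degree without
common zeros. -/
def MorphismOfQP {N N' : ℕ} (X : Set (ProjSp N)) (Y : Set (ProjSp N')) (F : ↥X → ↥Y) : Prop :=
  ∀ p : ↥X, ∃ (g : Fin (N' + 1) → MvPolynomial (Fin (N + 1)) ℂ) (d : ℕ),
    (∀ j, (g j).IsHomogeneous d) ∧
    (fun j => MvPolynomial.eval (↑p : ProjSp N).rep (g j)) ≠ 0 ∧
    ∀ q : ↥X, ∀ hq : (fun j => MvPolynomial.eval (↑q : ProjSp N).rep (g j)) ≠ 0,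
      (↑(F q) : ProjSp N') = Projectivization.mk ℂ _ hq

/-- An algebraic morphism defined on a subset `U` of `ℙ^N`. -/
def MorphismOnSubset {N N' : ℕ} (U : Set (ProjSp N)) (F : ProjSp N → ProjSp N') : Prop :=
  ∀ q ∈ U, ∃ (g : Fin (N' + 1) → MvPolynomial (Fin (N + 1)) ℂ) (d : ℕ),
    (∀ j, (g j).IsHomogeneous d) ∧
    (fun j => MvPolynomial.eval (Projectivization.rep q) (g j)) ≠ 0 ∧
    ∀ q' ∈ U, ∀ hq : (fun j => MvPolynomial.eval (Projectivization.rep q') (g j)) ≠ 0,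
      F q' = Projectivization.mk ℂ _ hq

/-- Birational equivalence of (quasi-)projective varieties: mutually inverse rational maps,
defined and regular on dense Zariski-open subsets. -/
def BirationallyEquivalent {N N' : ℕ} (X : Set (ProjSp N)) (Y : Set (ProjSp N')) : Prop :=
  ∃ (C : Set (ProjSp N)) (C' : Set (ProjSp N'))
    (F : ProjSp N → ProjSp N') (G : ProjSp N' → ProjSp N),
    IsProjectiveVariety C ∧ IsProjectiveVariety C' ∧
    MorphismOnSubset (X \ C) F ∧ MorphismOnSubset (Y \ C') G ∧
    MapsTo F (X \ C) Y ∧ MapsTo G (Y \ C') X ∧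
    X ⊆ closure ((X \ C) ∩ F ⁻¹' (Y \ C')) ∧
    Y ⊆ closure ((Y \ C') ∩ G ⁻¹' (X \ C)) ∧
    (∀ q ∈ (X \ C) ∩ F ⁻¹' (Y \ C'), G (F q) = q) ∧
    (∀ q ∈ (Y \ C') ∩ G ⁻¹' (X \ C), F (G q) = q)

/-- A Zariski-open subset of `X ⊆ ℙ^N`. -/
def ZariskiOpenIn {N : ℕ} (X : Set (ProjSp N)) (U : Set ↥X) : Prop :=
  ∃ C : Set (ProjSp N), IsProjectiveVariety C ∧ U = {p : ↥X | (↑p : ProjSp N) ∉ C}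

/-- A regular (algebraic) function on a subset `U` of a variety `X ⊆ ℙ^N`: locally a ratio
of homogeneous polynomials of the same degree. -/
def RegularFunOn {N : ℕ} (X : Set (ProjSp N)) (c : ↥X → ℂ) (U : Set ↥X) : Prop :=
  ∀ p ∈ U, ∃ (P Q : MvPolynomial (Fin (N + 1)) ℂ) (d : ℕ),
    P.IsHomogeneous d ∧ Q.IsHomogeneous d ∧
    MvPolynomial.eval (↑p : ProjSp N).rep Q ≠ 0 ∧
    ∀ q ∈ U, MvPolynomial.eval (↑q : ProjSp N).rep Q ≠ 0 →
      c q = MvPolynomial.eval (↑q : ProjSp N).rep P / MvPolynomial.eval (↑q : ProjSp N).rep Q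

/-- An algebraic manifold `X ⊆ ℙ^N` of dimension `n` is algebraically elliptic: it carries a
dominating algebraic spray `s : E → X` defined on the total space of an algebraic vector
bundle `E → X` (with algebraic zero section `z`, Zariski-locally trivial with fibrewise
linear transition maps), i.e. `s ∘ z = id` and for every `x ∈ X` the differential at `0_x`
of the restriction of `s` to the fibre `E_x` is surjective onto `T_x X` (equivalently, has
rank `n = dim X`). -/
def IsAlgebraicallyElliptic {N : ℕ} (n : ℕ) (X : Set (ProjSp N)) : Prop :=
  ∃ (K kE : ℕ) (Etot : Set (ProjSp K)), IsAlgebraicManifold Etot kE ∧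
  ∃ (π : ↥Etot → ↥X) (z : ↥X → ↥Etot) (s : ↥Etot → ↥X),
    MorphismOfQP Etot X π ∧ MorphismOfQP X Etot z ∧ MorphismOfQP Etot X s ∧
    (∀ x, π (z x) = x) ∧ (∀ x, s (z x) = x) ∧
    ∃ (ι : Type) (U : ι → Set ↥X) (r : ι → ℕ)
      (c : ∀ i, ↥Etot → (Fin (r i) → ℂ)) (ψ : ∀ i, ↥X → (Fin (r i) → ℂ) → ↥Etot),
      (∀ i, ZariskiOpenIn X (U i)) ∧ (⋃ i, U i) = univ ∧
      (∀ i (j : Fin (r i)), RegularFunOn Etot (fun e => c i e j) (π ⁻¹' U i)) ∧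
      (∀ i, ∀ x ∈ U i, ∀ v, π (ψ i x v) = x ∧ c i (ψ i x v) = v) ∧
      (∀ i, ∀ e : ↥Etot, π e ∈ U i → ψ i (π e) (c i e) = e) ∧
      (∀ i, ∀ x ∈ U i, c i (z x) = 0) ∧
      (∀ i, ∃ (g : Fin (K + 1) → MvPolynomial (Fin (N + 1) ⊕ Fin (r i)) ℂ) (d : ℕ),
        (∀ a, (g a).IsWeightedHomogeneous (Sum.elim (fun _ => (1 : ℕ)) fun _ => 0) d) ∧
        ∀ x ∈ U i, ∀ v,
          ∃ hg : (fun a =>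
              MvPolynomial.eval (Sum.elim (↑x : ProjSp N).rep v) (g a)) ≠ 0,
            (↑(ψ i x v) : ProjSp K) = Projectivization.mk ℂ _ hg) ∧
      (∀ i i', ∀ x : ↥X, x ∈ U i → x ∈ U i' →
        ∃ T : (Fin (r i) → ℂ) →ₗ[ℂ] (Fin (r i') → ℂ),
          ∀ e : ↥Etot, π e = x → c i' e = T (c i e)) ∧
      (∀ x : ↥X, ∃ i, x ∈ U i ∧ ∃ ℓ : Fin (N + 1), (↑x : ProjSp N).rep ℓ ≠ 0 ∧
        Module.finrank ℂ
          (LinearMap.range ((fderiv ℂ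
            (fun v : Fin (r i) → ℂ => affChart ℓ (↑(s (ψ i x v)) : ProjSp N)) 0)
              : (Fin (r i) → ℂ) →ₗ[ℂ] (Fin N → ℂ))) = n)

/-- A morphism `ℙ¹ → ℙ^N` (a rational curve): given by a tuple of homogeneous polynomials in
two variables of the same degree without common zeros. -/
def MorphismFromP1 {N : ℕ} (F : ProjSp 1 → ProjSp N) : Prop :=
  ∃ (g : Fin (N + 1) → MvPolynomial (Fin 2) ℂ) (d : ℕ),
    (∀ j, (g j).IsHomogeneous d) ∧
    ∀ q : ProjSp 1, ∃ h : (fun j => MvPolynomial.eval q.rep (g j)) ≠ 0,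
      F q = Projectivization.mk ℂ _ h

/-- A (connected) subvariety `X ⊆ ℙ^N` is rationally connected: any two of its points lie on
the image of a morphism `ℙ¹ → X`. -/
def IsRationallyConnected {N : ℕ} (X : Set (ProjSp N)) : Prop :=
  ∀ p ∈ X, ∀ q ∈ X, ∃ F : ProjSp 1 → ProjSp N, MorphismFromP1 F ∧
    range F ⊆ X ∧ p ∈ range F ∧ q ∈ range F



/-- The cylinder `S × ℂⁿ` over an affine variety `S ⊆ ℂ^M`, as an affine variety in
`ℂ^{M+n}`. -/
def cylinderVariety {M : ℕ} (n : ℕ) (S : Set (Fin M → ℂ)) : Set ((Fin M ⊕ Fin n) → ℂ) :=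
  {w | (fun i => w (Sum.inl i)) ∈ S}

/-- The point `(x, t)` of the cylinder `S × ℂⁿ`. -/
def cylPt {M n : ℕ} {S : Set (Fin M → ℂ)} (x : ↥S) (t : Fin n → ℂ) :
    ↥(cylinderVariety n S) :=
  ⟨Sum.elim (↑x : Fin M → ℂ) t, x.2⟩

/-- The unit cube `[0,1]ⁿ ⊆ ℝⁿ`. -/
def unitCube (n : ℕ) : Set (Fin n → ℝ) := {t | ∀ i, t i ∈ Icc (0 : ℝ) 1}

open MvPolynomial (X C eval aeval aeval_eq_eval continuous_eval eval_X rename mem_support_iff eval_C eval_rename aeval_X eval_eq)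
open Sum (elim inl inr elim_inl elim_inr)
open RingHom (ker)
open Finset (sum_congr mul_sum sum_sub_distrib single_le_sum sum_mul sum_comm sum_add_distrib prod_mul_distrib sum_insert sum_eq_zero prod_pow_eq_pow_sum sum_const)
open Matrix (mulVec_mulVec vecMulVec mulVec vecMulVec_apply mulVec_smul smul_mulVec smul_mul)
open Complex (exp I norm_real norm_I log)
open Metric (ball isOpen_ball closedBall_mem_nhds)
open Function (update comp_apply Injective Surjective ne_iff update_of_ne)
open Filter (eventually_all Tendsto Eventually mem_of_superset)
open Real (norm_of_nonneg)
open Projectivization (mk)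
open intervalIntegral (integral_congr integral_const_mul)
open Submodule (mem_sup)
open Ideal (span)
open Algebra (FiniteType)
open Fin (tail cons)

local notation:max "ℂ^" n:max => Fin n → ℂ
local notation:max "ℂ[" n "]" => MvPolynomial (Fin n) ℂ

section HolomorphicBasics

open Filter Metric

variable {E : Type*} [NormedAddCommGroup E] [NormedSpace ℂ E]
  {F : Type*} [NormedAddCommGroup F] [NormedSpace ℂ F]

theorem norm_fderiv_le_of_norm_le_on_ball {f : E → F} {c : E} {R M : ℝ} (hR : 0 < R)
    (hd : DifferentiableOn ℂ f (ball c R)) (hM : ∀ w ∈ ball c R, ‖f w‖ ≤ M) :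
    ‖fderiv ℂ f c‖ ≤ 2 * M / R := by
  refine Complex.norm_fderiv_le_div_of_mapsTo_ball hd (fun w hw => ?_) hR
  rw [mem_closedBall, dist_eq_norm]
  linarith [norm_sub_le (f w) (f c), hM w hw, hM c (mem_ball_self hR)]

theorem continuousOn_fderiv_of_differentiableOn [FiniteDimensional ℂ E] {f : E → F} {V : Set E}
    (hV : IsOpen V) (hf : DifferentiableOn ℂ f V) : ContinuousOn (fderiv ℂ f) V := by
  have : ProperSpace E := FiniteDimensional.proper ℂ E
  intro z hz
  obtain ⟨r, hr, hrV⟩ := Metric.isOpen_iff.1 hV z hz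
  have hcpt : IsCompact (closedBall z (r / 2)) := isCompact_closedBall _ _
  have hsub : closedBall z (r / 2) ⊆ V := (closedBall_subset_ball (by linarith)).trans hrV
  have huc := hcpt.uniformContinuousOn_of_continuous (hf.continuousOn.mono hsub)
  refine ContinuousAt.continuousWithinAt ?_
  rw [Metric.continuousAt_iff]
  intro ε hε
  obtain ⟨δ, hδ, huc⟩ := Metric.uniformContinuousOn_iff.1 huc (ε * r / 16) (by positivity)
  refine ⟨min δ (r / 4), by positivity, fun {w} hw => ?_⟩
  have hw1 : dist w z < δ := hw.trans_le (min_le_left _ _)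
  have hw2 : dist w z < r / 4 := hw.trans_le (min_le_right _ _)
  have hdw : DifferentiableAt ℂ f w := (hf.differentiableAt (hV.mem_nhds (hrV (by
    rw [mem_ball]; linarith))))
  have hdz : DifferentiableAt ℂ f z := hf.differentiableAt (hV.mem_nhds hz)
  set g : E → F := fun u => f (u + (w - z)) - f u with hg
  have hgd : DifferentiableOn ℂ g (ball z (r / 4)) := by
    intro u hu
    have hu' : dist u z < r / 4 := hu
    have h1 : DifferentiableAt ℂ f u := hf.differentiableAt (hV.mem_nhds (hrV (by
      rw [mem_ball]; linarith)))
    have h2 : DifferentiableAt ℂ f (u + (w - z)) := hf.differentiableAt (hV.mem_nhds (hrV (by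
      rw [mem_ball, dist_eq_norm, show u + (w - z) - z = (u - z) + (w - z) by abel]
      rw [dist_eq_norm] at hu' hw2
      have := norm_add_le (u - z) (w - z)
      linarith)))
    exact ((h2.comp u (differentiableAt_id.add_const _)).sub h1).differentiableWithinAt
  have hgM : ∀ u ∈ ball z (r / 4), ‖g u‖ ≤ ε * r / 16 := by
    intro u hu
    have hu' : dist u z < r / 4 := hu
    have := huc (u + (w - z)) (by
      rw [mem_closedBall, dist_eq_norm, show u + (w - z) - z = (u - z) + (w - z) by abel]
      rw [dist_eq_norm] at hu' hw2
      have := norm_add_le (u - z) (w - z)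
      linarith) u (by rw [mem_closedBall]; linarith) (by
      rw [dist_eq_norm] at hw1 ⊢
      simpa using hw1)
    rw [dist_eq_norm] at this
    exact this.le
  have hle := norm_fderiv_le_of_norm_le_on_ball (by positivity) hgd hgM
  have hfd : fderiv ℂ g z = fderiv ℂ f w - fderiv ℂ f z := by
    have h2 : DifferentiableAt ℂ (fun u => f (u + (w - z))) z := by
      refine DifferentiableAt.comp z ?_ (differentiableAt_id.add_const _)
      simpa using hdw
    rw [hg, fderiv_fun_sub h2 hdz, fderiv_comp_add_right]
    simp
  rw [dist_eq_norm, ← hfd]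
  refine hle.trans_lt ?_
  rw [div_lt_iff₀ (by positivity)]
  nlinarith

theorem differentiableOn_of_tendstoUniformlyOn [CompleteSpace F] {f : ℕ → E → F} {g : E → F}
    {V : Set E} (hV : IsOpen V) (hf : ∀ k, DifferentiableOn ℂ (f k) V)
    (hfg : TendstoUniformlyOn f g atTop V) : DifferentiableOn ℂ g V := by
  intro z hz
  obtain ⟨r, hr, hrV⟩ := Metric.isOpen_iff.1 hV z hz
  have hcau : UniformCauchySeqOn (fun k => fderiv ℂ (f k)) atTop (ball z (r / 2)) := by
    rw [Metric.uniformCauchySeqOn_iff]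
    intro ε hε
    obtain ⟨N, hN⟩ := Metric.uniformCauchySeqOn_iff.1 hfg.uniformCauchySeqOn (ε * r / 8)
      (by positivity)
    refine ⟨N, fun m hm k hk x hx => ?_⟩
    have hxV : ball x (r / 2) ⊆ V := by
      refine Subset.trans (fun u hu => ?_) hrV
      have h1 : dist u x < r / 2 := hu
      have h2 : dist x z < r / 2 := hx
      have := dist_triangle u x z
      rw [mem_ball]; linarith
    have hx0 : x ∈ V := hxV (mem_ball_self (by positivity))
    have h := norm_fderiv_le_of_norm_le_on_ball (f := f m - f k) (c := x) (R := r / 2)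
      (M := ε * r / 8) (by positivity) (((hf m).sub (hf k)).mono hxV) (fun w hw => by
        have := hN m hm k hk w (hxV hw)
        rw [dist_eq_norm] at this
        exact this.le)
    rw [fderiv_sub ((hf m).differentiableAt (hV.mem_nhds hx0))
      ((hf k).differentiableAt (hV.mem_nhds hx0))] at h
    rw [dist_eq_norm]
    refine h.trans_lt ?_
    rw [div_lt_iff₀ (by positivity)]
    nlinarith
  have hlim : ∀ x ∈ ball z (r / 2), ∃ L, Tendsto (fun k => fderiv ℂ (f k) x) atTop (𝓝 L) :=
    fun x hx => cauchySeq_tendsto_of_complete (hcau.cauchySeq hx)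
  choose! g' hg' using hlim
  have hsub : ball z (r / 2) ⊆ V := (ball_subset_ball (by linarith)).trans hrV
  have := hasFDerivAt_of_tendstoUniformlyOn (𝕜 := ℂ) isOpen_ball
    (hcau.tendstoUniformlyOn_of_tendsto hg')
    (fun k x hx => ((hf k).differentiableAt (hV.mem_nhds (hsub hx))).hasFDerivAt)
    (fun x hx => hfg.tendsto_at (hsub hx)) (mem_ball_self (by positivity : (0:ℝ) < r / 2))
  exact this.differentiableAt.differentiableWithinAt

theorem differentiableOn_integral_of_differentiableOn_prod [FiniteDimensional ℂ E]
    [CompleteSpace F]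
    {Φ : E × ℂ → F} {Ω : Set (E × ℂ)} (hΩ : IsOpen Ω) (hΦ : DifferentiableOn ℂ Φ Ω)
    {γ : ℝ → ℂ} (hγ : Continuous γ) {a b : ℝ} {V : Set E}
    (hVΩ : ∀ z ∈ V, ∀ y ∈ uIcc a b, (z, γ y) ∈ Ω) {h : ℝ → ℂ} (hh : Continuous h) :
    DifferentiableOn ℂ (fun z => ∫ y in a..b, h y • Φ (z, γ y)) V := by
  intro z hz
  have : ProperSpace E := FiniteDimensional.proper ℂ E
  refine DifferentiableAt.differentiableWithinAt ?_
  have hcont' : ContinuousOn (fderiv ℂ Φ) Ω := continuousOn_fderiv_of_differentiableOn hΩ hΦ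
  obtain ⟨T, u, hTo, huo, hzT, hau, hTu⟩ := generalized_tube_lemma
    (isCompact_singleton (x := z)) (isCompact_uIcc (a := a) (b := b))
    (hΩ.preimage (by fun_prop : Continuous fun p : E × ℝ => (p.1, γ p.2)))
    (by rintro ⟨x, y⟩ ⟨rfl, hy⟩; exact hVΩ _ hz y hy)
  obtain ⟨r, hr, hrT⟩ := Metric.isOpen_iff.1 hTo z (hzT rfl)
  have hmem : ∀ x ∈ closedBall z (r / 2), ∀ y ∈ uIcc a b, (x, γ y) ∈ Ω := fun x hx y hy =>
    hTu (show (x, y) ∈ T ×ˢ u from ⟨hrT (closedBall_subset_ball (by linarith) hx), hau hy⟩)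
  have hcptm : IsCompact (closedBall z (r / 2) ×ˢ uIcc a b) :=
    (isCompact_closedBall _ _).prod isCompact_uIcc
  set F' : E → ℝ → E →L[ℂ] F := fun x y =>
    h y • (fderiv ℂ Φ (x, γ y)).comp (ContinuousLinearMap.inl ℂ E ℂ) with hF'
  have hF'c : ContinuousOn (fun p : E × ℝ => F' p.1 p.2) (closedBall z (r / 2) ×ˢ uIcc a b) := by
    refine ContinuousOn.smul (hh.comp continuous_snd).continuousOn ?_
    refine ContinuousOn.clm_comp (hcont'.comp (f := fun p : E × ℝ => (p.1, γ p.2))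
      (by fun_prop) ?_) continuousOn_const
    rintro ⟨x, y⟩ ⟨hx, hy⟩
    exact hmem x hx y hy
  obtain ⟨C, hC⟩ := hcptm.exists_bound_of_continuousOn hF'c
  have hFc : ∀ x ∈ closedBall z (r / 2), ContinuousOn (fun y => h y • Φ (x, γ y)) (uIcc a b) := by
    intro x hx
    refine ContinuousOn.smul hh.continuousOn ?_
    exact hΦ.continuousOn.comp (f := fun y => (x, γ y)) (by fun_prop) (fun y hy => hmem x hx y hy)
  have hball : closedBall z (r / 2) ∈ 𝓝 z := closedBall_mem_nhds _ (by positivity)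
  have key := intervalIntegral.hasFDerivAt_integral_of_dominated_of_fderiv_le (𝕜 := ℂ)
    (μ := MeasureTheory.volume) (a := a) (b := b)
    (F := fun x y => h y • Φ (x, γ y)) (F' := F') (x₀ := z) (bound := fun _ => C) hball
    (by
      filter_upwards [hball] with x hx
      exact ((hFc x hx).intervalIntegrable (μ := MeasureTheory.volume)).aestronglyMeasurable_restrict_uIoc)
    ((hFc z (mem_closedBall_self (by positivity))).intervalIntegrable)
    (by
      have : ContinuousOn (F' z) (uIcc a b) := hF'c.comp (f := fun y => (z, y)) (by fun_prop)
        (fun y hy => ⟨mem_closedBall_self (by positivity), hy⟩)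
      exact (this.intervalIntegrable (μ := MeasureTheory.volume)).aestronglyMeasurable_restrict_uIoc)
    (by
      refine Eventually.of_forall fun y hy x hx => hC (x, y) ⟨hx, uIoc_subset_uIcc hy⟩)
    (by simp)
    (by
      refine Eventually.of_forall fun y hy x hx => ?_
      have h1 : HasFDerivAt Φ (fderiv ℂ Φ (x, γ y)) (x, γ y) :=
        (hΦ.differentiableAt (hΩ.mem_nhds (hmem x hx y (uIoc_subset_uIcc hy)))).hasFDerivAt
      have h2 : HasFDerivAt (fun x : E => (x, γ y)) (ContinuousLinearMap.inl ℂ E ℂ) x :=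
        hasFDerivAt_prodMk_left x (γ y)
      exact (h1.comp x h2).const_smul (h y))
  exact key.differentiableAt

end HolomorphicBasics

section RectangleCauchy

open Complex

/-- The real linear form `Re (I ^ e * w)`. -/
def dirRe (e : Fin 4) (w : ℂ) : ℝ := (I ^ (e : ℕ) * w).re

/-- The closed rectangle cut out by four half-planes. -/
def cRect (ρ : Fin 4 → ℝ) : Set ℂ := {w | ∀ e, dirRe e w ≤ ρ e}

/-- The parametrised `e`-th edge of a rectangle. -/
def edgePt (ρ : Fin 4 → ℝ) (e : Fin 4) (y : ℝ) : ℂ := (-I) ^ (e : ℕ) * (ρ e + y * I)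

/-- The integral of `f` along the `e`-th edge of a rectangle. -/
def edgeInt (ρ : Fin 4 → ℝ) (e : Fin 4) (f : ℂ → ℂ) : ℂ :=
  ∫ y in (-ρ (e + 1))..(ρ (e + 3)), ((-I) ^ (e : ℕ) * I) * f (edgePt ρ e y)

@[simp] theorem dirRe_zero (w : ℂ) : dirRe 0 w = w.re := by simp [dirRe]
@[simp] theorem dirRe_one (w : ℂ) : dirRe 1 w = -w.im := by simp [dirRe]
@[simp] theorem dirRe_two (w : ℂ) : dirRe 2 w = -w.re := by simp [dirRe]
@[simp] theorem dirRe_three (w : ℂ) : dirRe 3 w = w.im := by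
  simp [dirRe, pow_succ]

theorem I_pow_mul_neg_I_pow (e : ℕ) : I ^ e * (-I) ^ e = 1 := by
  rw [← mul_pow]; simp

theorem continuous_edgePt (ρ : Fin 4 → ℝ) (e : Fin 4) : Continuous (edgePt ρ e) := by
  unfold edgePt; fun_prop

theorem continuous_dirRe (e : Fin 4) : Continuous (dirRe e) := by
  unfold dirRe; fun_prop

theorem mem_cRect_iff (ρ : Fin 4 → ℝ) (w : ℂ) :
    w ∈ cRect ρ ↔ w.re ∈ Icc (-ρ 2) (ρ 0) ∧ w.im ∈ Icc (-ρ 1) (ρ 3) := by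
  simp only [cRect, mem_ofPred_eq, Fin.forall_fin_succ, Fin.isValue, mem_Icc]
  have h1 : (Fin.succ (0 : Fin 3)) = 1 := rfl
  have h2 : (Fin.succ (Fin.succ (0 : Fin 2))) = 2 := rfl
  have h3 : (Fin.succ (Fin.succ (Fin.succ (0 : Fin 1)))) = 3 := rfl
  simp only [h1, h2, h3, dirRe_zero, dirRe_one, dirRe_two, dirRe_three]
  constructor
  · rintro ⟨a, b, c, d, -⟩
    exact ⟨⟨by linarith, by linarith⟩, by linarith, by linarith⟩
  · rintro ⟨⟨a, b⟩, c, d⟩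
    exact ⟨by linarith, by linarith, by linarith, by linarith, fun i => i.elim0⟩

theorem edgePt_mem {ρ : Fin 4 → ℝ} (h02 : -ρ 2 ≤ ρ 0) (h13 : -ρ 1 ≤ ρ 3) (e : Fin 4) {y : ℝ}
    (hy : y ∈ uIcc (-ρ (e + 1)) (ρ (e + 3))) : edgePt ρ e y ∈ cRect ρ := by
  rw [mem_cRect_iff]
  fin_cases e
  · replace hy : y ∈ uIcc (-ρ 1) (ρ 3) := hy
    rw [uIcc_of_le h13] at hy
    simpa [edgePt, h02] using hy
  · replace hy : y ∈ uIcc (-ρ 2) (ρ 0) := hy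
    rw [uIcc_of_le h02] at hy
    simpa [edgePt, h13] using hy
  · replace hy : y ∈ uIcc (-ρ 3) (ρ 1) := hy
    rw [uIcc_of_le (by linarith)] at hy
    have h1 := hy.1
    have h2 := hy.2
    simp [edgePt]
    refine ⟨by linarith, by linarith, by linarith⟩
  · replace hy : y ∈ uIcc (-ρ 0) (ρ 2) := hy
    rw [uIcc_of_le (by linarith)] at hy
    have h1 := hy.1
    have h2 := hy.2
    simp [edgePt, pow_succ]
    refine ⟨⟨by linarith, by linarith⟩, by linarith⟩

theorem dirRe_edgePt (ρ : Fin 4 → ℝ) (e : Fin 4) (y : ℝ) : dirRe e (edgePt ρ e y) = ρ e := by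
  rw [dirRe, edgePt, ← mul_assoc, I_pow_mul_neg_I_pow]
  simp

theorem sum_edgeInt_eq_zero {ρ : Fin 4 → ℝ} (h02 : -ρ 2 ≤ ρ 0) (h13 : -ρ 1 ≤ ρ 3) {g : ℂ → ℂ}
    (hc : ContinuousOn g (cRect ρ)) {s : Set ℂ} (hs : s.Countable)
    (hd : ∀ w, (∀ e, dirRe e w < ρ e) → w ∉ s → DifferentiableAt ℂ g w) :
    ∑ e, edgeInt ρ e g = 0 := by
  have key := integral_boundary_rect_eq_zero_of_differentiable_on_off_countable g
    (⟨-ρ 2, -ρ 1⟩) (⟨ρ 0, ρ 3⟩) s hs (by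
      refine hc.mono fun w hw => ?_
      rw [mem_cRect_iff]
      simpa [mem_reProdIm, uIcc_of_le h02, uIcc_of_le h13] using hw) (by
      rintro w ⟨hw, hws⟩
      refine hd w ?_ hws
      simp only [min_eq_left h02, max_eq_right h02, min_eq_left h13, max_eq_right h13,
        mem_reProdIm, mem_Ioo] at hw
      obtain ⟨⟨h1, h2⟩, h3, h4⟩ := hw
      intro e
      fin_cases e
      · simpa using h2
      · simpa using (by linarith : -w.im < ρ 1)
      · simpa using (by linarith : -w.re < ρ 2)
      · simpa using h4)
  have e0 : edgeInt ρ 0 g = I • ∫ y in (-ρ 1)..(ρ 3), g (((ρ 0 : ℝ) : ℂ) + y * I) := by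
    rw [edgeInt, smul_eq_mul, ← integral_const_mul]
    simp [edgePt]
  have e1 : edgeInt ρ 1 g = ∫ x in (-ρ 2)..(ρ 0), g (x + ((-ρ 1 : ℝ) : ℂ) * I) := by
    rw [edgeInt]
    refine integral_congr fun y _ => ?_
    simp only [edgePt, Fin.val_one, pow_one, neg_mul, I_mul_I, neg_neg, one_mul]
    congr 1
    push_cast
    linear_combination (-(y:ℂ)) * I_mul_I
  have e2 : edgeInt ρ 2 g = -(I • ∫ y in (-ρ 1)..(ρ 3), g (((-ρ 2 : ℝ) : ℂ) + y * I)) := by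
    have := intervalIntegral.integral_comp_neg (a := -ρ 3) (b := ρ 1)
      (fun y : ℝ => g (((-ρ 2 : ℝ) : ℂ) + y * I))
    rw [neg_neg] at this
    rw [← this, edgeInt, smul_eq_mul, ← neg_mul, ← integral_const_mul]
    change ∫ y in (-ρ 3)..(ρ 1), _ = _
    refine integral_congr fun y _ => ?_
    simp only [edgePt, Fin.val_two]
    have h2 : (-I) ^ 2 = -1 := by rw [neg_sq, I_sq]
    rw [h2]
    congr 1
    · ring
    · congr 1
      push_cast
      ring
  have e3 : edgeInt ρ 3 g = -∫ x in (-ρ 2)..(ρ 0), g (x + ((ρ 3 : ℝ) : ℂ) * I) := by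
    have := intervalIntegral.integral_comp_neg (a := -ρ 0) (b := ρ 2)
      (fun x : ℝ => g (x + ((ρ 3 : ℝ) : ℂ) * I))
    rw [neg_neg] at this
    rw [← this, edgeInt, ← intervalIntegral.integral_neg]
    change ∫ y in (-ρ 0)..(ρ 2), _ = _
    refine integral_congr fun y _ => ?_
    have h3 : (-I) ^ ((3 : Fin 4) : ℕ) = I := by
      change (-I) ^ 3 = I
      rw [pow_succ, neg_sq, I_sq]; ring
    simp only [edgePt, h3, I_mul_I, neg_mul, one_mul]
    congr 2
    push_cast
    linear_combination ((y:ℂ)) * I_mul_I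
  rw [Fin.sum_univ_four, e0, e1, e2, e3, ← key]
  ring

theorem edgeInt_inv_sub {ρ : Fin 4 → ℝ} {w : ℂ} (hw : ∀ e, dirRe e w < ρ e) (e : Fin 4) :
    edgeInt ρ e (fun ζ => (ζ - w)⁻¹) = Real.pi / 2 * I +
      (log ((ρ (e + 3) - dirRe (e + 3) w : ℝ) - ((ρ e - dirRe e w : ℝ) : ℂ) * I)
      - log ((ρ e - dirRe e w : ℝ) - ((ρ (e + 1) - dirRe (e + 1) w : ℝ) : ℂ) * I)) := by
  set α : Fin 4 → ℝ := fun e => ρ e - dirRe e w with hα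
  have hαpos : ∀ e, 0 < α e := fun e => sub_pos.2 (hw e)
  have him1 : (I ^ (e : ℕ) * w).im = -dirRe (e + 1) w := by
    fin_cases e
    · simp
    · simp
    · change (I ^ 2 * w).im = - dirRe 3 w
      simp
    · change (I ^ 3 * w).im = - dirRe 0 w
      simp [pow_succ]
  have him3 : (I ^ (e : ℕ) * w).im = dirRe (e + 3) w := by
    fin_cases e
    · simp
    · change (I ^ 1 * w).im = dirRe 0 w
      simp
    · change (I ^ 2 * w).im = dirRe 1 w
      simp
    · change (I ^ 3 * w).im = dirRe 2 w
      simp [pow_succ]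
  have hIw : I ^ (e : ℕ) * w = (dirRe e w : ℂ) + ((I ^ (e : ℕ) * w).im : ℂ) * I :=
    (re_add_im _).symm
  have hint : edgeInt ρ e (fun ζ => (ζ - w)⁻¹) =
      ∫ y in (-α (e + 1))..(α (e + 3)), I / (α e + y * I) := by
    have := intervalIntegral.integral_comp_sub_right (a := -ρ (e + 1)) (b := ρ (e + 3))
      (fun y : ℝ => I / (α e + y * I)) ((I ^ (e : ℕ) * w).im)
    rw [show -ρ (e + 1) - (I ^ (e : ℕ) * w).im = -α (e + 1) by rw [him1, hα]; ring,
      show ρ (e + 3) - (I ^ (e : ℕ) * w).im = α (e + 3) by rw [him3]] at this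
    rw [← this, edgeInt]
    refine integral_congr fun y _ => ?_
    have h1 : edgePt ρ e y - w = (-I) ^ (e : ℕ) * (α e + ((y - (I ^ (e : ℕ) * w).im : ℝ) : ℂ) * I) := by
      have h2 : w = (-I) ^ (e : ℕ) * (I ^ (e : ℕ) * w) := by
        rw [← mul_assoc, mul_comm ((-I) ^ (e : ℕ)), I_pow_mul_neg_I_pow, one_mul]
      have h3 : (-I) ^ (e : ℕ) * (I ^ (e : ℕ) * w) =
        (-I) ^ (e : ℕ) * ((dirRe e w : ℂ) + ((I ^ (e : ℕ) * w).im : ℂ) * I) := by rw [← hIw]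
      rw [edgePt]
      conv_lhs => rw [h2, h3]
      rw [hα]
      push_cast
      ring
    have hne : (-I) ^ (e : ℕ) ≠ 0 := pow_ne_zero _ (by simp)
    rw [h1, mul_inv, div_eq_mul_inv]
    field_simp
  have hder : ∀ y : ℝ, HasDerivAt (fun y : ℝ => log (α e + y * I)) (I / (α e + y * I)) y := by
    intro y
    have h1 : HasDerivAt (fun y : ℝ => (α e : ℂ) + y * I) I y := by
      simpa using ((hasDerivAt_id (y : ℂ)).mul_const I |>.const_add (α e : ℂ)).comp_ofReal
    exact h1.clog_real (Or.inl (by simpa using hαpos e))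
  have hne : ∀ y : ℝ, (α e : ℂ) + y * I ≠ 0 := fun y h => by
    have := congrArg re h
    simp at this
    exact (hαpos e).ne' this
  have hcont : Continuous fun y : ℝ => I / ((α e : ℂ) + y * I) :=
    continuous_const.div (by fun_prop) hne
  rw [hint, intervalIntegral.integral_eq_sub_of_hasDerivAt (fun y _ => hder y)
    (hcont.intervalIntegrable _ _)]
  have hrot : log ((α (e + 3) : ℂ) - (α e : ℂ) * I) =
      log ((α e : ℂ) + α (e + 3) * I) - Real.pi / 2 * I := by
    have h1 : ((α (e + 3) : ℂ) - (α e : ℂ) * I) = ((α e : ℂ) + α (e + 3) * I) * (-I) := by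
      linear_combination (α (e + 3) : ℂ) * I_mul_I
    have h2 : 0 ≤ arg ((α e : ℂ) + α (e + 3) * I) := by
      rw [arg_nonneg_iff]; simpa using (hαpos _).le
    have h3 : |arg ((α e : ℂ) + α (e + 3) * I)| < Real.pi / 2 := by
      rw [abs_arg_lt_pi_div_two_iff]; left; simpa using hαpos e
    rw [h1, (log_mul_eq_add_log_iff (hne _) (by simp)).2, log_neg_I]
    · ring
    · rw [arg_neg_I]
      have := Real.pi_pos
      rw [abs_lt] at h3
      constructor <;> linarith
  change _ = _ + (log ((α (e + 3) : ℂ) - (α e : ℂ) * I) - log ((α e : ℂ) - (α (e + 1) : ℂ) * I))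
  rw [hrot]
  push_cast
  ring_nf

theorem sum_edgeInt_inv_sub {ρ : Fin 4 → ℝ} {w : ℂ} (hw : ∀ e, dirRe e w < ρ e) :
    ∑ e, edgeInt ρ e (fun ζ => (ζ - w)⁻¹) = 2 * Real.pi * I := by
  rw [Fin.sum_univ_four, edgeInt_inv_sub hw, edgeInt_inv_sub hw, edgeInt_inv_sub hw,
    edgeInt_inv_sub hw]
  have h1 : (1 : Fin 4) + 3 = 0 := rfl
  have h2 : (2 : Fin 4) + 3 = 1 := rfl
  have h3 : (3 : Fin 4) + 3 = 2 := rfl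
  have h4 : (3 : Fin 4) + 1 = 0 := rfl
  have h5 : (2 : Fin 4) + 1 = 3 := rfl
  have h6 : (1 : Fin 4) + 1 = 2 := rfl
  simp only [h1, h2, h3, h4, h5, h6, zero_add]
  ring

theorem rectangle_cauchy {ρ : Fin 4 → ℝ} {f : ℂ → ℂ} {V : Set ℂ} (hV : IsOpen V)
    (hρV : cRect ρ ⊆ V) (hf : DifferentiableOn ℂ f V) {w : ℂ} (hw : ∀ e, dirRe e w < ρ e) :
    ∑ e, edgeInt ρ e (fun ζ => f ζ * (ζ - w)⁻¹) = 2 * Real.pi * I * f w := by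
  have h02 : -ρ 2 ≤ ρ 0 := by
    have h0 := hw 0; have h2 := hw 2; simp at h0 h2; linarith
  have h13 : -ρ 1 ≤ ρ 3 := by
    have h0 := hw 1; have h2 := hw 3; simp at h0 h2; linarith
  have hwr : w ∈ cRect ρ := fun e => (hw e).le
  have hopen : IsOpen {u : ℂ | ∀ e, dirRe e u < ρ e} := by
    simp only [ofPred_forall]
    exact isOpen_iInter_of_finite fun e => isOpen_lt (continuous_dirRe e) continuous_const
  have hnhds : cRect ρ ∈ 𝓝 w :=
    mem_of_superset (hopen.mem_nhds hw) fun u hu e => (hu e).le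
  have hfc : ContinuousOn (dslope f w) (cRect ρ) :=
    (continuousOn_dslope hnhds).2 ⟨hf.continuousOn.mono hρV,
      hf.differentiableAt (hV.mem_nhds (hρV hwr))⟩
  have hz := sum_edgeInt_eq_zero h02 h13 hfc (countable_singleton w) (fun u hu huw => by
    rw [differentiableAt_dslope_of_ne (by simpa using huw)]
    exact hf.differentiableAt (hV.mem_nhds (hρV fun e => (hu e).le)))
  have hne : ∀ e y, edgePt ρ e y - w ≠ 0 := by
    intro e y h
    have := dirRe_edgePt ρ e y
    rw [sub_eq_zero.1 h] at this
    exact (hw e).ne this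
  have hsplit : ∀ e, edgeInt ρ e (fun ζ => f ζ * (ζ - w)⁻¹) =
      edgeInt ρ e (dslope f w) + f w * edgeInt ρ e (fun ζ => (ζ - w)⁻¹) := by
    intro e
    rw [edgeInt, edgeInt, edgeInt, ← integral_const_mul,
      ← intervalIntegral.integral_add]
    · refine integral_congr fun y _ => ?_
      have h1 := hne e y
      rw [dslope_of_ne _ (sub_ne_zero.1 h1), slope_def_field]
      field_simp
      ring
    · refine ContinuousOn.intervalIntegrable (continuousOn_const.mul ?_)
      exact hfc.comp (continuous_edgePt ρ e).continuousOn fun y hy => edgePt_mem h02 h13 e hy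
    · refine Continuous.intervalIntegrable ?_ _ _
      exact continuous_const.mul (continuous_const.mul
        (((continuous_edgePt ρ e).sub continuous_const).inv₀ (hne e)))
  rw [sum_congr rfl fun e _ => hsplit e, sum_add_distrib, hz, ← mul_sum,
    sum_edgeInt_inv_sub hw]
  ring

end RectangleCauchy

section Boxes

variable {n : ℕ}

/-- The bounds of a box in `ℂⁿ` in the four real directions of every coordinate. -/
abbrev Box (n : ℕ) := Fin n → Fin 4 → ℝ

/-- A compact box in `ℂⁿ`, cut out by real half-spaces. -/
def cBox (r : Box n) : Set ℂ^n := {z | ∀ i e, dirRe e (z i) ≤ r i e}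

/-- The open `s`-thickening of a box. -/
def oBox (r : Box n) (s : ℝ) : Set ℂ^n :=
  {z | ∀ i e, dirRe e (z i) < r i e + s}

/-- Replace the bound of a box in one direction. -/
def setB (r : Box n) (i : Fin n) (e : Fin 4) (c : ℝ) : Box n :=
  update r i (update (r i) e c)

/-- The width of a box in a given direction. -/
def bWidth (r : Box n) (i : Fin n) (e : Fin 4) : ℝ := r i e + r i (e + 2)

section setB

variable {r : Box n} {i j : Fin n} {e e' : Fin 4} {c : ℝ}

theorem setB_same : setB r i e c i e = c := by simp [setB]

theorem setB_of_ne_dir (h : e' ≠ e) : setB r i e c j e' = r j e' := by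
  by_cases hj : j = i
  · subst hj; simp [setB, h]
  · simp [setB, hj]

theorem setB_of_ne (h : j ≠ i) : setB r i e c j e' = r j e' := by
  simp [setB, h]

theorem forall_setB {Q : Fin n → Fin 4 → ℝ → Prop} (h : Q i e c) (hr : ∀ j e', Q j e' (r j e'))
    (j : Fin n) (e' : Fin 4) : Q j e' (setB r i e c j e') := by
  by_cases he : e' = e
  · by_cases hj : j = i
    · subst hj he; rwa [setB_same]
    · rw [setB_of_ne hj]; exact hr _ _
  · rw [setB_of_ne_dir he]; exact hr _ _

theorem setB_le (h : c ≤ r i e) : setB r i e c ≤ r :=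
  forall_setB (Q := fun j e' x => x ≤ r j e') h fun _ _ => le_rfl

theorem setB_mono {r' : Box n} (h : r ≤ r') : setB r i e c ≤ setB r' i e c := by
  simpa [setB, update_le_update_iff] using ⟨fun _ _ => h _ _, fun _ _ => h _⟩

theorem bWidth_mono {r' : Box n} (h : r' ≤ r) (i : Fin n) (e : Fin 4) :
    bWidth r' i e ≤ bWidth r i e := add_le_add (h _ _) (h _ _)

theorem fin4_add_two_ne (e : Fin 4) : e + 2 ≠ e := by decide +revert

/-- The common face of the two halves of a box. -/
abbrev faceB (r : Box n) (i : Fin n) (e : Fin 4) (c : ℝ) : Box n :=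
  setB (setB r i e c) i (e + 2) (-c)

end setB

theorem isOpen_oBox (r : Box n) (s : ℝ) : IsOpen (oBox r s) := by
  simp only [oBox, ofPred_forall]
  exact isOpen_iInter_of_finite fun i => isOpen_iInter_of_finite fun e =>
    isOpen_lt ((continuous_dirRe e).comp (continuous_apply i)) continuous_const

theorem isClosed_cBox (r : Box n) : IsClosed (cBox r) := by
  simp only [cBox, ofPred_forall]
  exact isClosed_iInter fun i => isClosed_iInter fun e =>
    isClosed_le ((continuous_dirRe e).comp (continuous_apply i)) continuous_const

theorem norm_le_of_dirRe_le {w : ℂ} {M : ℝ} (h : ∀ e, dirRe e w ≤ M) : ‖w‖ ≤ 2 * M := by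
  have h0 := h 0; have h1 := h 1; have h2 := h 2; have h3 := h 3
  simp only [dirRe_zero, dirRe_one, dirRe_two, dirRe_three] at h0 h1 h2 h3
  have := Complex.norm_le_abs_re_add_abs_im w
  have h4 : |w.re| ≤ M := abs_le.2 ⟨by linarith, h0⟩
  have h5 : |w.im| ≤ M := abs_le.2 ⟨by linarith, h3⟩
  linarith

theorem dirRe_le_norm (e : Fin 4) (w : ℂ) : dirRe e w ≤ ‖w‖ := by
  refine (Complex.re_le_norm _).trans ?_
  simp

theorem dirRe_sub (e : Fin 4) (w u : ℂ) : dirRe e (w - u) = dirRe e w - dirRe e u := by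
  simp [dirRe, mul_sub]

theorem dirRe_add_two (e : Fin 4) (w : ℂ) : dirRe (e + 2) w = -dirRe e w := by
  fin_cases e
  · simp
  · change dirRe 3 w = - dirRe 1 w
    simp
  · change dirRe 0 w = - dirRe 2 w
    simp
  · change dirRe 1 w = - dirRe 3 w
    simp

theorem isCompact_cBox (r : Box n) : IsCompact (cBox r) := by
  refine Metric.isCompact_of_isClosed_isBounded (isClosed_cBox r) ?_
  refine (Metric.isBounded_iff_subset_closedBall 0).2 ⟨2 * ∑ i, ∑ e, |r i e|, fun z hz => ?_⟩
  rw [mem_closedBall_zero_iff, pi_norm_le_iff_of_nonneg (by positivity)]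
  intro i
  refine norm_le_of_dirRe_le fun e => (hz i e).trans ((le_abs_self _).trans ?_)
  exact (single_le_sum (f := fun e => |r i e|) (fun _ _ => abs_nonneg _)
    (Finset.mem_univ e)).trans (single_le_sum (f := fun i => ∑ e, |r i e|)
      (fun _ _ => Finset.sum_nonneg fun _ _ => abs_nonneg _) (Finset.mem_univ i))

theorem cBox_subset_oBox {r : Box n} {s : ℝ} (hs : 0 < s) : cBox r ⊆ oBox r s :=
  fun _ hz i e => (hz i e).trans_lt (by linarith)

theorem oBox_mono {r r' : Box n} {s s' : ℝ} (hr : r ≤ r') (hs : s ≤ s') :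
    oBox r s ⊆ oBox r' s' :=
  fun _ hz i e => (hz i e).trans_le (add_le_add (hr i e) hs)

theorem cBox_mono {r r' : Box n} (hr : r ≤ r') : cBox r ⊆ cBox r' :=
  fun _ hz i e => (hz i e).trans (hr i e)

/-- Any neighbourhood of a compact box contains a thickening of it. -/
theorem exists_oBox_subset {r : Box n} {W : Set ℂ^n} (hW : IsOpen W)
    (h : cBox r ⊆ W) : ∃ s > 0, oBox r s ⊆ W := by
  have hdir : Directed (fun A B => A ⊇ B)
      (fun k : ℕ => cBox (fun i e => r i e + 1 / ((k : ℝ) + 1))) := by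
    refine (antitone_nat_of_succ_le fun k => cBox_mono fun i e => ?_).directed_ge
    have := one_div_le_one_div_of_le (by positivity : (0 : ℝ) < k + 1)
      (by push_cast; linarith : (k : ℝ) + 1 ≤ ((k + 1 : ℕ) : ℝ) + 1)
    linarith
  have hinter : ⋂ k : ℕ, cBox (fun i e => r i e + 1 / ((k : ℝ) + 1)) ⊆ W := by
    refine Subset.trans (fun z hz => ?_) h
    intro i e
    refine le_of_forall_pos_le_add fun ε hε => ?_
    obtain ⟨k, hk⟩ := exists_nat_one_div_lt hε
    have := mem_iInter.1 hz k i e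
    linarith
  obtain ⟨k, hk⟩ := exists_subset_nhds_of_isCompact' hdir
    (fun k => isCompact_cBox _) (fun k => isClosed_cBox _)
    (fun x hx => hW.mem_nhds (hinter hx))
  exact ⟨1 / ((k : ℝ) + 1), by positivity, fun z hz => hk fun i e => (hz i e).le⟩

/-- `f` is holomorphic near the compact box `r`. -/
def HolNear (r : Box n) (f : ℂ^n → ℂ) : Prop :=
  ∃ s > 0, DifferentiableOn ℂ f (oBox r s)

/-- Bisection: a property of boxes which is local and stable under gluing holds. -/
@[elab_as_elim]
theorem box_induction {P : Box n → Prop} (r₀ : Box n)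
    (hempty : ∀ r, cBox r = ∅ → P r)
    (hlocal : ∀ p ∈ cBox r₀, ∃ ε > 0, ∀ r ≤ r₀, cBox r ⊆ ball p ε → P r)
    (hglue : ∀ (r : Box n) (i : Fin n) (e : Fin 4) (c : ℝ), r ≤ r₀ →
      c ≤ r i e → -c ≤ r i (e + 2) → 0 < bWidth r i e →
      P (setB r i e c) → P (setB r i (e + 2) (-c)) → P r) : P r₀ := by
  choose! ε hε hP using hlocal
  obtain ⟨δ, hδ, hleb⟩ := lebesgue_number_lemma_of_metric (isCompact_cBox r₀)
    (c := fun p : cBox r₀ => ball (p : ℂ^n) (ε p)) (fun _ => isOpen_ball)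
    (fun p hp => mem_iUnion.2 ⟨⟨p, hp⟩, Metric.mem_ball_self (hε p hp)⟩)
  have main : ∀ J : Finset (Fin n × Fin 4), ∀ r ≤ r₀,
      (∀ i e, (i, e) ∉ J → bWidth r i e ≤ δ / 4) → P r := by
    intro J
    induction J using Finset.induction_on with
    | empty =>
      intro r hr hw
      rcases (cBox r).eq_empty_or_nonempty with h | ⟨p, hp⟩
      · exact hempty r h
      obtain ⟨q, hq⟩ := hleb p (cBox_mono hr hp)
      refine hP q q.2 r hr (Subset.trans (fun z hz => ?_) hq)
      rw [Metric.mem_ball, dist_pi_lt_iff hδ]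
      intro i
      rw [dist_eq_norm]
      refine (norm_le_of_dirRe_le (M := δ / 4) fun e => ?_).trans_lt (by linarith)
      have h1 := hz i e
      have h2 := hp i (e + 2)
      have h3 := hw i e (by simp)
      rw [bWidth] at h3
      rw [dirRe_add_two] at h2
      rw [dirRe_sub]
      linarith
    | insert a J ha ih =>
      obtain ⟨i, e⟩ := a
      have ih' : ∀ r ≤ r₀, bWidth r i e ≤ δ / 4 →
          (∀ i' e', (i', e') ∉ insert (i, e) J → bWidth r i' e' ≤ δ / 4) → P r := by
        refine fun r hr hk hw => ih r hr fun i' e' h' => ?_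
        by_cases heq : (i', e') = (i, e)
        · obtain ⟨rfl, rfl⟩ := Prod.mk.inj heq
          exact hk
        · exact hw i' e' (by simp [Finset.mem_insert, heq, h'])
      have inner : ∀ k : ℕ, ∀ r ≤ r₀, bWidth r i e ≤ k * (δ / 4) →
          (∀ i' e', (i', e') ∉ insert (i, e) J → bWidth r i' e' ≤ δ / 4) → P r := by
        intro k
        induction k with
        | zero => exact fun r hr hk => ih' r hr (hk.trans (by push_cast; linarith))
        | succ k ihk =>
          intro r hr hk hw
          rcases le_or_gt (bWidth r i e) (δ / 4) with hsm | hsm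
          · exact ih' r hr hsm hw
          · have hc1 : setB r i e (r i e - δ / 4) ≤ r := setB_le (by linarith)
            have hc2' : -(r i e - δ / 4) ≤ r i (e + 2) := by rw [bWidth] at hsm; linarith
            have hc2 : setB r i (e + 2) (-(r i e - δ / 4)) ≤ r := setB_le hc2'
            refine hglue r i e (r i e - δ / 4) hr (by linarith) hc2' (by linarith)
              (ihk _ (hc1.trans hr) ?_ fun i' e' h' => (bWidth_mono hc1 i' e').trans (hw i' e' h'))
              (ih' _ (hc2.trans hr) ?_ fun i' e' h' => (bWidth_mono hc2 i' e').trans (hw i' e' h'))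
            · rw [bWidth, setB_same, setB_of_ne_dir (fin4_add_two_ne e)]
              rw [bWidth] at hk
              push_cast at hk
              linarith
            · rw [bWidth, setB_same, setB_of_ne_dir (fin4_add_two_ne e).symm]
              linarith
      intro r hr hw
      obtain ⟨k, hk⟩ := exists_nat_ge (bWidth r i e / (δ / 4))
      exact inner k r hr (by rwa [div_le_iff₀ (by positivity)] at hk) hw
  exact main Finset.univ r₀ le_rfl (by simp)

/-- One of the four pieces of the Cauchy integral in the `i`-th variable. -/
def edgeFun (i : Fin n) (ρ : Fin 4 → ℝ) (f : ℂ^n → ℂ) (e : Fin 4) (z : ℂ^n) : ℂ :=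
  (2 * Real.pi * I)⁻¹ *
    edgeInt ρ e (fun ζ => f (update z i ζ) * (ζ - z i)⁻¹)

theorem differentiable_update_prod (i : Fin n) :
    Differentiable ℂ (fun p : ℂ^n × ℂ => update p.1 i p.2) := by
  rw [differentiable_pi]
  intro j
  by_cases h : j = i
  · subst h; simp
  · simpa [h] using (by fun_prop : Differentiable ℂ fun p : ℂ^n × ℂ => p.1 j)

section edgeFun

variable {i : Fin n} {ρ : Fin 4 → ℝ} {f : ℂ^n → ℂ} {Ω : Set ℂ^n}

theorem edgeFun_differentiableOn (hΩ : IsOpen Ω) (hf : DifferentiableOn ℂ f Ω)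
    (h02 : -ρ 2 ≤ ρ 0) (h13 : -ρ 1 ≤ ρ 3) (e : Fin 4) {V : Set ℂ^n}
    (hV : ∀ z ∈ V, dirRe e (z i) < ρ e ∧ ∀ ζ ∈ cRect ρ, update z i ζ ∈ Ω) :
    DifferentiableOn ℂ (edgeFun i ρ f e) V := by
  refine DifferentiableOn.const_mul ?_ _
  have hu := differentiable_update_prod (n := n) i
  set Ω' : Set (ℂ^n × ℂ) :=
    {p | update p.1 i p.2 ∈ Ω} ∩ {p | p.2 ≠ p.1 i} with hΩ'
  have hΩo : IsOpen Ω' := (hΩ.preimage hu.continuous).inter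
    (isOpen_ne_fun continuous_snd (by fun_prop))
  refine differentiableOn_integral_of_differentiableOn_prod (E := ℂ^n)
    (Φ := fun p : ℂ^n × ℂ => f (update p.1 i p.2) * (p.2 - p.1 i)⁻¹)
    hΩo ?_ (continuous_edgePt ρ e) ?_
    (continuous_const : Continuous fun _ : ℝ => (-I) ^ (e : ℕ) * I)
  · refine DifferentiableOn.mul (hf.comp hu.differentiableOn fun p hp => hp.1) ?_
    refine DifferentiableOn.inv (by fun_prop) fun p hp => sub_ne_zero.2 hp.2
  · intro z hz y hy
    refine ⟨(hV z hz).2 _ (edgePt_mem h02 h13 e hy), fun h => ?_⟩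
    replace h : edgePt ρ e y = z i := h
    have := dirRe_edgePt ρ e y
    rw [h] at this
    exact (hV z hz).1.ne this

theorem norm_edgeFun_le (h02 : -ρ 2 ≤ ρ 0) (h13 : -ρ 1 ≤ ρ 3) (e : Fin 4) {z : ℂ^n} {δ τ L : ℝ}
    (hτ : 0 < τ) (hL : ∀ e, ρ e ≤ L)
    (hz : dirRe e (z i) ≤ ρ e - τ) (hδ : ∀ ζ ∈ cRect ρ, ‖f (update z i ζ)‖ ≤ δ) :
    ‖edgeFun i ρ f e z‖ ≤ L * δ / τ := by
  have hle : -ρ (e + 1) ≤ ρ (e + 3) := by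
    fin_cases e
    · exact h13
    · exact h02
    · change -ρ 3 ≤ ρ 1; linarith
    · change -ρ 0 ≤ ρ 2; linarith
  have hδ0 : 0 ≤ δ := (norm_nonneg _).trans (hδ _ (edgePt_mem h02 h13 e left_mem_uIcc))
  have hb : ‖edgeInt ρ e (fun ζ => f (update z i ζ) * (ζ - z i)⁻¹)‖ ≤
      δ / τ * |ρ (e + 3) - (-ρ (e + 1))| := by
    refine intervalIntegral.norm_integral_le_of_norm_le_const fun y hy => ?_
    have h1 := hδ _ (edgePt_mem h02 h13 e (uIoc_subset_uIcc hy))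
    have h2 : τ ≤ ‖edgePt ρ e y - z i‖ := by
      refine le_trans ?_ (dirRe_le_norm e _)
      rw [dirRe_sub, dirRe_edgePt]
      linarith
    rw [norm_mul, norm_mul, norm_mul, norm_pow, norm_neg, norm_I, one_pow, one_mul,
      one_mul, norm_inv, div_eq_mul_inv]
    gcongr
  rw [edgeFun, norm_mul]
  have hpi : ‖(2 * (Real.pi : ℂ) * I)⁻¹‖ ≤ 1 / 2 := by
    rw [norm_inv, norm_mul, norm_mul, norm_I, mul_one, norm_real,
      norm_of_nonneg Real.pi_pos.le, one_div]
    refine inv_anti₀ (by norm_num) ?_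
    have := Real.pi_gt_three
    norm_num; linarith
  have habs : |ρ (e + 3) - (-ρ (e + 1))| ≤ 2 * L := by
    rw [abs_of_nonneg (by linarith)]
    linarith [hL (e + 3), hL (e + 1)]
  calc _ ≤ 1 / 2 * (δ / τ * (2 * L)) := by
        refine mul_le_mul hpi (hb.trans ?_) (norm_nonneg _) (by norm_num)
        exact mul_le_mul_of_nonneg_left habs (by positivity)
    _ = L * δ / τ := by ring

theorem sum_edgeFun (hΩ : IsOpen Ω) (hf : DifferentiableOn ℂ f Ω) {z : ℂ^n}
    (hz : ∀ e, dirRe e (z i) < ρ e) (hzΩ : ∀ ζ ∈ cRect ρ, update z i ζ ∈ Ω) :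
    ∑ e, edgeFun i ρ f e z = f z := by
  have hu := (differentiable_update_prod (n := n) i).comp
    (show Differentiable ℂ (fun ζ : ℂ => (z, ζ)) from
      (differentiable_const z).prodMk differentiable_id)
  have := rectangle_cauchy (ρ := ρ) (f := fun ζ => f (update z i ζ))
    (hΩ.preimage hu.continuous) hzΩ (hf.comp hu.differentiableOn fun _ h => h) hz
  simp only [edgeFun]
  rw [← mul_sum, this, Function.update_eq_self]
  have : (2 * (Real.pi : ℂ) * I) ≠ 0 := by simp [Real.pi_ne_zero]
  field_simp

end edgeFun

/-- The additive Cousin problem on a box cut by a real hyperplane, with bounds. -/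
theorem cousin_splitting (r : Box n) (i : Fin n) (e₀ : Fin 4) (c : ℝ) :
    ∃ C > 0, ∀ s s' : ℝ, 0 ≤ s' → s' < s → s ≤ 1 → ∀ (f : ℂ^n → ℂ) (δ : ℝ), 0 ≤ δ →
      DifferentiableOn ℂ f (oBox (faceB r i e₀ c) s) →
      (∀ z ∈ oBox (faceB r i e₀ c) s, ‖f z‖ ≤ δ) →
      ∃ f₁ f₂ : ℂ^n → ℂ,
        DifferentiableOn ℂ f₁ (oBox (setB r i e₀ c) s') ∧
        DifferentiableOn ℂ f₂ (oBox (setB r i (e₀ + 2) (-c)) s') ∧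
        (∀ z ∈ oBox (faceB r i e₀ c) s', f z = f₁ z - f₂ z) ∧
        (∀ z ∈ oBox (setB r i e₀ c) s', ‖f₁ z‖ ≤ C * δ / (s - s')) ∧
        (∀ z ∈ oBox (setB r i (e₀ + 2) (-c)) s', ‖f₂ z‖ ≤ C * δ / (s - s')) := by
  set r₁ := setB r i e₀ c with hr₁
  set r₂ := setB r i (e₀ + 2) (-c) with hr₂
  set r₁₂ := faceB r i e₀ c with hr₁₂
  have h1 : ∀ e, e ≠ e₀ + 2 → r₁₂ i e = r₁ i e := fun e he => setB_of_ne_dir he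
  have h2 : r₁₂ i (e₀ + 2) = r₂ i (e₀ + 2) := by rw [hr₁₂, faceB, setB_same, hr₂, setB_same]
  have h3 : ∀ j ≠ i, ∀ e, r₁₂ j e = r₁ j e := fun j hj e => setB_of_ne hj
  have h4 : ∀ j ≠ i, ∀ e, r₁₂ j e = r₂ j e := fun j hj e => by
    rw [h3 j hj, hr₁, setB_of_ne hj, hr₂, setB_of_ne hj]
  set L : ℝ := ∑ e, |r₁₂ i e| + 1 with hL
  have hLpos : 0 < L := by positivity
  refine ⟨8 * L, by positivity, fun s s' hs' hss hs1 f δ hδ hf hfδ => ?_⟩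
  set σ := (s - s') / 2 with hσ
  have hσpos : 0 < σ := by rw [hσ]; linarith
  set ρ : Fin 4 → ℝ := fun e => r₁₂ i e + s - σ with hρ
  have hρL : ∀ e, ρ e ≤ L := by
    intro e
    have := single_le_sum (f := fun e => |r₁₂ i e|) (fun _ _ => abs_nonneg _)
      (Finset.mem_univ e)
    have h5 := le_abs_self (r₁₂ i e)
    simp only [hρ, hL] at *
    linarith
  have hρs : ∀ e, ρ e = r₁₂ i e + s' + σ := fun e => by simp only [hρ, hσ]; ring
  by_cases hne : -ρ 2 ≤ ρ 0 ∧ -ρ 1 ≤ ρ 3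
  swap
  · have hemp : oBox r₁₂ s' = ∅ := by
      refine eq_empty_of_forall_notMem fun z hz => hne ?_
      have a0 := hz i 0; have a1 := hz i 1; have a2 := hz i 2; have a3 := hz i 3
      simp only [dirRe_zero, dirRe_one, dirRe_two, dirRe_three] at a0 a1 a2 a3
      rw [hρs, hρs, hρs, hρs]
      constructor <;> linarith
    have h0 : 0 ≤ 8 * L * δ / (s - s') := by
      have : 0 < s - s' := by linarith
      positivity
    exact ⟨0, 0, differentiableOn_const _, differentiableOn_const _, by simp [hemp],
      fun z _ => by simpa using h0, fun z _ => by simpa using h0⟩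
  obtain ⟨h02, h13⟩ := hne
  have hupd : ∀ z : ℂ^n, (∀ j ≠ i, ∀ e, dirRe e (z j) < r₁₂ j e + s) →
      ∀ ζ ∈ cRect ρ, update z i ζ ∈ oBox r₁₂ s := by
    intro z hz ζ hζ j e
    by_cases hj : j = i
    · subst hj
      rw [Function.update_self]
      refine (hζ e).trans_lt ?_
      simp only [hρ]; linarith
    · rw [update_of_ne hj]
      exact hz j hj e
  have hz1 : ∀ z ∈ oBox r₁ s', ∀ j ≠ i, ∀ e, dirRe e (z j) < r₁₂ j e + s :=
    fun z hz j hj e => h3 j hj e ▸ (hz j e).trans (by linarith)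
  have hz2 : ∀ z ∈ oBox r₂ s', ∀ j ≠ i, ∀ e, dirRe e (z j) < r₁₂ j e + s :=
    fun z hz j hj e => h4 j hj e ▸ (hz j e).trans (by linarith)
  have hd1 : ∀ z ∈ oBox r₁ s', ∀ e ≠ e₀ + 2, dirRe e (z i) ≤ ρ e - σ := by
    intro z hz e he
    rw [hρs, h1 e he]
    have := hz i e
    linarith
  have hd2 : ∀ z ∈ oBox r₂ s', dirRe (e₀ + 2) (z i) ≤ ρ (e₀ + 2) - σ := by
    intro z hz
    rw [hρs, h2]
    have := hz i (e₀ + 2)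
    linarith
  have hΩ := isOpen_oBox r₁₂ s
  have hbd : ∀ e z, dirRe e (z i) ≤ ρ e - σ → (∀ j ≠ i, ∀ e, dirRe e (z j) < r₁₂ j e + s) →
      ‖edgeFun i ρ f e z‖ ≤ L * δ / σ := fun e z ha hb =>
    norm_edgeFun_le h02 h13 e hσpos hρL ha fun ζ hζ => hfδ _ (hupd z hb ζ hζ)
  have h0 : 0 ≤ L * δ / (s - s') := by
    have : 0 < s - s' := by linarith
    positivity
  have e1 : L * δ / ((s - s') / 2) = 2 * (L * δ / (s - s')) := by field_simp
  have e2 : 8 * L * δ / (s - s') = 8 * (L * δ / (s - s')) := by ring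
  refine ⟨fun z => ∑ e ∈ Finset.univ.erase (e₀ + 2), edgeFun i ρ f e z,
    fun z => -edgeFun i ρ f (e₀ + 2) z, ?_, ?_, ?_, ?_, ?_⟩
  · refine DifferentiableOn.fun_sum fun e he => ?_
    refine edgeFun_differentiableOn hΩ hf h02 h13 e fun z hz => ⟨?_, hupd z (hz1 z hz)⟩
    have := hd1 z hz e (Finset.ne_of_mem_erase he)
    linarith
  · refine (edgeFun_differentiableOn hΩ hf h02 h13 _ fun z hz => ⟨?_, hupd z (hz2 z hz)⟩).fun_neg
    have := hd2 z hz
    linarith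
  · intro z hz
    rw [sub_neg_eq_add, Finset.sum_erase_add _ _ (Finset.mem_univ _)]
    refine (sum_edgeFun hΩ hf (fun e => ?_) (hupd z fun j _ e => ?_)).symm
    · rw [hρs]; have := hz i e; linarith
    · have := hz j e; linarith
  · intro z hz
    refine (norm_sum_le_of_le _ fun e he =>
      hbd e z (hd1 z hz e (Finset.ne_of_mem_erase he)) (hz1 z hz)).trans ?_
    rw [sum_const, Finset.card_erase_of_mem (Finset.mem_univ _), Finset.card_univ,
      Fintype.card_fin, nsmul_eq_mul, hσ]
    rw [e1, e2]
    norm_num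
    linarith
  · intro z hz
    rw [norm_neg]
    refine (hbd _ z (hd2 z hz) (hz2 z hz)).trans ?_
    rw [hσ, e1, e2]
    linarith

end Boxes

section Runge

variable {n : ℕ}

instance (r : Box n) : CompactSpace (cBox r) :=
  isCompact_iff_compactSpace.1 (isCompact_cBox r)

/-- Polynomials as continuous functions on a subset of affine space. -/
def polyToC (D : Set ℂ^n) : ℂ[n] →ₐ[ℂ] C(D, ℂ) :=
  aeval fun i => ⟨fun z => (z : ℂ^n) i,
    (continuous_apply i).comp continuous_subtype_val⟩

theorem polyToC_apply (D : Set ℂ^n) (P : ℂ[n]) (z : D) :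
    polyToC D P z = eval (z : ℂ^n) P := by
  induction P using MvPolynomial.induction_on with
  | C a => simp [polyToC, algebraMap_apply]
  | add p q hp hq => rw [map_add, ContinuousMap.add_apply, hp, hq, map_add]
  | mul_X p i hp =>
    rw [map_mul, ContinuousMap.mul_apply, hp, map_mul]
    simp [polyToC]

/-- Uniform limits of polynomials on a compact set. -/
def polyClosure (D : Set ℂ^n) [CompactSpace D] : Subalgebra ℂ C(D, ℂ) :=
  (polyToC D).range.topologicalClosure

theorem polyToC_mem (D : Set ℂ^n) [CompactSpace D] (P : ℂ[n]) :
    polyToC D P ∈ polyClosure D :=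
  Subalgebra.le_topologicalClosure _ ⟨P, rfl⟩

theorem exists_poly_of_mem_polyClosure {D : Set ℂ^n} [CompactSpace D] {g : C(D, ℂ)}
    (hg : g ∈ polyClosure D) {ε : ℝ} (hε : 0 < ε) :
    ∃ P : ℂ[n], ∀ z : D, ‖g z - eval (z : ℂ^n) P‖ < ε := by
  have h1 : g ∈ closure ((polyToC D).range : Set C(D, ℂ)) := hg
  obtain ⟨_, ⟨P, rfl⟩, hP⟩ := Metric.mem_closure_iff.1 h1 ε hε
  refine ⟨P, fun z => ?_⟩
  rw [dist_eq_norm] at hP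
  have := (ContinuousMap.norm_coe_le_norm (g - polyToC D P) z).trans_lt hP
  rwa [ContinuousMap.sub_apply, polyToC_apply] at this

instance (D : Set ℂ^n) [CompactSpace D] : CompleteSpace (polyClosure D) :=
  (Subalgebra.isClosed_topologicalClosure _).completeSpace_coe

instance (D : Set ℂ^n) [CompactSpace D] :
    CompleteSpace (Subalgebra.toSubmodule (polyClosure D)) :=
  (Subalgebra.isClosed_topologicalClosure (polyToC D).range).completeSpace_coe

/-- Cauchy kernels with pole off a box are uniform limits of polynomials. -/
theorem cauchyKernel_mem (r : Box n) (i : Fin n) (e : Fin 4) {ζ : ℂ}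
    (hζ : r i e < dirRe e ζ) (g : C(cBox r, ℂ)) (hg : ∀ z : cBox r, g z = (ζ - (z : ℂ^n) i)⁻¹) :
    g ∈ polyClosure (cBox r) := by
  set σ := dirRe e ζ - r i e with hσ
  have hσ0 : 0 < σ := sub_pos.2 hζ
  obtain ⟨Λ, hΛ⟩ : ∃ Λ : ℝ, ∀ z ∈ cBox r, ‖ζ - z i‖ ≤ Λ := by
    obtain ⟨C, hC⟩ := (isCompact_cBox r).exists_bound_of_continuousOn
      (f := fun z : Fin n → ℂ => ζ - z i) (by fun_prop)
    exact ⟨C, hC⟩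
  set T : ℝ := Λ ^ 2 / σ + σ + 1 with hT
  have hT0 : 0 < T := by positivity
  have hTσ : Λ ^ 2 < T * σ := by
    rw [hT]; field_simp; nlinarith
  set b : ℂ[n] := 1 - C (I ^ (e : ℕ) / T) *
    (C ζ - X i) with hb
  have hbval : ∀ z : cBox r, polyToC (cBox r) b z =
      1 - I ^ (e : ℕ) / T * (ζ - (z : ℂ^n) i) := by
    intro z; rw [polyToC_apply]; simp [hb]
  have hbnorm : ‖polyToC (cBox r) b‖ < 1 := by
    rw [ContinuousMap.norm_lt_iff _ one_pos]
    intro z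
    rw [hbval]
    set w := I ^ (e : ℕ) * (ζ - (z : ℂ^n) i) with hw
    have hre : σ ≤ w.re := by
      have h1 : w.re = dirRe e (ζ - (z : ℂ^n) i) := rfl
      rw [h1, dirRe_sub]
      have := z.2 i e
      linarith
    have hwn : ‖w‖ ≤ Λ := by
      rw [hw, norm_mul, norm_pow, norm_I, one_pow, one_mul]
      exact hΛ _ z.2
    have h2 : (1 : ℂ) - I ^ (e : ℕ) / T * (ζ - (z : ℂ^n) i) = (T - w) / T := by
      have : (T : ℂ) ≠ 0 := by exact_mod_cast hT0.ne'
      rw [hw]; field_simp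
    rw [h2, norm_div, norm_real, norm_of_nonneg hT0.le, div_lt_one hT0]
    refine lt_of_pow_lt_pow_left₀ 2 hT0.le ?_
    have h3 : ‖w‖ ^ 2 ≤ Λ ^ 2 := pow_le_pow_left₀ (norm_nonneg _) hwn 2
    rw [← Complex.normSq_eq_norm_sq, Complex.normSq_apply] at h3 ⊢
    simp only [Complex.sub_re, Complex.ofReal_re, Complex.sub_im, Complex.ofReal_im]
    nlinarith
  set B : polyClosure (cBox r) := ⟨polyToC (cBox r) b, polyToC_mem _ b⟩ with hB
  have hBn : ‖B‖ < 1 := hbnorm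
  set u := Units.oneSub B hBn with hu
  have hmul : ((u : polyClosure (cBox r)) : C(cBox r, ℂ)) *
      ((↑u⁻¹ : polyClosure (cBox r)) : C(cBox r, ℂ)) = 1 := by
    have := congrArg (fun x : polyClosure (cBox r) => (x : C(cBox r, ℂ))) (Units.mul_inv u)
    exact this
  have hgeq : g = (I ^ (e : ℕ) / T) • ((↑u⁻¹ : polyClosure (cBox r)) : C(cBox r, ℂ)) := by
    ext z
    have h1 := congrArg (fun x : C(cBox r, ℂ) => x z) hmul
    have h2 : ((u : polyClosure (cBox r)) : C(cBox r, ℂ)) z =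
        I ^ (e : ℕ) / T * (ζ - (z : ℂ^n) i) := by
      have : ((u : polyClosure (cBox r)) : C(cBox r, ℂ)) z = 1 - polyToC (cBox r) b z := rfl
      rw [this, hbval]; ring
    simp only [ContinuousMap.mul_apply, h2, ContinuousMap.one_apply] at h1
    rw [hg, ContinuousMap.smul_apply, smul_eq_mul]
    refine inv_eq_of_mul_eq_one_right ?_
    rw [← h1]; ring
  rw [hgeq]
  exact Subalgebra.smul_mem _ (SetLike.coe_mem _) _

theorem mem_polyClosure_of_depends (r : Box n) (hne : (cBox r).Nonempty)
    (J : Finset (Fin n)) : ∀ s > 0, ∀ f : ℂ^n → ℂ, DifferentiableOn ℂ f (oBox r s) →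
      (∀ z ∈ oBox r s, ∀ z' ∈ oBox r s, (∀ i ∈ J, z i = z' i) → f z = f z') →
      ∀ g : C(cBox r, ℂ), (∀ z : cBox r, g z = f z) → g ∈ polyClosure (cBox r) := by
  induction J using Finset.induction_on with
  | empty =>
    intro s hs f hf hdep g hg
    obtain ⟨p, hp⟩ := hne
    have : g = algebraMap ℂ _ (f p) := by
      ext z
      rw [hg, hdep z (cBox_subset_oBox hs z.2) p (cBox_subset_oBox hs hp) (by simp)]
      simp [algebraMap_apply]
    rw [this]
    exact Subalgebra.algebraMap_mem _ _
  | insert i J hi ih =>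
    intro s hs f hf hdep g hg
    set ρ : Fin 4 → ℝ := fun e => r i e + s / 2 with hρ
    have h02 : -ρ 2 ≤ ρ 0 ∧ -ρ 1 ≤ ρ 3 := by
      obtain ⟨p, hp⟩ := hne
      have a0 := hp i 0; have a1 := hp i 1; have a2 := hp i 2; have a3 := hp i 3
      simp only [dirRe_zero, dirRe_one, dirRe_two, dirRe_three] at a0 a1 a2 a3
      constructor <;> (simp only [hρ]; linarith)
    have hle : ∀ e, -ρ (e + 1) ≤ ρ (e + 3) := by
      obtain ⟨h02, h13⟩ := h02
      intro e
      fin_cases e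
      · exact h13
      · exact h02
      · change -ρ 3 ≤ ρ 1; linarith
      · change -ρ 0 ≤ ρ 2; linarith
    have hupd : ∀ z ∈ oBox r s, ∀ ζ ∈ cRect ρ, update z i ζ ∈ oBox r s := by
      intro z hz ζ hζ j e
      by_cases hj : j = i
      · subst hj
        rw [Function.update_self]
        refine (hζ e).trans_lt ?_
        simp only [hρ]; linarith
      · rw [update_of_ne hj]
        exact hz j e
    have hu := differentiable_update_prod (n := n) i
    have key : ∀ e : Fin 4, ∃ G : C(cBox r, ℂ), G ∈ polyClosure (cBox r) ∧
        ∀ z : cBox r, G z = edgeInt ρ e (fun ζ => f (update z i ζ) * (ζ - (z : ℂ^n) i)⁻¹) := by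
      intro e
      set E : ℝ → ℂ := fun y => edgePt ρ e y with hE
      have hEc : Continuous E := continuous_edgePt ρ e
      have hEm : ∀ y ∈ Icc (-ρ (e + 1)) (ρ (e + 3)), E y ∈ cRect ρ := fun y hy =>
        edgePt_mem h02.1 h02.2 e (by rwa [uIcc_of_le (hle e)])
      have hEd : ∀ y, dirRe e (E y) = ρ e := fun y => dirRe_edgePt ρ e y
      have hEne : ∀ y, ∀ z : cBox r, E y - (z : ℂ^n) i ≠ 0 := fun y z h => by
        have h1 := hEd y
        rw [sub_eq_zero.1 h] at h1
        have h2 := z.2 i e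
        simp only [hρ] at h1
        linarith
      set Y := Icc (-ρ (e + 1)) (ρ (e + 3)) with hY
      set φ : C(Y × cBox r, ℂ) := ⟨fun p => ((-I) ^ (e : ℕ) * I) *
          (f (update (p.2 : ℂ^n) i (E p.1)) * (E p.1 - (p.2 : ℂ^n) i)⁻¹), by
        refine continuous_const.mul (Continuous.mul ?_ ?_)
        · refine (hf.continuousOn).comp_continuous
            (f := fun p : Y × cBox r => update (p.2 : ℂ^n) i (E p.1)) ?_ fun p =>
            hupd _ (cBox_subset_oBox hs p.2.2) _ (hEm _ p.1.2)
          exact hu.continuous.comp ((continuous_subtype_val.comp continuous_snd).prodMk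
            (hEc.comp (continuous_subtype_val.comp continuous_fst)))
        · refine Continuous.inv₀ ?_ fun p => hEne _ _
          exact (hEc.comp (continuous_subtype_val.comp continuous_fst)).sub
            ((continuous_apply i).comp (continuous_subtype_val.comp continuous_snd))⟩ with hφ
      have hmem : ∀ y : Y, φ.curry y ∈ polyClosure (cBox r) := by
        intro y
        have h1 : (⟨fun z => f (update (z : ℂ^n) i (E y)), by
            refine (hf.continuousOn).comp_continuous
              (f := fun z : cBox r => update (z : ℂ^n) i (E y)) ?_ fun p =>
              hupd _ (cBox_subset_oBox hs p.2) _ (hEm _ y.2)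
            exact continuous_subtype_val.update i continuous_const⟩ : C(cBox r, ℂ)) ∈
              polyClosure (cBox r) := by
          refine ih s hs (fun z => f (update z i (E y))) ?_ ?_ _ fun z => rfl
          · refine hf.comp (f := fun z : Fin n → ℂ => update z i (E y)) ?_ fun z hz => hupd z hz _ (hEm _ y.2)
            exact (hu.comp (differentiable_id.prodMk (differentiable_const (E y)))).differentiableOn
          · intro z hz z' hz' hzz
            refine hdep _ (hupd z hz _ (hEm _ y.2)) _ (hupd z' hz' _ (hEm _ y.2)) fun j hj => ?_
            by_cases hji : j = i
            · subst hji; simp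
            · rw [update_of_ne hji, update_of_ne hji]
              exact hzz j ((Finset.mem_insert.1 hj).resolve_left hji)
        have h2 : (⟨fun z => (E y - (z : ℂ^n) i)⁻¹,
            Continuous.inv₀ (continuous_const.sub
              ((continuous_apply i).comp continuous_subtype_val)) fun z => hEne y z⟩ : C(cBox r, ℂ)) ∈
              polyClosure (cBox r) := by
          refine cauchyKernel_mem r i e (ζ := E y) ?_ _ fun z => rfl
          rw [hEd]; simp only [hρ]; linarith
        have h3 := Subalgebra.smul_mem _ (Subalgebra.mul_mem _ h1 h2)
          ((-I) ^ (e : ℕ) * I)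
        exact (congrArg (· ∈ polyClosure (cBox r)) (ContinuousMap.ext fun z => rfl)).mp h3
      set ψ : ℝ → polyClosure (cBox r) := fun y =>
        ⟨φ.curry (projIcc _ _ (hle e) y), hmem _⟩ with hψ
      have hψc : Continuous ψ := by
        refine Continuous.subtype_mk ?_ _
        exact φ.curry.continuous.comp continuous_projIcc
      refine ⟨(∫ y in (-ρ (e + 1))..(ρ (e + 3)), ψ y : polyClosure (cBox r)),
        SetLike.coe_mem _, fun z => ?_⟩
      have hcomp := ((ContinuousMap.evalCLM ℂ z).comp
        (polyClosure (cBox r)).toSubmodule.subtypeL).intervalIntegral_comp_comm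
        (hψc.intervalIntegrable (μ := MeasureTheory.volume) (-ρ (e + 1)) (ρ (e + 3)))
      refine hcomp.symm.trans ?_
      rw [edgeInt]
      refine integral_congr fun y hy => ?_
      rw [uIcc_of_le (hle e)] at hy
      change φ.curry (projIcc _ _ (hle e) y) z = _
      rw [projIcc_of_mem (hle e) hy]
      rfl
    choose G hG hGz using key
    have hgeq : g = (2 * Real.pi * I : ℂ)⁻¹ • ∑ e, G e := by
      ext z
      rw [hg]
      have := sum_edgeFun (i := i) (ρ := ρ) (isOpen_oBox r s) hf (z := z)
        (fun e => by have := z.2 i e; simp only [hρ]; linarith)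
        (hupd z (cBox_subset_oBox hs z.2))
      rw [← this]
      simp only [edgeFun, ← hGz]
      rw [← mul_sum, ContinuousMap.smul_apply, ContinuousMap.sum_apply, smul_eq_mul]
    rw [hgeq]
    exact Subalgebra.smul_mem _ (Subalgebra.sum_mem _ fun e _ => hG e) _

/-- Runge approximation on boxes. -/
theorem runge_box {r : Box n} {f : ℂ^n → ℂ} (hf : HolNear r f) {ε : ℝ}
    (hε : 0 < ε) :
    ∃ Q : ℂ[n], ∀ z ∈ cBox r, ‖f z - eval z Q‖ < ε := by
  rcases (cBox r).eq_empty_or_nonempty with h | hne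
  · exact ⟨0, by simp [h]⟩
  obtain ⟨s, hs, hf⟩ := hf
  have hc : Continuous fun z : cBox r => f z :=
    (hf.continuousOn.mono (cBox_subset_oBox hs)).comp_continuous continuous_subtype_val
      fun z => z.2
  have := mem_polyClosure_of_depends r hne Finset.univ s hs f hf
    (fun z _ z' _ h => by rw [funext fun i => h i (Finset.mem_univ i)]) ⟨_, hc⟩ fun z => rfl
  obtain ⟨Q, hQ⟩ := exists_poly_of_mem_polyClosure this hε
  exact ⟨Q, fun z hz => hQ ⟨z, hz⟩⟩

end Runge

section PowerSeries

variable {n : ℕ}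

theorem summable_pow_sum (n : ℕ) {t : ℝ} (h0 : 0 ≤ t) (h1 : t < 1) :
    Summable fun α : Fin n → ℕ => t ^ (∑ i, α i) := by
  induction n with
  | zero => exact (hasSum_fintype _).summable
  | succ n ih =>
    rw [← (Fin.consEquiv fun _ => ℕ).summable_iff]
    have := (summable_geometric_of_lt_one h0 h1).mul_of_nonneg ih (fun _ => by positivity)
      (fun _ => by positivity)
    refine this.congr fun p => ?_
    simp [Fin.consEquiv, Fin.sum_univ_succ, pow_add]

theorem norm_cons_lt {w : ℂ} {z : ℂ^n} {ρ : ℝ} (hρ : 0 < ρ) (hw : ‖w‖ < ρ) (hz : ‖z‖ < ρ) :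
    ‖(cons w z : ℂ^(n + 1))‖ < ρ := by
  rw [pi_norm_lt_iff hρ]
  intro i
  refine Fin.cases ?_ (fun j => ?_) i
  · simpa using hw
  · simpa using (norm_le_pi_norm z j).trans_lt hz

/-- Taylor expansion of a holomorphic function of several variables, with Cauchy estimates. -/
theorem exists_taylor_aux (n : ℕ) : ∀ (f : ℂ^n → ℂ) (ρ M R : ℝ), 0 < R → R < ρ →
    DifferentiableOn ℂ f (ball 0 ρ) → (∀ z ∈ ball (0 : ℂ^n) ρ, ‖f z‖ ≤ M) →
    ∃ a : (Fin n → ℕ) → ℂ, (∀ α, ‖a α‖ ≤ M * (1 / R) ^ (∑ i, α i)) ∧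
      ∀ z ∈ ball (0 : ℂ^n) R, HasSum (fun α => a α * ∏ i, z i ^ α i) (f z) := by
  induction n with
  | zero =>
    intro f ρ M R hR hRρ hf hM
    refine ⟨fun _ => f 0, fun α => by simpa using hM 0 (by simp; linarith), fun z _ => ?_⟩
    rw [Subsingleton.elim z 0]
    have := hasSum_fintype (fun α : Fin 0 → ℕ => f 0 * ∏ i, (0 : Fin 0 → ℂ) i ^ α i)
    simp only [Finset.univ_eq_empty, Finset.prod_empty, mul_one] at this ⊢
    simpa using this
  | succ n ih =>
    intro f ρ M R hR hRρ hf hM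
    have hρ : 0 < ρ := hR.trans hRρ
    have hcd : Differentiable ℂ fun p : ℂ^n × ℂ => (cons p.2 p.1 : ℂ^(n + 1)) := by
      rw [differentiable_pi]
      intro i
      refine Fin.cases ?_ (fun j => ?_) i
      · simp only [Fin.cons_zero]; exact differentiable_snd
      · simpa using (by fun_prop : Differentiable ℂ fun p : ℂ^n × ℂ => p.1 j)
    set g : ℕ → ℂ^n → ℂ := fun k z' => (2 * Real.pi * I : ℂ)⁻¹ •
      ∮ ζ in C(0, R), ((1 / ζ) ^ k * ζ⁻¹) • f (cons ζ z') with hg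
    have hgd : ∀ k, DifferentiableOn ℂ (g k) (ball 0 ρ) := by
      intro k
      refine DifferentiableOn.fun_const_smul ?_ _
      set Ω : Set (ℂ^n × ℂ) := {p | ‖p.1‖ < ρ ∧ ‖p.2‖ < ρ ∧ p.2 ≠ 0}
      have hΩ : IsOpen Ω := by
        exact (isOpen_lt continuous_fst.norm continuous_const).inter
          ((isOpen_lt continuous_snd.norm continuous_const).inter (isOpen_ne_fun continuous_snd
            continuous_const))
      refine differentiableOn_integral_of_differentiableOn_prod (E := ℂ^n)
        (Φ := fun p => ((1 / p.2) ^ k * (p.2)⁻¹) • f (cons p.2 p.1)) hΩ ?_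
        (continuous_circleMap 0 R) ?_ (by
          have : deriv (circleMap 0 R) = fun θ => circleMap 0 R θ * I :=
            funext fun θ => deriv_circleMap 0 R θ
          rw [this]
          exact (continuous_circleMap 0 R).mul continuous_const)
      · refine DifferentiableOn.fun_smul ?_ (hf.comp (f := fun p : ℂ^n × ℂ => (cons p.2 p.1 : ℂ^(n + 1))) hcd.differentiableOn fun p hp => ?_)
        · intro p hp
          have : p.2 ≠ 0 := hp.2.2
          exact (DifferentiableAt.mul (DifferentiableAt.pow (by
            simp only [one_div]; exact differentiableAt_snd.inv this) k) (differentiableAt_snd.inv this)).differentiableWithinAt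
        · rw [mem_ball_zero_iff]
          exact norm_cons_lt hρ hp.2.1 hp.1
      · intro z hz y _
        have hn : ‖circleMap 0 R y‖ = R := by simp [abs_of_pos hR]
        refine ⟨by simpa using hz, by rw [hn]; exact hRρ, ?_⟩
        change circleMap 0 R y ≠ 0
        rw [← norm_ne_zero_iff, hn]; exact hR.ne'
    have hgM : ∀ k, ∀ z ∈ ball (0 : ℂ^n) ρ, ‖g k z‖ ≤ M * (1 / R) ^ k := by
      intro k z hz
      have := circleIntegral.norm_two_pi_i_inv_smul_integral_le_of_norm_le_const (c := 0)
        (f := fun ζ => ((1 / ζ) ^ k * ζ⁻¹) • f (cons ζ z)) (C := (1 / R) ^ k * R⁻¹ * M) hR.le ?_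
      · refine this.trans (le_of_eq ?_)
        field_simp
      · intro ζ hζ
        have hζR : ‖ζ‖ = R := by simpa using hζ
        rw [norm_smul, norm_mul, norm_pow, norm_div, norm_one, norm_inv, hζR]
        refine mul_le_mul_of_nonneg_left (hM _ ?_) (by positivity)
        rw [mem_ball_zero_iff]
        exact norm_cons_lt hρ (by rw [hζR]; exact hRρ) (by simpa using hz)
    have hgsum : ∀ w z, ‖w‖ < R → ‖z‖ < ρ →
        HasSum (fun k => w ^ k * g k z) (f (cons w z)) := by
      intro w z hw hz
      have hd : DifferentiableOn ℂ (fun ζ : ℂ => f (cons ζ z)) (Metric.closedBall 0 R) := by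
        refine hf.comp (hcd.comp (f := fun ζ : ℂ => (z, ζ)) (by fun_prop)).differentiableOn fun ζ hζ => ?_
        rw [mem_ball_zero_iff]
        exact norm_cons_lt hρ ((by simpa using hζ : ‖ζ‖ ≤ R).trans_lt hRρ) hz
      have h1 := (DifferentiableOn.hasFPowerSeriesOnBall (R := .mk R hR.le) hd hR).hasSum (y := w)
        (by rw [mem_eball_zero_iff, ← coe_nnnorm] at *; exact ENNReal.coe_lt_coe.2 (NNReal.coe_lt_coe.1 hw))
      rw [zero_add] at h1
      refine (congrArg (fun F : ℕ → ℂ => HasSum F (f (cons w z))) (funext fun k => ?_)).mp h1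
      rw [cauchyPowerSeries_apply]
      simp only [hg, sub_zero, smul_eq_mul]
      rw [mul_left_comm (w ^ k)]
      congr 1
      rw [← smul_eq_mul (w ^ k), ← circleIntegral.integral_smul]
      refine congrArg (fun F : ℂ → ℂ => circleIntegral F 0 R) (funext fun ζ => ?_)
      simp only [smul_eq_mul, div_eq_mul_inv, mul_pow, one_pow]
      ring
    choose a ha haS using fun k => ih (g k) ρ (M * (1 / R) ^ k) R hR hRρ (hgd k) (hgM k)
    refine ⟨fun α => a (α 0) (tail α), fun α => ?_, fun z hz => ?_⟩
    · refine (ha _ _).trans (le_of_eq ?_)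
      rw [Fin.sum_univ_succ, pow_add, mul_assoc]
      rfl
    · rw [mem_ball_zero_iff] at hz
      have hM0 : 0 ≤ M := (norm_nonneg _).trans (hM 0 (by simpa using hρ))
      have hsum : Summable fun α : Fin (n + 1) → ℕ => a (α 0) (tail α) * ∏ i, z i ^ α i := by
        refine Summable.of_norm_bounded ((summable_pow_sum (n + 1) (t := ‖z‖ / R) (by positivity)
          ((div_lt_one hR).2 hz)).mul_left M) fun α => ?_
        have h1 := ha (α 0) (tail α)
        have h2 : ‖∏ i, z i ^ α i‖ ≤ ‖z‖ ^ (∑ i, α i) := by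
          rw [norm_prod, ← prod_pow_eq_pow_sum]
          refine Finset.prod_le_prod (fun _ _ => norm_nonneg _) fun i _ => ?_
          rw [norm_pow]
          exact pow_le_pow_left₀ (norm_nonneg _) (norm_le_pi_norm z i) _
        have h3 : M * (1 / R) ^ (α 0) * (1 / R) ^ (∑ i, tail α i) = M * (1 / R) ^ (∑ i, α i) := by
          rw [Fin.sum_univ_succ, pow_add, mul_assoc]; rfl
        rw [h3] at h1
        rw [norm_mul]
        calc _ ≤ M * (1 / R) ^ (∑ i, α i) * ‖z‖ ^ (∑ i, α i) := by gcongr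
          _ = _ := by rw [mul_assoc, ← mul_pow, one_div, inv_mul_eq_div]
      have hz0 : ‖z 0‖ < R := (norm_le_pi_norm z 0).trans_lt hz
      have hzt : ‖tail z‖ < R := by
        rw [pi_norm_lt_iff hR]
        exact fun i => (norm_le_pi_norm z _).trans_lt hz
      have h1 := hgsum (z 0) (tail z) hz0 (hzt.trans hRρ)
      rw [Fin.cons_self_tail] at h1
      obtain ⟨S, hS⟩ := hsum
      have h2 := ((Fin.consEquiv fun _ => ℕ).hasSum_iff).2 hS
      have h3 := h2.prod_fiberwise (g := fun k => z 0 ^ k * g k (tail z)) fun k => by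
        have := (haS k (tail z) (by simpa using hzt)).mul_left (z 0 ^ k)
        refine (congrArg (fun F : (Fin n → ℕ) → ℂ => HasSum F (z 0 ^ k * g k (tail z)))
          (funext fun α => ?_)).mp this
        simp only [comp_apply, Fin.consEquiv, Equiv.coe_fn_mk, Fin.cons_zero, Fin.tail_cons,
          Fin.prod_univ_succ, Fin.cons_succ]
        simp only [tail]
        ring
      rw [h1.unique h3]
      exact hS

end PowerSeries

section PowerSeriesFinsupp

variable {n : ℕ}

/-- The value of a monomial. -/
def monoVal (z : ℂ^n) (α : Fin n →₀ ℕ) : ℂ := ∏ i, z i ^ α i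

theorem norm_monoVal_le (z : ℂ^n) (α : Fin n →₀ ℕ) : ‖monoVal z α‖ ≤ ‖z‖ ^ α.degree := by
  rw [monoVal, norm_prod, Finsupp.degree_eq_sum, ← prod_pow_eq_pow_sum]
  refine Finset.prod_le_prod (fun _ _ => norm_nonneg _) fun i _ => ?_
  rw [norm_pow]
  exact pow_le_pow_left₀ (norm_nonneg _) (norm_le_pi_norm z i) _

theorem monoVal_add (z : ℂ^n) (α β : Fin n →₀ ℕ) :
    monoVal z (α + β) = monoVal z α * monoVal z β := by
  simp [monoVal, pow_add, prod_mul_distrib]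

theorem monoVal_smul (t : ℂ) (z : ℂ^n) (α : Fin n →₀ ℕ) :
    monoVal (t • z) α = t ^ α.degree * monoVal z α := by
  simp [monoVal, mul_pow, prod_mul_distrib, prod_pow_eq_pow_sum,
    Finsupp.degree_eq_sum]

theorem eval_monomial_eq (z : ℂ^n) (α : Fin n →₀ ℕ) (c : ℂ) :
    eval z (MvPolynomial.monomial α c) = c * monoVal z α := by
  rw [MvPolynomial.eval_monomial, Finsupp.prod_fintype _ _ (by simp), monoVal]

theorem eval_eq_sum_monoVal (z : ℂ^n) (P : ℂ[n]) :
    eval z P = ∑ α ∈ P.support, P.coeff α * monoVal z α :=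
  MvPolynomial.eval_eq' z P

/-- Normal convergence of a power series on the polydisc of radius `R`. -/
def PSConv (a : (Fin n →₀ ℕ) → ℂ) (R : ℝ) : Prop := Summable fun α => ‖a α‖ * R ^ α.degree

/-- The sum of a power series. -/
def psEval (a : (Fin n →₀ ℕ) → ℂ) (z : ℂ^n) : ℂ := ∑' α, a α * monoVal z α

/-- The Taylor polynomial of order `k`. -/
def psTrunc (a : (Fin n →₀ ℕ) → ℂ) (k : ℕ) : ℂ[n] :=
  ∑ α ∈ (Finsupp.finite_of_degree_le (σ := Fin n) k).toFinset with α.degree < k,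
    MvPolynomial.monomial α (a α)

theorem coeff_psTrunc (a : (Fin n →₀ ℕ) → ℂ) (k : ℕ) (α : Fin n →₀ ℕ) :
    (psTrunc a k).coeff α = if α.degree < k then a α else 0 := by
  classical
  rw [psTrunc, MvPolynomial.coeff_sum]
  simp only [MvPolynomial.coeff_monomial, Finset.sum_ite_eq', Finset.mem_filter,
    Set.Finite.mem_toFinset, mem_ofPred_eq]
  congr 1
  exact propext ⟨fun h => h.2, fun h => ⟨h.le, h⟩⟩

variable {a : (Fin n →₀ ℕ) → ℂ} {R : ℝ}

theorem PSConv.summable_norm (ha : PSConv a R) {z : ℂ^n} (hz : ‖z‖ ≤ R) :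
    Summable fun α => ‖a α * monoVal z α‖ := by
  refine Summable.of_nonneg_of_le (fun _ => norm_nonneg _) (fun α => ?_) ha
  rw [norm_mul]
  gcongr
  exact (norm_monoVal_le z α).trans (pow_le_pow_left₀ (norm_nonneg _) hz _)

theorem PSConv.hasSum (ha : PSConv a R) {z : ℂ^n} (hz : ‖z‖ ≤ R) :
    HasSum (fun α => a α * monoVal z α) (psEval a z) :=
  (ha.summable_norm hz).of_norm.hasSum

theorem PSConv.mono (ha : PSConv a R) {R' : ℝ} (h0 : 0 ≤ R') (h : R' ≤ R) : PSConv a R' := by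
  refine Summable.of_nonneg_of_le (fun _ => by positivity) (fun α => ?_) ha
  gcongr

theorem PSConv.of_norm_le (ha : PSConv a R) (hR : 0 ≤ R) {b : (Fin n →₀ ℕ) → ℂ}
    (h : ∀ α, ‖b α‖ ≤ ‖a α‖) : PSConv b R := by
  refine Summable.of_nonneg_of_le (fun _ => by positivity) (fun α => ?_) ha
  gcongr
  exact h α

theorem PSConv.neg (ha : PSConv a R) (hR : 0 ≤ R) : PSConv (-a) R :=
  ha.of_norm_le hR fun α => by simp

theorem PSConv.add (ha : PSConv a R) (hR : 0 ≤ R) {b : (Fin n →₀ ℕ) → ℂ} (hb : PSConv b R) :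
    PSConv (a + b) R := by
  refine Summable.of_nonneg_of_le (fun _ => by positivity) (fun α => ?_) (Summable.add ha hb)
  rw [← add_mul]
  gcongr
  exact norm_add_le _ _

theorem psEval_add {b : (Fin n →₀ ℕ) → ℂ} (ha : PSConv a R) (hb : PSConv b R)
    {z : ℂ^n} (hz : ‖z‖ ≤ R) : psEval (a + b) z = psEval a z + psEval b z := by
  refine HasSum.tsum_eq ?_
  simpa [add_mul] using (ha.hasSum hz).add (hb.hasSum hz)

theorem psConv_coeff (P : ℂ[n]) (R : ℝ) : PSConv (fun α => P.coeff α) R :=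
  summable_of_ne_finset_zero (s := P.support) fun α hα => by
    simp [MvPolynomial.notMem_support_iff.1 hα]

theorem psEval_coeff (P : ℂ[n]) (z : ℂ^n) :
    psEval (fun α => P.coeff α) z = eval z P := by
  rw [eval_eq_sum_monoVal]
  exact tsum_eq_sum fun α hα => by simp [MvPolynomial.notMem_support_iff.1 hα]

theorem PSConv.norm_sub_trunc_le (ha : PSConv a R) (hR : 0 < R) (k : ℕ) {z : ℂ^n}
    (hz : ‖z‖ ≤ R) :
    ‖psEval a z - eval z (psTrunc a k)‖ ≤
      (∑' α, ‖a α‖ * R ^ α.degree) * (‖z‖ / R) ^ k := by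
  rw [← psEval_coeff, psEval, psEval, ← ((ha.summable_norm hz).of_norm).tsum_sub
    (((psConv_coeff _ R).summable_norm hz).of_norm), ← tsum_mul_right]
  refine tsum_of_norm_bounded (ha.mul_right _).hasSum fun α => ?_
  rw [coeff_psTrunc]
  split_ifs with h
  · rw [sub_self, norm_zero]; positivity
  · push Not at h
    rw [zero_mul, sub_zero, norm_mul, mul_assoc]
    gcongr
    refine (norm_monoVal_le z α).trans ?_
    have h1 : ‖z‖ ^ α.degree = R ^ α.degree * (‖z‖ / R) ^ α.degree := by
      rw [← mul_pow, mul_div_cancel₀ _ hR.ne']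
    rw [h1]
    refine mul_le_mul_of_nonneg_left ?_ (by positivity)
    exact pow_le_pow_of_le_one (by positivity) ((div_le_one hR).2 hz) h

theorem PSConv.isBigO_sub_trunc (ha : PSConv a R) (hR : 0 < R) (k : ℕ) :
    (fun z => psEval a z - eval z (psTrunc a k)) =O[𝓝 0] fun z => ‖z‖ ^ k := by
  refine IsBigO.of_bound ((∑' α, ‖a α‖ * R ^ α.degree) / R ^ k) ?_
  filter_upwards [closedBall_mem_nhds (0 : ℂ^n) hR] with z hz
  refine (ha.norm_sub_trunc_le hR k (by simpa using hz)).trans (le_of_eq ?_)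
  rw [norm_pow, norm_norm, div_pow]; ring

theorem differentiable_eval (P : ℂ[n]) :
    Differentiable ℂ fun z : Fin n → ℂ => eval z P := by
  induction P using MvPolynomial.induction_on with
  | C a => simp
  | add p q hp hq => simpa using hp.fun_add hq
  | mul_X p i hp =>
    simp only [map_mul, eval_X]
    exact hp.fun_mul (by fun_prop)

theorem PSConv.differentiableOn (ha : PSConv a R) (hR : 0 < R) :
    DifferentiableOn ℂ (psEval a) (ball 0 R) := by
  intro z hz
  rw [mem_ball_zero_iff] at hz
  obtain ⟨t, ht1, ht2⟩ := exists_between hz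
  have ht0 : 0 ≤ t := (norm_nonneg _).trans ht1.le
  have : DifferentiableOn ℂ (psEval a) (ball 0 t) := by
    refine differentiableOn_of_tendstoUniformlyOn isOpen_ball
      (f := fun k z => eval z (psTrunc a k)) (fun k => ?_) ?_
    · exact (differentiable_eval _).differentiableOn
    · rw [Metric.tendstoUniformlyOn_iff]
      intro ε hε
      have hlim : Tendsto (fun k => (∑' α, ‖a α‖ * R ^ α.degree) * (t / R) ^ k)
          Filter.atTop (𝓝 ((∑' α, ‖a α‖ * R ^ α.degree) * 0)) :=
        (tendsto_pow_atTop_nhds_zero_of_lt_one (by positivity) ((div_lt_one hR).2 ht2)).const_mul _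
      rw [mul_zero] at hlim
      filter_upwards [hlim.eventually_lt_const hε] with k hk w hw
      rw [mem_ball_zero_iff] at hw
      rw [dist_eq_norm]
      refine (ha.norm_sub_trunc_le hR k (hw.trans ht2).le).trans_lt (lt_of_le_of_lt ?_ hk)
      have : 0 ≤ ∑' α, ‖a α‖ * R ^ α.degree := tsum_nonneg fun _ => by positivity
      gcongr
  exact (this.differentiableAt (isOpen_ball.mem_nhds
    (by simpa using ht1))).differentiableWithinAt

theorem exists_taylor {f : ℂ^n → ℂ} {ρ : ℝ} (hρ : 0 < ρ)
    (hf : DifferentiableOn ℂ f (ball 0 ρ)) :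
    ∃ R > 0, ∃ a : (Fin n →₀ ℕ) → ℂ, PSConv a R ∧ ∀ z, ‖z‖ ≤ R → f z = psEval a z := by
  obtain ⟨M, hM⟩ := (isCompact_closedBall (0 : ℂ^n) (ρ / 2)).exists_bound_of_continuousOn
    (hf.continuousOn.mono (Metric.closedBall_subset_ball (by linarith)))
  obtain ⟨a, ha, haS⟩ := exists_taylor_aux n f (ρ / 2) M (ρ / 4) (by linarith) (by linarith)
    (hf.mono (Metric.ball_subset_ball (by linarith)))
    fun z hz => hM z (Metric.ball_subset_closedBall hz)
  have hconv : PSConv (fun α : Fin n →₀ ℕ => a α) (ρ / 8) := by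
    have h1 := (summable_pow_sum n (t := 1 / 2) (by norm_num) (by norm_num)).mul_left M
    have h2 := (Finsupp.equivFunOnFinite (α := Fin n) (M := ℕ)).summable_iff.2 h1
    refine Summable.of_nonneg_of_le (fun _ => by positivity) (fun α => ?_) h2
    have := ha α
    rw [Finsupp.degree_eq_sum]
    simp only [comp_apply, Finsupp.equivFunOnFinite_apply]
    calc _ ≤ M * (1 / (ρ / 4)) ^ (∑ i, α i) * (ρ / 8) ^ (∑ i, α i) := by gcongr
      _ = _ := by rw [mul_assoc, ← mul_pow]; congr 2; field_simp; norm_num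
  refine ⟨ρ / 8, by linarith, fun α => a α, hconv, fun z hz => ?_⟩
  have h1 := haS z (by rw [mem_ball_zero_iff]; linarith)
  have h2 := (Finsupp.equivFunOnFinite (α := Fin n) (M := ℕ)).hasSum_iff.2 h1
  exact h2.tsum_eq.symm

theorem coeff_eq_zero_of_isBigO (ha : PSConv a R) (hR : 0 < R) {k : ℕ}
    (h : psEval a =O[𝓝 0] fun z => ‖z‖ ^ k) : ∀ α : Fin n →₀ ℕ, α.degree < k → a α = 0 := by
  suffices H : ∀ d, d < k → ∀ α : Fin n →₀ ℕ, α.degree = d → a α = 0 from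
    fun α hα => H _ hα α rfl
  intro d
  induction d using Nat.strong_induction_on with
  | _ d ih =>
    intro hdk
    have hhom : ∀ (t : ℂ) (z : ℂ^n), eval (t • z) (psTrunc a (d + 1)) =
        t ^ d * eval z (psTrunc a (d + 1)) := by
      intro t z
      rw [eval_eq_sum_monoVal, eval_eq_sum_monoVal, mul_sum]
      refine sum_congr rfl fun α hα => ?_
      have h1 := mem_support_iff.1 hα
      rw [coeff_psTrunc] at h1
      have h2 : α.degree < d + 1 := by by_contra h'; simp [h'] at h1
      rw [if_pos h2] at h1
      have h3 : α.degree = d := by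
        by_contra h'
        exact h1 (ih _ (by omega) (by omega) α rfl)
      rw [monoVal_smul, h3]; ring
    have hO : (fun z => eval z (psTrunc a (d + 1))) =O[𝓝 0]
        fun z : Fin n → ℂ => ‖z‖ ^ (d + 1) := by
      have h1 : psEval a =O[𝓝 0] fun z : Fin n → ℂ => ‖z‖ ^ (d + 1) := by
        refine h.trans (IsBigO.of_bound 1 ?_)
        filter_upwards [closedBall_mem_nhds (0 : ℂ^n) one_pos] with z hz
        rw [norm_pow, norm_pow, norm_norm, one_mul]
        exact pow_le_pow_of_le_one (norm_nonneg _) (by simpa using hz) hdk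
      exact (h1.sub (ha.isBigO_sub_trunc hR (d + 1))).congr_left fun z => by ring
    have hzero : psTrunc a (d + 1) = 0 := by
      refine MvPolynomial.funext fun z => ?_
      rw [map_zero]
      have hlim : Tendsto (fun t : ℂ => t • z) (𝓝 0) (𝓝 0) := by
        have : Continuous fun t : ℂ => t • z := by fun_prop
        simpa using this.tendsto 0
      have h2 := hO.comp_tendsto hlim
      obtain ⟨C, hC⟩ := h2.bound
      obtain ⟨δ, hδ, hball⟩ := Metric.eventually_nhds_iff.1 hC
      by_contra hne
      have hpos : 0 < ‖eval z (psTrunc a (d + 1))‖ := norm_pos_iff.2 hne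
      set E := ‖eval z (psTrunc a (d + 1))‖
      set B := |C| * ‖z‖ ^ (d + 1) + 1
      have hB : 0 < B := by positivity
      set t : ℝ := min (δ / 2) (E / (2 * B)) with ht
      have ht0 : 0 < t := by positivity
      have h3 := @hball (t : ℂ) (by
        rw [dist_zero_right, norm_real, norm_of_nonneg ht0.le]
        exact (min_le_left _ _).trans_lt (by linarith))
      simp only [comp_apply, hhom, norm_mul, norm_pow, norm_smul, norm_real,
        norm_norm, norm_of_nonneg ht0.le] at h3
      have h4 : t ^ d * E ≤ t ^ d * (t * B) := by
        refine h3.trans ?_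
        rw [mul_pow, pow_succ t d]
        have : C * ‖z‖ ^ (d + 1) ≤ B := by
          have := mul_le_mul_of_nonneg_right (le_abs_self C) (by positivity : 0 ≤ ‖z‖ ^ (d + 1))
          linarith
        calc _ = t ^ d * t * (C * ‖z‖ ^ (d + 1)) := by ring
          _ ≤ t ^ d * t * B := by gcongr
          _ = _ := by ring
      have h5 := le_of_mul_le_mul_left h4 (by positivity)
      have h6 : t * B ≤ E / 2 := by
        calc t * B ≤ E / (2 * B) * B := by gcongr; exact min_le_right _ _
          _ = E / 2 := by field_simp
      linarith
    intro α hα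
    have := coeff_psTrunc a (d + 1) α
    rw [hzero, MvPolynomial.coeff_zero, if_pos (by omega)] at this
    exact this.symm

end PowerSeriesFinsupp

section SumOperator

variable {Γ : Type*} {V : Type*} [NormedAddCommGroup V] [NormedSpace ℂ V] [CompleteSpace V]

/-- Complex summable families. -/
abbrev Lone (Γ : Type*) : Type _ := ↥(lp (fun _ : Γ => ℂ) 1)

theorem Lone.summable_norm (x : Lone Γ) : Summable fun γ => ‖x γ‖ := by
  simpa using x.2.summable

theorem Lone.norm_eq (x : Lone Γ) : ‖x‖ = ∑' γ, ‖x γ‖ := by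
  refine (lp.norm_eq_tsum_rpow (by simp) x).trans ?_
  simp

theorem Lone.summable_smul {T : Γ → V} {C : ℝ} (hT : ∀ γ, ‖T γ‖ ≤ C) (x : Lone Γ) :
    Summable fun γ => x γ • T γ := by
  refine Summable.of_norm_bounded ((Lone.summable_norm x).mul_right C) fun γ => ?_
  refine (norm_smul _ _).trans_le ?_
  exact mul_le_mul_of_nonneg_left (hT γ) (norm_nonneg _)

/-- The bounded operator on summable families with prescribed values on the unit vectors. -/
def sumOp (T : Γ → V) (C : ℝ) (hT : ∀ γ, ‖T γ‖ ≤ C) : Lone Γ →L[ℂ] V :=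
  LinearMap.mkContinuous
    { toFun := fun x => ∑' γ, x γ • T γ
      map_add' := fun x y =>
        (tsum_congr fun γ => add_smul (x γ) (y γ) (T γ)).trans
          ((Lone.summable_smul hT x).tsum_add (Lone.summable_smul hT y))
      map_smul' := fun c x =>
        (tsum_congr fun γ => mul_smul c (x γ) (T γ)).trans
          ((Lone.summable_smul hT x).tsum_const_smul c) }
    C (fun x => by
      rw [Lone.norm_eq x, ← tsum_mul_left]
      refine tsum_of_norm_bounded ((Lone.summable_norm x).mul_left C).hasSum fun γ => ?_
      refine (norm_smul _ _).trans_le ?_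
      rw [mul_comm]
      exact mul_le_mul_of_nonneg_right (hT γ) (norm_nonneg _))

theorem sumOp_apply {T : Γ → V} {C : ℝ} (hT : ∀ γ, ‖T γ‖ ≤ C) (x : Lone Γ) :
    sumOp T C hT x = ∑' γ, x γ • T γ := rfl

theorem norm_sumOp_le {T : Γ → V} {C : ℝ} (hC : 0 ≤ C) (hT : ∀ γ, ‖T γ‖ ≤ C) :
    ‖sumOp T C hT‖ ≤ C := LinearMap.mkContinuous_norm_le _ hC _

theorem exists_hasSum_smul [DecidableEq Γ] (T : Γ → Lone Γ)
    (hT : ∀ γ, ‖(lp.single 1 γ (1 : ℂ) : Lone Γ) - T γ‖ ≤ 1 / 2) (x : Lone Γ) :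
    ∃ y : Lone Γ, HasSum (fun γ => y γ • T γ) x := by
  set N := sumOp (fun γ => (lp.single 1 γ (1 : ℂ) : Lone Γ) - T γ) (1 / 2) hT
  have hN : ‖N‖ < 1 := (norm_sumOp_le (by norm_num) hT).trans_lt (by norm_num)
  obtain ⟨u, hu⟩ := isUnit_one_sub_of_norm_lt_one hN
  obtain ⟨y, h1⟩ : ∃ y, (1 - N) y = x := ⟨(↑u⁻¹ : Lone Γ →L[ℂ] Lone Γ) x, by
    rw [← hu, ← mul_apply_eq_comp, Units.mul_inv]; rfl⟩
  refine ⟨y, ?_⟩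
  have h2 : HasSum (fun γ => y γ • ((lp.single 1 γ (1 : ℂ) : Lone Γ) - T γ)) (N y) :=
    (Lone.summable_smul hT y).hasSum
  have h3 := lp.hasSum_single ENNReal.one_ne_top y
  have h4 := h3.sub h2
  have h5 : y - N y = x := h1
  rw [h5] at h4
  refine (congrArg (fun F => HasSum F x) (funext fun γ => ?_)).mp h4
  have h6 : (lp.single 1 γ (y γ) : Lone Γ) = y γ • (lp.single 1 γ (1 : ℂ) : Lone Γ) := by
    rw [← lp.single_smul]; simp
  rw [smul_sub, h6]
  exact sub_sub_cancel _ _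

end SumOperator

section GrauertDivision

variable {n : ℕ} {κ : Type*} [Fintype κ]

/-- Multiplicative weights on monomials of a free module separating all monomials. -/
theorem exists_monomial_weight (n : ℕ) (κ : Type*) [Finite κ] :
    ∃ (N : (Fin n →₀ ℕ) → ℕ) (c : κ → ℕ) (Q : ℕ), (∀ α β, N (α + β) = N α * N β) ∧
      (∀ α, 2 ^ α.degree ≤ N α) ∧ (∀ α, N α ≤ Q ^ α.degree) ∧ (∀ k, 0 < c k) ∧
      Injective fun γ : (Σ _ : κ, (Fin n →₀ ℕ)) => N γ.2 * c γ.1 := by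
  classical
  obtain ⟨e⟩ := nonempty_embedding_nat (Fin n ⊕ κ)
  set P : Fin n ⊕ κ → ℕ := fun j => Nat.nth Nat.Prime (e j) with hP
  have hPp : ∀ j, (P j).Prime := fun j => Nat.prime_nth_prime _
  have hPi : Injective P := (Nat.nth_injective Nat.infinite_setOfPred_prime).comp e.injective
  refine ⟨fun α => ∏ i, P (inl i) ^ α i, fun k => P (inr k), ∑ i, P (inl i),
    fun α β => by simp [pow_add, prod_mul_distrib], fun α => ?_, fun α => ?_,
    fun k => (hPp _).pos, ?_⟩
  · rw [Finsupp.degree_eq_sum, ← prod_pow_eq_pow_sum]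
    exact Finset.prod_le_prod' fun i _ => Nat.pow_le_pow_left (hPp _).two_le _
  · rw [Finsupp.degree_eq_sum, ← prod_pow_eq_pow_sum]
    exact Finset.prod_le_prod' fun i _ => Nat.pow_le_pow_left
      (single_le_sum (f := fun i => P (inl i)) (fun _ _ => Nat.zero_le _)
        (Finset.mem_univ i)) _
  · have key : ∀ (γ : (Σ _ : κ, (Fin n →₀ ℕ))) (j : Fin n ⊕ κ),
        ((∏ i, P (inl i) ^ γ.2 i) * P (inr γ.1)).factorization (P j)
          = elim (fun i => γ.2 i) (fun k => if k = γ.1 then 1 else 0) j := by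
      intro γ j
      rw [Nat.factorization_mul (Finset.prod_ne_zero_iff.2 fun i _ =>
        pow_ne_zero _ (hPp _).ne_zero) (hPp _).ne_zero, Nat.factorization_prod fun i _ =>
        pow_ne_zero _ (hPp _).ne_zero]
      simp only [(hPp _).factorization_pow, (hPp _).factorization, Finsupp.add_apply,
        Finsupp.coe_finsetSum, Finset.sum_apply, Finsupp.single_apply, hPi.eq_iff]
      cases j with
      | inl i => simp
      | inr k => simp [eq_comm]
    rintro ⟨k, α⟩ ⟨k', α'⟩ h
    have h' : ∀ j, elim (fun i => α i) (fun l => if l = k then 1 else 0) j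
        = elim (fun i => α' i) (fun l => if l = k' then 1 else 0) j := fun j => by
      rw [← key ⟨k, α⟩ j, ← key ⟨k', α'⟩ j]
      exact congrArg (fun m : ℕ => m.factorization (P j)) h
    have h1 : α = α' := Finsupp.ext fun i => by simpa using h' (inl i)
    have h2 : k = k' := by
      have := h' (inr k)
      by_contra hk
      simp [hk] at this
    rw [h1, h2]

end GrauertDivision

section GrauertDivision

variable {n : ℕ} {κ : Type*} [Fintype κ]

/-- Indices of monomials of a free module. -/
abbrev MIdx (n : ℕ) (κ : Type*) := Σ _ : κ, (Fin n →₀ ℕ)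

theorem grauert_division (N : (Fin n →₀ ℕ) → ℕ) (c : κ → ℕ) (Q : ℕ)
    (hN : ∀ α β, N (α + β) = N α * N β) (hN2 : ∀ α, 2 ^ α.degree ≤ N α)
    (hNQ : ∀ α, N α ≤ Q ^ α.degree) (hc : ∀ k, 0 < c k)
    (hinj : Injective fun γ : MIdx n κ => N γ.2 * c γ.1)
    (L : Set (MIdx n κ)) (F : Finset (MIdx n κ))
    (ld : MIdx n κ → MIdx n κ)
    (hld : ∀ γ ∈ L, ld γ ∈ F ∧ ∃ β, γ = ⟨(ld γ).1, (ld γ).2 + β⟩)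
    (ν : MIdx n κ → κ → ℂ[n])
    (hν1 : ∀ γ ∈ F, (ν γ γ.1).coeff γ.2 = 1)
    (hν0 : ∀ γ ∈ F, ∀ δ : MIdx n κ, N δ.2 * c δ.1 < N γ.2 * c γ.1 →
      (ν γ δ.1).coeff δ.2 = 0)
    (v : κ → (Fin n →₀ ℕ) → ℂ) {R : ℝ} (hR : 0 < R) (hv : ∀ k, PSConv (v k) R) :
    ∃ R' > 0, R' ≤ R ∧ ∃ (r : κ → (Fin n →₀ ℕ) → ℂ)
      (q : MIdx n κ → (Fin n →₀ ℕ) → ℂ),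
      (∀ k, PSConv (r k) R') ∧ (∀ γ, PSConv (q γ) R') ∧ (∀ γ ∈ L, r γ.1 γ.2 = 0) ∧
      ∀ z, ‖z‖ ≤ R' → ∀ k, psEval (v k) z
        = psEval (r k) z + ∑ γ ∈ F, psEval (q γ) z * eval z (ν γ k) := by
  classical
  set m : MIdx n κ → ℕ := fun γ => N γ.2 * c γ.1 with hm
  have hNpos : ∀ α, 0 < N α := fun α => lt_of_lt_of_le (by positivity) (hN2 α)
  have hmpos : ∀ γ, 0 < m γ := fun γ => Nat.mul_pos (hNpos _) (hc _)
  set S : MIdx n κ → Finset (MIdx n κ) := fun γ => Finset.univ.sigma fun k => (ν γ k).support with hS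
  -- choice of the exponent
  have hlim : ∀ γ ∈ F, Tendsto (fun s : ℕ => ∑ δ ∈ (S γ).erase γ,
      ‖(ν γ δ.1).coeff δ.2‖ * ((m γ : ℝ) / m δ) ^ s) Filter.atTop (𝓝 0) := by
    intro γ hγ
    rw [← Finset.sum_const_zero (s := (S γ).erase γ)]
    refine tendsto_finsetSum _ fun δ hδ => ?_
    rw [← mul_zero ‖(ν γ δ.1).coeff δ.2‖]
    refine (tendsto_pow_atTop_nhds_zero_of_lt_one (by positivity) ?_).const_mul _
    rw [div_lt_one (by exact_mod_cast hmpos δ), Nat.cast_lt]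
    rw [Finset.mem_erase, hS, Finset.mem_sigma, mem_support_iff] at hδ
    refine lt_of_le_of_ne (not_lt.1 fun h => hδ.2.2 (hν0 γ hγ δ h)) fun h => hδ.1 (hinj h.symm)
  have hsmall : ∀ᶠ s : ℕ in Filter.atTop, ∀ γ ∈ F, ∑ δ ∈ (S γ).erase γ,
      ‖(ν γ δ.1).coeff δ.2‖ * ((m γ : ℝ) / m δ) ^ s < 1 / 2 :=
    (Filter.eventually_all_finset F).2 fun γ hγ =>
      (hlim γ hγ).eventually_lt_const (by norm_num)
  have hhalf : ∀ᶠ s : ℕ in Filter.atTop, (1 / 2 : ℝ) ^ s < R :=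
    (tendsto_pow_atTop_nhds_zero_of_lt_one (by norm_num) (by norm_num)).eventually_lt_const hR
  obtain ⟨s, hs1, hs2⟩ := (hsmall.and hhalf).exists
  have hmc : ∀ γ, (0 : ℝ) < m γ := fun γ => by exact_mod_cast hmpos γ
  have hNc : ∀ α, (0 : ℝ) < N α := fun α => by exact_mod_cast hNpos α
  have hcc : ∀ k, (0 : ℝ) < c k := fun k => by exact_mod_cast hc k
  set w : MIdx n κ → ℝ := fun γ => ((m γ : ℝ) ^ s)⁻¹ with hw
  have hwpos : ∀ γ, 0 < w γ := fun γ => inv_pos.2 (pow_pos (hmc γ) s)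
  -- the weighted coefficient family
  have hx : Memℓp (fun γ : MIdx n κ => v γ.1 γ.2 * (w γ : ℂ)) 1 := by
    refine memℓp_gen ?_
    simp only [ENNReal.toReal_one, Real.rpow_one]
    rw [summable_sigma_of_nonneg fun _ => norm_nonneg _]
    refine ⟨fun k => Summable.of_nonneg_of_le (fun _ => norm_nonneg _) (fun α => ?_) (hv k),
      Summable.of_finite⟩
    rw [norm_mul, norm_real, norm_of_nonneg (hwpos _).le]
    refine mul_le_mul_of_nonneg_left ?_ (norm_nonneg _)
    have h1 : (2 : ℝ) ^ α.degree ≤ m ⟨k, α⟩ := by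
      have := (hN2 α).trans (Nat.le_mul_of_pos_right _ (hc k))
      exact_mod_cast this
    calc w ⟨k, α⟩ ≤ (((2 : ℝ) ^ α.degree) ^ s)⁻¹ := by
          simp only [hw]; gcongr
      _ = ((1 / 2 : ℝ) ^ s) ^ α.degree := by
          rw [← pow_mul, ← pow_mul, mul_comm, one_div, inv_pow]
      _ ≤ R ^ α.degree := by gcongr
  set x : Lone (MIdx n κ) := ⟨_, hx⟩ with hxdef
  -- the perturbation of the identity
  set T : MIdx n κ → Lone (MIdx n κ) := fun γ => if γ ∈ L then
      ∑ δ ∈ S (ld γ), ((ν (ld γ) δ.1).coeff δ.2 * (w δ / w (ld γ) : ℝ) : ℂ) •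
        (lp.single 1 (⟨δ.1, δ.2 + (γ.2 - (ld γ).2)⟩ : MIdx n κ) (1 : ℂ) : Lone (MIdx n κ))
    else lp.single 1 γ (1 : ℂ) with hT
  have hTn : ∀ γ, ‖(lp.single 1 γ (1 : ℂ) : Lone (MIdx n κ)) - T γ‖ ≤ 1 / 2 := by
    intro γ
    by_cases hγ : γ ∈ L
    · obtain ⟨hF, β, hβ⟩ := hld γ hγ
      have hmem : ld γ ∈ S (ld γ) := by
        rw [hS, Finset.mem_sigma, mem_support_iff, hν1 _ hF]
        exact ⟨Finset.mem_univ _, one_ne_zero⟩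
      have hγe : (⟨(ld γ).1, (ld γ).2 + (γ.2 - (ld γ).2)⟩ : MIdx n κ) = γ := by
        generalize ld γ = γ₀ at *
        subst hβ
        simp
      rw [show T γ = _ from if_pos hγ, ← Finset.add_sum_erase _ _ hmem, hγe, hν1 _ hF,
        div_self (hwpos _).ne', Complex.ofReal_one, mul_one, one_smul, sub_add_cancel_left,
        norm_neg]
      refine (norm_sum_le _ _).trans (le_trans (Finset.sum_le_sum fun δ _ => ?_) (hs1 _ hF).le)
      rw [norm_smul, lp.norm_single (by simp), norm_one, mul_one, norm_mul, norm_real,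
        norm_of_nonneg (div_nonneg (hwpos _).le (hwpos _).le)]
      refine le_of_eq ?_
      simp only [hw]
      rw [div_pow, div_inv_eq_mul, inv_mul_eq_div]
    · rw [show T γ = _ from if_neg hγ, sub_self, norm_zero]
      norm_num
  obtain ⟨y, hy⟩ := exists_hasSum_smul T hTn x
  have hQ : 0 < (Q + 2 : ℝ) := by positivity
  set R₁ : ℝ := min R ((((Q + 2 : ℝ)) ^ s)⁻¹) with hR₁
  have hR₁pos : 0 < R₁ := lt_min hR (by positivity)
  have hNR : ∀ α, (N α : ℝ) ^ s * R₁ ^ α.degree ≤ 1 := by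
    intro α
    have h1 : (N α : ℝ) ≤ (Q + 2) ^ α.degree := by
      calc (N α : ℝ) ≤ (Q : ℝ) ^ α.degree := by exact_mod_cast hNQ α
        _ ≤ (Q + 2) ^ α.degree := by gcongr; linarith
    calc (N α : ℝ) ^ s * R₁ ^ α.degree
        ≤ ((Q + 2 : ℝ) ^ α.degree) ^ s * ((((Q + 2 : ℝ)) ^ s)⁻¹) ^ α.degree := by
          gcongr
          exact min_le_right _ _
      _ = 1 := by
          rw [inv_pow, pow_right_comm, mul_inv_cancel₀ (by positivity)]
  have hwinv : ∀ γ, (w γ)⁻¹ = (N γ.2 : ℝ) ^ s * (c γ.1 : ℝ) ^ s := fun γ => by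
    simp [hw, hm, mul_pow]
  have hwadd : ∀ k α β, (w ⟨k, α + β⟩)⁻¹ = (w ⟨k, α⟩)⁻¹ * (N β : ℝ) ^ s := fun k α β => by
    rw [hwinv, hwinv, hN]; push_cast; ring
  set Cm : ℝ := ∑ k, (c k : ℝ) ^ s with hCm
  have hcC : ∀ k, (c k : ℝ) ^ s ≤ Cm := fun k =>
    single_le_sum (f := fun k => (c k : ℝ) ^ s) (fun _ _ => by positivity)
      (Finset.mem_univ k)
  have hwR : ∀ γ : MIdx n κ, (w γ)⁻¹ * R₁ ^ γ.2.degree ≤ Cm := fun γ => by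
    rw [hwinv, mul_right_comm]
    exact (mul_le_of_le_one_left (by positivity) (hNR _)).trans (hcC _)
  -- remainder and quotients
  set r : κ → (Fin n →₀ ℕ) → ℂ := fun k α =>
    if (⟨k, α⟩ : MIdx n κ) ∈ L then 0 else y ⟨k, α⟩ * ((w ⟨k, α⟩)⁻¹ : ℝ) with hr
  set q : MIdx n κ → (Fin n →₀ ℕ) → ℂ := fun γ β =>
    if (⟨γ.1, γ.2 + β⟩ : MIdx n κ) ∈ L ∧ ld ⟨γ.1, γ.2 + β⟩ = γ then
      y ⟨γ.1, γ.2 + β⟩ * ((w ⟨γ.1, γ.2 + β⟩)⁻¹ : ℝ) else 0 with hq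
  have hji : ∀ γ : MIdx n κ, Injective fun β => (⟨γ.1, γ.2 + β⟩ : MIdx n κ) := by
    intro γ β β' h
    simpa using h
  have hki : ∀ k : κ, Injective fun α => (⟨k, α⟩ : MIdx n κ) := by
    intro k α α' h
    simpa using h
  have hrs : ∀ k, PSConv (r k) R₁ := by
    intro k
    refine Summable.of_nonneg_of_le (fun _ => by positivity) (fun α => ?_)
      (((Lone.summable_norm y).comp_injective (hki k)).mul_right Cm)
    simp only [hr, comp_apply]
    split_ifs
    · rw [norm_zero, zero_mul]
      exact mul_nonneg (norm_nonneg _) ((by positivity : (0:ℝ) ≤ (c k : ℝ) ^ s).trans (hcC k))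
    · rw [norm_mul, norm_real, norm_of_nonneg (inv_pos.2 (hwpos _)).le, mul_assoc]
      exact mul_le_mul_of_nonneg_left (hwR ⟨k, α⟩) (norm_nonneg _)
  have hqs : ∀ γ, PSConv (q γ) R₁ := by
    intro γ
    refine Summable.of_nonneg_of_le (fun _ => by positivity) (fun β => ?_)
      (((Lone.summable_norm y).comp_injective (hji γ)).mul_right (w γ)⁻¹)
    have h0 : (0 : ℝ) ≤ (w γ)⁻¹ := (inv_pos.2 (hwpos _)).le
    simp only [hq, comp_apply]
    split_ifs
    · rw [norm_mul, norm_real, norm_of_nonneg (inv_pos.2 (hwpos _)).le, mul_assoc,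
        hwadd, mul_assoc]
      exact mul_le_mul_of_nonneg_left (mul_le_of_le_one_right h0 (hNR β)) (norm_nonneg _)
    · rw [norm_zero, zero_mul]
      exact mul_nonneg (norm_nonneg _) h0
  refine ⟨R₁, hR₁pos, min_le_left _ _, r, q, hrs, hqs, fun γ hγ => if_pos hγ, ?_⟩
  intro z hz k
  set E : MIdx n κ → ℂ := fun γ =>
    if γ.1 = k then ((w γ)⁻¹ : ℝ) * monoVal z γ.2 else 0 with hE
  have hEn : ∀ γ, ‖E γ‖ ≤ Cm := by
    intro γ
    simp only [hE]
    split_ifs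
    · rw [norm_mul, norm_real, norm_of_nonneg (inv_pos.2 (hwpos _)).le]
      refine le_trans (mul_le_mul_of_nonneg_left ((norm_monoVal_le z γ.2).trans
        (pow_le_pow_left₀ (norm_nonneg _) hz _)) (inv_pos.2 (hwpos _)).le) (hwR γ)
    · rw [norm_zero]
      exact (by positivity : (0:ℝ) ≤ (c k : ℝ) ^ s).trans (hcC k)
  set Φ := sumOp E Cm hEn with hΦ
  have hΦs : ∀ γ, Φ (lp.single 1 γ (1 : ℂ)) = E γ := by
    intro γ
    rw [hΦ, sumOp_apply, tsum_eq_single γ]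
    · simp
    · intro δ hδ
      have : (lp.single 1 γ (1 : ℂ) : Lone (MIdx n κ)) δ = 0 := lp.single_apply_ne 1 γ _ hδ
      rw [this, zero_smul]
  have hΦx : HasSum (fun γ => x γ * E γ) (Φ x) := (Lone.summable_smul hEn x).hasSum
  have hΦx' : Φ x = psEval (v k) z := by
    have h1 := ((hki k).hasSum_iff (f := fun γ => x γ * E γ) (fun γ hγ => by
      have : γ.1 ≠ k := fun h => hγ ⟨γ.2, by rw [← h]⟩
      simp [hE, this])).2 hΦx
    refine (h1.tsum_eq.symm.trans (tsum_congr fun α => ?_))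
    have h2 : x ⟨k, α⟩ = v k α * (w ⟨k, α⟩ : ℂ) := rfl
    have h3 : (w ⟨k, α⟩ : ℂ) ≠ 0 := by exact_mod_cast (hwpos _).ne'
    simp only [comp_apply, hE, if_true, h2]
    push_cast
    field_simp
  have hΦy : HasSum (fun γ => y γ * Φ (T γ)) (psEval (v k) z) := by
    rw [← hΦx']
    refine (congrArg (fun F => HasSum F (Φ x)) (funext fun γ => ?_)).mp (Φ.hasSum hy)
    simp
  -- values of the operator on the perturbed basis
  have hΦL : ∀ γ ∈ L, Φ (T γ) = ((w γ)⁻¹ : ℝ) * monoVal z (γ.2 - (ld γ).2)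
      * eval z (ν (ld γ) k) := by
    intro γ hγ
    obtain ⟨hF, β, hβ⟩ := hld γ hγ
    have hβ2 : γ.2 - (ld γ).2 = β := by
      have := congrArg (fun g : MIdx n κ => g.2) hβ
      simp only at this
      rw [this, add_tsub_cancel_left]
    have hwγ : (w γ)⁻¹ = (w (ld γ))⁻¹ * (N β : ℝ) ^ s := by
      rw [← hwadd, ← hβ]
    rw [show T γ = _ from if_pos hγ, map_sum, hβ2, hwγ, eval_eq_sum_monoVal, mul_sum,
      hS, Finset.sum_sigma, Finset.sum_eq_single k]
    · refine sum_congr rfl fun α _ => ?_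
      rw [map_smul, hΦs]
      simp only [hE, if_true, smul_eq_mul]
      rw [hwadd, monoVal_add]
      have h3 : (w ⟨k, α⟩ : ℂ) ≠ 0 := by exact_mod_cast (hwpos _).ne'
      have h4 : (w (ld γ) : ℂ) ≠ 0 := by exact_mod_cast (hwpos _).ne'
      push_cast
      field_simp
    · intro k' _ hk'
      refine sum_eq_zero fun α _ => ?_
      rw [map_smul, hΦs]
      simp [hE, hk']
    · simp
  have hA : HasSum (fun γ => if γ ∈ L then 0 else y γ * E γ) (psEval (r k) z) := by
    refine ((hki k).hasSum_iff fun γ hγ => ?_).1 ?_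
    · have : γ.1 ≠ k := fun h => hγ ⟨γ.2, by rw [← h]⟩
      simp [hE, this]
    · refine (congrArg (fun F => HasSum F (psEval (r k) z)) (funext fun α => ?_)).mp ((hrs k).hasSum hz)
      simp only [hr, hE, comp_apply, if_true]
      split_ifs
      · simp
      · ring
  have hB : ∀ γ₀ ∈ F, HasSum (fun γ => if γ ∈ L ∧ ld γ = γ₀ then y γ * Φ (T γ) else 0)
      (psEval (q γ₀) z * eval z (ν γ₀ k)) := by
    intro γ₀ hγ₀
    refine ((hji γ₀).hasSum_iff fun γ hγ => ?_).1 ?_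
    · refine if_neg fun h => hγ ?_
      obtain ⟨hF, β, hβ⟩ := hld γ h.1
      exact ⟨β, by rw [h.2] at hβ; exact hβ.symm⟩
    · refine (congrArg (fun F => HasSum F _) (funext fun β => ?_)).mp
        (((hqs γ₀).hasSum hz).mul_right (eval z (ν γ₀ k)))
      simp only [hq, comp_apply]
      split_ifs with h
      · rw [hΦL _ h.1, h.2, add_tsub_cancel_left]
        ring
      · simp
  have hsum := hA.add (hasSum_sum hB)
  refine hΦy.unique ((congrArg (fun F => HasSum F _) (funext fun γ => ?_)).mp hsum)
  by_cases hγ : γ ∈ L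
  · rw [if_pos hγ, zero_add, Finset.sum_eq_single (ld γ)]
    · simp [hγ]
    · intro γ₀ _ h
      exact if_neg fun h' => h h'.2.symm
    · exact fun h => absurd (hld γ hγ).1 h
  · rw [if_neg hγ, sum_eq_zero fun γ₀ _ => if_neg fun h => hγ h.1, add_zero,
      show T γ = _ from if_neg hγ, hΦs]

end GrauertDivision

section LocalDivision

variable {n : ℕ} {κ ι : Type*} [Fintype κ] [Fintype ι]

theorem exists_finite_leading (L : Set (MIdx n κ)) :
    ∃ (F : Finset (MIdx n κ)) (ld : MIdx n κ → MIdx n κ), (∀ γ ∈ F, γ ∈ L) ∧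
      ∀ γ ∈ L, ld γ ∈ F ∧ ∃ β, γ = ⟨(ld γ).1, (ld γ).2 + β⟩ := by
  classical
  have hfin : ∀ k : κ, {α | Minimal (fun α => (⟨k, α⟩ : MIdx n κ) ∈ L) α}.Finite := fun k =>
    WellQuasiOrderedLE.finite_of_isAntichain (setOfPred_minimal_antichain _)
  have hex : ∀ γ : MIdx n κ, γ ∈ L → ∃ α ≤ γ.2, Minimal (fun α => (⟨γ.1, α⟩ : MIdx n κ) ∈ L) α :=
    fun γ hγ => exists_minimal_le_of_wellFoundedLT _ γ.2 hγ
  choose! f hf1 hf2 using hex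
  refine ⟨Finset.univ.sigma fun k => (hfin k).toFinset, fun γ => ⟨γ.1, f γ⟩, fun γ hγ => ?_,
    fun γ hγ => ⟨?_, γ.2 - f γ, ?_⟩⟩
  · have := (Finset.mem_sigma.1 hγ).2
    rw [Set.Finite.mem_toFinset] at this
    exact this.1
  · simpa using hf2 γ hγ
  · simp [add_tsub_cancel_of_le (hf1 γ hγ)]

/-- A function is holomorphic near a point. -/
def HolAt (p : ℂ^n) (f : ℂ^n → ℂ) : Prop := ∀ᶠ z in 𝓝 p, DifferentiableAt ℂ f z

theorem holAt_iff_exists_ball {p : ℂ^n} {f : ℂ^n → ℂ} :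
    HolAt p f ↔ ∃ ρ > 0, DifferentiableOn ℂ f (ball p ρ) := by
  rw [HolAt, Metric.eventually_nhds_iff_ball]
  refine exists_congr fun ρ => and_congr_right fun _ => ?_
  exact ⟨fun h z hz => (h z hz).differentiableWithinAt,
    fun h z hz => h.differentiableAt (isOpen_ball.mem_nhds hz)⟩

theorem isBigO_mul_bounded {E : Type*} [NormedAddCommGroup E] {p : E} {f g : E → ℂ} {h : E → ℝ}
    (hf : f =O[𝓝 p] h) (hg : ContinuousAt g p) : (fun z => f z * g z) =O[𝓝 p] h := by
  simpa using hf.mul (hg.norm.isBoundedUnder_le.isBigO_one ℝ)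

theorem exists_eq_mulVec_of_jets_zero (A : Matrix κ ι ℂ[n])
    (v : κ → ℂ^n → ℂ) (hv : ∀ i, HolAt 0 (v i))
    (h : ∀ m : ℕ, ∃ q : ι → ℂ[n], ∀ i,
      (fun z => v i z - eval z (A.mulVec q i)) =O[𝓝 0] fun z => ‖z‖ ^ m) :
    ∃ q : ι → ℂ^n → ℂ, (∀ j, HolAt 0 (q j)) ∧
      ∀ i, ∀ᶠ z in 𝓝 0, v i z = ∑ j, eval z (A i j) * q j z := by
  classical
  obtain ⟨N, c, Q, hN, hN2, hNQ, hc, hinj⟩ := exists_monomial_weight n κ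
  have hT : ∀ i, ∃ R > 0, ∃ a : (Fin n →₀ ℕ) → ℂ, PSConv a R ∧ ∀ z, ‖z‖ ≤ R →
      v i z = psEval a z := fun i => by
    obtain ⟨ρ, hρ, hd⟩ := holAt_iff_exists_ball.1 (hv i)
    exact exists_taylor hρ hd
  choose Ri hRi a ha hav using hT
  obtain ⟨R, hR, hRle⟩ : ∃ R > 0, ∀ i, R ≤ Ri i := by
    have h1 : ∀ᶠ R in 𝓝[>] (0 : ℝ), ∀ i, R ≤ Ri i := by
      rw [eventually_all]
      exact fun i => (eventually_le_nhds (hRi i)).filter_mono nhdsWithin_le_nhds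
    obtain ⟨R, h1, h2⟩ := (h1.and self_mem_nhdsWithin).exists
    exact ⟨R, h2, h1⟩
  set m : MIdx n κ → ℕ := fun γ => N γ.2 * c γ.1 with hm
  set L : Set (MIdx n κ) := {γ | ∃ q : ι → ℂ[n],
    (A.mulVec q γ.1).coeff γ.2 = 1 ∧ ∀ δ : MIdx n κ, m δ < m γ →
      (A.mulVec q δ.1).coeff δ.2 = 0} with hL
  obtain ⟨F, ld, hFL, hld⟩ := exists_finite_leading L
  have hFL' : ∀ γ, γ ∈ F → ∃ q : ι → ℂ[n],
    (A.mulVec q γ.1).coeff γ.2 = 1 ∧ ∀ δ : MIdx n κ, m δ < m γ →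
      (A.mulVec q δ.1).coeff δ.2 = 0 := fun γ hγ => hFL γ hγ
  choose! g hg1 hg0 using hFL'
  obtain ⟨R', hR', hR'R, r, q, hr, hq, hrL, heq⟩ := grauert_division N c Q hN hN2 hNQ hc hinj L F
    ld hld (fun γ => A.mulVec (g γ)) hg1 hg0 a hR (fun k => (ha k).mono hR.le (hRle k))
  have hball : ∀ᶠ z in 𝓝 (0 : ℂ^n), ‖z‖ ≤ R' := by
    filter_upwards [closedBall_mem_nhds (0 : ℂ^n) hR'] with z hz
    simpa using hz
  have hr0 : ∀ γ : MIdx n κ, r γ.1 γ.2 = 0 := by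
    by_contra! hne
    obtain ⟨γ, hγ, hmin⟩ := exists_minimalFor_of_wellFoundedLT (fun γ : MIdx n κ => r γ.1 γ.2 ≠ 0)
      m hne
    obtain ⟨p, hp⟩ := h (m γ + 1)
    set W : ι → ℂ[n] := p - ∑ γ₀ ∈ F, psTrunc (q γ₀) (m γ + 1) • g γ₀ with hW
    have hO : ∀ i, psEval (r i + -fun α => (A.mulVec W i).coeff α) =O[𝓝 0]
        fun z => ‖z‖ ^ (m γ + 1) := by
      intro i
      have h1 : ∀ γ₀ ∈ F, (fun z => (psEval (q γ₀) z - eval z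
          (psTrunc (q γ₀) (m γ + 1))) * eval z (A.mulVec (g γ₀) i))
          =O[𝓝 0] fun z => ‖z‖ ^ (m γ + 1) := fun γ₀ _ =>
        isBigO_mul_bounded ((hq γ₀).isBigO_sub_trunc hR' _)
          (differentiable_eval _).continuous.continuousAt
      refine ((hp i).sub (IsBigO.sum h1)).congr' ?_ Filter.EventuallyEq.rfl
      filter_upwards [hball] with z hz
      have h2 : psEval (r i + -fun α => (A.mulVec W i).coeff α) z
          = psEval (r i) z + -eval z (A.mulVec W i) := by
        rw [psEval_add (hr i) ((psConv_coeff _ R').neg hR'.le) hz]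
        congr 1
        rw [← psEval_coeff]
        simp [psEval, tsum_neg]
      have h3 : A.mulVec W i = A.mulVec p i
          - ∑ γ₀ ∈ F, psTrunc (q γ₀) (m γ + 1) * A.mulVec (g γ₀) i := by
        rw [hW, Matrix.mulVec_sub, Matrix.mulVec_sum]
        simp [mulVec_smul]
      rw [h2, hav i z (hz.trans (hR'R.trans (hRle i))), heq z hz i, h3]
      simp only [Finset.sum_apply, map_sub, map_sum, map_mul, sub_mul, sum_sub_distrib]
      ring
    have hcoef : ∀ δ : MIdx n κ, m δ ≤ m γ → (A.mulVec W δ.1).coeff δ.2 = r δ.1 δ.2 := by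
      intro δ hδ
      have h1 := coeff_eq_zero_of_isBigO ((hr δ.1).add hR'.le ((psConv_coeff _ R').neg hR'.le))
        hR' (hO δ.1) δ.2 (by
          have h2 : δ.2.degree < 2 ^ δ.2.degree := Nat.lt_two_pow_self
          have h3 := (hN2 δ.2).trans (Nat.le_mul_of_pos_right _ (hc δ.1))
          have h4 : m δ = N δ.2 * c δ.1 := rfl
          omega)
      simp only [Pi.add_apply, Pi.neg_apply] at h1
      exact (add_neg_eq_zero.1 h1).symm
    refine hγ (hrL γ ⟨(C (σ := Fin n) (r γ.1 γ.2)⁻¹) • W, ?_, fun δ hδ => ?_⟩)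
    · rw [mulVec_smul, Pi.smul_apply, smul_eq_mul, MvPolynomial.coeff_C_mul,
        hcoef γ le_rfl, inv_mul_cancel₀ hγ]
    · rw [mulVec_smul, Pi.smul_apply, smul_eq_mul, MvPolynomial.coeff_C_mul,
        hcoef δ hδ.le]
      by_contra hne'
      exact absurd (hmin (right_ne_zero_of_mul hne') hδ.le) (not_le.2 hδ)
  refine ⟨fun j z => ∑ γ ∈ F, psEval (q γ) z * eval z (g γ j), fun j => ?_,
    fun i => ?_⟩
  · rw [holAt_iff_exists_ball]
    exact ⟨R', hR', DifferentiableOn.fun_sum fun γ _ => ((hq γ).differentiableOn hR').fun_mul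
      (differentiable_eval _).differentiableOn⟩
  · filter_upwards [hball] with z hz
    rw [hav i z (hz.trans (hR'R.trans (hRle i))), heq z hz i]
    have : psEval (r i) z = 0 := by
      simp [psEval, show ∀ α, r i α = 0 from fun α => hr0 ⟨i, α⟩]
    rw [this, zero_add]
    simp only [mulVec, dotProduct, map_sum, map_mul, mul_sum]
    rw [sum_comm]
    exact sum_congr rfl fun j _ => sum_congr rfl fun γ _ => by ring

/-- Translation of polynomials. -/
def polyShift (p : ℂ^n) : ℂ[n] →ₐ[ℂ] ℂ[n] :=
  aeval fun i => X i + C (p i)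

theorem eval_polyShift (p z : ℂ^n) (P : ℂ[n]) :
    eval z (polyShift p P) = eval (z + p) P := by
  induction P using MvPolynomial.induction_on with
  | C a => simp [polyShift]
  | add P Q hP hQ => simp only [map_add, hP, hQ]
  | mul_X P i hP =>
    rw [map_mul, map_mul, hP, map_mul]
    congr 1
    simp [polyShift]

theorem tendsto_add_nhds_zero (p : ℂ^n) :
    Tendsto (fun z => z + p) (𝓝 0) (𝓝 p) := by
  have : Continuous fun z : Fin n → ℂ => z + p := by fun_prop
  simpa using this.tendsto 0

theorem tendsto_sub_nhds (p : ℂ^n) :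
    Tendsto (fun z => z - p) (𝓝 p) (𝓝 0) := by
  have : Continuous fun z : Fin n → ℂ => z - p := by fun_prop
  simpa using this.tendsto p

/-- If a germ of holomorphic vector is, up to any finite order, a combination of the columns of
a polynomial matrix, then it is a combination with holomorphic coefficients. -/
theorem exists_eq_mulVec_of_jets (A : Matrix κ ι ℂ[n]) (p : ℂ^n)
    (v : κ → ℂ^n → ℂ) (hv : ∀ i, HolAt p (v i))
    (h : ∀ m : ℕ, ∃ q : ι → ℂ[n], ∀ i,
      (fun z => v i z - eval z (A.mulVec q i)) =O[𝓝 p] fun z => ‖z - p‖ ^ m) :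
    ∃ q : ι → ℂ^n → ℂ, (∀ j, HolAt p (q j)) ∧
      ∀ i, ∀ᶠ z in 𝓝 p, v i z = ∑ j, eval z (A i j) * q j z := by
  have h1 : ∀ i, HolAt 0 fun z => v i (z + p) := fun i => by
    filter_upwards [(tendsto_add_nhds_zero p).eventually (hv i)] with z hz
    exact DifferentiableAt.comp z hz (by fun_prop)
  have h2 : ∀ m : ℕ, ∃ q : ι → ℂ[n], ∀ i,
      (fun z => v i (z + p) - eval z ((A.map (polyShift p)).mulVec q i))
        =O[𝓝 0] fun z => ‖z‖ ^ m := fun m => by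
    obtain ⟨q, hq⟩ := h m
    refine ⟨fun j => polyShift p (q j), fun i => ?_⟩
    refine ((hq i).comp_tendsto (tendsto_add_nhds_zero p)).congr (fun z => ?_) fun z => ?_
    · simp only [comp_apply, mulVec, dotProduct, Matrix.map_apply, ← map_mul,
        ← map_sum, eval_polyShift]
    · simp
  obtain ⟨q, hq, hqv⟩ := exists_eq_mulVec_of_jets_zero (A.map (polyShift p)) _ h1 h2
  refine ⟨fun j z => q j (z - p), fun j => ?_, fun i => ?_⟩
  · filter_upwards [(tendsto_sub_nhds p).eventually (hq j)] with z hz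
    exact DifferentiableAt.comp z hz (by fun_prop)
  · filter_upwards [(tendsto_sub_nhds p).eventually (hqv i)] with z hz
    simpa [eval_polyShift] using hz

end LocalDivision

section Jets

theorem artinRees_range {R M M' : Type*} [CommRing R] [IsNoetherianRing R] [AddCommGroup M]
    [AddCommGroup M'] [Module R M] [Module R M'] [Module.Finite R M'] (I : Ideal R)
    (φ : M →ₗ[R] M') : ∃ c : ℕ, ∀ k, ∀ x ∈ LinearMap.range φ, x ∈ I ^ k • (⊤ : Submodule R M') →
      ∃ y ∈ I ^ (k - c) • (⊤ : Submodule R M), φ y = x := by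
  obtain ⟨c, hc⟩ := I.exists_pow_inf_eq_pow_smul (LinearMap.range φ)
  refine ⟨c, fun k x hx hk => ?_⟩
  rcases lt_or_ge k c with h | h
  · obtain ⟨y, rfl⟩ := hx
    exact ⟨y, by simp [Nat.sub_eq_zero_of_le h.le], rfl⟩
  · have h1 : x ∈ I ^ k • (⊤ : Submodule R M') ⊓ LinearMap.range φ := ⟨hk, hx⟩
    rw [hc k h] at h1
    have h2 : x ∈ I ^ (k - c) • LinearMap.range φ :=
      Submodule.smul_mono le_rfl inf_le_right h1
    rw [LinearMap.range_eq_map, ← Submodule.map_smul''] at h2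
    exact h2

theorem mem_smul_top_pi {R ι : Type*} [CommRing R] [Fintype ι] {J : Ideal R} {x : ι → R} :
    x ∈ J • (⊤ : Submodule R (ι → R)) ↔ ∀ i, x i ∈ J := by
  classical
  constructor
  · intro h i
    have h1 := Submodule.mem_map_of_mem (f := LinearMap.proj (R := R) (φ := fun _ : ι => R) i) h
    rw [Submodule.map_smul''] at h1
    have h2 := Submodule.smul_mono (le_refl J) (le_top) h1
    simpa using h2
  · intro h
    rw [pi_eq_sum_univ x]
    exact Submodule.sum_mem _ fun i _ => Submodule.smul_mem_smul (h i) trivial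

variable {n : ℕ}

/-- The maximal ideal of a point. -/
def mIdl (p : ℂ^n) : Ideal ℂ[n] := ker (eval p)

theorem mem_mIdl {p : ℂ^n} {P : ℂ[n]} :
    P ∈ mIdl p ↔ eval p P = 0 := Iff.rfl

theorem polyShift_polyShift (p q : ℂ^n) (P : ℂ[n]) :
    polyShift p (polyShift q P) = polyShift (p + q) P := by
  apply MvPolynomial.funext
  intro x
  simp only [eval_polyShift, add_assoc]

theorem polyShift_zero (P : ℂ[n]) : polyShift 0 P = P := by
  apply MvPolynomial.funext
  intro x
  simp only [eval_polyShift, add_zero]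

theorem polyShift_mem_mIdl_pow {p q : ℂ^n} {k : ℕ} {P : ℂ[n]}
    (hP : P ∈ mIdl (p + q) ^ k) : polyShift q P ∈ mIdl p ^ k := by
  have h1 := Ideal.mem_map_of_mem (polyShift q) hP
  rw [Ideal.map_pow] at h1
  refine Ideal.pow_right_mono (Ideal.map_le_iff_le_comap.2 fun Q hQ => ?_) k h1
  rw [Ideal.mem_comap, mem_mIdl, eval_polyShift]
  exact hQ

theorem isBigO_eval_of_mem_mIdl {p : ℂ^n} {P : ℂ[n]} (hP : P ∈ mIdl p) :
    (fun z => eval z P) =O[𝓝 p] fun z => ‖z - p‖ := by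
  have h := ((differentiable_eval P) p).isBigO_sub
  rw [mem_mIdl.1 hP] at h
  simpa using h.norm_right

theorem isBigO_eval_of_mem_pow {p : ℂ^n} {k : ℕ} {P : ℂ[n]}
    (hP : P ∈ mIdl p ^ k) : (fun z => eval z P) =O[𝓝 p] fun z => ‖z - p‖ ^ k := by
  induction k generalizing P with
  | zero =>
    simpa using ((differentiable_eval P) p).continuousAt.norm.isBoundedUnder_le.isBigO_one ℝ
  | succ k ih =>
    rw [pow_succ] at hP
    refine Submodule.mul_induction_on hP (fun a ha b hb => ?_) fun a b ha hb => ?_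
    · simpa [pow_succ] using (ih ha).mul (isBigO_eval_of_mem_mIdl hb)
    · simpa using ha.add hb

theorem idealOfVars_le_mIdl : MvPolynomial.idealOfVars (Fin n) ℂ ≤ mIdl 0 := by
  rw [MvPolynomial.idealOfVars, Ideal.span_le]
  rintro _ ⟨i, rfl⟩
  simp [mIdl]

theorem mem_pow_of_isBigO_eval {p : ℂ^n} {k : ℕ} {P : ℂ[n]}
    (hP : (fun z => eval z P) =O[𝓝 p] fun z => ‖z - p‖ ^ k) : P ∈ mIdl p ^ k := by
  have h1 : (fun z => eval z (polyShift p P)) =O[𝓝 0] fun z => ‖z‖ ^ k := by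
    refine (hP.comp_tendsto (tendsto_add_nhds_zero p)).congr (fun z => ?_) fun z => ?_
    · simp [eval_polyShift]
    · simp
  have h2 : polyShift p P ∈ mIdl 0 ^ k := by
    refine Ideal.pow_right_mono idealOfVars_le_mIdl k ?_
    rw [MvPolynomial.mem_pow_idealOfVars_iff']
    intro α hα
    refine coeff_eq_zero_of_isBigO (psConv_coeff (polyShift p P) 1) one_pos ?_ α hα
    rwa [show psEval (fun α => (polyShift p P).coeff α) = _ from funext (psEval_coeff _)]
  have h3 : polyShift (-p) (polyShift p P) ∈ mIdl p ^ k :=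
    polyShift_mem_mIdl_pow (by simpa using h2)
  simpa [polyShift_polyShift, polyShift_zero] using h3

theorem exists_jet {p : ℂ^n} {F : ℂ^n → ℂ} (hF : HolAt p F) (k : ℕ) :
    ∃ P : ℂ[n],
      (fun z => F z - eval z P) =O[𝓝 p] fun z => ‖z - p‖ ^ k := by
  have h1 : HolAt 0 fun z => F (z + p) := by
    filter_upwards [(tendsto_add_nhds_zero p).eventually hF] with z hz
    exact DifferentiableAt.comp z hz (by fun_prop)
  obtain ⟨ρ, hρ, hd⟩ := holAt_iff_exists_ball.1 h1
  obtain ⟨R, hR, a, ha, haF⟩ := exists_taylor hρ hd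
  refine ⟨polyShift (-p) (psTrunc a k), ?_⟩
  refine ((ha.isBigO_sub_trunc hR k).comp_tendsto (tendsto_sub_nhds p)).congr' ?_
    (Eventually.of_forall fun z => rfl)
  filter_upwards [(tendsto_sub_nhds p).eventually (closedBall_mem_nhds 0 hR)] with z hz
  simp only [comp_apply, eval_polyShift, ← sub_eq_add_neg]
  rw [← haF _ (by simpa using hz)]
  simp

theorem HolAt.continuousAt {p : ℂ^n} {F : ℂ^n → ℂ} (hF : HolAt p F) :
    ContinuousAt F p := hF.self_of_nhds.continuousAt

variable {κ ι : Type*} [Fintype ι]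

theorem isBigO_eval_mulVec (A : Matrix κ ι ℂ[n]) (p : ℂ^n) (k : ℕ)
    (a : ι → ℂ^n → ℂ) (q : ι → ℂ[n])
    (h : ∀ j, (fun z => a j z - eval z (q j)) =O[𝓝 p] fun z => ‖z - p‖ ^ k) (i : κ) :
    (fun z => ∑ j, eval z (A i j) * a j z - eval z (A.mulVec q i))
      =O[𝓝 p] fun z => ‖z - p‖ ^ k := by
  have h1 : ∀ j ∈ (Finset.univ : Finset ι), (fun z => (a j z - eval z (q j)) *
      eval z (A i j)) =O[𝓝 p] fun z => ‖z - p‖ ^ k := fun j _ =>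
    isBigO_mul_bounded (h j) (differentiable_eval _).continuous.continuousAt
  refine (IsBigO.sum h1).congr_left fun z => ?_
  simp only [Finset.sum_apply, mulVec, dotProduct, map_sum, map_mul,
    ← sum_sub_distrib]
  exact sum_congr rfl fun j _ => by ring

variable [Fintype κ]

/-- Flatness of the ring of germs of holomorphic functions over the polynomial ring. -/
theorem exists_syzygy_matrix (A : Matrix κ ι ℂ[n]) :
    ∃ (b : ℕ) (B : Matrix ι (Fin b) ℂ[n]), A * B = 0 ∧
      ∀ (p : ℂ^n) (a : ι → ℂ^n → ℂ), (∀ j, HolAt p (a j)) →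
        (∀ i, ∀ᶠ z in 𝓝 p, ∑ j, eval z (A i j) * a j z = 0) →
        ∃ c : Fin b → ℂ^n → ℂ, (∀ l, HolAt p (c l)) ∧
          ∀ j, ∀ᶠ z in 𝓝 p, a j z = ∑ l, eval z (B j l) * c l z := by
  obtain ⟨b, g, hg⟩ := Submodule.fg_iff_exists_fin_generating_family.1
    (IsNoetherian.noetherian (LinearMap.ker A.mulVecLin))
  refine ⟨b, Matrix.of fun j l => g l j, ?_, fun p a ha h0 => ?_⟩
  · ext1 i l
    have h1 : g l ∈ LinearMap.ker A.mulVecLin := hg ▸ Submodule.subset_span (mem_range_self l)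
    exact congrFun (show A.mulVec (g l) = 0 from h1) i
  refine exists_eq_mulVec_of_jets _ p a ha fun m => ?_
  obtain ⟨c, hc⟩ := artinRees_range (mIdl p) A.mulVecLin
  choose q hq using fun j => exists_jet (ha j) (m + c)
  have h1 : A.mulVec q ∈ mIdl p ^ (m + c) •
      (⊤ : Submodule ℂ[n] (κ → ℂ[n])) := by
    refine mem_smul_top_pi.2 fun i => mem_pow_of_isBigO_eval ?_
    refine (isBigO_eval_mulVec A p (m + c) a q hq i).neg_left.congr' ?_
      Filter.EventuallyEq.rfl
    filter_upwards [h0 i] with z hz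
    rw [hz]; ring
  obtain ⟨y, hy, hyq⟩ := hc _ _ ⟨q, rfl⟩ h1
  rw [Nat.add_sub_cancel, mem_smul_top_pi] at hy
  have h2 : q - y ∈ Submodule.span ℂ[n] (range g) := by
    rw [hg, LinearMap.mem_ker, map_sub, hyq]
    exact sub_self _
  obtain ⟨w, hw⟩ := (Submodule.mem_span_range_iff_exists_fun _).1 h2
  refine ⟨w, fun j => ?_⟩
  have h3 : (Matrix.of fun j l => g l j).mulVec w j = q j - y j := by
    rw [← Pi.sub_apply, ← hw]
    simp [mulVec, dotProduct, mul_comm]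
  rw [h3]
  have h4 : (fun z => ‖z - p‖ ^ (m + c)) =O[𝓝 p] fun z => ‖z - p‖ ^ m := by
    have : ContinuousAt (fun z : Fin n → ℂ => ‖z - p‖ ^ c) p := by fun_prop
    have := (isBigO_refl (fun z : Fin n → ℂ => ‖z - p‖ ^ m) (𝓝 p)).mul
      (this.norm.isBoundedUnder_le.isBigO_one ℝ)
    simpa [pow_add] using this
  refine (((hq j).trans h4).add (isBigO_eval_of_mem_pow (hy j))).congr_left fun z => ?_
  rw [map_sub]; ring

end Jets

section BoxGluing

variable {n : ℕ}

theorem HolNear.holAt {r : Box n} {f : ℂ^n → ℂ} (hf : HolNear r f)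
    {p : ℂ^n} (hp : p ∈ cBox r) : HolAt p f := by
  obtain ⟨s, hs, hd⟩ := hf
  filter_upwards [(isOpen_oBox r s).mem_nhds (cBox_subset_oBox hs hp)] with z hz
  exact hd.differentiableAt ((isOpen_oBox r s).mem_nhds hz)

theorem HolNear.mono {r r' : Box n} {f : ℂ^n → ℂ} (hf : HolNear r f)
    (h : r' ≤ r) : HolNear r' f := by
  obtain ⟨s, hs, hd⟩ := hf
  exact ⟨s, hs, hd.mono (oBox_mono h le_rfl)⟩

theorem holNear_eval (r : Box n) (P : ℂ[n]) :
    HolNear r fun z => eval z P :=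
  ⟨1, one_pos, (differentiable_eval P).differentiableOn⟩

theorem eventually_nhdsSet_cBox_iff {r : Box n} {p : ℂ^n → Prop} :
    (∀ᶠ z in 𝓝ˢ (cBox r), p z) ↔ ∃ s > 0, ∀ z ∈ oBox r s, p z := by
  constructor
  · intro h
    obtain ⟨W, hW, hsub, hp⟩ := mem_nhdsSet_iff_exists.1 h
    obtain ⟨s, hs, hs'⟩ := exists_oBox_subset hW hsub
    exact ⟨s, hs, fun z hz => hp (hs' hz)⟩
  · rintro ⟨s, hs, h⟩
    exact mem_of_superset ((isOpen_oBox r s).mem_nhdsSet.2 (cBox_subset_oBox hs)) h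

theorem holNear_iff {r : Box n} {f : ℂ^n → ℂ} :
    HolNear r f ↔ ∀ᶠ z in 𝓝ˢ (cBox r), DifferentiableAt ℂ f z := by
  rw [eventually_nhdsSet_cBox_iff]
  refine exists_congr fun s => and_congr_right fun _ => ⟨fun h z hz =>
    h.differentiableAt ((isOpen_oBox r s).mem_nhds hz), fun h z hz =>
    (h z hz).differentiableWithinAt⟩

/-- The number of directions in which a box has positive width. -/
def bDim (r : Box n) : ℕ := by
  classical exact (Finset.univ.filter fun a : Fin n × Fin 4 => 0 < bWidth r a.1 a.2).card

theorem bDim_mono {r r' : Box n} (h : r' ≤ r) : bDim r' ≤ bDim r := by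
  classical
  exact Finset.card_le_card fun a ha => by
    simp only [Finset.mem_filter, Finset.mem_univ, true_and] at ha ⊢
    exact ha.trans_le (bWidth_mono h _ _)

section

variable {r : Box n} {i : Fin n} {e : Fin 4} {c : ℝ}

theorem faceB_le_left (h2 : -c ≤ r i (e + 2)) :
    faceB r i e c ≤ setB r i e c :=
  setB_le (by rwa [setB_of_ne_dir (fin4_add_two_ne e)])

theorem faceB_le_right (h1 : c ≤ r i e) : faceB r i e c ≤ setB r i (e + 2) (-c) :=
  setB_mono (setB_le h1)

theorem oBox_inter (h1 : c ≤ r i e) (h2 : -c ≤ r i (e + 2)) (s : ℝ) :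
    oBox (setB r i e c) s ∩ oBox (setB r i (e + 2) (-c)) s = oBox (faceB r i e c) s :=
  Subset.antisymm (fun z hz => forall_setB (Q := fun j e' x => dirRe e' (z j) < x + s)
    (by simpa only [setB_same] using hz.2 i (e + 2)) hz.1)
    (subset_inter (oBox_mono (faceB_le_left h2) le_rfl) (oBox_mono (faceB_le_right h1) le_rfl))

theorem oBox_subset_union {s : ℝ} (hs : 0 < s) :
    oBox r s ⊆ oBox (setB r i e c) s ∪ oBox (setB r i (e + 2) (-c)) s := by
  intro z hz
  have H := fun i e c h => forall_setB (Q := fun j e' x => dirRe e' (z j) < x + s)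
    (i := i) (e := e) (c := c) h hz
  rcases lt_or_ge (dirRe e (z i)) (c + s) with h | h
  · exact .inl (H _ _ _ h)
  · exact .inr (H _ _ _ (by rw [dirRe_add_two]; linarith))

theorem cBox_subset_union :
    cBox r ⊆ cBox (setB r i e c) ∪ cBox (setB r i (e + 2) (-c)) := by
  intro z hz
  have H := fun i e c h => forall_setB (Q := fun j e' x => dirRe e' (z j) ≤ x)
    (i := i) (e := e) (c := c) h hz
  rcases le_total (dirRe e (z i)) c with h | h
  · exact .inl (H _ _ _ h)
  · exact .inr (H _ _ _ (by rw [dirRe_add_two]; linarith))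

theorem bDim_faceB_lt (h1 : c ≤ r i e) (h2 : -c ≤ r i (e + 2)) (hw : 0 < bWidth r i e) :
    bDim (faceB r i e c) < bDim r := by
  classical
  refine Finset.card_lt_card ((Finset.ssubset_iff_of_subset fun a ha => ?_).2 ⟨(i, e), ?_, ?_⟩)
  · simp only [Finset.mem_filter, Finset.mem_univ, true_and] at ha ⊢
    exact ha.trans_le (bWidth_mono ((faceB_le_left h2).trans (setB_le h1)) _ _)
  · simpa using hw
  · have : bWidth (faceB r i e c) i e = 0 := by
      rw [bWidth, faceB, setB_same, setB_of_ne_dir (fin4_add_two_ne e).symm, setB_same]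
      ring
    simp [this]

/-- Two holomorphic functions on the halves of a box which agree on the overlap. -/
theorem exists_glue {F : Type*} [NormedAddCommGroup F] [NormedSpace ℂ F]
    (h1 : c ≤ r i e) (h2 : -c ≤ r i (e + 2)) {s : ℝ} (hs : 0 < s)
    {f₁ f₂ : ℂ^n → F}
    (hf₁ : DifferentiableOn ℂ f₁ (oBox (setB r i e c) s))
    (hf₂ : DifferentiableOn ℂ f₂ (oBox (setB r i (e + 2) (-c)) s))
    (h : ∀ z ∈ oBox (faceB r i e c) s, f₁ z = f₂ z) :
    ∃ f : ℂ^n → F, DifferentiableOn ℂ f (oBox r s) ∧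
      (∀ z ∈ oBox (setB r i e c) s, f z = f₁ z) ∧
      ∀ z ∈ oBox (setB r i (e + 2) (-c)) s, f z = f₂ z := by
  classical
  have e1 : ∀ z ∈ oBox (setB r i e c) s,
      (if z ∈ oBox (setB r i e c) s then f₁ z else f₂ z) = f₁ z := fun z hz => if_pos hz
  have e2 : ∀ z ∈ oBox (setB r i (e + 2) (-c)) s,
      (if z ∈ oBox (setB r i e c) s then f₁ z else f₂ z) = f₂ z := fun z hz => by
    split_ifs with h'
    · exact h z (oBox_inter h1 h2 s ▸ ⟨h', hz⟩)
    · rfl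
  refine ⟨_, fun z hz => ?_, e1, e2⟩
  refine DifferentiableAt.differentiableWithinAt ?_
  rcases oBox_subset_union hs hz with hz | hz
  · have ho := (isOpen_oBox (setB r i e c) s).mem_nhds hz
    exact (hf₁.differentiableAt ho).congr_of_eventuallyEq (mem_of_superset ho e1)
  · have ho := (isOpen_oBox (setB r i (e + 2) (-c)) s).mem_nhds hz
    exact (hf₂.differentiableAt ho).congr_of_eventuallyEq (mem_of_superset ho e2)

theorem exists_bound_oBox {f : ℂ^n → ℂ} {s s' : ℝ} (hs : s' < s)
    (hf : DifferentiableOn ℂ f (oBox r s)) : ∃ δ ≥ 0, ∀ z ∈ oBox r s', ‖f z‖ ≤ δ := by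
  have hsub : cBox (fun i e => r i e + s') ⊆ oBox r s := fun z hz i e =>
    (hz i e).trans_lt (by linarith)
  obtain ⟨M, hM⟩ := (isCompact_cBox _).exists_bound_of_continuousOn (hf.continuousOn.mono hsub)
  exact ⟨max M 0, le_max_right _ _, fun z hz =>
    (hM z fun i e => (hz i e).le).trans (le_max_left _ _)⟩

theorem cousin_split {f : ℂ^n → ℂ} (hf : HolNear (faceB r i e c) f) :
    ∃ f₁ f₂ : ℂ^n → ℂ, HolNear (setB r i e c) f₁ ∧ HolNear (setB r i (e + 2) (-c)) f₂ ∧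
      ∀ᶠ z in 𝓝ˢ (cBox (faceB r i e c)), f z = f₁ z - f₂ z := by
  obtain ⟨s, hs, hd⟩ := hf
  obtain ⟨C, hC, H⟩ := cousin_splitting r i e c
  set s₁ := min (s / 2) 1 with hs₁
  have hs1 : 0 < s₁ := by positivity
  obtain ⟨δ, hδ, hb⟩ := exists_bound_oBox (s' := s₁)
    ((min_le_left _ _).trans_lt (by linarith)) hd
  obtain ⟨f₁, f₂, h1, h2, h3, -, -⟩ := H s₁ (s₁ / 2) (by positivity) (by linarith)
    (min_le_right _ _) f δ hδ
    (hd.mono (oBox_mono le_rfl ((min_le_left _ _).trans (by linarith)))) hb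
  exact ⟨f₁, f₂, ⟨_, by positivity, h1⟩, ⟨_, by positivity, h2⟩,
    eventually_nhdsSet_cBox_iff.2 ⟨_, by positivity, h3⟩⟩

end

/-- A property holding near both halves of a box, for functions agreeing on the overlap. -/
theorem exists_glue_near {F : Type*} [NormedAddCommGroup F] [NormedSpace ℂ F]
    {r : Box n} {i : Fin n} {e : Fin 4} {c : ℝ}
    (h1 : c ≤ r i e) (h2 : -c ≤ r i (e + 2)) {f₁ f₂ : ℂ^n → F}
    (hf₁ : ∀ᶠ z in 𝓝ˢ (cBox (setB r i e c)), DifferentiableAt ℂ f₁ z)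
    (hf₂ : ∀ᶠ z in 𝓝ˢ (cBox (setB r i (e + 2) (-c))), DifferentiableAt ℂ f₂ z)
    (h : ∀ᶠ z in 𝓝ˢ (cBox (faceB r i e c)), f₁ z = f₂ z) :
    ∃ f : ℂ^n → F, (∀ᶠ z in 𝓝ˢ (cBox r), DifferentiableAt ℂ f z) ∧
      (∀ᶠ z in 𝓝ˢ (cBox (setB r i e c)), f z = f₁ z) ∧
      ∀ᶠ z in 𝓝ˢ (cBox (setB r i (e + 2) (-c))), f z = f₂ z := by
  simp only [eventually_nhdsSet_cBox_iff] at *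
  obtain ⟨s₁, hs₁, hf₁⟩ := hf₁
  obtain ⟨s₂, hs₂, hf₂⟩ := hf₂
  obtain ⟨s₃, hs₃, h⟩ := h
  have hs : 0 < min s₁ (min s₂ s₃) := by positivity
  obtain ⟨f, hf, e1, e2⟩ := exists_glue (F := F) h1 h2 hs
    (fun z hz => (hf₁ z (oBox_mono le_rfl (min_le_left _ _) hz)).differentiableWithinAt)
    (fun z hz => (hf₂ z (oBox_mono le_rfl ((min_le_right _ _).trans
      (min_le_left _ _)) hz)).differentiableWithinAt)
    (fun z hz => h z (oBox_mono le_rfl ((min_le_right _ _).trans (min_le_right _ _)) hz))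
  exact ⟨f, ⟨_, hs, fun z hz => hf.differentiableAt ((isOpen_oBox _ _).mem_nhds hz)⟩,
    ⟨_, hs, e1⟩, ⟨_, hs, e2⟩⟩

theorem nhdsSet_cBox_le (r : Box n) (i : Fin n) (e : Fin 4) (c : ℝ) :
    𝓝ˢ (cBox r) ≤ 𝓝ˢ (cBox (setB r i e c)) ⊔ 𝓝ˢ (cBox (setB r i (e + 2) (-c))) := by
  rw [← nhdsSet_union]
  exact nhdsSet_mono cBox_subset_union

end BoxGluing

section GlobalDivision

variable {n : ℕ}

theorem exists_ball_eventually_nhdsSet {p : ℂ^n} {Q : ℂ^n → Prop}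
    (h : ∀ᶠ z in 𝓝 p, Q z) :
    ∃ ε > 0, ∀ r, cBox r ⊆ ball p ε → ∀ᶠ z in 𝓝ˢ (cBox r), Q z := by
  obtain ⟨ε, hε, hb⟩ := Metric.eventually_nhds_iff_ball.1 h
  exact ⟨ε, hε, fun r hr => mem_of_superset (isOpen_ball.mem_nhdsSet.2 hr) hb⟩

theorem HolNear.fun_add {r : Box n} {f g : ℂ^n → ℂ} (hf : HolNear r f)
    (hg : HolNear r g) : HolNear r fun z => f z + g z := by
  rw [holNear_iff] at *
  filter_upwards [hf, hg] with z h1 h2 using h1.add h2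

theorem HolNear.fun_sub {r : Box n} {f g : ℂ^n → ℂ} (hf : HolNear r f)
    (hg : HolNear r g) : HolNear r fun z => f z - g z := by
  rw [holNear_iff] at *
  filter_upwards [hf, hg] with z h1 h2 using h1.sub h2

theorem HolNear.fun_mul {r : Box n} {f g : ℂ^n → ℂ} (hf : HolNear r f)
    (hg : HolNear r g) : HolNear r fun z => f z * g z := by
  rw [holNear_iff] at *
  filter_upwards [hf, hg] with z h1 h2 using h1.mul h2

theorem HolNear.fun_sum {r : Box n} {ι : Type*} {s : Finset ι}
    {f : ι → ℂ^n → ℂ} (hf : ∀ i ∈ s, HolNear r (f i)) :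
    HolNear r fun z => ∑ i ∈ s, f i z := by
  classical
  induction s using Finset.induction_on with
  | empty => exact ⟨1, one_pos, by simp [differentiableOn_const]⟩
  | insert a s ha ih =>
    simp only [sum_insert ha]
    exact (hf a (Finset.mem_insert_self _ _)).fun_add
      (ih fun i hi => hf i (Finset.mem_insert_of_mem hi))

/-- A holomorphic vector near a box which is locally a combination of the columns of a polynomial
matrix is globally such a combination. -/
theorem exists_eq_mulVec_near {a b : ℕ} (r : Box n)
    (A : Matrix (Fin a) (Fin b) ℂ[n]) (v : Fin a → ℂ^n → ℂ)
    (hv : ∀ i, HolNear r (v i))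
    (hloc : ∀ p ∈ cBox r, ∃ q : Fin b → ℂ^n → ℂ, (∀ j, HolAt p (q j)) ∧
      ∀ i, ∀ᶠ z in 𝓝 p, v i z = ∑ j, eval z (A i j) * q j z) :
    ∃ q : Fin b → ℂ^n → ℂ, (∀ j, HolNear r (q j)) ∧
      ∀ i, ∀ᶠ z in 𝓝ˢ (cBox r), v i z = ∑ j, eval z (A i j) * q j z := by
  induction hN : bDim r using Nat.strong_induction_on generalizing a b r with
  | _ N ih =>
  obtain ⟨m, B, hAB, hB⟩ := exists_syzygy_matrix A
  refine box_induction (P := fun r => ∃ q : Fin b → ℂ^n → ℂ, (∀ j, HolNear r (q j)) ∧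
      ∀ i, ∀ᶠ z in 𝓝ˢ (cBox r), v i z = ∑ j, eval z (A i j) * q j z) r
    (fun r' hr' => ⟨fun _ _ => 0, fun j => holNear_iff.2 (by simp [hr']), by simp [hr']⟩)
    (fun p hp => ?_) fun r' i e c hr' h1 h2 hw hP1 hP2 => ?_
  · obtain ⟨q, hq, hqv⟩ := hloc p hp
    obtain ⟨ε, hε, H⟩ := exists_ball_eventually_nhdsSet
      ((eventually_all.2 hq).and (eventually_all.2 hqv))
    refine ⟨ε, hε, fun r' _ hr' => ⟨q, fun j => holNear_iff.2 ?_, fun i => ?_⟩⟩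
    · exact (H r' hr').mono fun z hz => hz.1 j
    · exact (H r' hr').mono fun z hz => hz.2 i
  · obtain ⟨q₁, hq₁, e₁⟩ := hP1
    obtain ⟨q₂, hq₂, e₂⟩ := hP2
    have f1 := faceB_le_left (c := c) (i := i) (e := e) h2
    have f2 := faceB_le_right (c := c) (i := i) (e := e) h1
    have hd : ∀ j, HolNear (faceB r' i e c) fun z => q₁ j z - q₂ j z := fun j =>
      ((hq₁ j).mono f1).fun_sub ((hq₂ j).mono f2)
    have hker : ∀ k, ∀ᶠ z in 𝓝ˢ (cBox (faceB r' i e c)),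
        ∑ j, eval z (A k j) * (q₁ j z - q₂ j z) = 0 := fun k => by
      filter_upwards [nhdsSet_mono (cBox_mono f1) (e₁ k), nhdsSet_mono (cBox_mono f2) (e₂ k)]
        with z h1 h2
      simp only [mul_sub, sum_sub_distrib]
      rw [← h1, ← h2, sub_self]
    have hlt : bDim (faceB r' i e c) < N :=
      (bDim_faceB_lt h1 h2 hw).trans_le (hN ▸ bDim_mono hr')
    obtain ⟨w, hw, hwe⟩ := ih _ hlt (faceB r' i e c) B (fun j z => q₁ j z - q₂ j z) hd
      (fun p hp => hB p _ (fun j => (hd j).holAt hp) fun k =>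
        (hker k).filter_mono (nhds_le_nhdsSet hp)) rfl
    choose w₁ w₂ hw₁ hw₂ hw₁₂ using fun l => cousin_split (hw l)
    have hcorr : ∀ (u : Fin m → ℂ^n → ℂ) (z : ℂ^n) (k : Fin a),
        ∑ j, eval z (A k j) * ∑ l, eval z (B j l) * u l z = 0 := by
      intro u z k
      simp only [mul_sum]
      rw [sum_comm]
      refine sum_eq_zero fun l _ => ?_
      have h3 : eval z ((A * B) k l) = 0 := by rw [hAB]; simp
      rw [Matrix.mul_apply, map_sum] at h3
      simp only [← mul_assoc, ← sum_mul, ← map_mul]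
      rw [h3, zero_mul]
    have hglue : ∀ j, ∃ f : ℂ^n → ℂ, (∀ᶠ z in 𝓝ˢ (cBox r'), DifferentiableAt ℂ f z) ∧
        (∀ᶠ z in 𝓝ˢ (cBox (setB r' i e c)),
          f z = q₁ j z - ∑ l, eval z (B j l) * w₁ l z) ∧
        ∀ᶠ z in 𝓝ˢ (cBox (setB r' i (e + 2) (-c))),
          f z = q₂ j z - ∑ l, eval z (B j l) * w₂ l z := fun j => by
      refine exists_glue_near h1 h2 ?_ ?_ ?_
      · exact holNear_iff.1 ((hq₁ j).fun_sub
          (HolNear.fun_sum fun l _ => (holNear_eval _ _).fun_mul (hw₁ l)))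
      · exact holNear_iff.1 ((hq₂ j).fun_sub
          (HolNear.fun_sum fun l _ => (holNear_eval _ _).fun_mul (hw₂ l)))
      · filter_upwards [hwe j, eventually_all.2 hw₁₂] with z h3 h4
        simp only [h4, mul_sub, sum_sub_distrib] at h3
        linear_combination h3
    choose q hq g₁ g₂ using hglue
    refine ⟨q, fun j => holNear_iff.2 (hq j), fun k => ?_⟩
    refine Eventually.filter_mono (nhdsSet_cBox_le r' i e c) (Filter.eventually_sup.2 ⟨?_, ?_⟩)
    · filter_upwards [e₁ k, eventually_all.2 g₁] with z h3 h4
      simp only [h4, mul_sub, sum_sub_distrib]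
      rw [hcorr w₁ z k, ← h3, sub_zero]
    · filter_upwards [e₂ k, eventually_all.2 g₂] with z h3 h4
      simp only [h4, mul_sub, sum_sub_distrib]
      rw [hcorr w₂ z k, ← h3, sub_zero]

end GlobalDivision

section FiniteCover

variable {A B : Type*} [CommRing A] [IsDomain A] [IsIntegrallyClosed A] [Algebra ℂ A] [CommRing B]
  [IsDomain B] [Algebra ℂ B] [FiniteType ℂ B] [Algebra A B] [IsScalarTower ℂ A B]
  [Algebra.IsIntegral A B] [FaithfulSMul A B]

omit [IsDomain B] in
theorem exists_algHom_of_isMaximal (Q : Ideal B) [Q.IsMaximal] :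
    ∃ χ : B →ₐ[ℂ] ℂ, ∀ b, b ∈ Q → χ b = 0 := by
  let _ : Field (B ⧸ Q) := Ideal.Quotient.field Q
  have h1 : FiniteType ℂ (B ⧸ Q) :=
    FiniteType.of_surjective (Ideal.Quotient.mkₐ ℂ Q) Ideal.Quotient.mk_surjective
  have h2 : Module.Finite ℂ (B ⧸ Q) := finite_of_finite_type_of_isJacobsonRing _ _
  have h3 : Function.Bijective (algebraMap ℂ (B ⧸ Q)) :=
    IsAlgClosed.algebraMap_bijective_of_isIntegral
  let e : ℂ ≃ₐ[ℂ] (B ⧸ Q) := AlgEquiv.ofBijective (Algebra.ofId ℂ (B ⧸ Q)) h3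
  refine ⟨e.symm.toAlgHom.comp (Ideal.Quotient.mkₐ ℂ Q), fun b hb => ?_⟩
  have : Ideal.Quotient.mk Q b = 0 := Ideal.Quotient.eq_zero_iff_mem.2 hb
  simp [this]

theorem exists_algHom_of_isRoot (x : A →ₐ[ℂ] ℂ) (b : B) (c : ℂ)
    (hc : ((minpoly A b).map (x : A →+* ℂ)).IsRoot c) :
    ∃ χ : B →ₐ[ℂ] ℂ, χ b = c ∧ ∀ a, χ (algebraMap A B a) = x a := by
  have hb : IsIntegral A b := Algebra.IsIntegral.isIntegral b
  let C := Algebra.adjoin A ({b} : Set B)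
  let e := minpoly.equivAdjoin hb
  let ξ₀ : AdjoinRoot (minpoly A b) →+* ℂ :=
    AdjoinRoot.lift (x : A →+* ℂ) c (by rwa [← Polynomial.eval_map])
  let ξ : C →+* ℂ := ξ₀.comp (e.symm : C →+* AdjoinRoot (minpoly A b))
  have hξA : ∀ a, ξ (algebraMap A C a) = x a := fun a => by
    have : e.symm (algebraMap A C a) = AdjoinRoot.of _ a := e.symm.commutes a
    simp only [ξ, RingHom.comp_apply, RingHom.coe_coe, this]
    exact AdjoinRoot.lift_of _
  let b' : C := ⟨b, Algebra.self_mem_adjoin_singleton A b⟩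
  have hξb : ξ b' = c := by
    have h0 : e (AdjoinRoot.root _) = b' := by
      rw [minpoly.coe_equivAdjoin]
      ext
      exact AdjoinRoot.Minpoly.coe_toAdjoin_mk_X
    have : e.symm b' = AdjoinRoot.root _ := by rw [← h0, AlgEquiv.symm_apply_apply]
    simp only [ξ, RingHom.comp_apply, RingHom.coe_coe, this]
    exact AdjoinRoot.lift_root _
  have hξℂ : ∀ w : ℂ, ξ (algebraMap A C (algebraMap ℂ A w)) = w := fun w => by
    rw [hξA]; exact x.commutes w
  have hsurj : Surjective ξ := fun w => ⟨_, hξℂ w⟩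
  have hmax : (ker ξ).IsMaximal := RingHom.ker_isMaximal_of_surjective ξ hsurj
  have hint : Algebra.IsIntegral C B := ⟨fun y =>
    (Algebra.IsIntegral.isIntegral (R := A) y).tower_top⟩
  obtain ⟨Q, hQ, hQc⟩ := Ideal.exists_ideal_over_maximal_of_isIntegral (S := B) (ker ξ)
    (by
      rw [(RingHom.injective_iff_ker_eq_bot (algebraMap C B)).1 Subtype.val_injective]
      exact bot_le)
  obtain ⟨χ, hχ⟩ := exists_algHom_of_isMaximal Q
  have key : ∀ u : C, χ (u : B) = ξ u := fun u => by
    have h1 : u - algebraMap A C (algebraMap ℂ A (ξ u)) ∈ ker ξ := by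
      rw [RingHom.mem_ker, map_sub, hξℂ, sub_self]
    rw [← hQc, Ideal.mem_comap] at h1
    have h2 := hχ _ h1
    rw [map_sub, map_sub, sub_eq_zero] at h2
    refine h2.trans ?_
    rw [← IsScalarTower.algebraMap_apply A C B, ← IsScalarTower.algebraMap_apply ℂ A B]
    exact χ.commutes _
  refine ⟨χ, (key b').trans hξb, fun a => ?_⟩
  exact (key (algebraMap A C a)).trans (hξA a)

/-- A multiple of the trace, with values in the base ring. -/
def nTrace (A : Type*) {B : Type*} [CommRing A] [CommRing B] [Algebra A B] (b : B) : A :=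
  -(minpoly A b).nextCoeff

theorem norm_nTrace_le (x : A →ₐ[ℂ] ℂ) (b : B) {δ : ℝ}
    (h : ∀ χ : B →ₐ[ℂ] ℂ, (∀ a, χ (algebraMap A B a) = x a) → ‖χ b‖ ≤ δ) :
    ‖x (nTrace A b)‖ ≤ (minpoly A b).natDegree * δ := by
  have hm : (minpoly A b).Monic := minpoly.monic (Algebra.IsIntegral.isIntegral b)
  set q := (minpoly A b).map (x : A →+* ℂ) with hq
  have hqm : q.Monic := hm.map _
  have h1 : x (nTrace A b) = q.roots.sum := by
    have h2 : q.nextCoeff = (x : A →+* ℂ) (minpoly A b).nextCoeff := by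
      simp only [Polynomial.nextCoeff, hq, hm.natDegree_map]
      split_ifs <;> simp
    rw [(IsAlgClosed.splits q).nextCoeff_eq_neg_sum_roots_of_monic hqm] at h2
    simp only [nTrace, map_neg]
    rw [← RingHom.coe_coe x, ← h2, neg_neg]
  rw [h1]
  have h3 : ∀ c ∈ q.roots, ‖c‖ ≤ δ := fun c hc => by
    obtain ⟨χ, rfl, hχ⟩ := exists_algHom_of_isRoot x b c (Polynomial.isRoot_of_mem_roots hc)
    exact h χ hχ
  calc ‖q.roots.sum‖ ≤ (q.roots.map fun c => ‖c‖).sum := norm_multiset_sum_le _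
    _ ≤ Multiset.card (q.roots.map fun c => ‖c‖) • δ :=
        Multiset.sum_le_card_nsmul _ _ fun y hy => by
          obtain ⟨c, hc, rfl⟩ := Multiset.mem_map.1 hy
          exact h3 c hc
    _ = (minpoly A b).natDegree * δ := by
        rw [Multiset.card_map, IsAlgClosed.card_roots_eq_natDegree, hq, hm.natDegree_map,
          nsmul_eq_mul]

end FiniteCover

section Discriminant

open nonZeroDivisors Matrix in
theorem exists_smul_mem_of_nTrace_mem (A B : Type*) [CommRing A] [IsDomain A]
    [IsIntegrallyClosed A] [CharZero A] [CommRing B] [IsDomain B] [Algebra A B] [Module.Finite A B]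
    [FaithfulSMul A B] :
    ∃ (δ : A) (d : ℕ) (b : Fin d → B), δ ≠ 0 ∧ ∀ (J : Ideal A) (h : B),
      (∀ i, nTrace A (h * b i) ∈ J) → algebraMap A B δ * h ∈ J.map (algebraMap A B) := by
  classical
  let K := FractionRing A
  let M := Algebra.algebraMapSubmonoid B A⁰
  have hM : M ≤ B⁰ := algebraMapSubmonoid_le_nonZeroDivisors_of_faithfulSMul B le_rfl
  let L := Localization M
  have hLd : IsDomain L := IsLocalization.isDomain_localization hM
  have hfin : Module.Finite K L := inferInstance
  have hint : Algebra.IsIntegral K L := inferInstance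
  have hLf : IsField L := isField_of_isIntegral_of_isField' (Field.toIsField K)
  let _ : Field L := hLf.toField
  have hcK : CharZero K := charZero_of_injective_algebraMap (IsFractionRing.injective A K)
  have hBL : Injective (algebraMap B L) := IsLocalization.injective L hM
  have hAK : Injective (algebraMap A K) := IsFractionRing.injective A K
  have htr : ∀ x : B, ∃ c : ℕ, Algebra.trace K L (algebraMap B L x) =
      algebraMap A K ((c : A) * nTrace A x) := fun x => by
    refine ⟨Module.finrank (IntermediateField.adjoin K {algebraMap B L x}) L,
      (trace_eq_finrank_mul_minpoly_nextCoeff K (algebraMap B L x)).trans ?_⟩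
    rw [map_mul, map_natCast, nTrace, map_neg]
    congr 2
    have hx : IsIntegral A x := Algebra.IsIntegral.isIntegral x
    have h1 := minpoly.isIntegrallyClosed_eq_field_fractions K L hx
    rw [h1]
    simp only [Polynomial.nextCoeff, (minpoly.monic hx).natDegree_map]
    split_ifs <;> simp
  choose c hc using htr
  let t : B → A := fun x => (c x : A) * nTrace A x
  have ht : ∀ x, Algebra.trace K L (algebraMap B L x) = algebraMap A K (t x) := hc
  have hAL : ∀ a, algebraMap K L (algebraMap A K a) = algebraMap B L (algebraMap A B a) :=
    fun a => by rw [← IsScalarTower.algebraMap_apply A K L, ← IsScalarTower.algebraMap_apply A B L]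
  obtain ⟨⟨_, a, ha, rfl⟩, hm⟩ := IsLocalization.exist_integer_multiples_of_finite M
    (Module.finBasis K L)
  choose b hb using hm
  have haK : IsUnit (algebraMap A K a) := IsLocalization.map_units K ⟨a, ha⟩
  let β := (Module.finBasis K L).isUnitSMul (w := fun _ => algebraMap A K a) fun _ => haK
  have hβ : ∀ i, β i = algebraMap B L (b i) := fun i => by
    rw [Module.Basis.isUnitSMul_apply, hb, Algebra.smul_def, Algebra.smul_def, hAL]
  let T : Matrix (Fin (Module.finrank K L)) (Fin (Module.finrank K L)) A :=
    Matrix.of fun i j => t (b i * b j)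
  have hT : T.map (algebraMap A K) = Algebra.traceMatrix K β := by
    ext i j
    rw [Algebra.traceMatrix_apply, Algebra.traceForm_apply, hβ, hβ, ← map_mul, ht]
    rfl
  refine ⟨T.det, _, b, fun h0 => Algebra.discr_not_zero_of_basis K β ?_, fun J h hJ => ?_⟩
  · rw [Algebra.discr_def, ← hT, ← RingHom.mapMatrix_apply, ← RingHom.map_det, h0, map_zero]
  · let τ : Fin (Module.finrank K L) → A := fun i => t (h * b i)
    have hτ : ∀ i, τ i ∈ J := fun i => J.mul_mem_left _ (hJ i)
    let z := β.equivFun (algebraMap B L h)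
    have h1 : Algebra.traceMatrix K β *ᵥ z = fun i => algebraMap A K (τ i) := by
      rw [Algebra.traceMatrix_of_basis_mulVec]
      funext i
      rw [hβ, ← map_mul, ht]
    have h2 : ∀ i, algebraMap A K T.det * z i = algebraMap A K ((T.adjugate *ᵥ τ) i) := fun i => by
      have h3 : ((T.map (algebraMap A K)).adjugate * T.map (algebraMap A K)) *ᵥ z =
          (T.map (algebraMap A K)).adjugate *ᵥ fun i => algebraMap A K (τ i) := by
        rw [← mulVec_mulVec, hT, h1]
      rw [Matrix.adjugate_mul, smul_mulVec, Matrix.one_mulVec] at h3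
      have h4 := congrFun h3 i
      rw [Pi.smul_apply, smul_eq_mul, ← RingHom.mapMatrix_apply, ← RingHom.map_det] at h4
      rw [h4, ← RingHom.map_adjugate, RingHom.map_mulVec]
      rfl
    have h5 : algebraMap A B T.det * h = ∑ i, algebraMap A B ((T.adjugate *ᵥ τ) i) * b i := by
      apply hBL
      rw [map_mul, ← hAL, map_sum]
      conv_lhs => rw [← β.sum_equivFun (algebraMap B L h), mul_sum]
      refine sum_congr rfl fun i _ => ?_
      rw [Algebra.smul_def, ← mul_assoc, ← map_mul, hβ, map_mul (algebraMap B L), ← hAL]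
      exact congrArg (fun w => algebraMap K L w * algebraMap B L (b i)) (h2 i)
    rw [h5]
    refine Ideal.sum_mem _ fun i _ => Ideal.mul_mem_right _ _ (Ideal.mem_map_of_mem _ ?_)
    rw [mulVec, dotProduct]
    exact Ideal.sum_mem _ fun j _ => J.mul_mem_left _ (hτ j)

end Discriminant

section PrimeJets

variable {n : ℕ} {B : Type*} [CommRing B] [Algebra ℂ B] (π : ℂ[n] →ₐ[ℂ] B)

/-- The variety cut out by the kernel of `π`. -/
abbrev kerLocus : Set ℂ^n := AffZeroLocus (ker π : Set ℂ[n])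

/-- Evaluation at a point of a variety as a homomorphism from the coordinate ring. -/
def evalQuot (hπ : Surjective π) (y : ℂ^n)
    (hy : y ∈ kerLocus π) : B →ₐ[ℂ] ℂ :=
  AlgHom.liftOfSurjective π hπ (aeval y) fun F hF => hy F hF

variable {π}

theorem evalQuot_mk (hπ : Surjective π) (y : ℂ^n)
    (hy : y ∈ kerLocus π)
    (F : ℂ[n]) : evalQuot π hπ y hy (π F) = eval y F := by
  exact congrArg (fun φ : ℂ[n] →ₐ[ℂ] ℂ => φ F)
    (AlgHom.liftOfSurjective_comp π hπ (aeval y) fun F hF => hy F hF)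

theorem exists_eq_evalQuot (hπ : Surjective π) (χ : B →ₐ[ℂ] ℂ) :
    ∃ y, ∃ hy : y ∈ kerLocus π,
      χ = evalQuot π hπ y hy := by
  let y : ℂ^n := fun j => χ (π (X j))
  have h : ∀ F, χ (π F) = eval y F := fun F => by
    have : χ.comp π = aeval y := by
      ext j
      simp [y]
    exact congrArg (fun φ : ℂ[n] →ₐ[ℂ] ℂ => φ F) this
  have hy : y ∈ kerLocus π := fun F hF => by
    rw [← h, (RingHom.mem_ker).1 hF, map_zero]
  refine ⟨y, hy, AlgHom.ext fun b => ?_⟩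
  obtain ⟨F, rfl⟩ := hπ b
  rw [h, evalQuot_mk]

theorem isClosed_affZeroLocus {ι : Type*} (s : Set (MvPolynomial ι ℂ)) :
    IsClosed (AffZeroLocus s) := by
  rw [show AffZeroLocus s = ⋂ F ∈ s, {x | eval x F = 0} by
    ext x; simp [AffZeroLocus]]
  exact isClosed_biInter fun F _ =>
    isClosed_eq (continuous_eval F) continuous_const

theorem exists_poly_separating (p : ℂ^n) {T : Set ℂ^n} (hT : T.Finite) (hp : p ∉ T) :
    ∃ e : ℂ[n], eval p e = 1 ∧
      ∀ y ∈ T, eval y e = 0 := by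
  have h1 : ∀ y : T, ∃ e : ℂ[n], eval p e = 1 ∧
      eval y.1 e = 0 := fun y => by
    obtain ⟨j, hj⟩ : ∃ j, p j ≠ y.1 j := by
      by_contra! h
      exact hp (funext h ▸ y.2)
    refine ⟨C (p j - y.1 j)⁻¹ * (X j - C (y.1 j)), ?_, ?_⟩
    · simp [inv_mul_cancel₀ (sub_ne_zero.2 hj)]
    · simp
  choose e he1 he0 using h1
  have := hT.fintype
  refine ⟨∏ y, e y, ?_, fun y hy => ?_⟩
  · simp [map_prod, he1]
  · rw [map_prod]
    exact Finset.prod_eq_zero (i := (⟨y, hy⟩ : T)) (Finset.mem_univ _) (he0 ⟨y, hy⟩)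

theorem norm_le_of_isRoot {q : Polynomial ℂ} (hq : q.Monic) {c : ℂ} (hc : q.IsRoot c) :
    ‖c‖ ≤ 1 + ∑ i ∈ Finset.range q.natDegree, ‖q.coeff i‖ := by
  have h : ‖c‖ ≤ (Polynomial.cauchyBound q : ℝ) :=
    (Polynomial.IsRoot.norm_lt_cauchyBound hq.ne_zero hc).le
  refine h.trans ?_
  rw [Polynomial.cauchyBound, hq.leadingCoeff, nnnorm_one, div_one, NNReal.coe_add, NNReal.coe_one,
    add_comm]
  gcongr
  have : (Finset.range q.natDegree).sup (fun i => ‖q.coeff i‖₊) ≤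
      ∑ i ∈ Finset.range q.natDegree, ‖q.coeff i‖₊ :=
    Finset.sup_le fun i hi => single_le_sum (f := fun i => ‖q.coeff i‖₊)
      (fun _ _ => zero_le) hi
  simpa only [NNReal.coe_sum, coe_nnnorm] using NNReal.coe_le_coe.2 this

theorem norm_pow_le_sum {n N : ℕ} (hN : N ≠ 0) (v : ℂ^n) : ‖v‖ ^ N ≤ ∑ j, ‖v j‖ ^ N := by
  rcases isEmpty_or_nonempty (Fin n) with h | h
  · rw [Subsingleton.elim v 0]
    simp [hN]
  · obtain ⟨j, -, hj⟩ := Finset.exists_mem_eq_sup' (Finset.univ_nonempty (α := Fin n))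
      fun j => ‖v j‖₊
    have : ‖v‖ ≤ ‖v j‖ := (pi_norm_le_iff_of_nonneg (norm_nonneg _)).2 fun i => by
      have h1 : ‖v i‖₊ ≤ ‖v j‖₊ := hj ▸ Finset.le_sup' (fun j => ‖v j‖₊) (Finset.mem_univ i)
      exact_mod_cast h1
    exact (pow_le_pow_left₀ (norm_nonneg _) this N).trans
      (single_le_sum (f := fun j => ‖v j‖ ^ N) (fun _ _ => by positivity)
        (Finset.mem_univ j))

theorem exists_jet_bound_of_finite [IsDomain B] {s : ℕ} [Algebra ℂ[s] B]
    [IsScalarTower ℂ ℂ[s] B] [Module.Finite ℂ[s] B]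
    [FaithfulSMul ℂ[s] B] (hπ : Surjective π) {p : ℂ^n}
    (hp : p ∈ kerLocus π) :
    ∀ k', ∃ K₀, ∀ f : ℂ[n],
      (fun z => eval z f)
        =O[𝓝[kerLocus π] p]
        (fun z => ‖z - p‖ ^ K₀) → f ∈ mIdl p ^ k' ⊔ ker π := by
  classical
  let A := ℂ[s]
  set V := kerLocus π with hV
  choose G hG using fun i : Fin s => hπ (algebraMap A B (X i))
  let xm : ℂ^n → ℂ^s := fun y i => eval y (G i)
  have hxm : Continuous xm := continuous_pi fun i => continuous_eval _
  have hev : ∀ y (hy : y ∈ V) (a : A), evalQuot π hπ y hy (algebraMap A B a) =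
      eval (xm y) a := fun y hy a => by
    have : (evalQuot π hπ y hy).comp (IsScalarTower.toAlgHom ℂ A B) = aeval (xm y) := by
      apply MvPolynomial.algHom_ext
      intro i
      rw [AlgHom.comp_apply, IsScalarTower.coe_toAlgHom', ← hG, evalQuot_mk, aeval_X]
    exact congrArg (fun φ : A →ₐ[ℂ] ℂ => φ a) this
  let q : Fin n → Polynomial A := fun j => minpoly A (π (X j))
  have hq : ∀ j, (q j).Monic := fun j => minpoly.monic (Algebra.IsIntegral.isIntegral _)
  have hroot : ∀ y ∈ V, ∀ j, ((q j).map (eval (xm y))).IsRoot (y j) := by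
    intro y hy j
    have h1 := congrArg (evalQuot π hπ y hy)
      (minpoly.aeval A (π (X j)))
    rw [map_zero, Polynomial.aeval_def, ← RingHom.coe_coe (evalQuot π hπ y hy),
      Polynomial.hom_eval₂] at h1
    rw [Polynomial.IsRoot, Polynomial.eval_map, ← h1]
    congr 1
    · exact RingHom.ext fun a => (hev y hy a).symm
    · simp [evalQuot_mk]
  have hfib : {y | y ∈ V ∧ xm y = xm p}.Finite := by
    refine (Set.Finite.pi' fun j => (((q j).map (eval (xm p))).roots.toFinset
      ).finite_toSet).subset fun y hy j => ?_
    have h1 := hroot y hy.1 j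
    rw [hy.2] at h1
    simpa using ⟨((hq j).map _).ne_zero, h1⟩
  let Ω : Set ℂ^n := {y | y ∈ V ∧ ‖xm y - xm p‖ ≤ 1}
  have hΩ : IsCompact Ω := by
    refine Metric.isCompact_of_isClosed_isBounded ?_ ?_
    · exact (isClosed_affZeroLocus _).inter
        (isClosed_le (hxm.sub continuous_const).norm continuous_const)
    · have h1 : ∀ j, ∃ C, ∀ x ∈ Metric.closedBall (xm p) 1, ‖1 + ∑ i ∈ Finset.range (q j).natDegree,
          ‖eval x ((q j).coeff i)‖‖ ≤ C := fun j =>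
        (isCompact_closedBall _ _).exists_bound_of_continuousOn
          (continuous_const.add (continuous_finsetSum _ fun i _ =>
            (continuous_eval _).norm)).continuousOn
      choose C hC using h1
      refine (isBounded_iff_forall_norm_le).2 ⟨∑ j, |C j|, fun y hy => ?_⟩
      refine (pi_norm_le_iff_of_nonneg (by positivity)).2 fun j => ?_
      refine le_trans ?_ (single_le_sum (f := fun j => |C j|) (fun _ _ => abs_nonneg _)
        (Finset.mem_univ j))
      have h2 := norm_le_of_isRoot ((hq j).map _) (hroot y hy.1 j)
      rw [(hq j).natDegree_map] at h2
      simp only [Polynomial.coeff_map] at h2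
      exact h2.trans ((le_abs_self _).trans ((hC j (xm y) (by simpa [dist_eq_norm] using hy.2)).trans
        (le_abs_self _)))
  obtain ⟨e, hep, he0⟩ := exists_poly_separating p (hfib.subset (sdiff_subset (t := {p})))
    (by simp)
  let J : Ideal ℂ[n] :=
    ker π ⊔ span (Set.range fun i => G i - C (xm p i))
  have hJV : ∀ j, ∃ N : ℕ, (e * (X j - C (p j))) ^ N ∈ J := fun j => by
    have h1 : e * (X j - C (p j)) ∈ J.radical := by
      rw [← MvPolynomial.vanishingIdeal_zeroLocus_eq_radical (K := ℂ),
        MvPolynomial.mem_vanishingIdeal_iff]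
      intro y hy
      have hyV : y ∈ V := fun F hF => hy F (Ideal.mem_sup_left hF)
      have hyx : xm y = xm p := funext fun i => by
        have := hy _ (Ideal.mem_sup_right (Ideal.subset_span (Set.mem_range_self i)))
        simpa [sub_eq_zero, aeval_eq_eval] using this
      rcases eq_or_ne y p with rfl | hyp
      · simp
      · have := he0 y ⟨⟨hyV, hyx⟩, hyp⟩
        simp [aeval_eq_eval, this]
    exact h1
  have hJb : ∀ h ∈ J, ∃ C, ∀ y ∈ Ω, ‖eval y h‖ ≤ C * ‖xm y - xm p‖ := by
    intro h hh
    obtain ⟨a, ha, b, hb, rfl⟩ := mem_sup.1 hh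
    obtain ⟨c, rfl⟩ := (Ideal.mem_span_range_iff_exists_fun).1 hb
    have h1 : ∀ i, ∃ C, ∀ y ∈ Ω, ‖eval y (c i)‖ ≤ C := fun i =>
      hΩ.exists_bound_of_continuousOn (continuous_eval _).continuousOn
    choose C hC using h1
    refine ⟨∑ i, C i, fun y hy => ?_⟩
    rw [map_add, hy.1 a ha, zero_add, map_sum, sum_mul]
    refine (norm_sum_le _ _).trans (Finset.sum_le_sum fun i _ => ?_)
    rw [map_mul, norm_mul]
    refine mul_le_mul (hC i y hy) ?_ (norm_nonneg _) ((norm_nonneg _).trans (hC i y hy))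
    simpa [xm] using norm_le_pi_norm (xm y - xm p) i
  choose N hN using hJV
  obtain ⟨N₀, hN0, hN₀⟩ : ∃ N₀ : ℕ, N₀ ≠ 0 ∧ ∀ j, N j ≤ N₀ :=
    ⟨∑ j, N j + 1, by simp, fun j => (single_le_sum (f := N) (fun _ _ => Nat.zero_le _)
      (Finset.mem_univ j)).trans (Nat.le_succ _)⟩
  have hN' : ∀ j, (e * (X j - C (p j))) ^ N₀ ∈ J := fun j =>
    J.pow_mem_of_pow_mem (hN j) (hN₀ j)
  choose C₁ hC₁ using fun j => hJb _ (hN' j)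
  obtain ⟨C, hC0, hC⟩ : ∃ C, 0 ≤ C ∧ ∀ y ∈ Ω, (‖eval y e‖ * ‖y - p‖) ^ N₀ ≤
      C * ‖xm y - xm p‖ := by
    refine ⟨∑ j, |C₁ j|, by positivity, fun y hy => ?_⟩
    have h1 := norm_pow_le_sum hN0 (eval y e • (y - p))
    rw [norm_smul] at h1
    refine h1.trans ?_
    rw [sum_mul]
    refine Finset.sum_le_sum fun j _ => ?_
    have h2 := hC₁ j y hy
    simp only [map_pow, map_mul, map_sub, eval_X, eval_C, norm_pow] at h2
    exact h2.trans (mul_le_mul_of_nonneg_right (le_abs_self _) (norm_nonneg _))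
  obtain ⟨δ, d, b, hδ, hb⟩ := exists_smul_mem_of_nTrace_mem A B
  choose b' hb' using fun i => hπ (b i)
  have : FiniteType ℂ B := FiniteType.of_surjective π hπ
  have : IsNoetherianRing B := isNoetherianRing_of_surjective _ _ π.toRingHom hπ
  obtain ⟨c, hc⟩ := artinRees_range ((mIdl p).map π) (LinearMap.mulLeft B (algebraMap A B δ))
  intro k'
  refine ⟨N₀ * (k' + c), fun f hf => ?_⟩
  set k := k' + c with hk
  have hfb : ∃ C₂, 0 ≤ C₂ ∧ ∀ y ∈ Ω, ‖eval y f‖ ≤ C₂ * ‖y - p‖ ^ (N₀ * k) := by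
    obtain ⟨C₀, hC₀, hC₀'⟩ := hf.exists_pos
    rw [isBigOWith_iff, eventually_nhdsWithin_iff] at hC₀'
    obtain ⟨r, hr, hr'⟩ := Metric.eventually_nhds_iff_ball.1 hC₀'
    obtain ⟨C₃, hC₃⟩ := hΩ.exists_bound_of_continuousOn
      (continuous_eval f).continuousOn
    refine ⟨C₀ + |C₃| / r ^ (N₀ * k), by positivity, fun y hy => ?_⟩
    by_cases hyr : y ∈ ball p r
    · have h1 := hr' y hyr hy.1
      simp only [norm_pow, norm_norm] at h1
      refine h1.trans (mul_le_mul_of_nonneg_right ?_ (by positivity))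
      simp only [le_add_iff_nonneg_right]
      positivity
    · have h1 : r ≤ ‖y - p‖ := by simpa [dist_eq_norm] using hyr
      have h2 : r ^ (N₀ * k) ≤ ‖y - p‖ ^ (N₀ * k) := pow_le_pow_left₀ hr.le h1 _
      have h3 := (hC₃ y hy).trans (le_abs_self _)
      calc ‖eval y f‖ ≤ |C₃| / r ^ (N₀ * k) * r ^ (N₀ * k) := by
            rwa [div_mul_cancel₀ _ (by positivity)]
        _ ≤ |C₃| / r ^ (N₀ * k) * ‖y - p‖ ^ (N₀ * k) :=
            mul_le_mul_of_nonneg_left h2 (by positivity)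
        _ ≤ _ := mul_le_mul_of_nonneg_right (by linarith) (by positivity)
  obtain ⟨C₂, hC₂, hfb⟩ := hfb
  have hfe : ∀ y ∈ Ω, ‖eval y (f * e ^ (N₀ * k))‖ ≤
      C₂ * C ^ k * ‖xm y - xm p‖ ^ k := fun y hy => by
    calc ‖eval y (f * e ^ (N₀ * k))‖
        = ‖eval y f‖ * ‖eval y e‖ ^ (N₀ * k) := by simp
      _ ≤ C₂ * ‖y - p‖ ^ (N₀ * k) * ‖eval y e‖ ^ (N₀ * k) :=
          mul_le_mul_of_nonneg_right (hfb y hy) (by positivity)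
      _ = C₂ * ((‖eval y e‖ * ‖y - p‖) ^ N₀) ^ k := by ring
      _ ≤ C₂ * (C * ‖xm y - xm p‖) ^ k := by gcongr; exact hC y hy
      _ = _ := by ring
  have htr : ∀ i, nTrace A (π (f * e ^ (N₀ * k)) * b i) ∈ mIdl (xm p) ^ k := fun i => by
    obtain ⟨C₄, hC₄⟩ := hΩ.exists_bound_of_continuousOn
      (continuous_eval (b' i)).continuousOn
    refine mem_pow_of_isBigO_eval ?_
    refine IsBigO.of_bound ((minpoly A (π (f * e ^ (N₀ * k)) * b i)).natDegree *
      (C₂ * C ^ k * |C₄|)) ?_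
    filter_upwards [closedBall_mem_nhds (xm p) one_pos] with x hx
    have h1 := norm_nTrace_le (aeval x : A →ₐ[ℂ] ℂ)
      (π (f * e ^ (N₀ * k)) * b i) (δ := C₂ * C ^ k * ‖x - xm p‖ ^ k * |C₄|) fun χ hχ => by
        obtain ⟨y, hy, rfl⟩ := exists_eq_evalQuot hπ χ
        have hyx : xm y = x := funext fun j => by
          have := hχ (X j)
          rw [hev y hy] at this
          simpa using this
        have hyΩ : y ∈ Ω := ⟨hy, by rw [hyx]; simpa [dist_eq_norm] using hx⟩
        rw [← hb', ← map_mul, evalQuot_mk, map_mul, norm_mul, ← hyx]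
        exact mul_le_mul (hfe y hyΩ) ((hC₄ y hyΩ).trans (le_abs_self _)) (norm_nonneg _)
          (by positivity)
    rw [aeval_eq_eval] at h1
    refine h1.trans (le_of_eq ?_)
    rw [norm_pow, norm_norm]
    ring
  have h1 := hb _ _ htr
  have h2 : ((mIdl (xm p) ^ k).map (algebraMap A B)) ≤ ((mIdl p).map π) ^ k := by
    rw [Ideal.map_pow]
    refine Ideal.pow_right_mono (Ideal.map_le_iff_le_comap.2 fun a ha => ?_) k
    obtain ⟨F, hF⟩ := hπ (algebraMap A B a)
    rw [Ideal.mem_comap, ← hF]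
    refine Ideal.mem_map_of_mem π ?_
    rw [mem_mIdl, ← evalQuot_mk hπ p hp, hF, hev p hp]
    exact ha
  obtain ⟨y, hy, hyx⟩ := hc k _ ⟨π (f * e ^ (N₀ * k)), rfl⟩ (by
    simpa using h2 h1)
  have h3 : y = π (f * e ^ (N₀ * k)) := by
    refine mul_left_cancel₀ ?_ hyx
    simpa using (FaithfulSMul.algebraMap_injective A B).ne hδ
  rw [h3, smul_eq_mul, Ideal.mul_top, hk, Nat.add_sub_cancel, ← Ideal.map_pow,
    Ideal.mem_map_iff_of_surjective π hπ] at hy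
  obtain ⟨w, hw, hwf⟩ := hy
  have h4 : f * e ^ (N₀ * (k' + c)) ∈ mIdl p ^ k' ⊔ ker π := by
    refine mem_sup.2 ⟨w, hw, f * e ^ (N₀ * (k' + c)) - w, ?_, by ring⟩
    rw [RingHom.mem_ker, map_sub, hwf, sub_self]
  set E := e ^ (N₀ * (k' + c)) with hE
  have h5 : (1 - E) ^ k' ∈ mIdl p ^ k' := Ideal.pow_mem_pow (by simp [mem_mIdl, hE, hep]) k'
  obtain ⟨u, hu⟩ : E ∣ 1 - (1 - E) ^ k' := by
    have := sub_dvd_pow_sub_pow 1 (1 - E) k'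
    rwa [one_pow, sub_sub_cancel] at this
  have h6 : f = f * E * u + f * (1 - E) ^ k' := by linear_combination f * hu
  rw [h6]
  exact add_mem (Ideal.mul_mem_right _ _ h4) (Ideal.mul_mem_left _ _ (Ideal.mem_sup_left h5))

end PrimeJets

section RadicalJets

variable {n : ℕ}

theorem affZeroLocus_anti {ι : Type*} {s t : Set (MvPolynomial ι ℂ)} (h : s ⊆ t) :
    AffZeroLocus t ⊆ AffZeroLocus s := fun _ hx P hP => hx P (h hP)

theorem exists_jet_bound_of_isDomain {B : Type*} [CommRing B] [IsDomain B] [Algebra ℂ B]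
    {π : ℂ[n] →ₐ[ℂ] B} (hπ : Surjective π) {p : ℂ^n}
    (hp : p ∈ AffZeroLocus (ker π : Set ℂ[n])) (k : ℕ) :
    ∃ K₀, ∀ f : ℂ[n],
      (fun z => eval z f)
        =O[𝓝[AffZeroLocus (ker π : Set ℂ[n])] p]
        (fun z => ‖z - p‖ ^ K₀) → f ∈ mIdl p ^ k ⊔ ker π := by
  have : FiniteType ℂ B := FiniteType.of_surjective π hπ
  obtain ⟨s, g, hg, hfin⟩ := exists_finite_inj_algHom_of_fg ℂ B
  let _ : Algebra ℂ[s] B := g.toRingHom.toAlgebra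
  have : IsScalarTower ℂ ℂ[s] B :=
    IsScalarTower.of_algebraMap_eq fun c => (g.commutes c).symm
  have : Module.Finite ℂ[s] B := hfin
  have : FaithfulSMul ℂ[s] B :=
    (faithfulSMul_iff_algebraMap_injective _ _).2 hg
  exact exists_jet_bound_of_finite (s := s) hπ hp k

theorem mIdl_isMaximal (p : ℂ^n) : (mIdl p).IsMaximal :=
  RingHom.ker_isMaximal_of_surjective _ fun c => ⟨C c, eval_C c⟩

theorem mIdl_pow_sup_eq_top {p : ℂ^n} {I : Ideal ℂ[n]}
    (hp : p ∉ AffZeroLocus (I : Set ℂ[n])) (k : ℕ) : mIdl p ^ k ⊔ I = ⊤ := by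
  have h1 : mIdl p ⊔ I = ⊤ := (mIdl_isMaximal p).1.2 _ <| by
    refine lt_of_le_of_ne le_sup_left fun h => hp fun P hP => ?_
    rw [← mem_mIdl, h]
    exact Ideal.mem_sup_right hP
  exact Ideal.isCoprime_iff_sup_eq.1 ((Ideal.isCoprime_iff_sup_eq.2 h1).pow_left)

theorem exists_jet_bound_of_isPrime {P : Ideal ℂ[n]} (hP : P.IsPrime)
    (p : ℂ^n) (k : ℕ) :
    ∃ K₀, ∀ f : ℂ[n],
      (fun z => eval z f)
        =O[𝓝[AffZeroLocus (P : Set ℂ[n])] p]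
        (fun z => ‖z - p‖ ^ K₀) → f ∈ mIdl p ^ k ⊔ P := by
  by_cases hp : p ∈ AffZeroLocus (P : Set ℂ[n])
  · have hk : ker (Ideal.Quotient.mkₐ ℂ P) = P := Ideal.Quotient.mkₐ_ker ℂ P
    have := exists_jet_bound_of_isDomain (π := Ideal.Quotient.mkₐ ℂ P)
      (Ideal.Quotient.mkₐ_surjective ℂ P) (p := p) (by rwa [hk]) k
    rwa [hk] at this
  · exact ⟨0, fun f _ => by rw [mIdl_pow_sup_eq_top hp]; trivial⟩

theorem exists_jet_bound_of_isRadical {I : Ideal ℂ[n]} (hI : I.IsRadical)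
    (p : ℂ^n) (k : ℕ) :
    ∃ K₀, ∀ f : ℂ[n],
      (fun z => eval z f)
        =O[𝓝[AffZeroLocus (I : Set ℂ[n])] p]
        (fun z => ‖z - p‖ ^ K₀) → f ∈ mIdl p ^ k ⊔ I := by
  classical
  have hfin := (I.finite_minimalPrimes_of_isNoetherianRing).fintype
  let φ : ℂ[n] →ₗ[ℂ[n]]
      (∀ P : I.minimalPrimes, ℂ[n] ⧸ P.1) :=
    LinearMap.pi fun P => Submodule.mkQ P.1
  obtain ⟨c, hc⟩ := artinRees_range (mIdl p) φ
  choose K₀ hK₀ using fun P : I.minimalPrimes =>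
    exists_jet_bound_of_isPrime P.2.isPrime p (k + c)
  refine ⟨∑ P, K₀ P, fun f hf => ?_⟩
  have h1 : ∀ P : I.minimalPrimes, f ∈ mIdl p ^ (k + c) ⊔ P.1 := fun P => by
    refine hK₀ P f ((hf.mono (nhdsWithin_mono _ (affZeroLocus_anti P.2.1.2))).trans ?_)
    refine IsBigO.of_bound 1 ?_
    filter_upwards [mem_nhdsWithin_of_mem_nhds (closedBall_mem_nhds p one_pos)] with z hz
    rw [norm_pow, norm_norm, norm_pow, norm_norm, one_mul]
    exact pow_le_pow_of_le_one (norm_nonneg _) (by simpa [dist_eq_norm] using hz)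
      (single_le_sum (f := K₀) (fun _ _ => Nat.zero_le _) (Finset.mem_univ P))
  have h2 : φ f ∈ mIdl p ^ (k + c) • (⊤ : Submodule ℂ[n]
      (∀ P : I.minimalPrimes, ℂ[n] ⧸ P.1)) := by
    rw [← Finset.univ_sum_single (φ f)]
    refine sum_mem fun P _ => ?_
    obtain ⟨a, ha, b, hb, hab⟩ := mem_sup.1 (h1 P)
    have h3 : Pi.single P (φ f P) = a • (Pi.single P (Submodule.Quotient.mk 1) :
        ∀ P : I.minimalPrimes, ℂ[n] ⧸ P.1) := by
      rw [← Pi.single_smul, ← Submodule.Quotient.mk_smul, smul_eq_mul, mul_one]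
      congr 1
      refine (Submodule.Quotient.eq _).2 ?_
      rw [← hab, add_sub_cancel_left]
      exact hb
    rw [h3]
    exact Submodule.smul_mem_smul ha trivial
  obtain ⟨y, hy, hyf⟩ := hc _ _ ⟨f, rfl⟩ h2
  rw [smul_eq_mul, Ideal.mul_top, Nat.add_sub_cancel] at hy
  refine mem_sup.2 ⟨y, hy, f - y, ?_, by ring⟩
  rw [← hI.radical, ← Ideal.sInf_minimalPrimes, Ideal.mem_sInf]
  intro P hP
  have := congrFun hyf ⟨P, hP⟩
  exact (Submodule.Quotient.eq P).1 this.symm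

end RadicalJets

section VanishingIdeal

variable {n : ℕ}

/-- The ideal of polynomials vanishing on a set. -/
def vanIdl (S : Set ℂ^n) : Ideal ℂ[n] :=
  MvPolynomial.vanishingIdeal ℂ S

theorem mem_vanIdl {S : Set ℂ^n} {P : ℂ[n]} :
    P ∈ vanIdl S ↔ ∀ x ∈ S, eval x P = 0 := by
  simp only [vanIdl, MvPolynomial.mem_vanishingIdeal_iff, aeval_eq_eval]

theorem vanIdl_isRadical (S : Set ℂ^n) : (vanIdl S).IsRadical := by
  rintro P ⟨k, hk⟩
  rw [mem_vanIdl] at hk ⊢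
  exact fun x hx => eq_zero_of_pow_eq_zero (by simpa using hk x hx)

theorem affZeroLocus_vanIdl {S : Set ℂ^n} (hS : IsAffineVariety S) :
    AffZeroLocus (vanIdl S : Set ℂ[n]) = S := by
  obtain ⟨s, rfl⟩ := hS
  refine Subset.antisymm (affZeroLocus_anti fun P hP => mem_vanIdl.2 fun x hx => hx P hP) ?_
  exact fun x hx P hP => mem_vanIdl.1 hP x hx

theorem exists_span_vanIdl (S : Set ℂ^n) :
    ∃ (m : ℕ) (r : Fin m → ℂ[n]), span (range r) = vanIdl S := by
  obtain ⟨m, r, hr⟩ := Submodule.fg_iff_exists_fin_generating_family.1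
    (IsNoetherian.noetherian (vanIdl S))
  exact ⟨m, r, hr⟩

theorem exists_eq_sum_of_vanish_local {S : Set ℂ^n} (hS : IsAffineVariety S) {m : ℕ}
    {r : Fin m → ℂ[n]} (hr : span (range r) = vanIdl S) {p : ℂ^n}
    {F : ℂ^n → ℂ} (hF : HolAt p F) (h0 : ∀ᶠ z in 𝓝[S] p, F z = 0) :
    ∃ q : Fin m → ℂ^n → ℂ, (∀ j, HolAt p (q j)) ∧
      ∀ᶠ z in 𝓝 p, F z = ∑ j, eval z (r j) * q j z := by
  obtain ⟨q, hq, h⟩ := exists_eq_mulVec_of_jets (Matrix.of fun (_ : Unit) j => r j) p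
    (fun _ => F) (fun _ => hF) fun k => by
      obtain ⟨K₀, hK₀⟩ := exists_jet_bound_of_isRadical (vanIdl_isRadical S) p k
      rw [affZeroLocus_vanIdl hS] at hK₀
      obtain ⟨P, hP⟩ := exists_jet hF (max K₀ k)
      have hmax : ∀ l ≤ max K₀ k, (fun z => ‖z - p‖ ^ max K₀ k) =O[𝓝 p] fun z => ‖z - p‖ ^ l :=
        fun l hl => IsBigO.of_bound 1 <| by
          filter_upwards [closedBall_mem_nhds p one_pos] with z hz
          rw [norm_pow, norm_norm, norm_pow, norm_norm, one_mul]
          exact pow_le_pow_of_le_one (norm_nonneg _) (by simpa [dist_eq_norm] using hz) hl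
      have h1 : P ∈ mIdl p ^ k ⊔ vanIdl S := by
        refine hK₀ P ?_
        have h2 := ((hP.trans (hmax K₀ (le_max_left _ _))).mono
          (nhdsWithin_le_nhds (s := S))).neg_left
        refine h2.congr' ?_ Filter.EventuallyEq.rfl
        filter_upwards [h0] with z hz
        rw [hz]
        ring
      obtain ⟨a, ha, b, hb, hab⟩ := mem_sup.1 h1
      rw [← hr] at hb
      obtain ⟨c, hc⟩ := Ideal.mem_span_range_iff_exists_fun.1 hb
      refine ⟨c, fun _ => ?_⟩
      have h3 := (hP.trans (hmax k (le_max_right _ _))).add (isBigO_eval_of_mem_pow ha)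
      refine h3.congr_left fun z => ?_
      rw [← hab, ← hc, mulVec, dotProduct]
      simp only [Matrix.of_apply, mul_comm (r _), map_add]
      ring
  exact ⟨q, hq, h ()⟩

theorem exists_eq_sum_of_vanish {S : Set ℂ^n} (hS : IsAffineVariety S) {m : ℕ}
    {r : Fin m → ℂ[n]} (hr : span (range r) = vanIdl S)
    {D : Box n} {F : ℂ^n → ℂ} (hF : HolNear D F)
    (h0 : ∀ᶠ z in 𝓝ˢ (cBox D), z ∈ S → F z = 0) :
    ∃ q : Fin m → ℂ^n → ℂ, (∀ j, HolNear D (q j)) ∧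
      ∀ᶠ z in 𝓝ˢ (cBox D), F z = ∑ j, eval z (r j) * q j z := by
  obtain ⟨q, hq, h⟩ := exists_eq_mulVec_near D (Matrix.of fun (_ : Fin 1) j => r j)
    (fun _ => F) (fun _ => hF) fun p hp => by
      obtain ⟨q, hq, h⟩ := exists_eq_sum_of_vanish_local hS hr (hF.holAt hp)
        (eventually_nhdsWithin_iff.2 (h0.filter_mono (nhds_le_nhdsSet hp)))
      exact ⟨q, hq, fun _ => h⟩
  exact ⟨q, hq, h 0⟩

end VanishingIdeal

section HolOnS

variable {n : ℕ}

theorem IsAffineVariety.isClosed {ι : Type*} {S : Set (ι → ℂ)} (hS : IsAffineVariety S) :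
    IsClosed S := by
  obtain ⟨s, rfl⟩ := hS
  exact isClosed_affZeroLocus _

/-- `h` agrees on `S` near `p` with a function holomorphic near `p`. -/
def HolOnS (S : Set ℂ^n) (p : ℂ^n) (h : ℂ^n → ℂ) : Prop :=
  ∃ H : ℂ^n → ℂ, HolAt p H ∧ ∀ᶠ z in 𝓝[S] p, h z = H z

variable {S : Set ℂ^n} {p : ℂ^n} {h h' : ℂ^n → ℂ}

theorem HolAt.holOnS (hh : HolAt p h) : HolOnS S p h := ⟨h, hh, by simp⟩

theorem holAt_eval (p : ℂ^n) (P : ℂ[n]) :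
    HolAt p fun z => eval z P :=
  Eventually.of_forall fun _ => (differentiable_eval P).differentiableAt

theorem HolOnS.congr (hh : HolOnS S p h) (e : ∀ᶠ z in 𝓝[S] p, h' z = h z) : HolOnS S p h' := by
  obtain ⟨H, hH, hE⟩ := hh
  exact ⟨H, hH, by filter_upwards [e, hE] with z h1 h2 using h1.trans h2⟩

theorem holOnS_of_notMem (hS : IsClosed S) (hp : p ∉ S) : HolOnS S p h :=
  ⟨0, Eventually.of_forall fun _ => differentiableAt_const _, by
    rw [(mem_closure_iff_nhdsWithin_neBot.not.trans Filter.not_neBot).1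
      (by rwa [hS.closure_eq])]
    trivial⟩

theorem HolOnS.map₂ {g : ℂ → ℂ → ℂ} (h1 : HolOnS S p h) (h2 : HolOnS S p h')
    (hg : ∀ {H H' : ℂ^n → ℂ} {z}, DifferentiableAt ℂ H z → DifferentiableAt ℂ H' z →
      DifferentiableAt ℂ (fun z => g (H z) (H' z)) z) : HolOnS S p fun z => g (h z) (h' z) := by
  obtain ⟨H, hH, e⟩ := h1
  obtain ⟨H', hH', e'⟩ := h2
  refine ⟨fun z => g (H z) (H' z), ?_, ?_⟩
  · filter_upwards [hH, hH'] with z a b using hg a b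
  · filter_upwards [e, e'] with z a b
    rw [a, b]

theorem HolOnS.fun_add (h1 : HolOnS S p h) (h2 : HolOnS S p h') :
    HolOnS S p fun z => h z + h' z := h1.map₂ h2 .fun_add

theorem HolOnS.fun_mul (h1 : HolOnS S p h) (h2 : HolOnS S p h') :
    HolOnS S p fun z => h z * h' z := h1.map₂ h2 .fun_mul

theorem holOnS_const (c : ℂ) : HolOnS S p fun _ => c :=
  ⟨fun _ => c, Eventually.of_forall fun _ => differentiableAt_const _, by simp⟩

theorem HolOnS.fun_neg (h1 : HolOnS S p h) : HolOnS S p fun z => -h z := by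
  simpa using (holOnS_const (-1)).fun_mul h1

theorem HolOnS.fun_sub (h1 : HolOnS S p h) (h2 : HolOnS S p h') :
    HolOnS S p fun z => h z - h' z := by
  simpa [sub_eq_add_neg] using h1.fun_add h2.fun_neg

theorem HolOnS.fun_sum {ι : Type*} {s : Finset ι} {h : ι → ℂ^n → ℂ}
    (hh : ∀ i ∈ s, HolOnS S p (h i)) : HolOnS S p fun z => ∑ i ∈ s, h i z := by
  classical
  induction s using Finset.induction_on with
  | empty => simpa using holOnS_const 0
  | insert a s ha ih =>
    simp only [sum_insert ha]
    exact (hh a (by simp)).fun_add (ih fun i hi => hh i (by simp [hi]))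

theorem HolOnS.fun_comp {g : ℂ → ℂ} (hh : HolOnS S p h) (hp : p ∈ S)
    (hg : ∀ᶠ w in 𝓝 (h p), DifferentiableAt ℂ g w) : HolOnS S p fun z => g (h z) := by
  obtain ⟨H, hH, e⟩ := hh
  rw [e.self_of_nhdsWithin hp] at hg
  refine ⟨fun z => g (H z), ?_, ?_⟩
  · filter_upwards [hH, hH.continuousAt.eventually hg] with z a b using DifferentiableAt.comp z b a
  · filter_upwards [e] with z a
    rw [a]

theorem HolOnS.inv (hh : HolOnS S p h) (hp : p ∈ S) (h0 : h p ≠ 0) :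
    HolOnS S p fun z => (h z)⁻¹ :=
  hh.fun_comp hp (by
    filter_upwards [isOpen_ne.mem_nhds h0] with w hw using differentiableAt_inv hw)

theorem HolOnS.cexp (hh : HolOnS S p h) : HolOnS S p fun z => exp (h z) :=
  hh.map₂ (g := fun w _ => exp w) hh fun a _ => a.cexp

theorem HolOnS.continuousWithinAt (hh : HolOnS S p h) (hp : p ∈ S) :
    ContinuousWithinAt h S p := by
  obtain ⟨H, hH, e⟩ := hh
  exact hH.continuousAt.continuousWithinAt.congr_of_eventuallyEq e (e.self_of_nhdsWithin hp)

theorem HolOnS.eventually (hh : HolOnS S p h) : ∀ᶠ z in 𝓝 p, HolOnS S z h := by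
  obtain ⟨H, hH, e⟩ := hh
  have h1 := (eventually_eventually_nhds.2 hH)
  have h2 := eventually_eventually_nhds.2 (eventually_nhdsWithin_iff.1 e)
  filter_upwards [h1, h2] with z a b
  exact ⟨H, a, eventually_nhdsWithin_iff.2 b⟩

section Boxes

variable {r : Box n} {i : Fin n} {e : Fin 4} {c : ℝ}

theorem exists_glue_set {F : Type*} (h1 : c ≤ r i e) (h2 : -c ≤ r i (e + 2)) {S : Set ℂ^n}
    {f₁ f₂ : ℂ^n → F} (h : ∀ᶠ z in 𝓝ˢ (cBox (faceB r i e c)), z ∈ S → f₁ z = f₂ z) :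
    ∃ f : ℂ^n → F, (∀ᶠ z in 𝓝ˢ (cBox (setB r i e c)), z ∈ S → f z = f₁ z) ∧
      ∀ᶠ z in 𝓝ˢ (cBox (setB r i (e + 2) (-c))), z ∈ S → f z = f₂ z := by
  classical
  simp only [eventually_nhdsSet_cBox_iff] at *
  obtain ⟨s, hs, h⟩ := h
  refine ⟨fun z => if z ∈ oBox (setB r i e c) s then f₁ z else f₂ z,
    ⟨s, hs, fun z hz _ => if_pos hz⟩, s, hs, fun z hz hzS => ?_⟩
  by_cases hz1 : z ∈ oBox (setB r i e c) s
  · simp only [hz1, if_true]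
    exact h z (by rw [← oBox_inter h1 h2]; exact ⟨hz1, hz⟩) hzS
  · simp only [hz1, if_false]

end Boxes

theorem exists_ext (hS : IsAffineVariety S) (D : Box n)
    (hh : ∀ p ∈ cBox D, HolOnS S p h) :
    ∃ H, HolNear D H ∧ ∀ᶠ z in 𝓝ˢ (cBox D), z ∈ S → h z = H z := by
  obtain ⟨m, P, hP⟩ := exists_span_vanIdl S
  refine box_induction D
    (fun r' hr' => ⟨0, holNear_iff.2 (by simp [hr']), by simp [hr']⟩) (fun p hp => ?_)
    fun r i e c _ h1 h2 _ hP1 hP2 => ?_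
  · obtain ⟨H, hH, hE⟩ := hh p hp
    obtain ⟨ε, hε, hb⟩ := exists_ball_eventually_nhdsSet (hH.and (eventually_nhdsWithin_iff.1 hE))
    exact ⟨ε, hε, fun r' _ hr' => ⟨H, holNear_iff.2 ((hb r' hr').mono fun z hz => hz.1),
      (hb r' hr').mono fun z hz => hz.2⟩⟩
  · obtain ⟨H₁, hH₁, e₁⟩ := hP1
    obtain ⟨H₂, hH₂, e₂⟩ := hP2
    have f1 := faceB_le_left (c := c) (i := i) (e := e) h2
    have f2 := faceB_le_right (c := c) (i := i) (e := e) h1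
    obtain ⟨q, hq, hqe⟩ := exists_eq_sum_of_vanish hS hP ((hH₁.mono f1).fun_sub (hH₂.mono f2)) (by
      filter_upwards [nhdsSet_mono (cBox_mono f1) e₁, nhdsSet_mono (cBox_mono f2) e₂]
        with z a b hz
      rw [← a hz, ← b hz, sub_self])
    choose w₁ w₂ hw₁ hw₂ hw₁₂ using fun l => cousin_split (hq l)
    obtain ⟨H, hH, g₁, g₂⟩ := exists_glue_near h1 h2
      (f₁ := fun z => H₁ z - ∑ l, eval z (P l) * w₁ l z)
      (f₂ := fun z => H₂ z - ∑ l, eval z (P l) * w₂ l z)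
      (holNear_iff.1 (hH₁.fun_sub (HolNear.fun_sum fun l _ => (holNear_eval _ _).fun_mul (hw₁ l))))
      (holNear_iff.1 (hH₂.fun_sub (HolNear.fun_sum fun l _ => (holNear_eval _ _).fun_mul (hw₂ l))))
      (by
        filter_upwards [hqe, eventually_all.2 hw₁₂] with z h3 h4
        simp only [h4, mul_sub, sum_sub_distrib] at h3
        linear_combination h3)
    have hz0 : ∀ (w : Fin m → ℂ^n → ℂ), ∀ z ∈ S,
        ∑ l, eval z (P l) * w l z = 0 := fun w z hz =>
      sum_eq_zero fun l _ => by
        rw [mem_vanIdl.1 (hP ▸ Ideal.subset_span (mem_range_self l)) z hz, zero_mul]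
    refine ⟨H, holNear_iff.2 hH, Eventually.filter_mono (nhdsSet_cBox_le r i e c)
      (Filter.eventually_sup.2 ⟨?_, ?_⟩)⟩
    · filter_upwards [e₁, g₁] with z a b hz
      rw [b, hz0 _ z hz, sub_zero, a hz]
    · filter_upwards [e₂, g₂] with z a b hz
      rw [b, hz0 _ z hz, sub_zero, a hz]

/-- Multiplicative Cousin problem: holomorphic multiples of a continuous vector function which
exist locally with a logarithm exist globally. -/
theorem exists_exp_mul_holOnS_box {ι : Type*} (hS : IsAffineVariety S) (D : Box n)
    (T : ι → ℂ^n → ℂ) (hT : ∀ p ∈ cBox D, p ∈ S → ∃ j, T j p ≠ 0)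
    (hloc : ∀ p ∈ cBox D, p ∈ S → ∃ c : ℂ^n → ℂ, (∀ᶠ z in 𝓝 p, ContinuousWithinAt c S z) ∧
      ∀ᶠ z in 𝓝 p, ∀ j, HolOnS S z fun z => exp (c z) * T j z) :
    ∃ c : ℂ^n → ℂ, (∀ᶠ z in 𝓝ˢ (cBox D), ContinuousWithinAt c S z) ∧
      ∀ᶠ z in 𝓝ˢ (cBox D), ∀ j, HolOnS S z fun z => exp (c z) * T j z := by
  have hSc := hS.isClosed
  refine box_induction D
    (fun r' hr' => ⟨0, by simp [hr'], by simp [hr']⟩) (fun p hp => ?_)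
    fun r i e c hr h1 h2 _ hP1 hP2 => ?_
  · by_cases hpS : p ∈ S
    · obtain ⟨c, hc, hcT⟩ := hloc p hp hpS
      obtain ⟨ε, hε, hb⟩ := exists_ball_eventually_nhdsSet (hc.and hcT)
      exact ⟨ε, hε, fun r' _ hr' => ⟨c, (hb r' hr').mono fun z hz => hz.1,
        (hb r' hr').mono fun z hz => hz.2⟩⟩
    · obtain ⟨ε, hε, hb⟩ := exists_ball_eventually_nhdsSet (hSc.isOpen_compl.mem_nhds hpS)
      refine ⟨ε, hε, fun r' _ hr' => ⟨0, Eventually.of_forall fun z =>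
        continuousWithinAt_const, (hb r' hr').mono fun z hz j => holOnS_of_notMem hSc hz⟩⟩
  · obtain ⟨c₁, hc₁, e₁⟩ := hP1
    obtain ⟨c₂, hc₂, e₂⟩ := hP2
    have f1 := faceB_le_left (c := c) (i := i) (e := e) h2
    have f2 := faceB_le_right (c := c) (i := i) (e := e) h1
    have hl : ∀ p ∈ cBox (faceB r i e c), HolOnS S p fun z => c₁ z - c₂ z := fun p hp => by
      by_cases hpS : p ∈ S
      swap
      · exact holOnS_of_notMem hSc hpS
      have hp1 := nhds_le_nhdsSet (cBox_mono f1 hp)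
      have hp2 := nhds_le_nhdsSet (cBox_mono f2 hp)
      obtain ⟨j, hj⟩ := hT p (cBox_mono (f1.trans (setB_le h1 |>.trans hr)) hp) hpS
      have a1 := (e₁.filter_mono hp1).self_of_nhds j
      have a2 := (e₂.filter_mono hp2).self_of_nhds j
      have a3 : HolOnS S p fun z => (exp (c₁ z) * T j z) * (exp (c₂ z) * T j z)⁻¹ *
          exp (-(c₁ p - c₂ p)) :=
        (a1.fun_mul (a2.inv hpS (mul_ne_zero (Complex.exp_ne_zero _) hj))).fun_mul (holOnS_const _)
      have hp0 : (exp (c₁ p) * T j p) * (exp (c₂ p) * T j p)⁻¹ *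
          exp (-(c₁ p - c₂ p)) = 1 := by
        rw [mul_inv, neg_sub, Complex.exp_sub]
        field_simp
      have a4 : HolOnS S p fun z => log ((exp (c₁ z) * T j z) *
          (exp (c₂ z) * T j z)⁻¹ * exp (-(c₁ p - c₂ p))) + (c₁ p - c₂ p) := by
        refine (a3.fun_comp hpS (g := log) ?_).fun_add (holOnS_const _)
        rw [hp0]
        filter_upwards [Complex.isOpen_slitPlane.mem_nhds Complex.one_mem_slitPlane] with w hw
          using differentiableAt_id.clog hw
      refine a4.congr ?_
      have b1 := (hc₁.filter_mono hp1).self_of_nhds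
      have b2 := (hc₂.filter_mono hp2).self_of_nhds
      have b3 : ∀ᶠ z in 𝓝[S] p, ‖(c₁ z - c₂ z) - (c₁ p - c₂ p)‖ < 1 := by
        have := ((b1.sub b2).sub_const (c₁ p - c₂ p)).norm.eventually_lt_const
          (u := 1) (by simp)
        exact this
      have b4 : ∀ᶠ z in 𝓝[S] p, exp (c₂ z) * T j z ≠ 0 :=
        (a2.continuousWithinAt hpS).eventually_ne (mul_ne_zero (Complex.exp_ne_zero _) hj)
      filter_upwards [b3, b4] with z hz hz4
      have hTz : T j z ≠ 0 := right_ne_zero_of_mul hz4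
      have h5 : (exp (c₁ z) * T j z) * (exp (c₂ z) * T j z)⁻¹ *
          exp (-(c₁ p - c₂ p)) = exp ((c₁ z - c₂ z) - (c₁ p - c₂ p)) := by
        rw [sub_eq_add_neg (c₁ z - c₂ z), Complex.exp_add, Complex.exp_sub]
        field_simp
      rw [h5, Complex.log_exp]
      · ring
      · have := (Complex.abs_im_le_norm _).trans_lt hz
        linarith [(abs_lt.1 this).1, Real.pi_gt_three]
      · have := (Complex.abs_im_le_norm _).trans_lt hz
        linarith [(abs_lt.1 this).2, Real.pi_gt_three]
    obtain ⟨L, hL, hLe⟩ := exists_ext hS _ hl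
    obtain ⟨w₁, w₂, hw₁, hw₂, hw⟩ := cousin_split hL
    obtain ⟨d, g₁, g₂⟩ := exists_glue_set h1 h2 (S := S) (f₁ := fun z => c₁ z - w₁ z)
      (f₂ := fun z => c₂ z - w₂ z) (by
        filter_upwards [hLe, hw] with z a b hz
        linear_combination (a hz).trans b)
    have key : ∀ (D' : Box n) (c' w' : ℂ^n → ℂ),
        (∀ᶠ z in 𝓝ˢ (cBox D'), ContinuousWithinAt c' S z) →
        (∀ᶠ z in 𝓝ˢ (cBox D'), ∀ j, HolOnS S z fun z => exp (c' z) * T j z) →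
        HolNear D' w' → (∀ᶠ z in 𝓝ˢ (cBox D'), z ∈ S → d z = c' z - w' z) →
        ∀ᶠ z in 𝓝ˢ (cBox D'), ContinuousWithinAt d S z ∧
          ∀ j, HolOnS S z fun z => exp (d z) * T j z := by
      intro D' c' w' k1 k2 k3 k4
      filter_upwards [k1, k2, (holNear_iff.1 k3).eventually_nhdsSet,
        k4.eventually_nhdsSet] with z a1 a2 a3 a4
      have a5 : ∀ᶠ y in 𝓝[S] z, d y = c' y - w' y := eventually_nhdsWithin_iff.2 a4
      by_cases hz : z ∈ S
      · refine ⟨?_, fun j => ?_⟩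
        · exact (a1.sub (HolAt.continuousAt a3).continuousWithinAt).congr_of_eventuallyEq a5
            (a5.self_of_nhdsWithin hz)
        · refine ((HolAt.holOnS a3).fun_neg.cexp.fun_mul (a2 j)).congr ?_
          filter_upwards [a5] with y hy
          rw [hy, sub_eq_add_neg, Complex.exp_add]
          ring
      · refine ⟨?_, fun j => holOnS_of_notMem hSc hz⟩
        rw [ContinuousWithinAt, (mem_closure_iff_nhdsWithin_neBot.not.trans Filter.not_neBot).1
          (by rwa [hSc.closure_eq])]
        exact Filter.tendsto_bot
    have key' := Eventually.filter_mono (nhdsSet_cBox_le r i e c)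
      (Filter.eventually_sup.2 ⟨key _ c₁ w₁ hc₁ e₁ hw₁ g₁, key _ c₂ w₂ hc₂ e₂ hw₂ g₂⟩)
    exact ⟨d, key'.mono fun z hz => hz.1, key'.mono fun z hz => hz.2⟩

end HolOnS

section PolyConvex

variable {n k : ℕ}

theorem mem_cBox_of_norm_le {z : ℂ^n} {R : ℝ} (h : ‖z‖ ≤ R) : z ∈ cBox fun _ _ => R :=
  fun i e => (dirRe_le_norm e _).trans ((norm_le_pi_norm z i).trans h)

/-- Polynomial convexity. -/
def PolyConvex (K : Set ℂ^n) : Prop :=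
  ∀ z ∉ K, ∃ P : ℂ[n], (∀ x ∈ K, ‖eval x P‖ ≤ 1) ∧
    2 < ‖eval z P‖

theorem exists_vanIdl_ne_zero {S : Set ℂ^n} (hS : IsAffineVariety S) {z : ℂ^n}
    (hz : z ∉ S) : ∃ P ∈ vanIdl S, eval z P ≠ 0 := by
  rw [← affZeroLocus_vanIdl hS] at hz
  simpa [AffZeroLocus] using hz

theorem polyConvex_of_isRungeCompactIn {S : Set ℂ^n} (hS : IsAffineVariety S) {K : Set ↥S}
    (hK : IsRungeCompactIn S K) : PolyConvex (Subtype.val '' K) := by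
  classical
  intro z hz
  by_cases hzS : z ∈ S
  swap
  · obtain ⟨P, hP, h0⟩ := exists_vanIdl_ne_zero hS hzS
    refine ⟨C (3 / eval z P) * P, ?_, ?_⟩
    · rintro _ ⟨x, -, rfl⟩
      simp [mem_vanIdl.1 hP x x.2]
    · simp [h0]
      norm_num
  obtain ⟨h, hh, hlt⟩ := hK.2 ⟨z, hzS⟩ fun hm => hz ⟨_, hm, rfl⟩
  have hb : IsCompact (insert z (Subtype.val '' K)) :=
    (hK.1.image continuous_subtype_val).insert z
  obtain ⟨R, hR⟩ := hb.isBounded.exists_norm_le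
  set h' : ℂ^n → ℂ := fun z => if hz : z ∈ S then h ⟨z, hz⟩ else 0 with hh'
  have h1 : ∀ p ∈ cBox fun (_ : Fin n) (_ : Fin 4) => R, HolOnS S p h' := fun p _ => by
    by_cases hp : p ∈ S
    · obtain ⟨W, hW, hpW, -, H, hH, e⟩ := hh ⟨p, hp⟩ trivial
      refine ⟨H, ?_, ?_⟩
      · filter_upwards [hW.mem_nhds hpW] with y hy using hH.differentiableAt (hW.mem_nhds hy)
      · filter_upwards [self_mem_nhdsWithin, mem_nhdsWithin_of_mem_nhds (hW.mem_nhds hpW)]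
          with y hy hyW
        simp only [hh', hy, dif_pos]
        exact e ⟨y, hy⟩ hyW
    · exact holOnS_of_notMem hS.isClosed hp
  obtain ⟨H, hH, hE⟩ := exists_ext hS _ h1
  have hmem : ∀ y ∈ insert z (Subtype.val '' K), y ∈ cBox fun (_ : Fin n) (_ : Fin 4) => R :=
    fun y hy => mem_cBox_of_norm_le (hR y hy)
  have hEq : ∀ y : ↥S, (y : ℂ^n) ∈ insert z (Subtype.val '' K) → h y = H y := fun y hy => by
    have := hE.self_of_nhdsSet _ (hmem _ hy) y.2
    simpa [hh'] using this
  have hcont : ContinuousOn h K := fun y hy => by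
    have h2 := (h1 _ (hmem y (mem_insert_of_mem _ ⟨y, hy, rfl⟩))).continuousWithinAt y.2
    have h3 : Tendsto (fun y : ↥S => h' y) (𝓝 y) (𝓝 (h' y)) := by
      have := h2.tendsto
      rw [nhdsWithin_eq_map_subtype_coe y.2] at this
      exact this
    refine Tendsto.mono_left ?_ nhdsWithin_le_nhds
    simpa [hh'] using h3
  obtain ⟨B, hB⟩ := hK.1.exists_bound_of_continuousOn hcont
  have hle : ∀ y ∈ K, ‖h y‖ ≤ ⨆ y ∈ K, ‖h y‖ := fun y hy => by
    have hbd : BddAbove (range fun y => ⨆ (_ : y ∈ K), ‖h y‖) := by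
      refine ⟨max B 0, ?_⟩
      rintro _ ⟨y, rfl⟩
      by_cases hy : y ∈ K
      · simp only [hy, ciSup_unique]
        exact (hB y hy).trans (le_max_left _ _)
      · simp [hy]
    refine le_trans ?_ (le_ciSup hbd y)
    simp [hy]
  have h0 : 0 ≤ ⨆ y ∈ K, ‖h y‖ :=
    Real.iSup_nonneg fun y => Real.iSup_nonneg fun _ => norm_nonneg _
  set a := ⨆ y ∈ K, ‖h y‖
  set b := ‖h ⟨z, hzS⟩‖
  obtain ⟨Q, hQ⟩ := runge_box hH (ε := (b - a) / 4) (by linarith)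
  have hz1 : (3 * b + a) / 4 < ‖eval z Q‖ := by
    have := hQ z (hmem z (mem_insert _ _))
    rw [← hEq ⟨z, hzS⟩ (mem_insert _ _)] at this
    have h3 := norm_sub_norm_le (h ⟨z, hzS⟩) (eval z Q)
    change b - _ ≤ _ at h3
    linarith
  have hK1 : ∀ x ∈ K, ‖eval (x : ℂ^n) Q‖ ≤ (b + 3 * a) / 4 := fun x hx => by
    have hx' : (x : ℂ^n) ∈ insert z (Subtype.val '' K) := mem_insert_of_mem _ ⟨x, hx, rfl⟩
    have := hQ x (hmem _ hx')
    rw [← hEq x hx', norm_sub_rev] at this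
    have h3 := norm_sub_norm_le (eval (x : ℂ^n) Q) (h x)
    have := hle x hx
    linarith
  set c := (b + 3 * a) / 4 with hc
  have hc0 : 0 < c := by simp only [hc]; linarith
  have hz2 : 1 < ‖eval z Q‖ / c := by
    rw [one_lt_div hc0]
    simp only [hc]
    linarith
  obtain ⟨m, hm⟩ := pow_unbounded_of_one_lt 2 hz2
  refine ⟨(C (c : ℂ)⁻¹ * Q) ^ m, ?_, ?_⟩
  · rintro _ ⟨x, hx, rfl⟩
    simp only [map_pow, map_mul, eval_C, norm_pow, norm_mul, norm_inv,
      norm_real, norm_of_nonneg hc0.le]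
    refine pow_le_one₀ (by positivity) ?_
    rw [inv_mul_le_one₀ hc0]
    exact hK1 x hx
  · simp only [map_pow, map_mul, eval_C, norm_pow, norm_mul, norm_inv,
      norm_real, norm_of_nonneg hc0.le]
    rwa [inv_mul_eq_div]

/-- The first coordinates of a point. -/
def fstPart (z : ℂ^(n + k)) : ℂ^n := fun i => z (Fin.castAdd k i)

/-- The graph map of a tuple of polynomials. -/
def graphMap (q : Fin k → ℂ[n]) (x : ℂ^n) : ℂ^(n + k) :=
  Fin.append x fun j => eval x (q j)

/-- The graph of a tuple of polynomials over a set. -/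
def graphSet (q : Fin k → ℂ[n]) (S : Set ℂ^n) : Set ℂ^(n + k) :=
  {z | fstPart z ∈ S ∧ ∀ j, z (Fin.natAdd n j) = eval (fstPart z) (q j)}

variable {q : Fin k → ℂ[n]} {S : Set ℂ^n}

@[simp] theorem fstPart_graphMap (x : ℂ^n) : fstPart (graphMap q x) = x := by
  ext i; simp [fstPart, graphMap]

theorem graphMap_mem {x : ℂ^n} (hx : x ∈ S) : graphMap q x ∈ graphSet q S := by
  refine ⟨by simpa, fun j => ?_⟩
  rw [fstPart_graphMap]
  simp [graphMap]

theorem graphMap_fstPart {z : ℂ^(n + k)} (hz : z ∈ graphSet q S) :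
    graphMap q (fstPart z) = z := by
  ext i
  refine Fin.addCases (fun i => by simp [graphMap, fstPart]) (fun j => ?_) i
  rw [hz.2 j]
  simp [graphMap]

theorem graphSet_mono {S' : Set ℂ^n} (h : S' ⊆ S) : graphSet q S' ⊆ graphSet q S :=
  fun _ hz => ⟨h hz.1, hz.2⟩

theorem differentiable_fstPart : Differentiable ℂ (fstPart : ℂ^(n + k) → ℂ^n) :=
  differentiable_pi.2 fun _ => differentiable_apply _

theorem differentiable_graphMap : Differentiable ℂ (graphMap q) := by
  refine differentiable_pi.2 fun i => Fin.addCases (fun i => ?_) (fun j => ?_) i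
  · simpa [graphMap] using differentiable_apply i
  · simpa [graphMap] using differentiable_eval (q j)

theorem isAffineVariety_graphSet (hS : IsAffineVariety S) : IsAffineVariety (graphSet q S) := by
  classical
  obtain ⟨s, rfl⟩ := hS
  refine ⟨s.image (rename (Fin.castAdd k)) ∪ Finset.univ.image fun j =>
    X (Fin.natAdd n j) - rename (Fin.castAdd k) (q j), ?_⟩
  ext z
  simp only [graphSet, AffZeroLocus, mem_ofPred_eq, Finset.coe_union, Finset.coe_image, mem_union,
    or_imp, forall_and, mem_image, Finset.mem_coe, Finset.coe_univ, mem_univ, true_and,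
    forall_exists_index, forall_apply_eq_imp_iff, and_imp, forall_apply_eq_imp_iff₂,
    eval_rename, map_sub, eval_X, sub_eq_zero]
  rfl

theorem HolOnS.fstPart {h : ℂ^n → ℂ} {z : ℂ^(n + k)} {q : Fin k → ℂ[n]}
    (hh : HolOnS S (fstPart z) h) : HolOnS (graphSet q S) z fun z => h (fstPart z) := by
  obtain ⟨H, hH, e⟩ := hh
  have hc := (differentiable_fstPart (n := n) (k := k)).continuous.tendsto z
  refine ⟨fun z => H (_root_.fstPart z), ?_, ?_⟩
  · filter_upwards [hc.eventually hH] with y hy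
    exact DifferentiableAt.comp y hy differentiable_fstPart.differentiableAt
  · rw [eventually_nhdsWithin_iff] at e ⊢
    filter_upwards [hc.eventually e] with y hy hyS using hy hyS.1

theorem HolOnS.comp_graphMap {h : ℂ^(n + k) → ℂ} {x : ℂ^n}
    (hh : HolOnS (graphSet q S) (graphMap q x) h) : HolOnS S x fun x => h (graphMap q x) := by
  obtain ⟨H, hH, e⟩ := hh
  have hc := (differentiable_graphMap (q := q)).continuous.tendsto x
  refine ⟨fun z => H (graphMap q z), ?_, ?_⟩
  · filter_upwards [hc.eventually hH] with y hy
    exact DifferentiableAt.comp y hy differentiable_graphMap.differentiableAt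
  · rw [eventually_nhdsWithin_iff] at e ⊢
    filter_upwards [hc.eventually e] with y hy hyS using hy (graphMap_mem hyS)

theorem PolyConvex.exists_graph {K O : Set ℂ^n} (hK : IsCompact K) (hKc : PolyConvex K)
    (hO : IsOpen O) (hKO : K ⊆ O) : ∃ (k : ℕ) (q : Fin k → ℂ[n])
      (D : Box (n + k)), (∀ x ∈ K, graphMap q x ∈ cBox D) ∧
      ∀ z ∈ cBox D, z ∈ graphSet q univ → fstPart z ∈ O := by
  obtain ⟨R, hR⟩ := hK.isBounded.exists_norm_le
  have hC : IsCompact (cBox (fun (_ : Fin n) (_ : Fin 4) => R) \ O) := (isCompact_cBox _).diff hO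
  choose! P hP1 hP2 using hKc
  obtain ⟨t, ht, hcov⟩ := hC.elim_nhds_subcover (fun z => {y | 2 < ‖eval y (P z)‖})
    fun z hz => (isOpen_lt continuous_const (continuous_eval _).norm).mem_nhds
      (hP2 z fun h => hz.2 (hKO h))
  let e := t.equivFin
  refine ⟨t.card, fun j => P (e.symm j), Fin.append (fun _ _ => R) fun _ _ => 1, fun x hx i => ?_,
    fun z hz hzg => ?_⟩
  · refine Fin.addCases (fun i => ?_) (fun j => ?_) i
    · simpa [graphMap] using mem_cBox_of_norm_le (hR x hx) i
    · intro e'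
      simp only [graphMap, Fin.append_right]
      exact (dirRe_le_norm _ _).trans
        (hP1 _ (fun h => (ht _ (e.symm j).2).2 (hKO h)) x hx)
  · by_contra hzO
    have hz1 : fstPart z ∈ cBox fun (_ : Fin n) (_ : Fin 4) => R := fun i e' => by
      simpa [fstPart] using hz (Fin.castAdd _ i) e'
    obtain ⟨y, hy, hyz⟩ := mem_iUnion₂.1 (hcov ⟨hz1, hzO⟩)
    have h1 := hzg.2 (e ⟨y, hy⟩)
    have h2 : ‖z (Fin.natAdd n (e ⟨y, hy⟩))‖ ≤ 2 * 1 := norm_le_of_dirRe_le fun e' => by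
      simpa using hz (Fin.natAdd _ (e ⟨y, hy⟩)) e'
    rw [h1] at h2
    simp only [Equiv.symm_apply_apply] at h2
    simp only [mem_ofPred_eq] at hyz
    linarith

end PolyConvex

section OkaWeil

variable {n : ℕ} {S S' K : Set ℂ^n}

theorem eventually_graphSet_fstPart {k : ℕ} {q : Fin k → ℂ[n]}
    {D : Box (n + k)} {O : Set ℂ^n} (hO : IsOpen O)
    (hD : ∀ z ∈ cBox D, z ∈ graphSet q univ → fstPart z ∈ O) :
    ∀ᶠ z in 𝓝ˢ (cBox D), z ∈ graphSet q univ → fstPart z ∈ O := by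
  have hu : IsAffineVariety (univ : Set ℂ^n) := ⟨∅, by simp [AffZeroLocus]⟩
  have ho : IsOpen ((graphSet q univ)ᶜ ∪ fstPart ⁻¹' O) :=
    (isAffineVariety_graphSet hu).isClosed.isOpen_compl.union
      (hO.preimage differentiable_fstPart.continuous)
  filter_upwards [ho.mem_nhdsSet.2 fun z hz => by
    by_cases h : z ∈ graphSet q univ
    · exact Or.inr (hD z hz h)
    · exact Or.inl h] with z hz hzg
  exact hz.resolve_left fun h => h hzg

/-- Oka–Weil approximation with interpolation on a subvariety. -/
theorem exists_poly_approx (hS : IsAffineVariety S) (hS' : IsAffineVariety S') (hSS : S' ⊆ S)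
    (hK : IsCompact K) (hKc : PolyConvex K) (hKS : K ⊆ S) {h : ℂ^n → ℂ}
    (hh : ∀ p ∈ K, HolOnS S p h) (h0 : ∀ᶠ z in 𝓝ˢ K, z ∈ S' → h z = 0) {ε : ℝ} (hε : 0 < ε) :
    ∃ P ∈ vanIdl S', ∀ x ∈ K, ‖h x - eval x P‖ < ε := by
  set O : Set ℂ^n := {z | HolOnS S z h ∧ ∀ᶠ y in 𝓝 z, y ∈ S' → h y = 0} with hOdef
  have hO : IsOpen O := isOpen_iff_eventually.2 fun z hz =>
    (hz.1.eventually).and (eventually_eventually_nhds.2 hz.2)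
  have hKO : K ⊆ O := fun z hz => ⟨hh z hz, (h0.eventually_nhdsSet).self_of_nhdsSet _ hz⟩
  obtain ⟨k, q, D, hKD, hD⟩ := hKc.exists_graph hK hO hKO
  have hS1 := isAffineVariety_graphSet (q := q) hS
  have hS2 := isAffineVariety_graphSet (q := q) hS'
  obtain ⟨H, hH, hE⟩ := exists_ext hS1 D (h := fun z => h (fstPart z)) fun p hp => by
    by_cases hpg : p ∈ graphSet q S
    · exact (hD p hp (graphSet_mono (subset_univ S) hpg)).1.fstPart
    · exact holOnS_of_notMem hS1.isClosed hpg
  obtain ⟨m, r, hr⟩ := exists_span_vanIdl (graphSet q S')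
  obtain ⟨w, hw, hwe⟩ := exists_eq_sum_of_vanish hS2 hr hH (by
    filter_upwards [hE, eventually_graphSet_fstPart hO hD] with z h1 h2 hz
    rw [← h1 (graphSet_mono hSS hz)]
    exact (h2 (graphSet_mono (subset_univ _) hz)).2.self_of_nhds hz.1)
  obtain ⟨B, hB⟩ : ∃ B : ℝ, ∀ z ∈ cBox D, ∀ j, ‖eval z (r j)‖ ≤ B := by
    obtain ⟨B, hB⟩ := (isCompact_cBox D).exists_bound_of_continuousOn
      (f := fun z => fun j => eval z (r j))
      (continuous_pi fun j => continuous_eval (r j)).continuousOn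
    exact ⟨B, fun z hz j => (norm_le_pi_norm (fun j => eval z (r j)) j).trans (hB z hz)⟩
  choose Q hQ using fun j => runge_box (hw j) (ε := ε / (2 * (m + 1) * (|B| + 1))) (by positivity)
  refine ⟨aeval (Fin.append X q) (∑ j, r j * Q j), ?_, fun x hx => ?_⟩
  all_goals
    have hev : ∀ (x : ℂ^n) (P : ℂ[n + k]),
        eval x (aeval (Fin.append X q) P) =
          eval (graphMap q x) P := fun x P => by
      rw [← MvPolynomial.coe_aeval_eq_eval, ← MvPolynomial.coe_aeval_eq_eval, RingHom.coe_coe,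
        RingHom.coe_coe, ← AlgHom.comp_apply]
      congr 1
      ext i
      refine Fin.addCases (fun i => ?_) (fun j => ?_) i <;>
        simp [graphMap, aeval_eq_eval]
  · refine mem_vanIdl.2 fun x hx => ?_
    rw [hev, map_sum]
    refine sum_eq_zero fun j _ => ?_
    rw [map_mul, mem_vanIdl.1 (hr ▸ Ideal.subset_span (mem_range_self j)) _ (graphMap_mem hx),
      zero_mul]
  · have h1 := hE.self_of_nhdsSet _ (hKD x hx) (graphMap_mem (hKS hx))
    rw [fstPart_graphMap] at h1
    rw [hev, h1, hwe.self_of_nhdsSet _ (hKD x hx), map_sum, ← sum_sub_distrib]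
    simp only [map_mul, ← mul_sub]
    refine (norm_sum_le_of_le (f := fun j => eval (graphMap q x) (r j) *
      (w j (graphMap q x) - eval (graphMap q x) (Q j))) _
      (n := fun _ => (|B| + 1) * (ε / (2 * (m + 1) * (|B| + 1)))) fun j _ => ?_).trans_lt ?_
    · rw [norm_mul]
      exact mul_le_mul ((hB _ (hKD x hx) j).trans ((le_abs_self _).trans (by linarith)))
        (hQ j _ (hKD x hx)).le (norm_nonneg _) (by positivity)
    · simp only [sum_const, Finset.card_univ, Fintype.card_fin, nsmul_eq_mul]
      have : (m : ℝ) * ((|B| + 1) * (ε / (2 * (m + 1) * (|B| + 1)))) = ε * (m / (2 * (m + 1))) := by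
        field_simp
      rw [this]
      have h3 : (m : ℝ) / (2 * (m + 1)) < 1 := by
        rw [div_lt_one (by positivity)]
        have : (0 : ℝ) ≤ m := by positivity
        linarith
      nlinarith

/-- Multiplicative Cousin problem near a polynomially convex compact set. -/
theorem exists_mul_holOnS {ι : Type*} [Finite ι] (hS : IsAffineVariety S) (hK : IsCompact K)
    (hKc : PolyConvex K) (T : ι → ℂ^n → ℂ) (hT : ∀ p ∈ K, ∃ j, T j p ≠ 0)
    (hTc : ∀ p ∈ K, ∀ᶠ z in 𝓝 p, ∀ j, ContinuousWithinAt (T j) S z)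
    (hloc : ∀ p ∈ K, ∃ c : ℂ^n → ℂ, (∀ᶠ z in 𝓝 p, ContinuousWithinAt c S z) ∧
      ∀ᶠ z in 𝓝 p, ∀ j, HolOnS S z fun z => exp (c z) * T j z) :
    ∃ θ : ℂ^n → ℂ, (∀ z, θ z ≠ 0) ∧ ∀ p ∈ K, ∀ j, HolOnS S p fun z => θ z * T j z := by
  set O : Set ℂ^n := {z | (z ∈ S → ∃ j, T j z ≠ 0) ∧
    (∀ᶠ y in 𝓝 z, ∀ j, ContinuousWithinAt (T j) S y) ∧
    ∃ c : ℂ^n → ℂ, (∀ᶠ z in 𝓝 z, ContinuousWithinAt c S z) ∧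
      ∀ᶠ z in 𝓝 z, ∀ j, HolOnS S z fun z => exp (c z) * T j z} with hOdef
  have hSc := hS.isClosed
  have hO : IsOpen O := isOpen_iff_eventually.2 fun z hz => by
    obtain ⟨h1, h2, c, h3, h4⟩ := hz
    have h5 : ∀ᶠ y in 𝓝 z, y ∈ S → ∃ j, T j y ≠ 0 := by
      by_cases hzS : z ∈ S
      · obtain ⟨j, hj⟩ := h1 hzS
        have := (h2.self_of_nhds j).eventually_ne hj
        rw [eventually_nhdsWithin_iff] at this
        filter_upwards [this] with y hy hyS using ⟨j, hy hyS⟩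
      · filter_upwards [hSc.isOpen_compl.mem_nhds hzS] with y hy hyS using absurd hyS hy
    filter_upwards [h5, eventually_eventually_nhds.2 h2, eventually_eventually_nhds.2 h3,
      eventually_eventually_nhds.2 h4] with y a1 a2 a3 a4 using ⟨a1, a2, c, a3, a4⟩
  obtain ⟨k, q, D, hKD, hD⟩ := hKc.exists_graph hK hO
    fun z hz => ⟨fun _ => hT z hz, hTc z hz, hloc z hz⟩
  have hS1 := isAffineVariety_graphSet (q := q) hS
  have hcont : ∀ z : ℂ^(n + k), Tendsto fstPart (𝓝[graphSet q S] z)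
      (𝓝[S] (fstPart z)) := fun z =>
    tendsto_nhdsWithin_of_tendsto_nhds_of_eventually_within _
      ((differentiable_fstPart.continuous.tendsto z).mono_left nhdsWithin_le_nhds)
      (by filter_upwards [self_mem_nhdsWithin] with y hy using hy.1)
  have hcont' := fun z => (differentiable_fstPart (n := n) (k := k)).continuous.tendsto z
  obtain ⟨c, hc, hcT⟩ := exists_exp_mul_holOnS_box hS1 D (fun j z => T j (fstPart z))
    (fun z hz hzg => (hD z hz (graphSet_mono (subset_univ S) hzg)).1 hzg.1) fun z hz hzg => by
      obtain ⟨-, -, c, h3, h4⟩ := hD z hz (graphSet_mono (subset_univ S) hzg)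
      refine ⟨fun z => c (fstPart z), ?_, ?_⟩
      · filter_upwards [(hcont' z).eventually h3] with y hy
        exact hy.tendsto.comp (hcont y)
      · filter_upwards [(hcont' z).eventually h4] with y hy j
        exact (hy j).fstPart
  refine ⟨fun z => exp (c (graphMap q z)), fun z => Complex.exp_ne_zero _,
    fun p hp j => ?_⟩
  simpa using (hcT.self_of_nhdsSet _ (hKD p hp) j).comp_graphMap

/-- Functions without common zeros on a polynomially convex compact set generate the unit
ideal, with polynomial coefficients up to a nonvanishing factor. -/
theorem exists_poly_bezout {ι : Type*} [Fintype ι] (hS : IsAffineVariety S) (hK : IsCompact K)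
    (hKc : PolyConvex K) (hKS : K ⊆ S) {ζ : ι → ℂ^n → ℂ}
    (hζ : ∀ p ∈ K, ∀ j, HolOnS S p (ζ j)) (h0 : ∀ p ∈ K, ∃ j, ζ j p ≠ 0) :
    ∃ c : ι → ℂ[n], ∀ p ∈ K, ∑ j, eval p (c j) * ζ j p ≠ 0 := by
  classical
  have : CompactSpace K := isCompact_iff_compactSpace.1 hK
  have hempty : IsAffineVariety (∅ : Set ℂ^n) := ⟨{1}, by simp [AffZeroLocus]⟩
  let g : ι → C(K, ℂ) := fun j => ⟨fun x => ζ j x, continuous_iff_continuousAt.2 fun x => by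
    have := ((hζ x x.2 j).continuousWithinAt (hKS x.2)).mono hKS
    have h3 := this.tendsto
    rw [nhdsWithin_eq_map_subtype_coe x.2] at h3
    exact h3⟩
  have hg : ∀ j, g j ∈ polyClosure K := fun j => by
    refine Metric.mem_closure_iff.2 fun ε hε => ?_
    obtain ⟨P, -, hP⟩ := exists_poly_approx hS hempty (empty_subset S) hK hKc hKS
      (fun p hp => hζ p hp j) (by simp) hε
    refine ⟨polyToC K P, ⟨P, rfl⟩, ?_⟩
    rw [ContinuousMap.dist_lt_iff hε]
    intro x
    rw [dist_eq_norm, polyToC_apply]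
    exact hP x x.2
  set A := polyClosure K
  set I : Ideal A := span (range fun j => (⟨g j, hg j⟩ : A)) with hI
  have hItop : I = ⊤ := by
    by_contra hne
    obtain ⟨J, hJ, hIJ⟩ := Ideal.exists_le_maximal I hne
    let φ := J.toCharacterSpace
    let x : ℂ^n := fun i => φ ⟨polyToC K (X i), polyToC_mem K _⟩
    let ψ : ℂ[n] →ₐ[ℂ] A := (polyToC K).codRestrict A (polyToC_mem K)
    have hψ : ∀ P, φ (ψ P) = eval x P := fun P => by
      have : (WeakDual.CharacterSpace.toAlgHom φ).comp ψ = aeval x := by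
        ext i
        rw [aeval_X]
        rfl
      rw [← aeval_eq_eval, ← this]
      rfl
    have hφ : ∀ a : A, ‖φ a‖ ≤ ‖a‖ * ‖(1 : A)‖ := fun a => by
      exact spectrum.norm_le_norm_mul_of_mem (AlgHom.apply_mem_spectrum φ a)
    have h1A : ‖(1 : A)‖ ≤ 1 := by
      change ‖(1 : C(K, ℂ))‖ ≤ 1
      exact (ContinuousMap.norm_le _ zero_le_one).2 fun x => by simp
    have hφ1 : ∀ a : A, ‖φ a‖ ≤ ‖a‖ := fun a =>
      (hφ a).trans (mul_le_of_le_one_right (norm_nonneg _) h1A)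
    have hxK : x ∈ K := by
      by_contra hx
      obtain ⟨P, h1, h2⟩ := hKc x hx
      rw [← hψ] at h2
      have h3 : ‖ψ P‖ ≤ 1 := by
        change ‖polyToC K P‖ ≤ 1
        exact (ContinuousMap.norm_le _ zero_le_one).2 fun y => by
          rw [polyToC_apply]
          exact h1 y y.2
      linarith [hφ1 (ψ P)]
    have hev : ∀ a : A, φ a = (a : C(K, ℂ)) ⟨x, hxK⟩ := fun a => by
      refine eq_of_forall_dist_le fun ε hε => ?_
      obtain ⟨P, hP⟩ := exists_poly_of_mem_polyClosure a.2 (half_pos hε)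
      have h1 : ‖φ (a - ψ P)‖ ≤ ε / 2 := (hφ1 _).trans (by
        change ‖(a : C(K, ℂ)) - polyToC K P‖ ≤ ε / 2
        exact (ContinuousMap.norm_le _ (by positivity)).2 fun y => by
          rw [ContinuousMap.sub_apply, polyToC_apply]
          exact (hP y).le)
      have h2 := hP ⟨x, hxK⟩
      rw [map_sub, hψ] at h1
      rw [dist_eq_norm]
      have := norm_sub_le_norm_sub_add_norm_sub (φ a) (eval x P)
        ((a : C(K, ℂ)) ⟨x, hxK⟩)
      rw [norm_sub_rev (eval x P)] at this
      change ‖_ - eval x P‖ < _ at h2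
      linarith
    obtain ⟨j, hj⟩ := h0 x hxK
    refine hj ?_
    have h3 : φ ⟨g j, hg j⟩ = 0 :=
      Ideal.toCharacterSpace_apply_eq_zero_of_mem J (hIJ (Ideal.subset_span ⟨j, rfl⟩))
    rw [hev] at h3
    exact h3
  obtain ⟨a, ha⟩ := (Ideal.mem_span_range_iff_exists_fun (R := A)).1
    (hItop ▸ Submodule.mem_top : (1 : A) ∈ I)
  have ha' : ∀ x : K, ∑ j, (a j : C(K, ℂ)) x * ζ j x = 1 := fun x => by
    have := congrArg (fun b : A => (b : C(K, ℂ)) x) ha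
    simpa [g, ContinuousMap.sum_apply] using this
  obtain ⟨B, hB⟩ : ∃ B : ℝ, ∀ j, ‖g j‖ ≤ B :=
    ⟨∑ j, ‖g j‖, fun j => single_le_sum (f := fun j => ‖g j‖)
      (fun _ _ => norm_nonneg _) (Finset.mem_univ j)⟩
  choose c hc using fun j => exists_poly_of_mem_polyClosure (a j).2
    (ε := 1 / (2 * (Fintype.card ι + 1) * (|B| + 1))) (by positivity)
  refine ⟨c, fun p hp hz => ?_⟩
  have h1 := ha' ⟨p, hp⟩
  have h2 : ‖∑ j, ((a j : C(K, ℂ)) ⟨p, hp⟩ - eval p (c j)) * ζ j p‖ ≤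
      ∑ _j : ι, 1 / (2 * (Fintype.card ι + 1) * (|B| + 1)) * (|B| + 1) := by
    refine norm_sum_le_of_le _ fun j _ => ?_
    rw [norm_mul]
    refine mul_le_mul (hc j ⟨p, hp⟩).le ?_ (norm_nonneg _) (by positivity)
    have := ((g j).norm_coe_le_norm ⟨p, hp⟩).trans ((hB j).trans (le_abs_self B))
    change ‖ζ j p‖ ≤ _ at this
    linarith
  simp only [sub_mul, sum_sub_distrib, hz, h1, sub_zero, norm_one, sum_const,
    Finset.card_univ, nsmul_eq_mul] at h2
  have h3 : (Fintype.card ι : ℝ) * (1 / (2 * (Fintype.card ι + 1) * (|B| + 1)) * (|B| + 1)) =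
      Fintype.card ι / (2 * (Fintype.card ι + 1)) := by
    field_simp
  rw [h3, le_div_iff₀ (by positivity)] at h2
  have : (0 : ℝ) ≤ Fintype.card ι := by positivity
  linarith

end OkaWeil

section Approximation

theorem eval_aeval_eq {α β : Type*} (G : β → MvPolynomial α ℂ) (P : MvPolynomial β ℂ) (z : α → ℂ) :
    eval z (aeval G P) =
      eval (fun i => eval z (G i)) P := by
  induction P using MvPolynomial.induction_on with
  | C a => simp [MvPolynomial.algebraMap_eq]
  | add p q hp hq => rw [map_add, map_add, hp, hq, map_add]
  | mul_X p i hp => rw [map_mul, map_mul, hp, map_mul, aeval_X, eval_X]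

theorem isCompact_unitCube (n : ℕ) : IsCompact (unitCube n) := by
  have : unitCube n = Set.pi univ fun _ => Icc (0 : ℝ) 1 := by
    ext t
    simp only [unitCube, mem_ofPred_eq, mem_univ_pi]
  rw [this]
  exact isCompact_univ_pi fun _ => isCompact_Icc

theorem zero_mem_unitCube (n : ℕ) : (0 : Fin n → ℝ) ∈ unitCube n := fun _ => by simp

theorem smul_mem_unitCube {n : ℕ} {t : Fin n → ℝ} (ht : t ∈ unitCube n) {c : ℝ} (h0 : 0 ≤ c)
    (h1 : c ≤ 1) : c • t ∈ unitCube n := fun i =>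
  ⟨mul_nonneg h0 (ht i).1, mul_le_one₀ h1 (ht i).1 (ht i).2⟩

/-- The inclusion of real parameters into complex ones. -/
def toCx {n : ℕ} (t : Fin n → ℝ) : ℂ^n := fun i => (t i : ℂ)

theorem continuous_toCx {n : ℕ} : Continuous (toCx : (Fin n → ℝ) → ℂ^n) :=
  continuous_pi fun i => Complex.continuous_ofReal.comp (continuous_apply i)

/-- Weierstrass approximation on a compact set of real parameters. -/
theorem exists_poly_weierstrass {n : ℕ} {C : Set (Fin n → ℝ)} (hC : IsCompact C)
    {χ : (Fin n → ℝ) → ℝ} (hχ : ContinuousOn χ C) {ε : ℝ} (hε : 0 < ε) :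
    ∃ P : ℂ[n], ∀ t ∈ C, ‖(χ t : ℂ) - eval (toCx t) P‖ < ε := by
  have : CompactSpace C := isCompact_iff_compactSpace.1 hC
  let A : Subalgebra ℝ C(C, ℝ) := (aeval fun i : Fin n =>
    (⟨fun z => (z : Fin n → ℝ) i, (continuous_apply i).comp continuous_subtype_val⟩ :
      C(C, ℝ))).range
  have hA : A.SeparatesPoints := by
    intro x y hxy
    obtain ⟨i, hi⟩ := ne_iff.1 fun h => hxy (Subtype.ext h)
    exact ⟨_, ⟨_, ⟨X i, rfl⟩, rfl⟩, by simpa using hi⟩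
  obtain ⟨⟨_, P, rfl⟩, hP⟩ := ContinuousMap.exists_mem_subalgebra_near_continuousMap_of_separatesPoints A hA
    ⟨fun t : C => χ t, continuousOn_iff_continuous_domRestrict.1 hχ⟩ ε hε
  refine ⟨MvPolynomial.map (algebraMap ℝ ℂ) P, fun t ht => ?_⟩
  have h1 := ((ContinuousMap.norm_coe_le_norm _ (⟨t, ht⟩ : C)).trans_lt hP)
  have h2 : ∀ P : MvPolynomial (Fin n) ℝ, (aeval fun i : Fin n =>
    (⟨fun z => (z : Fin n → ℝ) i, (continuous_apply i).comp continuous_subtype_val⟩ :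
      C(C, ℝ))) P ⟨t, ht⟩ = eval t P := fun P => by
    induction P using MvPolynomial.induction_on with
    | C a => simp
    | add p q hp hq => rw [map_add, ContinuousMap.add_apply, hp, hq, map_add]
    | mul_X p i hp =>
      rw [map_mul, ContinuousMap.mul_apply, hp, map_mul]
      simp
  have h3 : eval (toCx t) (MvPolynomial.map (algebraMap ℝ ℂ) P) =
      ((eval t P : ℝ) : ℂ) := by
    rw [MvPolynomial.eval_map]
    change MvPolynomial.eval₂ _ (fun i => algebraMap ℝ ℂ (t i)) P = algebraMap ℝ ℂ _
    exact (MvPolynomial.eval₂_comp_left (algebraMap ℝ ℂ) (RingHom.id ℝ) t P).symm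
  rw [h3, norm_sub_rev, ← Complex.ofReal_sub, norm_real]
  rw [ContinuousMap.sub_apply] at h1
  rw [← h2 P]
  exact h1

variable {M n : ℕ} {S S' K : Set ℂ^M}

/-- Approximation of a family of holomorphic functions by polynomials in all variables. -/
theorem exists_poly_approx_family (hS : IsAffineVariety S) (hS' : IsAffineVariety S')
    (hSS : S' ⊆ S) (hK : IsCompact K) (hKc : PolyConvex K) (hKS : K ⊆ S)
    {h : (Fin n → ℝ) → ℂ^M → ℂ}
    (hc : ContinuousOn (fun q : (Fin n → ℝ) × ℂ^M => h q.1 q.2) (unitCube n ×ˢ K))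
    (hh : ∀ t ∈ unitCube n, ∀ p ∈ K, HolOnS S p (h t))
    (h0 : ∀ x ∈ K, h 0 x = 0) (hS0 : ∀ t ∈ unitCube n, ∀ᶠ z in 𝓝ˢ K, z ∈ S' → h t z = 0)
    {ε : ℝ} (hε : 0 < ε) :
    ∃ P : (MvPolynomial (Fin M ⊕ Fin n) ℂ),
      (∀ x, eval (elim x 0) P = 0) ∧
      (∀ x ∈ S', ∀ t, eval (elim x t) P = 0) ∧
      ∀ x ∈ K, ∀ t ∈ unitCube n, ‖h t x - eval (elim x (toCx t)) P‖ < ε := by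
  classical
  suffices H : ∃ P : (MvPolynomial (Fin M ⊕ Fin n) ℂ),
      (∀ x ∈ S', ∀ t, eval (elim x t) P = 0) ∧
      ∀ x ∈ K, ∀ t ∈ unitCube n,
        ‖h t x - eval (elim x (toCx t)) P‖ < ε / 2 by
    obtain ⟨P, hP1, hP2⟩ := H
    have hev : ∀ (x : ℂ^M) (t : ℂ^n), eval (elim x t)
        (P - aeval (elim (fun i => X (inl i)) fun _ => 0) P) =
        eval (elim x t) P - eval (elim x 0) P := fun x t => by
      rw [map_sub, eval_aeval_eq]
      congr 3
      ext (i | i) <;> simp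
    refine ⟨_, fun x => (hev x 0).trans (sub_self _), fun x hx t => (hev x t).trans ?_,
      fun x hx t ht => ?_⟩
    · rw [hP1 x hx, hP1 x hx, sub_self]
    · rw [hev]
      have h1 := hP2 x hx t ht
      have h2 := hP2 x hx 0 (zero_mem_unitCube n)
      have h3 : toCx (0 : Fin n → ℝ) = 0 := by ext; simp [toCx]
      rw [h0 x hx, h3, zero_sub, norm_neg] at h2
      have := norm_add_le (h t x - eval (elim x (toCx t)) P)
        (eval (elim x 0) P)
      rw [sub_add] at this
      linarith
  have hcomp : IsCompact (unitCube n ×ˢ K) := (isCompact_unitCube n).prod hK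
  obtain ⟨δ, hδ, huc⟩ := Metric.uniformContinuousOn_iff.1
    (hcomp.uniformContinuousOn_of_continuous hc) (ε / 6) (by positivity)
  obtain ⟨B, hB⟩ := hcomp.exists_bound_of_continuousOn hc
  obtain ⟨T, hTC, hTcov⟩ := (isCompact_unitCube n).elim_nhds_subcover
    (fun t => ball t δ) fun t _ => Metric.ball_mem_nhds t hδ
  let b : (Fin n → ℝ) → (Fin n → ℝ) → ℝ := fun s t => max 0 (δ - dist t s)
  have hb0 : ∀ s t, 0 ≤ b s t := fun s t => le_max_left _ _
  have hbc : ∀ s, Continuous (b s) := fun s => by fun_prop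
  have hbs : ∀ t ∈ unitCube n, 0 < ∑ s ∈ T, b s t := fun t ht => by
    obtain ⟨s, hs, hst⟩ := mem_iUnion₂.1 (hTcov ht)
    exact Finset.sum_pos' (fun s _ => hb0 s t) ⟨s, hs, lt_max_of_lt_right (by simpa using hst)⟩
  let χ : (Fin n → ℝ) → (Fin n → ℝ) → ℝ := fun s t => b s t / ∑ s ∈ T, b s t
  have hχc : ∀ s, ContinuousOn (χ s) (unitCube n) := fun s =>
    (hbc s).continuousOn.div (continuous_finsetSum _ fun s _ => hbc s).continuousOn
      fun t ht => (hbs t ht).ne'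
  have hχ0 : ∀ s, ∀ t ∈ unitCube n, 0 ≤ χ s t := fun s t ht => div_nonneg (hb0 s t) (hbs t ht).le
  have hχs : ∀ t ∈ unitCube n, ∑ s ∈ T, χ s t = 1 := fun t ht => by
    rw [← Finset.sum_div, div_self (hbs t ht).ne']
  have hχd : ∀ s t, χ s t ≠ 0 → dist t s < δ := fun s t hst => by
    by_contra hd
    exact hst (by simp only [χ, b]; rw [max_eq_left (by linarith), zero_div])
  set L : ℝ := T.card + 1 with hL
  have hL0 : 0 < L := by positivity
  choose! p hp1 hp2 using fun s (hs : s ∈ unitCube n) => exists_poly_approx hS hS' hSS hK hKc hKS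
    (hh s hs) (hS0 s hs) (ε := ε / 6) (by positivity)
  choose q hq using fun s => exists_poly_weierstrass (isCompact_unitCube n) (hχc s)
    (ε := ε / 6 / (L * (|B| + ε))) (by positivity)
  refine ⟨∑ s ∈ T, rename inl (p s) * rename inr (q s),
    fun x hx t => ?_, fun x hx t ht => ?_⟩
  · rw [map_sum]
    refine sum_eq_zero fun s hs => ?_
    rw [map_mul, eval_rename, Sum.elim_comp_inl, mem_vanIdl.1 (hp1 s (hTC s hs)) x hx,
      zero_mul]
  · simp only [map_sum, map_mul, eval_rename, Sum.elim_comp_inl, Sum.elim_comp_inr]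
    have e1 : h t x - ∑ s ∈ T, eval x (p s) * eval (toCx t) (q s) =
        ∑ s ∈ T, ((χ s t : ℂ) * (h t x - h s x) + (χ s t : ℂ) * (h s x - eval x (p s))
          + ((χ s t : ℂ) - eval (toCx t) (q s)) * eval x (p s)) := by
      have : h t x = ∑ s ∈ T, (χ s t : ℂ) * h t x := by
        rw [← sum_mul, ← Complex.ofReal_sum, hχs t ht]
        simp
      rw [this, ← sum_sub_distrib]
      refine sum_congr rfl fun s _ => ?_
      rw [← this]
      ring
    rw [e1]
    refine (norm_sum_le_of_le _ (n := fun s => χ s t * (ε / 6) + χ s t * (ε / 6) +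
      ε / 6 / (L * (|B| + ε)) * (|B| + ε)) fun s hs => ?_).trans_lt ?_
    · have hsC := hTC s hs
      have hχn : ‖(χ s t : ℂ)‖ = χ s t := by
        rw [norm_real, norm_of_nonneg (hχ0 s t ht)]
      have hps := hp2 s hsC x hx
      refine (norm_add_le _ _).trans (add_le_add ((norm_add_le _ _).trans (add_le_add ?_ ?_)) ?_)
      · rw [norm_mul, hχn]
        by_cases hz : χ s t = 0
        · simp [hz]
        · refine mul_le_mul_of_nonneg_left ?_ (hχ0 s t ht)
          have := huc (t, x) ⟨ht, hx⟩ (s, x) ⟨hsC, hx⟩ (by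
            rw [Prod.dist_eq]
            rw [dist_self, max_eq_left dist_nonneg]
            exact hχd s t hz)
          rw [dist_eq_norm] at this
          exact this.le
      · rw [norm_mul, hχn]
        exact mul_le_mul_of_nonneg_left hps.le (hχ0 s t ht)
      · rw [norm_mul]
        refine mul_le_mul (hq s t ht).le ?_ (norm_nonneg _) (by positivity)
        have h1 := hB (s, x) ⟨hsC, hx⟩
        rw [norm_sub_rev] at hps
        have h2 := norm_sub_norm_le (eval x (p s)) (h s x)
        change ‖h s x‖ ≤ B at h1
        linarith [le_abs_self B]
    · rw [sum_add_distrib, sum_add_distrib, ← sum_mul, hχs t ht]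
      simp only [sum_const, nsmul_eq_mul]
      have : (T.card : ℝ) * (ε / 6 / (L * (|B| + ε)) * (|B| + ε)) = ε / 6 * (T.card / L) := by
        field_simp
      rw [this]
      have : (T.card : ℝ) / L < 1 := by rw [div_lt_one hL0, hL]; linarith
      nlinarith

end Approximation

section EulerScheme

/-- The polynomial map with given components. -/
def evalMap {α τ : Type*} (F : τ → MvPolynomial α ℂ) (z : α → ℂ) : τ → ℂ :=
  fun b => eval z (F b)

theorem continuous_evalMap {α τ : Type*} (F : τ → MvPolynomial α ℂ) : Continuous (evalMap F) :=
  continuous_pi fun b => continuous_eval (F b)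

theorem evalMap_aeval {α β τ : Type*} (F : τ → MvPolynomial β ℂ) (G : β → MvPolynomial α ℂ)
    (z : α → ℂ) :
    evalMap (fun b => aeval G (F b)) z = evalMap F (evalMap G z) :=
  funext fun _ => eval_aeval_eq _ _ _

theorem continuous_sumElim_apply {A α β : Type*} [TopologicalSpace A] {f : A → α → ℂ} {g : A → β → ℂ}
    (hf : Continuous f) (hg : Continuous g) : Continuous fun a => elim (f a) (g a) :=
  continuous_pi fun i => i.casesOn (fun i => (continuous_apply i).comp hf)
    fun i => (continuous_apply i).comp hg

theorem ContinuousOn.sumElim {A α β : Type*} [TopologicalSpace A] {f : A → α → ℂ} {g : A → β → ℂ}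
    {s : Set A} (hf : ContinuousOn f s) (hg : ContinuousOn g s) :
    ContinuousOn (fun a => elim (f a) (g a)) s :=
  continuousOn_pi.2 fun i => i.casesOn (fun i => (continuous_apply i).comp_continuousOn hf)
    fun i => (continuous_apply i).comp_continuousOn hg

variable {M n : ℕ} {S S' K : Set ℂ^M}

theorem HolOnS.eval {β : Type*} {p : ℂ^M} {h : ℂ^M → β → ℂ}
    (hh : ∀ i, HolOnS S p fun z => h z i) (P : MvPolynomial β ℂ) :
    HolOnS S p fun z => eval (h z) P := by
  induction P using MvPolynomial.induction_on with
  | C a => simpa using holOnS_const a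
  | add p q hp hq => simpa using hp.fun_add hq
  | mul_X p i hp => simpa using hp.fun_mul (hh i)

theorem holOnS_apply {p : ℂ^M} (i : Fin M) : HolOnS S p fun z => z i := by
  simpa using (holAt_eval p (X i)).holOnS

/-- Approximation of a homotopy with values in an affine variety with an algebraic spray. -/
theorem exists_poly_of_spray {τ ρ : Type*} [Fintype τ] [Fintype ρ] {X : Set (τ → ℂ)}
    (hXc : IsClosed X) (σ : τ → MvPolynomial (τ ⊕ ρ) ℂ) (w : ρ → MvPolynomial (τ ⊕ τ) ℂ)
    (hσX : ∀ y ∈ X, ∀ v, evalMap σ (elim y v) ∈ X)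
    (hσ0 : ∀ y ∈ X, evalMap σ (elim y 0) = y)
    (hw : ∀ y ∈ X, evalMap w (elim y y) = 0)
    (hstar : ∀ C ⊆ X, IsCompact C → ∃ δ > 0, ∀ y ∈ C, ∀ y' ∈ C, dist y y' < δ →
      dist (evalMap σ (elim y (evalMap w (elim y y')))) y' ≤ dist y y' / 4)
    (hS : IsAffineVariety S) (hS' : IsAffineVariety S')
    (hSS : S' ⊆ S) (hK : IsCompact K) (hKc : PolyConvex K) (hKS : K ⊆ S)
    (f : τ → ℂ[M]) (hfX : ∀ x ∈ S, evalMap f x ∈ X)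
    (g : (Fin n → ℝ) → ℂ^M → τ → ℂ)
    (hgc : ContinuousOn (fun q : (Fin n → ℝ) × ℂ^M => g q.1 q.2) (unitCube n ×ˢ K))
    (hgh : ∀ t ∈ unitCube n, ∀ p ∈ K, ∀ b, HolOnS S p fun z => g t z b)
    (hgX : ∀ t ∈ unitCube n, ∀ x ∈ K, g t x ∈ X)
    (hg0 : ∀ x ∈ K, g 0 x = evalMap f x)
    (hgS : ∀ t ∈ unitCube n, ∀ᶠ z in 𝓝ˢ K, z ∈ S' → g t z = evalMap f z) {ε : ℝ} (hε : 0 < ε) :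
    ∃ F : τ → (MvPolynomial (Fin M ⊕ Fin n) ℂ), (∀ x ∈ S, ∀ t, evalMap F (elim x t) ∈ X) ∧
      (∀ x ∈ S, evalMap F (elim x 0) = evalMap f x) ∧
      (∀ x ∈ S', ∀ t, evalMap F (elim x t) = evalMap f x) ∧
      ∀ x ∈ K, ∀ t ∈ unitCube n, dist (evalMap F (elim x (toCx t))) (g t x) ≤ ε := by
  have hcomp : IsCompact (unitCube n ×ˢ K) := (isCompact_unitCube n).prod hK
  set C : Set (τ → ℂ) := Metric.cthickening 1
    ((fun q : (Fin n → ℝ) × ℂ^M => g q.1 q.2) '' (unitCube n ×ˢ K)) ∩ X with hCdef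
  have hC : IsCompact C := ((hcomp.image_of_continuousOn hgc).cthickening).inter_right hXc
  obtain ⟨η, hη, hst⟩ := hstar C inter_subset_right hC
  set δ := min (η / 3) (min (1 / 2) ε) with hδ
  have hδ0 : 0 < δ := by positivity
  have hδη : 2 * δ < η := by
    have := min_le_left (η / 3) (min (1 / 2) ε)
    linarith
  have hδ1 : 2 * δ ≤ 1 := by
    have := (min_le_right (η / 3) (min (1 / 2) ε)).trans (min_le_left _ _)
    linarith
  have hδε : δ ≤ ε := (min_le_right (η / 3) (min (1 / 2) ε)).trans (min_le_right _ _)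
  obtain ⟨γ, hγ, huc⟩ := Metric.uniformContinuousOn_iff.1
    (hcomp.uniformContinuousOn_of_continuous hgc) δ hδ0
  obtain ⟨m, hm⟩ := exists_nat_gt (1 / γ)
  have hm0 : (0 : ℝ) < m := (by positivity : (0 : ℝ) < 1 / γ).trans hm
  have hcube : ∀ j ≤ m, ∀ t ∈ unitCube n, ((j : ℝ) / m) • t ∈ unitCube n := fun j hj t ht =>
    smul_mem_unitCube ht (by positivity) (by
      rw [div_le_one hm0]
      exact_mod_cast hj)
  have key : ∀ j ≤ m, ∃ F : τ → (MvPolynomial (Fin M ⊕ Fin n) ℂ),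
      (∀ x ∈ S, ∀ t, evalMap F (elim x t) ∈ X) ∧
      (∀ x ∈ S, evalMap F (elim x 0) = evalMap f x) ∧
      (∀ x ∈ S', ∀ t, evalMap F (elim x t) = evalMap f x) ∧
      ∀ x ∈ K, ∀ t ∈ unitCube n,
        dist (evalMap F (elim x (toCx t))) (g (((j : ℝ) / m) • t) x) ≤ δ := by
    intro j
    induction j with
    | zero =>
      intro _
      have hF : ∀ (x : ℂ^M) (t : ℂ^n),
          evalMap (fun b => rename inl (f b)) (elim x t) = evalMap f x :=
        fun x t => funext fun b => by
          simp only [evalMap, eval_rename, Sum.elim_comp_inl]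
      refine ⟨fun b => rename inl (f b), fun x hx t => ?_, fun x _ => hF _ _,
        fun x _ t => hF _ _, fun x hx t ht => ?_⟩
      · rw [hF]
        exact hfX x hx
      · rw [hF]
        simp [hg0 x hx, hδ0.le]
    | succ j ih =>
      intro hj
      obtain ⟨F, hF1, hF2, hF3, hF4⟩ := ih (by omega)
      set u : (Fin n → ℝ) → ℂ^M → ρ → ℂ := fun t x =>
        evalMap w (elim (evalMap F (elim x (toCx t))) (g (((j + 1 : ℕ) / m : ℝ) • t) x))
        with hu
      have hcF : Continuous fun q : (Fin n → ℝ) × ℂ^M =>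
          evalMap F (elim q.2 (toCx q.1)) := (continuous_evalMap F).comp
        (continuous_sumElim_apply continuous_snd (continuous_toCx.comp continuous_fst))
      have hcg : ContinuousOn (fun q : (Fin n → ℝ) × ℂ^M =>
          g (((j + 1 : ℕ) / m : ℝ) • q.1) q.2) (unitCube n ×ˢ K) :=
        hgc.comp (f := fun q : (Fin n → ℝ) × ℂ^M => ((((j + 1 : ℕ) / m : ℝ) • q.1), q.2))
          (by fun_prop) fun q hq => ⟨hcube _ hj _ hq.1, hq.2⟩
      have huc' : ContinuousOn (fun q : (Fin n → ℝ) × ℂ^M => u q.1 q.2)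
          (unitCube n ×ˢ K) :=
        (continuous_evalMap w).comp_continuousOn (hcF.continuousOn.sumElim hcg)
      set C₂ := (fun q : (Fin n → ℝ) × ℂ^M =>
        ((elim (evalMap F (elim q.2 (toCx q.1))) (u q.1 q.2) : τ ⊕ ρ → ℂ))) ''
          (unitCube n ×ˢ K)
      have hC₂ : IsCompact C₂ := hcomp.image_of_continuousOn (hcF.continuousOn.sumElim huc')
      obtain ⟨κ, hκ, hunif⟩ := Metric.mem_uniformity_dist.1
        (hC₂.uniformContinuousAt_of_continuousAt (evalMap σ)
          (fun a _ => (continuous_evalMap σ).continuousAt) (Metric.dist_mem_uniformity (half_pos hδ0)))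
      have happ : ∀ b, ∃ P : (MvPolynomial (Fin M ⊕ Fin n) ℂ),
          (∀ x, eval (elim x 0) P = 0) ∧
          (∀ x ∈ S', ∀ t, eval (elim x t) P = 0) ∧
          ∀ x ∈ K, ∀ t ∈ unitCube n,
            ‖u t x b - eval (elim x (toCx t)) P‖ < κ / 2 := fun b => by
        refine exists_poly_approx_family hS hS' hSS hK hKc hKS (h := fun t x => u t x b)
          ((continuous_apply b).comp_continuousOn huc') (fun t ht p hp => ?_) (fun x hx => ?_)
          (fun t ht => ?_) (half_pos hκ)
        · refine HolOnS.eval (fun i => i.casesOn (fun i => ?_) fun i => ?_) (w b)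
          · refine HolOnS.eval (fun i => i.casesOn (fun i => ?_) fun i => ?_) (F i)
            · exact holOnS_apply i
            · exact holOnS_const _
          · exact hgh _ (hcube _ hj t ht) p hp i
        · have h3 : toCx (0 : Fin n → ℝ) = 0 := by ext; simp [toCx]
          have : u 0 x = 0 := by
            simp only [hu, smul_zero, h3, hg0 x hx, hF2 x (hKS hx)]
            exact hw _ (hfX x (hKS hx))
          exact congrFun this b
        · filter_upwards [hgS _ (hcube _ hj t ht)] with z hz hzS
          have : u t z = 0 := by
            simp only [hu, hF3 z hzS, hz hzS]
            exact hw _ (hfX z (hSS hzS))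
          exact congrFun this b
      choose p hp1 hp2 hp3 using happ
      have hG : ∀ x t, evalMap (fun b => aeval (elim F p) (σ b)) (elim x t) =
          evalMap σ (elim (evalMap F (elim x t)) (evalMap p (elim x t))) :=
        fun x t => by
          rw [evalMap_aeval]
          congr 1
          ext (i | i) <;> rfl
      refine ⟨fun b => aeval (elim F p) (σ b), fun x hx t => ?_, fun x hx => ?_,
        fun x hx t => ?_, fun x hx t ht => ?_⟩
      · rw [hG]
        exact hσX _ (hF1 x hx t) _
      · rw [hG, hF2 x hx, show evalMap p (elim x 0) = 0 from funext fun b => hp1 b x]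
        exact hσ0 _ (hfX x hx)
      · rw [hG, hF3 x hx, show evalMap p (elim x t) = 0 from funext fun b => hp2 b x hx t]
        exact hσ0 _ (hfX x (hSS hx))
      · rw [hG]
        set y := evalMap F (elim x (toCx t))
        set y' := g (((j + 1 : ℕ) / m : ℝ) • t) x with hy'
        have hq : (t, x) ∈ unitCube n ×ˢ K := ⟨ht, hx⟩
        have d1 : dist y (g ((j / m : ℝ) • t) x) ≤ δ := hF4 x hx t ht
        have d2 : dist (g ((j / m : ℝ) • t) x) y' < δ := by
          refine huc (_, x) ⟨hcube j (by omega) t ht, hx⟩ (_, x) ⟨hcube _ hj t ht, hx⟩ ?_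
          rw [Prod.dist_eq, dist_self, max_eq_left dist_nonneg, dist_eq_norm, ← sub_smul,
            norm_smul, ← sub_div]
          have e1 : ‖((j : ℝ) - (j + 1 : ℕ)) / m‖ = 1 / m := by
            rw [Nat.cast_succ, norm_div]
            simp
          rw [e1]
          have e2 : ‖t‖ ≤ 1 := (pi_norm_le_iff_of_nonneg zero_le_one).2 fun i => by
            rw [norm_of_nonneg (ht i).1]
            exact (ht i).2
          calc 1 / (m : ℝ) * ‖t‖ ≤ 1 / m := mul_le_of_le_one_right (by positivity) e2
            _ < γ := (one_div_lt hγ hm0).1 hm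
        have hy2 : dist y y' ≤ 2 * δ := (dist_triangle _ _ _).trans (by linarith)
        have hyC : y ∈ C := ⟨Metric.mem_cthickening_of_dist_le _ (g ((j / m : ℝ) • t) x) _ _
          ⟨(_, x), ⟨hcube j (by omega) t ht, hx⟩, rfl⟩ (d1.trans (by linarith)),
          hF1 x (hKS hx) _⟩
        have hyC' : y' ∈ C := ⟨Metric.self_subset_cthickening _
          ⟨(_, x), ⟨hcube _ hj t ht, hx⟩, rfl⟩, hgX _ (hcube _ hj t ht) x hx⟩
        have d3 := hst y hyC y' hyC' (hy2.trans_lt hδη)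
        have d4 : dist (evalMap σ (elim y (u t x)))
            (evalMap σ (elim y (evalMap p (elim x (toCx t))))) < δ / 2 := by
          refine hunif (a := elim y (u t x)) ?_ ⟨(t, x), hq, rfl⟩
          rw [dist_pi_lt_iff hκ]
          rintro (i | i)
          · simpa using hκ
          · rw [dist_eq_norm]
            exact (hp3 i x hx t ht).trans (half_lt_self hκ)
        have d5 := dist_triangle_left (evalMap σ (elim y (evalMap p (elim x (toCx t))))) y'
          (evalMap σ (elim y (u t x)))
        change dist (evalMap σ (elim y (u t x))) y' ≤ _ at d3
        linarith
  obtain ⟨F, hF1, hF2, hF3, hF4⟩ := key m le_rfl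
  refine ⟨F, hF1, hF2, hF3, fun x hx t ht => ?_⟩
  have := hF4 x hx t ht
  rw [div_self hm0.ne', one_smul] at this
  exact this.trans hδε

end EulerScheme

/-- Polynomial functions on the affine space `ℂ^α`. -/
def PolyFun {α : Type*} (F : (α → ℂ) → ℂ) : Prop :=
  ∃ P : MvPolynomial α ℂ, ∀ z, F z = MvPolynomial.eval z P

namespace PolyFun

variable {α β ι : Type*} {F G : (α → ℂ) → ℂ}

theorem eval (P : MvPolynomial α ℂ) : PolyFun fun z => MvPolynomial.eval z P := ⟨P, fun _ => rfl⟩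

theorem const (c : ℂ) : PolyFun fun _ : α → ℂ => c := ⟨C c, by simp⟩

theorem coord (i : α) : PolyFun fun z : α → ℂ => z i := ⟨X i, by simp⟩

theorem add (hF : PolyFun F) (hG : PolyFun G) : PolyFun fun z => F z + G z := by
  obtain ⟨P, hP⟩ := hF
  obtain ⟨Q, hQ⟩ := hG
  exact ⟨P + Q, by simp [hP, hQ]⟩

theorem mul (hF : PolyFun F) (hG : PolyFun G) : PolyFun fun z => F z * G z := by
  obtain ⟨P, hP⟩ := hF
  obtain ⟨Q, hQ⟩ := hG
  exact ⟨P * Q, by simp [hP, hQ]⟩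

theorem sub (hF : PolyFun F) (hG : PolyFun G) : PolyFun fun z => F z - G z := by
  obtain ⟨P, hP⟩ := hF
  obtain ⟨Q, hQ⟩ := hG
  exact ⟨P - Q, by simp [hP, hQ]⟩

theorem sum {H : ι → (α → ℂ) → ℂ} (s : Finset ι) (h : ∀ i ∈ s, PolyFun (H i)) :
    PolyFun fun z => ∑ i ∈ s, H i z := by
  classical
  induction s using Finset.induction_on with
  | empty => simpa using const 0
  | insert a s ha ih =>
    simp only [sum_insert ha]
    exact (h a (s.mem_insert_self a)).add (ih fun i hi => h i (Finset.mem_insert_of_mem hi))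

theorem prod {H : ι → (α → ℂ) → ℂ} (s : Finset ι) (h : ∀ i ∈ s, PolyFun (H i)) :
    PolyFun fun z => ∏ i ∈ s, H i z := by
  classical
  induction s using Finset.induction_on with
  | empty => simpa using const 1
  | insert a s ha ih =>
    simp only [Finset.prod_insert ha]
    exact (h a (s.mem_insert_self a)).mul (ih fun i hi => h i (Finset.mem_insert_of_mem hi))

theorem pow (hF : PolyFun F) (k : ℕ) : PolyFun fun z => F z ^ k := by
  obtain ⟨P, hP⟩ := hF
  exact ⟨P ^ k, by simp [hP]⟩

theorem comp {F : (β → ℂ) → ℂ} (hF : PolyFun F) {G : (α → ℂ) → β → ℂ}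
    (hG : ∀ b, PolyFun fun z => G z b) : PolyFun fun z => F (G z) := by
  obtain ⟨P, hP⟩ := hF
  choose Q hQ using hG
  refine ⟨aeval Q P, fun z => ?_⟩
  change F (G z) = _
  rw [hP, eval_aeval_eq]
  congr 1
  exact congrArg _ (funext fun b => hQ b z)

theorem continuous (hF : PolyFun F) : Continuous F := by
  obtain ⟨P, hP⟩ := hF
  rw [show F = fun z => MvPolynomial.eval z P from funext hP]
  exact continuous_eval P

/-- First-order expansion of a polynomial in a group of its variables. -/
theorem exists_expansion [Fintype β] {F : (α ⊕ β → ℂ) → ℂ} (hF : PolyFun F) :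
    ∃ B : β → (α ⊕ β → ℂ) → ℂ, (∀ r, PolyFun (B r)) ∧
      ∀ y v, F (elim y v) = F (elim y 0) + ∑ r, v r * B r (elim y v) := by
  classical
  obtain ⟨P, hP⟩ := hF
  obtain rfl : F = fun z => MvPolynomial.eval z P := funext hP
  clear hP
  induction P using MvPolynomial.induction_on with
  | C a => exact ⟨fun _ _ => 0, fun _ => const 0, by simp⟩
  | add p q hp hq =>
    obtain ⟨B, hB, h1⟩ := hp
    obtain ⟨B', hB', h2⟩ := hq
    refine ⟨fun r z => B r z + B' r z, fun r => (hB r).add (hB' r), fun y v => ?_⟩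
    simp only [map_add, h1 y v, h2 y v, mul_add, sum_add_distrib]
    ring
  | mul_X p i hp =>
    obtain ⟨B, hB, h1⟩ := hp
    cases i with
    | inl i =>
      refine ⟨fun r z => B r z * z (inl i), fun r => (hB r).mul (coord _), fun y v => ?_⟩
      simp only [map_mul, eval_X, elim_inl, h1 y v, add_mul, sum_mul,
        mul_assoc]
    | inr i =>
      refine ⟨fun r z => if r = i then MvPolynomial.eval z p else 0, fun r => ?_, fun y v => ?_⟩
      · by_cases h : r = i <;> simp only [h, if_true, if_false]
        exacts [eval p, const 0]
      · simp [mul_comm]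

end PolyFun

variable {α β ι : Type*}

theorem evalMap_polyFun (F : β → MvPolynomial α ℂ) (b : β) : PolyFun fun z => evalMap F z b :=
  .eval _

theorem exists_evalMap_eq {G : (α → ℂ) → β → ℂ} (hG : ∀ b, PolyFun fun z => G z b) :
    ∃ F : β → MvPolynomial α ℂ, ∀ z, evalMap F z = G z := by
  choose F hF using hG
  exact ⟨F, fun z => funext fun b => (hF b z).symm⟩

theorem isAffineVariety_of_polyFun [Finite α] {F : ι → (α → ℂ) → ℂ} (hF : ∀ i, PolyFun (F i)) :
    IsAffineVariety {z | ∀ i, F i z = 0} := by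
  choose P hP using hF
  obtain ⟨s, hs⟩ := (isNoetherianRing_iff_ideal_fg (MvPolynomial α ℂ)).1 inferInstance
    (span (range P))
  have hz : ∀ (t : Set (MvPolynomial α ℂ)) (z : α → ℂ),
      (∀ p ∈ t, eval z p = 0) ↔ span t ≤ ker (eval z) :=
    fun t z => (Ideal.span_le (I := ker (eval z))).symm
  refine ⟨s, ext fun z => ?_⟩
  change (∀ i, F i z = 0) ↔ ∀ p ∈ (s : Set (MvPolynomial α ℂ)), eval z p = 0
  rw [hz, hs, ← hz, forall_mem_range]
  simp only [hP]

theorem IsAffineVariety.exists_polyFun {S : Set (α → ℂ)} (hS : IsAffineVariety S) :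
    ∃ (s : Finset (MvPolynomial α ℂ)) (F : s → (α → ℂ) → ℂ), (∀ i, PolyFun (F i)) ∧
      S = {z | ∀ i, F i z = 0} := by
  obtain ⟨s, rfl⟩ := hS
  exact ⟨s, fun P z => eval z P.1, fun P => .eval _, ext fun z =>
    ⟨fun h P => h P.1 P.2, fun h P hP => h ⟨P, hP⟩⟩⟩

theorem IsAffineVariety.preimage [Finite β] {S : Set (α → ℂ)} (hS : IsAffineVariety S)
    {G : (β → ℂ) → α → ℂ} (hG : ∀ a, PolyFun fun z => G z a) : IsAffineVariety (G ⁻¹' S) := by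
  obtain ⟨s, F, hF, rfl⟩ := hS.exists_polyFun
  exact isAffineVariety_of_polyFun fun i => (hF i).comp hG

theorem IsAffineVariety.inter [Finite α] {S T : Set (α → ℂ)} (hS : IsAffineVariety S)
    (hT : IsAffineVariety T) : IsAffineVariety (S ∩ T) := by
  classical
  obtain ⟨s, rfl⟩ := hS
  obtain ⟨t, rfl⟩ := hT
  refine ⟨s ∪ t, ext fun z => ⟨fun h P hP => ?_, fun h => ⟨fun P hP => ?_, fun P hP => ?_⟩⟩⟩
  · rcases Finset.mem_union.1 (Finset.mem_coe.1 hP) with h1 | h1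
    exacts [h.1 P h1, h.2 P h1]
  · exact h P (by simp [Finset.mem_coe.1 hP])
  · exact h P (by simp [Finset.mem_coe.1 hP])

/-- Polynomials without common zeros on an affine variety generate the unit ideal. -/
theorem IsAffineVariety.exists_partition [Finite α] {S : Set (α → ℂ)} (hS : IsAffineVariety S)
    {F : ι → (α → ℂ) → ℂ} (hF : ∀ i, PolyFun (F i)) (h0 : ∀ z ∈ S, ∃ i, F i z ≠ 0) :
    ∃ (t : Finset ι) (a : ι → (α → ℂ) → ℂ), (∀ i, PolyFun (a i)) ∧
      ∀ z ∈ S, ∑ i ∈ t, a i z * F i z = 1 := by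
  obtain ⟨s, rfl⟩ := hS
  choose P hP using hF
  have h1 : span (s : Set (MvPolynomial α ℂ)) ⊔ span (range P) = ⊤ := by
    rw [← Ideal.radical_eq_top, ← MvPolynomial.vanishingIdeal_zeroLocus_eq_radical (K := ℂ),
      ← Ideal.span_union, MvPolynomial.zeroLocus_span]
    convert MvPolynomial.vanishingIdeal_empty
    rw [eq_empty_iff_forall_notMem]
    intro z hz
    obtain ⟨i, hi⟩ := h0 z fun p hp => by
      simpa [aeval_eq_eval] using hz p (Or.inl hp)
    exact hi (by simpa [aeval_eq_eval, hP] using hz (P i) (Or.inr ⟨i, rfl⟩))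
  obtain ⟨a, ha, b, hb, hab⟩ := mem_sup.1 ((Ideal.eq_top_iff_one _).1 h1)
  obtain ⟨c, hc⟩ := (Finsupp.mem_ideal_span_range_iff_exists_finsupp).1 hb
  refine ⟨c.support, fun i z => eval z (c i), fun i => .eval _, fun z hz => ?_⟩
  have h2 : eval z a = 0 :=
    (Ideal.span_le (I := ker (eval z))).2 (fun p hp => hz p hp) ha
  have h3 := congrArg (eval z) hab
  rw [map_add, h2, zero_add, map_one, ← hc] at h3
  simpa [Finsupp.sum, hP] using h3

/-- The index set of the tensors used in the affine bundle over a quasi-projective variety. -/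
abbrev TIdx (N m D : ℕ) := (Fin (D + 1) → Fin (N + 1)) × Fin m

/-- The tensors with values in `ℂᵐ`. -/
abbrev Tens (N m D : ℕ) := TIdx N m D → ℂ

/-- The maps to tensors depending on a tensor and a parameter indexed by `ρ`. -/
abbrev HSpr (N m D : ℕ) (ρ : Type*) := (TIdx N m D ⊕ ρ → ℂ) → Tens N m D

/-- The families of coefficients of `m` forms of degree `D + 1` in `N + 1` variables. -/
abbrev Forms (N m D : ℕ) := Fin m → (Fin (D + 1) → Fin (N + 1)) → ℂ

section Tensor

variable {N m D : ℕ}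

/-- The monomial `∏ i, v (α i)`. -/
def mono {κ : Type*} (v : κ → ℂ) (α : Fin (D + 1) → κ) : ℂ := ∏ i, v (α i)

/-- The tensor `v ⊗ ⋯ ⊗ v ⊗ c`. -/
def tens (v : ℂ^(N + 1)) (c : ℂ^m) (a : TIdx N m D) : ℂ := mono v a.1 * c a.2

/-- The forms with coefficients `z`. -/
def zform (z : Forms N m D) (k : Fin m) (v : ℂ^(N + 1)) : ℂ := ∑ α, z k α * mono v α

/-- The linear functional on tensors with coefficients `z`. -/
def lam (z : Forms N m D) (T : Tens N m D) : ℂ :=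
  ∑ k, ∑ α, z k α * T (α, k)

/-- The action of a matrix on all but the last tensor factor. -/
def ten (Q : Matrix (Fin (N + 1)) (Fin (N + 1)) ℂ) (T : Tens N m D) (a : TIdx N m D) : ℂ :=
  ∑ β : Fin (D + 1) → Fin (N + 1), (∏ i, Q (a.1 i) (β i)) * T (β, a.2)

/-- The partial contraction of a tensor with `z`. -/
def pr (z : Forms N m D) (T : Tens N m D) : Matrix (Fin (N + 1)) (Fin (N + 1)) ℂ :=
  fun i j => ∑ k, ∑ α : Fin (D + 1) → Fin (N + 1),
    if α 0 = j then z k α * T (update α 0 i, k) else 0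

variable {z : Forms N m D} {T T' : Tens N m D} {Q : Matrix (Fin (N + 1)) (Fin (N + 1)) ℂ}
  {v v' φ : ℂ^(N + 1)} {c c' : ℂ^m}

theorem mono_smul (a : ℂ) (α : Fin (D + 1) → Fin (N + 1)) : mono (a • v) α = a ^ (D + 1) * mono v α := by
  simp [mono, prod_mul_distrib]

theorem sum_mono_prod (φ ψ : ℂ^(N + 1)) :
    ∑ β : Fin (D + 1) → Fin (N + 1), mono φ β * mono ψ β = (φ ⬝ᵥ ψ) ^ (D + 1) := by
  simp only [mono, ← prod_mul_distrib, dotProduct]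
  rw [← Fintype.piFinset_univ, ← Finset.prod_univ_sum (fun _ : Fin (D + 1) => Finset.univ)
    fun _ j => φ j * ψ j]
  simp

theorem ten_tens : ten Q (tens (D := D) v c) = tens (Q.mulVec v) c := by
  funext a
  simp only [ten, tens, ← mul_assoc, ← sum_mul, mono, ← prod_mul_distrib]
  congr 1
  rw [← Fintype.piFinset_univ, ← Finset.prod_univ_sum (fun _ : Fin (D + 1) => Finset.univ)
    fun i j => Q (a.1 i) j * v j]
  rfl

theorem ten_vecMulVec : ten (vecMulVec v φ) T
    = tens v fun k => ∑ β : Fin (D + 1) → Fin (N + 1), mono φ β * T (β, k) := by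
  funext a
  simp only [ten, tens, vecMulVec_apply, prod_mul_distrib, mul_sum, mono,
    mul_assoc]

theorem lam_tens : lam z (tens v c) = ∑ k, c k * zform z k v := by
  simp only [lam, tens, zform, mul_sum]
  exact sum_congr rfl fun k _ => sum_congr rfl fun α _ => by ring

theorem tens_smul (a : ℂ) : tens (D := D) (a • v) c = tens v (a ^ (D + 1) • c) := by
  funext x
  simp only [tens, mono_smul, Pi.smul_apply, smul_eq_mul]
  ring

theorem tens_smul_right (a : ℂ) : tens (D := D) v (a • c) = a • tens v c := by
  funext x
  simp only [tens, Pi.smul_apply, smul_eq_mul]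
  ring

theorem tens_add : tens (D := D) v (c + c') = tens v c + tens v c' := by
  funext x
  simp only [tens, Pi.add_apply, mul_add]

theorem lam_add : lam z (T + T') = lam z T + lam z T' := by
  simp [lam, mul_add, sum_add_distrib]

theorem lam_smul (a : ℂ) : lam z (a • T) = a * lam z T := by
  simp only [lam, Pi.smul_apply, smul_eq_mul, mul_sum]
  exact sum_congr rfl fun k _ => sum_congr rfl fun α _ => by ring

theorem lam_sub : lam z (T - T') = lam z T - lam z T' := by
  simp [lam, mul_sub, sum_sub_distrib]

theorem ten_add : ten Q (T + T') = ten Q T + ten Q T' := by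
  funext a
  simp [ten, mul_add, sum_add_distrib]

theorem ten_sub : ten Q (T - T') = ten Q T - ten Q T' := by
  funext a
  simp [ten, mul_sub, sum_sub_distrib]

theorem pr_add : pr z (T + T') = pr z T + pr z T' := by
  funext i j
  simp only [pr, Matrix.add_apply, Pi.add_apply, mul_add, ← sum_add_distrib]
  exact sum_congr rfl fun k _ => sum_congr rfl fun α _ => by split_ifs <;> simp

theorem pr_smul (a : ℂ) : pr z (a • T) = a • pr z T := by
  funext i j
  simp only [pr, Matrix.smul_apply, Pi.smul_apply, smul_eq_mul, mul_sum]
  exact sum_congr rfl fun k _ => sum_congr rfl fun α _ => by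
    split_ifs <;> ring

theorem trace_pr : (pr z T).trace = lam z T := by
  simp only [Matrix.trace, Matrix.diag, pr, lam]
  rw [sum_comm]
  refine sum_congr rfl fun k _ => ?_
  rw [sum_comm]
  refine sum_congr rfl fun α _ => ?_
  simp [Function.update_eq_self]

theorem exists_pr_tens : ∃ φ, pr z (tens (D := D) v c) = vecMulVec v φ ∧
    φ ⬝ᵥ v = lam z (tens v c) := by
  refine ⟨fun j => ∑ k, ∑ α : Fin (D + 1) → Fin (N + 1),
    if α 0 = j then z k α * (∏ i : Fin D, v (α i.succ)) * c k else 0, ?_, ?_⟩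
  · funext i j
    simp only [pr, vecMulVec_apply, mul_sum]
    refine sum_congr rfl fun k _ => sum_congr rfl fun α _ => ?_
    split_ifs with h
    · simp only [tens, mono, Fin.prod_univ_succ, Function.update_self, ne_eq, Fin.succ_ne_zero,
        not_false_eq_true, update_of_ne]
      ring
    · simp
  · simp only [dotProduct, lam, sum_mul]
    rw [sum_comm]
    refine sum_congr rfl fun k _ => ?_
    rw [sum_comm]
    refine sum_congr rfl fun α _ => ?_
    simp only [ite_mul, zero_mul, Finset.sum_ite_eq, Finset.mem_univ, if_true, tens, mono,
      Fin.prod_univ_succ]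
    ring

end Tensor

theorem exists_prod_eq_mono {κ : Type*} [DecidableEq κ] (s : κ →₀ ℕ) {n : ℕ}
    (hs : s.degree = n) :
    ∃ α : Fin n → κ, ∀ v : κ → ℂ, s.prod (fun i e => v i ^ e) = ∏ i, v (α i) := by
  subst hs
  have h1 : s.degree = s.toMultiset.toList.length := by
    rw [Multiset.length_toList, Finsupp.card_toMultiset]
    rfl
  rw [h1]
  refine ⟨fun i => s.toMultiset.toList.get i, fun v => ?_⟩
  have h2 : s.prod (fun i e => v i ^ e) = (s.toMultiset.map v).prod := by
    rw [Finsupp.toMultiset_map, Finsupp.prod_toMultiset, Finsupp.prod_mapDomain_index] <;>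
      simp [pow_add]
  rw [h2, ← Multiset.coe_toList s.toMultiset, Multiset.map_coe, Multiset.prod_coe,
    ← List.prod_ofFn]
  congr 1
  conv_lhs => rw [← List.ofFn_get s.toMultiset.toList]
  simp [List.map_ofFn, Function.comp_def]

theorem exists_zform {κ : Type*} [Fintype κ] [DecidableEq κ] {D : ℕ} {P : MvPolynomial κ ℂ}
    (hP : P.IsHomogeneous (D + 1)) :
    ∃ z : (Fin (D + 1) → κ) → ℂ, ∀ v, eval v P = ∑ α, z α * mono v α := by
  have h1 : ∀ s : P.support, ∃ α : Fin (D + 1) → κ,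
      ∀ v : κ → ℂ, s.1.prod (fun i e => v i ^ e) = mono v α := fun s =>
    exists_prod_eq_mono s.1 <| by
      exact (DFunLike.congr_fun Finsupp.degree_eq_weight_one s.1).trans
        (hP (mem_support_iff.1 s.2))
  choose a ha using h1
  refine ⟨fun α => ∑ s, if a s = α then P.coeff s.1 else 0, fun v => ?_⟩
  rw [eval_eq, ← Finset.sum_coe_sort]
  simp only [sum_mul, ite_mul, zero_mul]
  rw [sum_comm]
  refine sum_congr rfl fun s _ => ?_
  simp [← ha s v, Finsupp.prod]

theorem eval_isWeightedHomogeneous {σ : Type*} {P : MvPolynomial σ ℂ} {w : σ → ℕ} {d : ℕ}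
    (hP : P.IsWeightedHomogeneous w d) (a : ℂ) (z : σ → ℂ) :
    eval (fun i => a ^ w i * z i) P = a ^ d * eval z P := by
  rw [eval_eq, eval_eq, mul_sum]
  refine sum_congr rfl fun s hs => ?_
  have h1 := hP (mem_support_iff.1 hs)
  rw [← h1, Finsupp.weight_apply, Finsupp.sum]
  simp only [mul_pow, prod_mul_distrib, smul_eq_mul, ← pow_mul, prod_pow_eq_pow_sum]
  rw [sum_congr rfl fun i _ => mul_comm (w i) (s i)]
  ring

theorem eval_isHomogeneous {σ : Type*} {P : MvPolynomial σ ℂ} {d : ℕ} (hP : P.IsHomogeneous d)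
    (a : ℂ) (z : σ → ℂ) : eval (a • z) P = a ^ d * eval z P := by
  have h1 : (a • z : σ → ℂ) = fun i => a ^ (1 : σ → ℕ) i * z i := funext fun i => by simp
  rw [h1]
  exact eval_isWeightedHomogeneous hP a z

theorem exists_rep_eq {N : ℕ} {v : ℂ^(N + 1)} (hv : v ≠ 0) :
    ∃ a : ℂ, a ≠ 0 ∧ (mk ℂ v hv).rep = a • v := by
  obtain ⟨a, ha⟩ := Projectivization.exists_smul_eq_mk_rep ℂ v hv
  exact ⟨a, a.ne_zero, ha.symm⟩

theorem mk_eq_of_smul {N : ℕ} {v w : ℂ^(N + 1)} (hv : v ≠ 0) (hw : w ≠ 0) {a : ℂ}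
    (h : v = a • w) : mk ℂ v hv = mk ℂ w hw :=
  (Projectivization.mk_eq_mk_iff' ℂ _ _ hv hw).2 ⟨a, h.symm⟩

theorem mk_mem_projZeroLocus {N : ℕ} {s : Set ℂ[N + 1]}
    (hs : ∀ P ∈ s, ∃ d, P.IsHomogeneous d) {v : ℂ^(N + 1)} (hv : v ≠ 0) :
    mk ℂ v hv ∈ ProjZeroLocus s ↔ ∀ P ∈ s, eval v P = 0 := by
  obtain ⟨a, ha, h⟩ := exists_rep_eq hv
  refine forall₂_congr fun P hP => ?_
  obtain ⟨d, hd⟩ := hs P hP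
  rw [h, eval_isHomogeneous hd, mul_eq_zero, or_iff_right (pow_ne_zero _ ha)]

section Jouanolou

variable {N m D : ℕ} {z : Forms N m D} {T T' : Tens N m D}
  {q q' : ProjSp N} {X : Set (ProjSp N)} {α : Type*}

theorem PolyFun.lam {G : (α → ℂ) → Tens N m D} (hG : ∀ a, PolyFun fun y => G y a) :
    PolyFun fun y => lam z (G y) :=
  .sum _ fun _ _ => .sum _ fun _ _ => (PolyFun.const _).mul (hG _)

theorem PolyFun.ten {G : (α → ℂ) → Tens N m D} (hG : ∀ a, PolyFun fun y => G y a)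
    {Q : (α → ℂ) → Matrix (Fin (N + 1)) (Fin (N + 1)) ℂ} (hQ : ∀ i j, PolyFun fun y => Q y i j)
    (a : TIdx N m D) : PolyFun fun y => ten (Q y) (G y) a :=
  .sum _ fun _ _ => (PolyFun.prod _ fun _ _ => hQ _ _).mul (hG _)

theorem PolyFun.pr {G : (α → ℂ) → Tens N m D} (hG : ∀ a, PolyFun fun y => G y a)
    (i j : Fin (N + 1)) : PolyFun fun y => pr z (G y) i j :=
  .sum _ fun _ _ => .sum _ fun β _ => by
    by_cases h : β 0 = j <;> simp only [h, if_true, if_false]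
    exacts [(PolyFun.const _).mul (hG _), .const 0]

/-- The tensor `T` lies in the fibre over the point `q`. -/
def LiesOver (z : Forms N m D) (T : Tens N m D)
    (q : ProjSp N) : Prop :=
  lam z T = 1 ∧ ∃ c, T = tens q.rep c

theorem liesOver_mk {v : ℂ^(N + 1)} (hv : v ≠ 0) :
    LiesOver z T (mk ℂ v hv) ↔ lam z T = 1 ∧ ∃ c, T = tens v c := by
  obtain ⟨a, ha, h⟩ := exists_rep_eq hv
  refine and_congr_right fun _ => ⟨?_, ?_⟩
  · rintro ⟨c, rfl⟩
    exact ⟨_, by rw [h, tens_smul]⟩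
  · rintro ⟨c, rfl⟩
    exact ⟨(a ^ (D + 1))⁻¹ • c, by rw [h, tens_smul, smul_inv_smul₀ (pow_ne_zero _ ha)]⟩

theorem LiesOver.exists_pr (h : LiesOver z T q) :
    ∃ φ, pr z T = vecMulVec q.rep φ ∧ φ ⬝ᵥ q.rep = 1 := by
  obtain ⟨h1, c, rfl⟩ := h
  obtain ⟨φ, h2, h3⟩ := exists_pr_tens (z := z) (v := q.rep) (c := c) (D := D)
  exact ⟨φ, h2, h3.trans h1⟩

theorem LiesOver.pr_mulVec_rep (h : LiesOver z T q) : (pr z T).mulVec q.rep = q.rep := by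
  obtain ⟨φ, h1, h2⟩ := h.exists_pr
  rw [h1, Matrix.vecMulVec_mulVec, h2]
  simp

theorem LiesOver.eq_mk (h : LiesOver z T q) {u : ℂ^(N + 1)} (hu : (pr z T).mulVec u ≠ 0) :
    q = mk ℂ _ hu := by
  obtain ⟨φ, h1, h2⟩ := h.exists_pr
  conv_lhs => rw [← q.mk_rep]
  refine (mk_eq_of_smul _ _ (a := φ ⬝ᵥ u) ?_).symm
  rw [h1, Matrix.vecMulVec_mulVec]
  simp

theorem LiesOver.unique (h : LiesOver z T q) (h' : LiesOver z T q') : q = q' := by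
  have h0 : (pr z T).mulVec q.rep ≠ 0 := by
    rw [h.pr_mulVec_rep]
    exact q.rep_nonzero
  rw [h.eq_mk h0, h'.eq_mk h0]

/-- The base point of a tensor. -/
def projT (z : Forms N m D) (T : Tens N m D) : ProjSp N :=
  Classical.epsilon fun q => LiesOver z T q

theorem LiesOver.projT_eq (h : LiesOver z T q) : projT z T = q :=
  (Classical.epsilon_spec (p := fun q => LiesOver z T q) ⟨q, h⟩).unique h

theorem LiesOver.pr_mul_pr (h : LiesOver z T q) (h' : LiesOver z T' q) :
    pr z T * pr z T' = pr z T' := by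
  obtain ⟨φ, h1, -⟩ := h'.exists_pr
  rw [h1, Matrix.mul_vecMulVec, h.pr_mulVec_rep]

theorem LiesOver.ten_pr (h : LiesOver z T q) (h' : LiesOver z T' q) : ten (pr z T) T' = T' := by
  obtain ⟨-, c, rfl⟩ := h'
  rw [ten_tens, h.pr_mulVec_rep]

/-- Correction of a tensor within its fibre. -/
def corr (z : Forms N m D) (T B : Tens N m D) : Tens N m D :=
  T + ten (pr z T) B - lam z (ten (pr z T) B) • T

theorem LiesOver.corr (h : LiesOver z T q) (B : Tens N m D) : LiesOver z (corr z T B) q := by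
  obtain ⟨φ, h1, -⟩ := h.exists_pr
  obtain ⟨h2, c, h3⟩ := h
  refine ⟨?_, ?_⟩
  · rw [_root_.corr, lam_sub, lam_add, lam_smul, h2]
    ring
  · refine ⟨c + (fun k => ∑ β : Fin (D + 1) → Fin (N + 1), mono φ β * B (β, k)) +
      (-lam z (ten (pr z T) B)) • c, ?_⟩
    rw [tens_add, tens_add, tens_smul_right, ← ten_vecMulVec, ← h1, ← h3, _root_.corr, neg_smul,
      sub_eq_add_neg]

theorem LiesOver.corr_sub (h : LiesOver z T q) (h' : LiesOver z T' q) :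
    _root_.corr z T (T' - T) = T' := by
  rw [_root_.corr, ten_sub, h.ten_pr h', h.ten_pr h, lam_sub, h'.1, h.1]
  simp

theorem PolyFun.corr {G B : (α → ℂ) → Tens N m D} (hG : ∀ a, PolyFun fun y => G y a)
    (hB : ∀ a, PolyFun fun y => B y a) (a : TIdx N m D) : PolyFun fun y => corr z (G y) (B y) a :=
  ((hG a).add (PolyFun.ten hB (fun i j => PolyFun.pr hG i j) a)).sub
    ((PolyFun.lam fun a => PolyFun.ten hB (fun i j => PolyFun.pr hG i j) a).mul (hG a))

/-- The affine bundle over `X` consisting of all normalised tensors over points of `X`. -/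
def jou (X : Set (ProjSp N)) (z : Forms N m D) :
    Set (Tens N m D) :=
  {T | ∃ q ∈ X, LiesOver z T q}

theorem liesOver_projT (h : T ∈ jou X z) : LiesOver z T (projT z T) := by
  obtain ⟨q, -, h⟩ := h
  rwa [h.projT_eq]

theorem projT_mem (h : T ∈ jou X z) : projT z T ∈ X := by
  obtain ⟨q, hq, h⟩ := h
  rwa [h.projT_eq]

/-- The forms `z` cut out a subset such that `X` is closed in its complement. -/
def IsCutOut (X : Set (ProjSp N)) (z : Forms N m D) : Prop :=
  ∃ s : Set ℂ[N + 1], (∀ P ∈ s, ∃ d, P.IsHomogeneous d) ∧ ∀ (v : ℂ^(N + 1)) (hv : v ≠ 0),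
    mk ℂ v hv ∈ X ↔
      (∀ P ∈ s, eval v P = 0) ∧ ∃ k, zform z k v ≠ 0

theorem exists_isCutOut {Y Z : Set (ProjSp N)} (hY : IsProjectiveVariety Y)
    (hZ : IsProjectiveVariety Z) :
    ∃ (D m : ℕ) (z : Forms N m D), IsCutOut (Y \ Z) z := by
  obtain ⟨s, hs, rfl⟩ := hY
  obtain ⟨t, ht, rfl⟩ := hZ
  choose! d hd using ht
  set D := t.sup d with hD
  have h1 : ∀ p : t × Fin (N + 1), ∃ z : (Fin (D + 1) → Fin (N + 1)) → ℂ, ∀ v,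
      v p.2 ^ (D + 1 - d p.1) * eval v p.1.1 = ∑ α, z α * mono v α := fun p => by
    have h2 : (X p.2 ^ (D + 1 - d p.1) * p.1.1).IsHomogeneous (D + 1) := by
      have h3 := ((MvPolynomial.isHomogeneous_X ℂ p.2).pow (D + 1 - d p.1)).mul (hd _ p.1.2)
      have h4 : d p.1 ≤ D := Finset.le_sup (f := d) p.1.2
      rwa [one_mul, show D + 1 - d p.1 + d p.1 = D + 1 by omega] at h3
    obtain ⟨z, hz⟩ := exists_zform h2
    exact ⟨z, fun v => by simpa using hz v⟩
  choose ζ hζ using h1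
  let e := Fintype.equivFin (t × Fin (N + 1))
  refine ⟨D, _, fun k => ζ (e.symm k), s, hs, fun v hv => ?_⟩
  rw [mem_sdiff, mk_mem_projZeroLocus hs, mk_mem_projZeroLocus fun P hP => ⟨d P, hd P hP⟩]
  refine and_congr_right fun _ => ⟨fun h => ?_, ?_⟩
  · push Not at h
    obtain ⟨P, hP, h⟩ := h
    obtain ⟨j, hj⟩ := ne_iff.1 hv
    refine ⟨e (⟨P, hP⟩, j), ?_⟩
    rw [zform, e.symm_apply_apply, ← hζ]
    exact mul_ne_zero (pow_ne_zero _ hj) h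
  · rintro ⟨k, hk⟩ h
    refine hk ?_
    rw [zform, ← hζ, h _ (e.symm k).1.2, mul_zero]

theorem isAffineVariety_jou (hz : IsCutOut X z) : IsAffineVariety (jou X z) := by
  obtain ⟨s, hsh, hs⟩ := hz
  have hid : ∀ a : TIdx N m D, PolyFun fun T : Tens N m D => T a := fun a => .coord a
  have hpr : ∀ i j, PolyFun fun T : Tens N m D => pr z T i j := fun i j => PolyFun.pr hid i j
  have h1 := isAffineVariety_of_polyFun (ι := Unit) fun _ =>
    (PolyFun.lam (z := z) hid).sub (.const 1)
  have h2 := isAffineVariety_of_polyFun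
    (ι := Fin (N + 1) × Fin (N + 1) × Fin (N + 1) × Fin (N + 1)) fun a =>
      ((hpr a.1 a.2.1).mul (hpr a.2.2.1 a.2.2.2)).sub ((hpr a.1 a.2.2.2).mul (hpr a.2.2.1 a.2.1))
  have h3 := isAffineVariety_of_polyFun fun a => (PolyFun.ten hid hpr a).sub (hid a)
  have h4 := isAffineVariety_of_polyFun (ι := s × Fin (N + 1)) fun a =>
    (PolyFun.eval a.1.1).comp fun i => hpr i a.2
  convert ((h1.inter h2).inter h3).inter h4 using 1
  ext T
  simp only [mem_inter_iff, mem_ofPred_eq, sub_eq_zero, Prod.forall, Subtype.forall,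
    forall_const]
  constructor
  · rintro ⟨q, hq, h⟩
    obtain ⟨φ, h5, h6⟩ := h.exists_pr
    rw [← q.mk_rep, hs] at hq
    refine ⟨⟨⟨h.1, fun i j k l => ?_⟩, fun a b => congrFun (h.ten_pr h) (a, b)⟩,
      fun P hP j => ?_⟩
    · simp only [h5, vecMulVec_apply]
      ring
    · have h7 : (fun i => pr z T i j) = φ j • q.rep := by
        funext i
        simp [h5, vecMulVec_apply, mul_comm]
      obtain ⟨d, hd⟩ := hsh P hP
      rw [h7, eval_isHomogeneous hd, hq.1 P hP, mul_zero]
  · rintro ⟨⟨⟨h5, h6⟩, h7⟩, h8⟩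
    have h9 : (pr z T).trace ≠ 0 := by
      rw [trace_pr, h5]
      exact one_ne_zero
    obtain ⟨k, -, hk⟩ := Finset.exists_ne_zero_of_sum_ne_zero h9
    change pr z T k k ≠ 0 at hk
    set v : ℂ^(N + 1) := fun i => pr z T i k with hv
    have hv0 : v ≠ 0 := fun h => hk (congrFun h k)
    have h10 : pr z T = vecMulVec v fun j => pr z T k j / pr z T k k := by
      ext i j
      rw [vecMulVec_apply, hv, mul_div_assoc', eq_div_iff hk, h6 i j k k]
    have h11 : ∃ c, T = tens v c := by
      refine ⟨_, Eq.trans ?_ (ten_vecMulVec (T := T) (v := v) (φ := fun j => pr z T k j / pr z T k k))⟩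
      rw [← h10]
      exact funext fun a => (h7 a.1 a.2).symm
    refine ⟨_, (hs v hv0).2 ⟨fun P hP => h8 P hP k, ?_⟩, (liesOver_mk hv0).2 ⟨h5, h11⟩⟩
    obtain ⟨c, hc⟩ := h11
    rw [hc, lam_tens] at h5
    by_contra! h
    simp [h] at h5

end Jouanolou

section Lifting

variable {N m D : ℕ} {z : Forms N m D} {T T' : Tens N m D}
  {q q' : ProjSp N} {X : Set (ProjSp N)} {ι : Type*}

theorem liesOver_sum (s : Finset ι) {a : ι → ℂ} {T : ι → Tens N m D}
    (h : ∀ i ∈ s, ∃ c, T i = tens q.rep c) (h1 : ∑ i ∈ s, a i * lam z (T i) = 1) :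
    LiesOver z (∑ i ∈ s, a i • T i) q := by
  classical
  constructor
  · rw [← h1]
    clear h h1
    induction s using Finset.induction_on with
    | empty => simp [lam]
    | insert i s hi ih => rw [sum_insert hi, sum_insert hi, lam_add, lam_smul, ih]
  · clear h1
    induction s using Finset.induction_on with
    | empty => exact ⟨0, by funext; simp [tens]⟩
    | insert i s hi ih =>
      obtain ⟨c, hc⟩ := ih fun j hj => h j (Finset.mem_insert_of_mem hj)
      obtain ⟨d, hd⟩ := h i (Finset.mem_insert_self i s)
      exact ⟨a i • d + c, by rw [sum_insert hi, hc, hd, tens_add, tens_smul_right]⟩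

theorem LiesOver.exists_col (h : LiesOver z T q) : ∃ k, pr z T k k ≠ 0 := by
  have h9 : (pr z T).trace ≠ 0 := by
    rw [trace_pr, h.1]
    exact one_ne_zero
  obtain ⟨k, -, hk⟩ := Finset.exists_ne_zero_of_sum_ne_zero h9
  exact ⟨k, hk⟩

theorem LiesOver.eq_mk_col (h : LiesOver z T q) {k : Fin (N + 1)}
    (hk : (fun i => pr z T i k) ≠ 0) : q = mk ℂ _ hk := by
  have h1 : (pr z T).mulVec (Pi.single k 1) = fun i => pr z T i k := by
    rw [Matrix.mulVec_single_one]
    rfl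
  exact (h.eq_mk (u := Pi.single k 1) (by rwa [h1])).trans (by simp only [h1])

variable [Fintype ι] {S : Set (ι → ℂ)}

theorem exists_polyLift (hS : IsAffineVariety S) (hz : IsCutOut X z) {f : S → ProjSp N}
    (hf : MorphismToProjOf S f) (hfX : ∀ p, f p ∈ X) :
    ∃ G : (ι → ℂ) → Tens N m D, (∀ a, PolyFun fun x => G x a) ∧
      ∀ x : S, LiesOver z (G x) (f x) := by
  choose g hg0 hg using hf
  obtain ⟨s, -, hs⟩ := hz
  obtain ⟨t, a, ha, hta⟩ := hS.exists_partition
    (F := fun (i : S × Fin m) x => zform z i.2 fun j => eval x (g i.1 j))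
    (fun i => .sum _ fun _ _ => (PolyFun.const _).mul (.prod _ fun _ _ => .eval _))
    (fun x hx => by
      have h1 := hfX ⟨x, hx⟩
      rw [hg ⟨x, hx⟩ ⟨x, hx⟩ (hg0 _)] at h1
      obtain ⟨k, hk⟩ := ((hs _ _).1 h1).2
      exact ⟨(⟨x, hx⟩, k), hk⟩)
  refine ⟨fun x => ∑ i ∈ t, a i x • tens (fun j => eval x (g i.1 j))
    (Pi.single i.2 1), fun b => ?_, fun x => ?_⟩
  · simp only [Finset.sum_apply, Pi.smul_apply, smul_eq_mul, tens]
    exact .sum _ fun i _ => (ha i).mul ((PolyFun.prod _ fun _ _ => .eval _).mul (.const _))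
  · refine liesOver_sum t (fun i _ => ?_) ?_
    · by_cases h : (fun j => eval (x : ι → ℂ) (g i.1 j)) = 0
      · rw [h]
        exact ⟨0, by funext; simp [tens, mono]⟩
      · obtain ⟨c, hc, h1⟩ := exists_rep_eq h
        rw [← hg i.1 x h] at h1
        exact ⟨(c ^ (D + 1))⁻¹ • Pi.single i.2 1, by
          rw [h1, tens_smul, smul_inv_smul₀ (pow_ne_zero _ hc)]⟩
    · refine (sum_congr rfl fun i _ => ?_).trans (hta x x.2)
      rw [lam_tens, Finset.sum_eq_single i.2 (fun k _ hk => by simp [hk]) (by simp)]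
      simp

theorem morphism_projT {G : (ι → ℂ) → Tens N m D} (hG : ∀ a, PolyFun fun x => G x a)
    {f : S → ProjSp N} (hf : ∀ x : S, LiesOver z (G x) (f x)) : MorphismToProjOf S f := by
  intro p
  obtain ⟨k, hk⟩ := (hf p).exists_col
  have h1 : ∀ i, ∃ P : MvPolynomial ι ℂ, ∀ y, pr z (G y) i k = eval y P :=
    fun i => PolyFun.pr hG (z := z) i k
  choose P hP using h1
  refine ⟨P, fun h => hk ?_, fun q hq => ?_⟩
  · exact (hP k p).trans (congrFun h k)
  · simp only [← hP] at hq ⊢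
    exact (hf q).eq_mk_col hq

end Lifting

namespace PolyFun

variable {α β : Type*}

theorem differentiable [Fintype α] {F : (α → ℂ) → ℂ} (hF : PolyFun F) : Differentiable ℂ F := by
  obtain ⟨P, hP⟩ := hF
  rw [show F = fun z => MvPolynomial.eval z P from funext hP]
  exact fun z => ((AnalyticOnNhd.eval_mvPolynomial (𝕜 := ℂ) P) z (mem_univ _)).differentiableAt

/-- The derivative of a polynomial in a group of its variables depends polynomially on the
others. -/
theorem exists_hasFDerivAt [Fintype β] {F : (α ⊕ β → ℂ) → ℂ} (hF : PolyFun F) :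
    ∃ B : β → (α → ℂ) → ℂ, (∀ r, PolyFun (B r)) ∧ ∀ y,
      HasFDerivAt (fun v => F (elim y v))
        (∑ r, B r y • ContinuousLinearMap.proj (R := ℂ) (φ := fun _ : β => ℂ) r) 0 := by
  obtain ⟨B, hB, h⟩ := hF.exists_expansion
  refine ⟨fun r y => B r (elim y 0), fun r => (hB r).comp fun b => ?_, fun y => ?_⟩
  · rcases b with a | b
    exacts [.coord a, .const 0]
  · rw [show (fun v => F (elim y v)) = _ from funext (h y)]
    have h1 : ∀ r, HasFDerivAt (fun v : β → ℂ => v r * B r (elim y v))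
        (B r (elim y 0) • ContinuousLinearMap.proj (R := ℂ) (φ := fun _ : β => ℂ) r) 0 :=
      fun r => by
        have h2 : PolyFun fun v : β → ℂ => B r (elim y v) := (hB r).comp fun b => by
          rcases b with a | b
          exacts [.const _, .coord b]
        have h3 := ((ContinuousLinearMap.proj (R := ℂ) (φ := fun _ : β => ℂ) r).hasFDerivAt
          (x := 0)).mul (h2.differentiable 0).hasFDerivAt
        exact h3.congr_fderiv (by ext v; simp)
    exact (HasFDerivAt.fun_sum fun r _ => h1 r).const_add _

/-- Clearing denominators. -/
theorem exists_clear {F : (α ⊕ Unit → ℂ) → ℂ} (hF : PolyFun F) {h : (α → ℂ) → ℂ}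
    (hh : PolyFun h) : ∃ b₀ : ℕ, ∀ b ≥ b₀, ∃ Φ : (α → ℂ) → ℂ, PolyFun Φ ∧
      ∀ a, h a ≠ 0 → Φ a = h a ^ b * F (elim a fun _ => (h a)⁻¹) := by
  obtain ⟨P, hP⟩ := hF
  simp only [hP]
  clear hP F
  induction P using MvPolynomial.induction_on with
  | C a => exact ⟨0, fun b _ => ⟨_, (hh.pow b).mul (.const a), fun x _ => by simp⟩⟩
  | add p q hp hq =>
    obtain ⟨b, hb⟩ := hp
    obtain ⟨c, hc⟩ := hq
    refine ⟨max b c, fun d hd => ?_⟩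
    obtain ⟨Φ, h1, h2⟩ := hb d ((le_max_left _ _).trans hd)
    obtain ⟨Ψ, h3, h4⟩ := hc d ((le_max_right _ _).trans hd)
    exact ⟨_, h1.add h3, fun a ha => by rw [h2 a ha, h4 a ha, map_add, mul_add]⟩
  | mul_X p i hp =>
    obtain ⟨b, hb⟩ := hp
    refine ⟨b + 1, fun d hd => ?_⟩
    obtain ⟨e, rfl⟩ : ∃ e, d = e + 1 := ⟨d - 1, by omega⟩
    obtain ⟨Φ, h1, h2⟩ := hb e (by omega)
    rcases i with i | i
    · exact ⟨_, (h1.mul hh).mul (.coord i), fun a ha => by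
        rw [h2 a ha, map_mul, eval_X, elim_inl]
        ring⟩
    · exact ⟨_, h1, fun a ha => by
        rw [h2 a ha, map_mul, eval_X, elim_inr]
        rw [pow_succ, mul_assoc, mul_comm (MvPolynomial.eval _ _), mul_inv_cancel_left₀ ha]⟩

end PolyFun

/-- The local description of a dominating algebraic spray. -/
theorem IsAlgebraicallyElliptic.exists_chart {N n : ℕ} {X : Set (ProjSp N)}
    (hX : IsAlgebraicallyElliptic n X) (x : X) :
    ∃ (r : ℕ) (P : ℂ[N + 1]) (U : Set X) (Θ : X → ℂ^r → X),
      (∃ d, P.IsHomogeneous d) ∧ eval x.1.rep P ≠ 0 ∧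
      (∀ y : X, eval y.1.rep P ≠ 0 → y ∈ U) ∧
      (∀ y ∈ U, Θ y 0 = y) ∧
      (∀ y ∈ U, ∀ v, ∃ G : Fin (N + 1) → MvPolynomial (Fin (N + 1) ⊕ Fin r) ℂ,
        ∀ y' ∈ U, ∀ v' w, ∀ hw : w ≠ 0, y'.1 = mk ℂ w hw →
          ((y' = y → v' = v → (fun j => eval (elim w v') (G j)) ≠ 0) ∧
          ∀ h : (fun j => eval (elim w v') (G j)) ≠ 0,
            (Θ y' v').1 = mk ℂ _ h)) ∧
      ∃ ℓ : Fin (N + 1), x.1.rep ℓ ≠ 0 ∧ Module.finrank ℂ (LinearMap.range ((fderiv ℂ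
        (fun v : Fin r → ℂ => affChart ℓ (Θ x v).1) 0) : ℂ^r →ₗ[ℂ] ℂ^N)) = n := by
  obtain ⟨K, kE, E, -, π, z, s, -, -, hs, hπz, hsz, ι, U, r, c, ψ, hU, -, -, hψ1, hψ2, hcz, hψ3, -,
    hrk⟩ := hX
  obtain ⟨i, hxi, ℓ, hℓ, hn⟩ := hrk x
  obtain ⟨C, ⟨t, ht, rfl⟩, hC⟩ := hU i
  have hx : x.1 ∉ ProjZeroLocus (t : Set ℂ[N + 1]) := by
    rw [hC] at hxi
    exact hxi
  obtain ⟨P, hPt, hP⟩ : ∃ P ∈ t, eval x.1.rep P ≠ 0 := by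
    by_contra! h
    exact hx h
  refine ⟨r i, P, U i, fun y v => s (ψ i y v), ht P hPt, hP, fun y hy => ?_, fun y hy => ?_,
    fun y hy v => ?_, ℓ, hℓ, hn⟩
  · rw [hC]
    exact fun h => hy (h P hPt)
  · have h1 := hψ2 i (z y) (by rwa [hπz])
    rw [hπz, hcz i y hy] at h1
    simp only [h1, hsz]
  · obtain ⟨g, d, hg, hgψ⟩ := hψ3 i
    obtain ⟨gs, ds, hgs, hgs0, hgs1⟩ := hs (ψ i y v)
    refine ⟨fun j => aeval g (gs j), fun y' hy' v' w hw hyw => ?_⟩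
    obtain ⟨hg0, h2⟩ := hgψ y' hy' v'
    obtain ⟨a, ha, h3⟩ := exists_rep_eq hw
    rw [← hyw] at h3
    have h4 : (fun b => eval (elim y'.1.rep v') (g b)) =
        a ^ d • fun b => eval (elim w v') (g b) := by
      funext b
      rw [Pi.smul_apply, smul_eq_mul, ← eval_isWeightedHomogeneous (hg b), h3]
      congr 2
      funext k
      rcases k with k | k <;> simp
    obtain ⟨a', ha', h5⟩ := exists_rep_eq hg0
    rw [← h2, h4, smul_smul] at h5
    have h6 : (fun j => eval (ψ i y' v').1.rep (gs j)) = (a' * a ^ d) ^ ds •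
        fun j => eval (elim w v') (aeval g (gs j)) := by
      funext j
      rw [h5, eval_isHomogeneous (hgs j), Pi.smul_apply, smul_eq_mul, eval_aeval_eq]
    have h7 : (a' * a ^ d) ^ ds ≠ 0 := pow_ne_zero _ (mul_ne_zero ha' (pow_ne_zero _ ha))
    refine ⟨?_, fun h => ?_⟩
    · rintro rfl rfl h0
      apply hgs0
      rw [h6, h0, smul_zero]
    · have h8 : (fun j => eval (ψ i y' v').1.rep (gs j)) ≠ 0 := by
        rw [h6]
        exact smul_ne_zero h7 h
      rw [hgs1 (ψ i y' v') h8]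
      exact mk_eq_of_smul _ _ h6

section HorizontalSpray

variable {N m D n : ℕ} {z : Forms N m D} {X : Set (ProjSp N)}
  {ρ ρ' : Type} {σ : HSpr N m D ρ}
  {σ' : HSpr N m D ρ'} {y : Tens N m D} {q : ProjSp N}

/-- An algebraic spray on the affine bundle `jou X z`, not required to be dominating. -/
structure IsHSpray (X : Set (ProjSp N)) (z : Forms N m D)
    (σ : HSpr N m D ρ) : Prop where
  poly : ∀ a, PolyFun fun y => σ y a
  mem : ∀ y ∈ jou X z, ∀ v, σ (elim y v) ∈ jou X z
  zero : ∀ y, σ (elim y 0) = y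

theorem PolyFun.sumElim_inr {α β : Type*} (y : α → ℂ) (b : α ⊕ β) :
    PolyFun fun v : β → ℂ => elim y v b := by
  rcases b with b | b
  exacts [.const _, .coord b]

theorem PolyFun.sumElim {α β γ : Type*} {G : (γ → ℂ) → α → ℂ} {H : (γ → ℂ) → β → ℂ}
    (hG : ∀ a, PolyFun fun w => G w a) (hH : ∀ b, PolyFun fun w => H w b) (b : α ⊕ β) :
    PolyFun fun w => elim (G w) (H w) b := by
  rcases b with b | b
  exacts [hG b, hH b]

theorem PolyFun.matMul {α : Type*} {k : ℕ} {A B : (α → ℂ) → Matrix (Fin k) (Fin k) ℂ}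
    (hA : ∀ i j, PolyFun fun w => A w i j) (hB : ∀ i j, PolyFun fun w => B w i j) (i j : Fin k) :
    PolyFun fun w => (A w * B w) i j := by
  simp only [Matrix.mul_apply]
  exact .sum _ fun _ _ => (hA _ _).mul (hB _ _)

variable [Fintype ρ] [DecidableEq ρ] [Fintype ρ'] [DecidableEq ρ']

/-- The derivative along the zero section of the projector associated with a spray. -/
def hD (z : Forms N m D) (σ : HSpr N m D ρ)
    (y : Tens N m D) : Matrix (Fin (N + 1) × Fin (N + 1)) ρ ℂ := fun a r =>
  fderiv ℂ (fun v => (pr z (σ (elim y v)) * pr z y) a.1 a.2) 0 (Pi.single r 1)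

theorem IsHSpray.exists_hD (hσ : IsHSpray X z σ) (i j : Fin (N + 1)) :
    (∀ r, PolyFun fun y => hD z σ y (i, j) r) ∧ ∀ y,
      HasFDerivAt (fun v => (pr z (σ (elim y v)) * pr z y) i j)
        (∑ r, hD z σ y (i, j) r • ContinuousLinearMap.proj (R := ℂ) (φ := fun _ : ρ => ℂ) r) 0 := by
  obtain ⟨B, hB, h⟩ := PolyFun.exists_hasFDerivAt (F := fun w : TIdx N m D ⊕ ρ → ℂ =>
    (pr z (σ w) * pr z fun a => w (inl a)) i j)
    (.matMul (fun i j => .pr hσ.poly i j) (fun i j => .pr (fun a => .coord _) i j) i j)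
  have h1 : ∀ y r, hD z σ y (i, j) r = B r y := fun y r => by
    refine (DFunLike.congr_fun (h y).fderiv (Pi.single r 1)).trans ?_
    simp [Pi.single_apply]
  refine ⟨fun r => ?_, fun y => ?_⟩
  · simpa only [h1] using hB r
  · simp only [h1]
    exact h y

/-- Contraction of the second index with a vector. -/
def contr (x : ℂ^(N + 1)) :
    (Fin (N + 1) × Fin (N + 1) → ℂ) →ₗ[ℂ] ℂ^(N + 1) :=
  LinearMap.pi fun i => ∑ j, x j • LinearMap.proj (i, j)

theorem contr_apply (x : ℂ^(N + 1)) (c : Fin (N + 1) × Fin (N + 1) → ℂ) (i : Fin (N + 1)) :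
    contr x c i = ∑ j, x j * c (i, j) := by
  simp [contr]

/-- The curves `v ↦ pr z (σ (y, v)) x` in the cone over `X`. -/
theorem IsHSpray.hasFDerivAt (hσ : IsHSpray X z σ) (hy : LiesOver z y q) :
    HasFDerivAt (fun v => (pr z (σ (elim y v))).mulVec q.rep)
      (LinearMap.toContinuousLinearMap (contr q.rep ∘ₗ (hD z σ y).mulVecLin)) 0 := by
  have h1 : ∀ v, (pr z (σ (elim y v))).mulVec q.rep =
      fun i => ∑ j, (pr z (σ (elim y v)) * pr z y) i j * q.rep j := fun v => by
    conv_lhs => rw [← hy.pr_mulVec_rep, mulVec_mulVec]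
    rfl
  simp only [h1]
  refine hasFDerivAt_pi'.2 fun i => ?_
  have h2 := HasFDerivAt.fun_sum (u := Finset.univ) fun j _ =>
    ((hσ.exists_hD i j).2 y).mul_const (q.rep j)
  refine h2.congr_fderiv ?_
  ext r
  simp [contr_apply]
  rfl

theorem IsHSpray.le_rank (hσ : IsHSpray X z σ) (hy : LiesOver z y q) (hq : q ∈ X)
    {ℓ : Fin (N + 1)} (hℓ : q.rep ℓ ≠ 0) (hn : Module.finrank ℂ (LinearMap.range ((fderiv ℂ
      (fun v : ρ → ℂ => affChart ℓ (projT z (σ (elim y v)))) 0) :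
        (ρ → ℂ) →ₗ[ℂ] ℂ^N)) = n) : n ≤ (hD z σ y).rank := by
  have h1 := hσ.hasFDerivAt hy
  have h2 : (pr z (σ (elim y 0))).mulVec q.rep = q.rep := by rw [hσ.zero, hy.pr_mulVec_rep]
  set A : ℂ^(N + 1) → ℂ^N := fun u j => u (ℓ.succAbove j) / u ℓ with hA
  have h3 : DifferentiableAt ℂ A q.rep :=
    differentiableAt_pi.2 fun j => by
      have h5 : ∀ k, DifferentiableAt ℂ (fun u : Fin (N + 1) → ℂ => u k) q.rep := fun k =>
        differentiableAt_apply k _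
      simp only [hA, div_eq_mul_inv]
      exact (h5 _).fun_mul ((h5 ℓ).fun_inv hℓ)
  have h4 : (fun v : ρ → ℂ => affChart ℓ (projT z (σ (elim y v)))) =ᶠ[𝓝 0]
      A ∘ fun v => (pr z (σ (elim y v))).mulVec q.rep := by
    have h5 := h1.continuousAt.eventually_ne (y := 0) (by rw [h2]; exact q.rep_nonzero)
    filter_upwards [h5] with v hv
    have h6 := liesOver_projT (hσ.mem y ⟨q, hq, hy⟩ v)
    obtain ⟨a, ha, h7⟩ := exists_rep_eq hv
    rw [← h6.eq_mk hv] at h7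
    funext j
    simp only [affChart, hA, h7, Function.comp, Pi.smul_apply, smul_eq_mul]
    exact mul_div_mul_left _ _ ha
  have h7 : DifferentiableAt ℂ A ((pr z (σ (elim y 0))).mulVec q.rep) := h2.symm ▸ h3
  rw [h4.fderiv_eq, (h7.hasFDerivAt.comp (0 : ρ → ℂ) h1).fderiv] at hn
  rw [← hn, Matrix.rank]
  have h8 : ∀ L : ℂ^(N + 1) →L[ℂ] ℂ^N, LinearMap.range
      ((L.comp (LinearMap.toContinuousLinearMap (contr q.rep ∘ₗ (hD z σ y).mulVecLin)) :
        (ρ → ℂ) →L[ℂ] ℂ^N) : (ρ → ℂ) →ₗ[ℂ] ℂ^N) =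
      (LinearMap.range (hD z σ y).mulVecLin).map ((L : ℂ^(N + 1) →ₗ[ℂ] ℂ^N) ∘ₗ
        contr q.rep) := fun L => by
    rw [← LinearMap.range_comp]
    rfl
  rw [h8]
  exact Submodule.finrank_map_le _ _

end HorizontalSpray

section LocalSpray

variable {N m D n : ℕ} {z : Forms N m D} {X : Set (ProjSp N)}
  {y : Tens N m D}

/-- Near every point there is a spray on `jou X z` that is dominating in the directions of `X`. -/
theorem exists_local_spray (hz : IsCutOut X z) (hX : IsAlgebraicallyElliptic n X)
    (hy : y ∈ jou X z) : ∃ (r : ℕ) (σ : HSpr N m D (Fin r)),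
      IsHSpray X z σ ∧ n ≤ (hD z σ y).rank := by
  obtain ⟨q, hq, hyq⟩ := hy
  obtain ⟨r, P, U, Θ, ⟨d, hd⟩, hP0, hPU, hΘ0, hΘ, ℓ, hℓ, hn⟩ := hX.exists_chart ⟨q, hq⟩
  obtain ⟨k, hk⟩ := hyq.exists_col
  set h : Tens N m D → ℂ := fun y =>
    eval (fun i => pr z y i k) P * pr z y k k with hh
  have hpoly : PolyFun h := ((PolyFun.eval P).comp fun i => PolyFun.pr (fun a => .coord a) i k).mul
    (.pr (fun a => .coord a) k k)
  have hcol : ∀ y, h y ≠ 0 → (fun i => pr z y i k) ≠ 0 := fun y h1 h2 =>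
    h1 (by rw [hh]; exact mul_eq_zero_of_right _ (congrFun h2 k))
  have hU : ∀ y q, ∀ hq : q ∈ X, LiesOver z y q → h y ≠ 0 → (⟨q, hq⟩ : X) ∈ U := by
    intro y q hq hyq h1
    obtain ⟨a, ha, h2⟩ := exists_rep_eq (hcol y h1)
    rw [← hyq.eq_mk_col (hcol y h1)] at h2
    refine hPU _ ?_
    rw [h2, eval_isHomogeneous hd]
    exact mul_ne_zero (pow_ne_zero _ ha) (left_ne_zero_of_mul h1)
  have hhy : h y ≠ 0 := by
    have h1 : (fun i => pr z y i k) ≠ 0 := fun h => hk (congrFun h k)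
    obtain ⟨a, ha, h2⟩ := exists_rep_eq h1
    rw [← hyq.eq_mk_col h1] at h2
    rw [h2, eval_isHomogeneous hd] at hP0
    exact mul_ne_zero (right_ne_zero_of_mul hP0) hk
  set yy : ((TIdx N m D ⊕ Fin r) ⊕ Unit → ℂ) → Tens N m D := fun p a => p (.inl (.inl a))
  set vv : ((TIdx N m D ⊕ Fin r) ⊕ Unit → ℂ) → ℂ^r := fun p a => p (.inl (.inr a))
  set V : Set ((TIdx N m D ⊕ Fin r) ⊕ Unit → ℂ) :=
    yy ⁻¹' jou X z ∩ {p | ∀ _ : Unit, p (.inr ()) * h (yy p) - 1 = 0} with hV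
  have hVa : IsAffineVariety V := ((isAffineVariety_jou hz).preimage fun a => .coord _).inter
    (isAffineVariety_of_polyFun fun _ =>
      ((PolyFun.coord _).mul (hpoly.comp fun a => .coord _)).sub (.const 1))
  have hVh : ∀ p ∈ V, h (yy p) ≠ 0 := fun p hp h0 => by
    have h1 := hp.2 ()
    rw [h0] at h1
    simp at h1
  set b : V → X := fun p => ⟨projT z (yy p), projT_mem p.2.1⟩
  have hbU : ∀ p, b p ∈ U := fun p => hU _ _ _ (liesOver_projT p.2.1) (hVh p p.2)
  have hmor : MorphismToProjOf V fun p => (Θ (b p) (vv p)).1 := by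
    intro p
    obtain ⟨G, hG⟩ := hΘ (b p) (hbU p) (vv p)
    have h1 : ∀ j, ∃ Q : MvPolynomial ((TIdx N m D ⊕ Fin r) ⊕ Unit) ℂ, ∀ p,
        eval (elim (fun i => pr z (yy p) i k) (vv p)) (G j) =
          eval p Q := fun j =>
      (PolyFun.eval (G j)).comp fun b => PolyFun.sumElim (fun i => .pr (fun a => .coord _) i k)
        (fun i => .coord _) b
    choose Q hQ using h1
    have h2 : ∀ p : V, (b p).1 = mk ℂ _ (hcol _ (hVh p p.2)) := fun p =>
      (liesOver_projT p.2.1).eq_mk_col _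
    simp only [← hQ]
    exact ⟨Q, by simpa only [← hQ] using (hG _ (hbU p) (vv p) _ _ (h2 p)).1 rfl rfl,
      fun p' hp' => by
        simp only [← hQ] at hp' ⊢
        exact (hG _ (hbU p') (vv p') _ _ (h2 p')).2 hp'⟩
  obtain ⟨T₁, hT₁, hT₁V⟩ := exists_polyLift hVa hz hmor fun p => (Θ (b p) (vv p)).2
  set p₀ : ((TIdx N m D ⊕ Fin r) ⊕ Unit → ℂ) → (TIdx N m D ⊕ Fin r) ⊕ Unit → ℂ := fun p =>
    elim (elim (yy p) 0) fun a => p (.inr a)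
  set T : ((TIdx N m D ⊕ Fin r) ⊕ Unit → ℂ) → Tens N m D := fun p =>
    corr z (T₁ p) (yy p - T₁ (p₀ p)) with hT
  have hTp : ∀ a, PolyFun fun p => T p a := fun a => PolyFun.corr hT₁ (fun a =>
    (PolyFun.coord _).sub ((hT₁ a).comp fun b => PolyFun.sumElim
      (PolyFun.sumElim (fun _ => .coord _) fun _ => .const 0) (fun _ => .coord _) b)) a
  have hTV : ∀ p : V, LiesOver z (T p) (Θ (b p) (vv p)) := fun p => (hT₁V p).corr _
  have hT0 : ∀ p (hp : p ∈ V), vv p = 0 → T p = yy p := by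
    intro p hp h0
    have h1 : p₀ p = p := by
      funext a
      rcases a with (a | a) | a
      exacts [rfl, (congrFun h0 a).symm, rfl]
    have h2 := hT₁V ⟨p, hp⟩
    rw [h0, hΘ0 _ (hbU _)] at h2
    rw [hT]
    simp only [h1]
    exact h2.corr_sub (liesOver_projT hp.1)
  have h1 := fun a => (hTp a).exists_clear (h := fun w => h fun a => w (.inl a))
    (hpoly.comp fun a => .coord _)
  choose b₀ hb₀ using h1
  set e := Finset.univ.sup b₀
  choose Φ hΦ hΦT using fun a => hb₀ a e (Finset.le_sup (Finset.mem_univ a))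
  choose B hB hBΦ using fun a => (hΦ a).exists_expansion
  set σ : HSpr N m D (Fin r) := fun w a => w (.inl a) +
    h (fun a => w (.inl a)) * ∑ i, w (.inr i) * B a i (elim (fun a => w (.inl a))
      (fun i => h (fun a => w (.inl a)) ^ (e + 1) * w (.inr i))) with hσ
  have hh' : PolyFun fun w : TIdx N m D ⊕ Fin r → ℂ => h fun a => w (.inl a) :=
    hpoly.comp fun a => .coord _
  have hσT : ∀ y ∈ jou X z, h y ≠ 0 → ∀ v : ℂ^r, σ (elim y v) =
      T (elim (elim y (h y ^ (e + 1) • v)) fun _ => (h y)⁻¹) := by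
    intro y hy h0 v
    funext a
    have h2 := hΦT a (elim y (h y ^ (e + 1) • v)) h0
    have h3 := hΦT a (elim y 0) h0
    have h4 : T (elim (elim y 0) fun _ => (h y)⁻¹) = y :=
      hT0 _ ⟨hy, fun _ => sub_eq_zero.2 (inv_mul_cancel₀ h0)⟩ rfl
    have h5 := hBΦ a y (h y ^ (e + 1) • v)
    simp only [elim_inl] at h2 h3
    rw [h4] at h3
    rw [h2, h3] at h5
    refine mul_left_cancel₀ (pow_ne_zero e h0) (Eq.trans ?_ h5.symm)
    simp only [hσ, elim_inl, elim_inr, mul_add, mul_sum, Pi.smul_apply, smul_eq_mul]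
    congr 1
    refine sum_congr rfl fun i _ => ?_
    change h y ^ e * (h y * (v i * B a i (elim y (h y ^ (e + 1) • v)))) =
      h y ^ (e + 1) * v i * B a i (elim y (h y ^ (e + 1) • v))
    ring
  have hσV : ∀ y (hy : y ∈ jou X z), h y ≠ 0 → ∀ v : ℂ^r,
      LiesOver z (σ (elim y v)) (Θ ⟨projT z y, projT_mem hy⟩ (h y ^ (e + 1) • v)).1 := by
    intro y hy h0 v
    rw [hσT y hy h0]
    exact hTV ⟨_, ⟨hy, fun _ => sub_eq_zero.2 (inv_mul_cancel₀ h0)⟩⟩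
  have hspray : IsHSpray X z σ := by
    refine ⟨fun a => ?_, fun y hy v => ?_, fun y => ?_⟩
    · exact (PolyFun.coord _).add (hh'.mul (.sum _ fun i _ => (PolyFun.coord _).mul
        ((hB a i).comp fun b => PolyFun.sumElim (fun a => .coord _)
          (fun i => (hh'.pow _).mul (.coord _)) b)))
    · by_cases h0 : h y = 0
      · have h1 : σ (elim y v) = y := funext fun a => by
          simp [hσ, h0]
        rwa [h1]
      · exact ⟨_, Subtype.coe_prop _, hσV y hy h0 v⟩
    · funext a
      simp [hσ]
  refine ⟨r, σ, hspray, hspray.le_rank hyq hq hℓ ?_⟩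
  have h1 : (fun v => affChart ℓ (projT z (σ (elim y v)))) =
      fun v => affChart ℓ (Θ ⟨q, hq⟩ (h y ^ (e + 1) • v)).1 := by
    funext v
    rw [(hσV y ⟨q, hq, hyq⟩ hhy v).projT_eq]
    simp only [hyq.projT_eq]
  rw [h1, fderiv_comp_smul (f := fun v => affChart ℓ (Θ ⟨q, hq⟩ v).1), smul_zero,
    ContinuousLinearMap.toLinearMap_smul, LinearMap.range_smul _ _ (pow_ne_zero _ hhy)]
  exact hn

end LocalSpray

section GlobalSpray

theorem Matrix.exists_det_ne_zero {κ ρ : Type*} [Fintype κ] [DecidableEq κ] [Fintype ρ]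
    [DecidableEq ρ] {n : ℕ} {A : Matrix κ ρ ℂ} (h : n ≤ A.rank) :
    ∃ (a : Matrix ρ (Fin n) ℂ) (b : Matrix (Fin n) κ ℂ), (b * A * a).det ≠ 0 := by
  obtain ⟨u, hu⟩ := exists_linearIndependent_of_le_finrank h
  choose v hv using fun i => (u i).2
  have h1 : Injective (A * (Matrix.of v).transpose).mulVecLin := by
    rw [Matrix.coe_mulVecLin, Matrix.mulVec_injective_iff]
    have h2 := hu.map' (LinearMap.range A.mulVecLin).subtype (Submodule.ker_subtype _)
    rwa [show (LinearMap.range A.mulVecLin).subtype ∘ u = fun i => A.mulVec (v i) from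
      funext fun i => (hv i).symm] at h2
  obtain ⟨L, hL⟩ := LinearMap.exists_leftInverse_of_injective _ (LinearMap.ker_eq_bot.2 h1)
  refine ⟨(Matrix.of v).transpose, LinearMap.toMatrix' L, ?_⟩
  have h3 : LinearMap.toMatrix' L * A * (Matrix.of v).transpose = 1 := by
    rw [Matrix.mul_assoc, ← LinearMap.toMatrix'_toLin' (A * _), Matrix.toLin'_apply', ← LinearMap.toMatrix'_comp, hL,
      LinearMap.toMatrix'_id]
  rw [h3, Matrix.det_one]
  exact one_ne_zero

theorem Matrix.rank_mul_eq_of_det_ne_zero {κ ρ : Type*} [Fintype κ] [Fintype ρ] {n : ℕ}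
    {A : Matrix κ ρ ℂ} {a : Matrix ρ (Fin n) ℂ} {b : Matrix (Fin n) κ ℂ}
    (h : (b * A * a).det ≠ 0) : n ≤ (A * a).rank := by
  have h1 := Matrix.rank_of_isUnit _ ((Matrix.isUnit_iff_isUnit_det _).2 h.isUnit)
  rw [Fintype.card_fin, Matrix.mul_assoc] at h1
  conv_lhs => rw [← h1]
  exact Matrix.rank_mul_le_right _ _

theorem Matrix.mul_adjugate_mul_eq {κ ρ : Type*} [Fintype κ] [Fintype ρ] [DecidableEq ρ] {n : ℕ}
    {A : Matrix κ ρ ℂ} {a : Matrix ρ (Fin n) ℂ} {b : Matrix (Fin n) κ ℂ}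
    (hA : A.rank = n) (h : (b * A * a).det ≠ 0) :
    A * (a * (b * A * a).adjugate * b) * A = (b * A * a).det • A := by
  have h1 : LinearMap.range (A * a).mulVecLin = LinearMap.range A.mulVecLin := by
    refine Submodule.eq_of_le_of_finrank_le ?_ ?_
    · rintro _ ⟨v, rfl⟩
      exact ⟨a.mulVec v, by simp [mulVec_mulVec]⟩
    · exact hA.le.trans (Matrix.rank_mul_eq_of_det_ne_zero h)
  refine Matrix.ext_of_mulVec_single fun r => ?_
  obtain ⟨c, hc⟩ : A.mulVec (Pi.single r 1) ∈ LinearMap.range (A * a).mulVecLin :=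
    h1 ▸ ⟨_, rfl⟩
  rw [← mulVec_mulVec, smul_mulVec, ← hc, Matrix.mulVecLin_apply,
    mulVec_mulVec, ← smul_mulVec]
  congr 1
  simp only [Matrix.mul_assoc]
  rw [← Matrix.mul_assoc b A a, Matrix.adjugate_mul]
  simp

/-- A polynomial matrix of constant rank on an affine variety has a polynomial generalised
inverse. -/
theorem exists_generalised_inverse {α κ ρ : Type*} [Finite α] [Fintype κ] [DecidableEq κ]
    [Fintype ρ] [DecidableEq ρ] {S : Set (α → ℂ)} (hS : IsAffineVariety S) {n : ℕ}
    {A : (α → ℂ) → Matrix κ ρ ℂ} (hA : ∀ i j, PolyFun fun y => A y i j)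
    (hr : ∀ y ∈ S, (A y).rank = n) : ∃ R : (α → ℂ) → Matrix ρ κ ℂ,
      (∀ i j, PolyFun fun y => R y i j) ∧ ∀ y ∈ S, A y * R y * A y = A y := by
  choose a b hab using fun y : S => Matrix.exists_det_ne_zero (hr y y.2).ge
  set B : S → (α → ℂ) → Matrix (Fin n) (Fin n) ℂ := fun s y => b s * A y * a s
  have hB : ∀ s i j, PolyFun fun y => B s y i j := fun s i j => by
    simp only [B, Matrix.mul_apply]
    exact .sum _ fun _ _ => (PolyFun.sum _ fun _ _ => (PolyFun.const _).mul (hA _ _)).mul (.const _)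
  have hdet : ∀ C : (α → ℂ) → Matrix (Fin n) (Fin n) ℂ, (∀ i j, PolyFun fun y => C y i j) →
      PolyFun fun y => (C y).det := fun C hC => by
    simp only [Matrix.det_apply']
    exact .sum _ fun _ _ => (PolyFun.const _).mul (.prod _ fun _ _ => hC _ _)
  have hadj : ∀ s i j, PolyFun fun y => (B s y).adjugate i j := fun s i j => by
    simp only [Matrix.adjugate_apply]
    refine hdet _ fun i' j' => ?_
    by_cases h : i' = j <;> simp only [Matrix.updateRow_apply, h, if_true, if_false]
    exacts [.const _, hB _ _ _]
  obtain ⟨t, c, hc, hct⟩ := hS.exists_partition (F := fun s y => (B s y).det ^ 2)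
    (fun s => (hdet _ (hB s)).pow 2) fun y hy => ⟨⟨y, hy⟩, pow_ne_zero _ (hab ⟨y, hy⟩)⟩
  refine ⟨fun y => ∑ s ∈ t, (c s y * (B s y).det) • (a s * (B s y).adjugate * b s),
    fun i j => ?_, fun y hy => ?_⟩
  · simp only [Matrix.sum_apply, Matrix.smul_apply, smul_eq_mul, Matrix.mul_apply (M := _ * _),
      Matrix.mul_apply (M := a _)]
    exact .sum _ fun _ _ => ((hc _).mul (hdet _ (hB _))).mul (.sum _ fun _ _ =>
      (PolyFun.sum _ fun _ _ => (PolyFun.const _).mul (hadj _ _ _)).mul (.const _))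
  · have h1 : ∀ s ∈ t, A y * ((c s y * (B s y).det) • (a s * (B s y).adjugate * b s)) * A y =
        (c s y * (B s y).det ^ 2) • A y := fun s _ => by
      rw [Matrix.mul_smul, smul_mul]
      by_cases h : (B s y).det = 0
      · simp [h]
      · rw [Matrix.mul_adjugate_mul_eq (hr y hy) h, smul_smul, pow_two, mul_assoc]
    rw [Matrix.mul_sum, Matrix.sum_mul, sum_congr rfl h1, ← Finset.sum_smul, hct y hy,
      one_smul]

variable {N m D n : ℕ} {z : Forms N m D} {X : Set (ProjSp N)}
  {ρ ρ' : Type} {σ : HSpr N m D ρ}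
  {σ' : HSpr N m D ρ'} {y : Tens N m D}

theorem IsHSpray.comp (hσ : IsHSpray X z σ) (hσ' : IsHSpray X z σ') :
    IsHSpray X z fun w : TIdx N m D ⊕ (ρ ⊕ ρ') → ℂ => σ' (elim
      (σ (elim (fun a => w (.inl a)) fun r => w (.inr (.inl r)))) fun r => w (.inr (.inr r))) :=
  ⟨fun a => (hσ'.poly a).comp fun b => .sumElim (fun a => (hσ.poly a).comp fun b =>
    .sumElim (fun _ => .coord _) (fun _ => .coord _) b) (fun _ => .coord _) b,
    fun y hy _ => hσ'.mem _ (hσ.mem y hy _) _,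
    fun y => (hσ'.zero _).trans (hσ.zero y)⟩

variable [Fintype ρ] [DecidableEq ρ] [Fintype ρ'] [DecidableEq ρ']

theorem IsHSpray.rank_le (hσ : IsHSpray X z σ) (hσ' : IsHSpray X z σ') (e : ρ → ρ')
    (h : ∀ v : ρ' → ℂ, (∀ r ∉ range e, v r = 0) → σ' (elim y v) = σ (elim y (v ∘ e)))
    (he : Injective e) : (hD z σ y).rank ≤ (hD z σ' y).rank := by
  have h1 : ∀ i j r, hD z σ y (i, j) r = hD z σ' y (i, j) (e r) := by
    intro i j r
    set ι : ℂ →L[ℂ] (ρ' → ℂ) := ContinuousLinearMap.pi fun r' =>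
      if r' = e r then ContinuousLinearMap.id ℂ ℂ else 0
    set κ : ℂ →L[ℂ] (ρ → ℂ) := ContinuousLinearMap.pi fun r' =>
      if r' = r then ContinuousLinearMap.id ℂ ℂ else 0
    have hι : ∀ s r', ι s r' = if r' = e r then s else 0 := fun s r' => by
      by_cases h : r' = e r <;> simp [ι, h]
    have hκ : ∀ s r', κ s r' = if r' = r then s else 0 := fun s r' => by
      by_cases h : r' = r <;> simp [κ, h]
    have h2 := HasFDerivAt.comp (f := ι) (0 : ℂ)
      (by simpa using (hσ'.exists_hD i j).2 y) ι.hasFDerivAt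
    have h3 := HasFDerivAt.comp (f := κ) (0 : ℂ)
      (by simpa using (hσ.exists_hD i j).2 y) κ.hasFDerivAt
    have h4 : ∀ s, σ' (elim y (ι s)) = σ (elim y (κ s)) := fun s => by
      rw [h (ι s) fun r' hr' => by rw [hι, if_neg (fun h => hr' ⟨r, h.symm⟩)]]
      congr 2
      funext r'
      simp [hι, hκ, he.eq_iff]
    simp only [Function.comp_def, h4] at h2 h3
    have h5 := DFunLike.congr_fun (h3.unique h2) 1
    simpa [hι, hκ] using h5
  have h2 : hD z σ y = hD z σ' y * (1 : Matrix ρ' ρ' ℂ).submatrix id e :=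
    Matrix.ext fun a r => by simp [Matrix.mul_apply, Matrix.one_apply, ← h1]
  rw [h2]
  exact Matrix.rank_mul_le_left _ _

/-- There is a dominating horizontal spray on `jou X z`. -/
theorem exists_global_spray (hz : IsCutOut X z) (hX : IsAlgebraicallyElliptic n X) :
    ∃ (ρ : Type) (_ : Fintype ρ) (_ : DecidableEq ρ) (σ : HSpr N m D ρ),
      IsHSpray X z σ ∧ ∀ y ∈ jou X z, n ≤ (hD z σ y).rank := by
  choose r σ hσ hσr using fun y : jou X z => exists_local_spray hz hX y.2
  choose a b hab using fun y => Matrix.exists_det_ne_zero (hσr y)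
  obtain ⟨t, c, -, ht⟩ := (isAffineVariety_jou hz).exists_partition
    (F := fun s y => (b s * hD z (σ s) y * a s).det) (fun s => by
      simp only [Matrix.det_apply', Matrix.mul_apply]
      exact .sum _ fun _ _ => (PolyFun.const _).mul (.prod _ fun _ _ => .sum _ fun _ _ =>
        (PolyFun.sum _ fun _ _ => (PolyFun.const _).mul (((hσ s).exists_hD _ _).1 _)).mul
          (.const _))) fun y hy => ⟨⟨y, hy⟩, hab ⟨y, hy⟩⟩
  have h1 : ∀ t : Finset (jou X z), ∃ (ρ : Type) (_ : Fintype ρ) (_ : DecidableEq ρ)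
      (σ' : HSpr N m D ρ), IsHSpray X z σ' ∧
        ∀ s ∈ t, ∀ y, (hD z (σ s) y).rank ≤ (hD z σ' y).rank := by
    intro t
    induction t using Finset.induction_on with
    | empty =>
      exact ⟨Empty, inferInstance, inferInstance, fun w a => w (.inl a),
        ⟨fun a => .coord _, fun y hy _ => hy, fun y => rfl⟩, by simp⟩
    | insert s t hs ih =>
      obtain ⟨ρ, _, _, σ', h, h'⟩ := ih
      refine ⟨ρ ⊕ Fin (r s), inferInstance, inferInstance, _, h.comp (hσ s),
        (Finset.forall_mem_insert _ _ _).2 ⟨fun y => ?_, fun s' hs' y => (h' s' hs' y).trans ?_⟩⟩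
      · refine (hσ s).rank_le (h.comp (hσ s)) inr (fun v hv => ?_) Sum.inr_injective
        have h2 : (fun r => v (.inl r)) = 0 := funext fun r => hv _ (by simp)
        simp only [elim_inl, elim_inr, h2, h.zero]
        rfl
      · refine h.rank_le (h.comp (hσ s)) inl (fun v hv => ?_) Sum.inl_injective
        have h2 : (fun r => v (.inr r)) = 0 := funext fun r => hv _ (by simp)
        simp only [elim_inl, elim_inr, h2, (hσ s).zero]
        rfl
  obtain ⟨ρ, _, _, σ', h, h'⟩ := h1 t
  refine ⟨ρ, inferInstance, inferInstance, σ', h, fun y hy => ?_⟩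
  obtain ⟨s, hs, h0⟩ := Finset.exists_ne_zero_of_sum_ne_zero ((ht y hy).trans_ne one_ne_zero)
  exact ((Matrix.rank_mul_eq_of_det_ne_zero (right_ne_zero_of_mul h0)).trans
    (Matrix.rank_mul_le_left _ _)).trans (h' s hs y)

end GlobalSpray

section ConstantRank

variable {N m D n : ℕ} {z : Forms N m D} {X : Set (ProjSp N)}
  {ρ : Type} {σ : HSpr N m D ρ} {y : Tens N m D} {q : ProjSp N}
  {φ x : ℂ^(N + 1)}

theorem IsSmoothOfDim.exists_hasStrictFDerivAt (hs : IsSmoothOfDim X n) (hx : x ∈ projCone X) :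
    ∃ (g : ℂ^(N + 1) → ℂ^(N - n)) (L : ℂ^(N + 1) →L[ℂ] ℂ^(N - n)),
      HasStrictFDerivAt g L x ∧ Surjective L ∧
        ∀ᶠ w in 𝓝 x, w ∈ projCone X → g w = 0 := by
  obtain ⟨W, g, hW, hxW, hg, hsurj, hgX⟩ := hs x hx
  have h1 := hW.mem_nhds hxW
  refine ⟨g, fderiv ℂ g x, hasStrictFDerivAt_of_hasFDerivAt_of_continuousAt ?_
    ((continuousOn_fderiv_of_differentiableOn hW hg).continuousAt h1), hsurj x hxW, ?_⟩
  · filter_upwards [h1] with w hw using (hg.differentiableAt (hW.mem_nhds hw)).hasFDerivAt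
  · filter_upwards [h1] with w hw hwX using (hgX.subset ⟨hwX, hw⟩).2

theorem HasFDerivAt.apply_eq_zero_of_mem {E F G : Type*} [NormedAddCommGroup E] [NormedSpace ℂ E]
    [NormedAddCommGroup F] [NormedSpace ℂ F] [NormedAddCommGroup G] [NormedSpace ℂ G]
    {g : E → F} {L : E →L[ℂ] F} {c : G → E} {c' : G →L[ℂ] E} {S : Set E} {a : G} {x : E}
    (hg : HasFDerivAt g L x) (hc : HasFDerivAt c c' a) (hca : c a = x)
    (hS : ∀ᶠ w in 𝓝 x, w ∈ S → g w = 0) (hcS : ∀ᶠ v in 𝓝 a, c v ∈ S) (v : G) : L (c' v) = 0 := by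
  subst hca
  have h1 := hg.comp a hc
  have h2 : g ∘ c =ᶠ[𝓝 a] fun _ => 0 := by
    filter_upwards [hc.continuousAt.eventually hS, hcS] with v h1 h2 using h1 h2
  exact DFunLike.congr_fun (h1.unique ((hasFDerivAt_const 0 a).congr_of_eventuallyEq h2)) v

theorem LiesOver.mulVec_mem_projCone (hy : LiesOver z y q) (hq : q ∈ X) {u : ℂ^(N + 1)}
    (hu : (pr z y).mulVec u ≠ 0) : (pr z y).mulVec u ∈ projCone X :=
  ⟨hu, hy.eq_mk hu ▸ hq⟩

theorem LiesOver.eventually_mem_projCone (hy : LiesOver z y q) :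
    ∀ᶠ w in 𝓝 y, w ∈ jou X z → (pr z w).mulVec q.rep ∈ projCone X := by
  have h1 : Continuous fun w => (pr z w).mulVec q.rep := continuous_pi fun i =>
    show Continuous fun w => ∑ j, pr z w i j * q.rep j from continuous_finsetSum _ fun j _ =>
      (PolyFun.pr (fun a => .coord a) i j).continuous.mul continuous_const
  filter_upwards [h1.continuousAt.eventually_ne (y := 0)
    (by rw [hy.pr_mulVec_rep]; exact q.rep_nonzero)] with w hw ⟨q', hq', h⟩
  exact h.mulVec_mem_projCone hq' hw

variable [Fintype ρ] [DecidableEq ρ]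

theorem IsHSpray.hD_mulVec (hσ : IsHSpray X z σ) (hy : LiesOver z y q)
    (hφ : pr z y = vecMulVec q.rep φ) (v : ρ → ℂ) (i j : Fin (N + 1)) :
    (hD z σ y).mulVec v (i, j) = contr q.rep ((hD z σ y).mulVec v) i * φ j := by
  have h1 := (hasFDerivAt_pi'.1 (hσ.hasFDerivAt hy) i).mul_const (φ j)
  have h2 : ∀ v, (pr z (σ (elim y v))).mulVec q.rep i * φ j =
      (pr z (σ (elim y v)) * pr z y) i j := fun v => by
    rw [hφ, Matrix.mul_vecMulVec]
    rfl
  simp only [h2] at h1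
  have h3 := DFunLike.congr_fun (h1.unique ((hσ.exists_hD i j).2 y)) v
  simp only [smul_apply, ContinuousLinearMap.comp_apply, smul_eq_mul] at h3
  refine Eq.trans ?_ (h3.symm.trans (mul_comm _ _))
  simp [mulVec, dotProduct]

theorem IsHSpray.pr_mulVec_contr (hσ : IsHSpray X z σ) (hy : LiesOver z y q) (hq : q ∈ X)
    (v : ρ → ℂ) : (pr z y).mulVec (contr q.rep ((hD z σ y).mulVec v)) = 0 := by
  have hu := fun i => hasFDerivAt_pi'.1 (hσ.hasFDerivAt hy) i
  have hQ : ∀ i j, HasFDerivAt (fun v => pr z (σ (elim y v)) i j)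
      (fderiv ℂ (fun v => pr z (σ (elim y v)) i j) 0) 0 := fun i j =>
    ((PolyFun.comp (F := fun w : TIdx N m D ⊕ ρ → ℂ => pr z (σ w) i j)
      (G := fun v : ρ → ℂ => elim y v) (.pr hσ.poly i j) fun b => .sumElim_inr y b).differentiable 0).hasFDerivAt
  have h0 : pr z (σ (elim y 0)) = pr z y := by rw [hσ.zero]
  funext i
  have h1 := HasFDerivAt.fun_sum (u := Finset.univ (α := Fin (N + 1))) fun j _ => (hQ i j).mul_const (q.rep j)
  have h2 := HasFDerivAt.fun_sum (u := Finset.univ (α := Fin (N + 1))) fun j _ => (hQ i j).fun_mul (hu j)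
  have h3 : ∀ v : ρ → ℂ, ∑ j, pr z (σ (elim y v)) i j * (pr z (σ (elim y v))).mulVec q.rep j =
      ∑ j, pr z (σ (elim y v)) i j * q.rep j := fun v => by
    have h4 := liesOver_projT (hσ.mem y ⟨q, hq, hy⟩ v)
    have h5 := mulVec_mulVec q.rep (pr z (σ (elim y v))) (pr z (σ (elim y v)))
    rw [h4.pr_mul_pr h4] at h5
    exact congrFun h5 i
  simp only [h3] at h2
  have h5 := DFunLike.congr_fun (h2.unique h1) v
  simp only [_root_.sum_apply, add_apply, smul_apply,
    ContinuousLinearMap.comp_apply, sum_add_distrib, h0,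
    hy.pr_mulVec_rep] at h5
  exact add_eq_right.1 h5

/-- The image of a dominating horizontal spray complements the fibre direction in the tangent
space of the cone. -/
theorem IsHSpray.rank_eq (hσ : IsHSpray X z σ) (hy : LiesOver z y q) (hq : q ∈ X)
    {g : ℂ^(N + 1) → ℂ^(N - n)} {L : ℂ^(N + 1) →L[ℂ] ℂ^(N - n)}
    (hg : HasFDerivAt g L q.rep) (hL : Surjective L)
    (hgX : ∀ᶠ w in 𝓝 q.rep, w ∈ projCone X → g w = 0) (hr : n ≤ (hD z σ y).rank) :
    (hD z σ y).rank = n ∧ ∀ w, L w = 0 → ∃ v, w - (pr z y).mulVec w =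
      contr q.rep ((hD z σ y).mulVec v) := by
  obtain ⟨φ, hφ, -⟩ := hy.exists_pr
  set T := contr q.rep ∘ₗ (hD z σ y).mulVecLin with hT
  have h1 : (hD z σ y).rank ≤ Module.finrank ℂ (LinearMap.range T) := by
    set e : ℂ^(N + 1) →ₗ[ℂ] (Fin (N + 1) × Fin (N + 1) → ℂ) :=
      LinearMap.pi fun a => φ a.2 • LinearMap.proj a.1
    have h2 : (hD z σ y).mulVecLin = e ∘ₗ T := LinearMap.ext fun v => funext fun a => by
      refine (hσ.hD_mulVec hy hφ v a.1 a.2).trans (mul_comm _ _)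
    rw [Matrix.rank, h2, LinearMap.range_comp]
    exact Submodule.finrank_map_le _ _
  have h2 : LinearMap.range T ⊔ ℂ ∙ q.rep ≤ LinearMap.ker (L : ℂ^(N + 1) →ₗ[ℂ] ℂ^(N - n)) := by
    refine sup_le ?_ ((Submodule.span_singleton_le_iff_mem _ _).2 ?_)
    · rintro _ ⟨v, rfl⟩
      refine hg.apply_eq_zero_of_mem (hσ.hasFDerivAt hy) (by rw [hσ.zero, hy.pr_mulVec_rep]) hgX
        ?_ v
      have h3 : ContinuousAt (fun v => σ (elim y v)) 0 := continuousAt_pi.2 fun a =>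
        ((hσ.poly a).comp fun b => .sumElim_inr y b).continuous.continuousAt
      have h4 := h3.eventually (p := fun w => w ∈ jou X z → (pr z w).mulVec q.rep ∈ projCone X)
        (by beta_reduce; rw [hσ.zero]; exact hy.eventually_mem_projCone)
      filter_upwards [h4] with v hv using hv (hσ.mem y ⟨q, hq, hy⟩ v)
    · have h3 : HasFDerivAt (fun s : ℂ => s • q.rep)
          ((ContinuousLinearMap.id ℂ ℂ).smulRight q.rep) 1 := (hasFDerivAt_id 1).smul_const q.rep
      have h4 := hg.apply_eq_zero_of_mem h3 (one_smul _ _) hgX (S := projCone X) ?_ 1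
      · simpa using h4
      filter_upwards [continuousAt_id.eventually_ne one_ne_zero] with s hs
      refine ⟨smul_ne_zero hs q.rep_nonzero, ?_⟩
      rwa [mk_eq_of_smul _ q.rep_nonzero rfl, q.mk_rep]
  have h3 : Disjoint (LinearMap.range T) (ℂ ∙ q.rep) := by
    rw [Submodule.disjoint_def]
    rintro _ ⟨v, rfl⟩ h
    obtain ⟨a, ha⟩ := Submodule.mem_span_singleton.1 h
    have h4 := hσ.pr_mulVec_contr hy hq v
    change (pr z y).mulVec (T v) = 0 at h4
    rwa [← ha, mulVec_smul, hy.pr_mulVec_rep, ha] at h4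
  have h4 := Submodule.finrank_sup_add_finrank_inf_eq (LinearMap.range T) (ℂ ∙ q.rep)
  rw [h3.eq_bot, finrank_bot, finrank_span_singleton q.rep_nonzero] at h4
  have h5 := LinearMap.finrank_range_add_finrank_ker (L : ℂ^(N + 1) →ₗ[ℂ] ℂ^(N - n))
  rw [LinearMap.range_eq_top.2 hL, finrank_top, Module.finrank_fin_fun,
    Module.finrank_fin_fun] at h5
  have h6 := Submodule.finrank_mono h2
  refine ⟨by omega, fun w hw => ?_⟩
  have h7 := Submodule.eq_of_le_of_finrank_le h2 (by omega)
  have h8 : w ∈ LinearMap.range T ⊔ ℂ ∙ q.rep := h7 ▸ hw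
  obtain ⟨_, ⟨v, rfl⟩, _, hb, rfl⟩ := mem_sup.1 h8
  obtain ⟨a, rfl⟩ := Submodule.mem_span_singleton.1 hb
  refine ⟨v, ?_⟩
  have h9 := hσ.pr_mulVec_contr hy hq v
  change (pr z y).mulVec (T v) = 0 at h9
  rw [Matrix.mulVec_add, h9, mulVec_smul, hy.pr_mulVec_rep]
  simp [hT]

end ConstantRank

section Estimate

theorem LinearMap.exists_comp_eq_of_ker_le {k E F G : Type*} [Field k] [AddCommGroup E] [Module k E]
    [AddCommGroup F] [Module k F] [AddCommGroup G] [Module k G] {f : E →ₗ[k] F} {g : E →ₗ[k] G}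
    (h : LinearMap.ker f ≤ LinearMap.ker g) : ∃ T : F →ₗ[k] G, T ∘ₗ f = g := by
  obtain ⟨s, hs⟩ := ((LinearMap.ker f).liftQ f le_rfl).exists_leftInverse_of_injective
    (Submodule.ker_liftQ_eq_bot _ _ _ le_rfl)
  refine ⟨(LinearMap.ker f).liftQ g h ∘ₗ s, LinearMap.ext fun x => ?_⟩
  have h1 := LinearMap.congr_fun hs (Submodule.Quotient.mk x)
  simp only [LinearMap.comp_apply, Submodule.liftQ_apply, LinearMap.id_apply] at h1 ⊢
  rw [h1, Submodule.liftQ_apply]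

theorem Differentiable.hasStrictFDerivAt {E F : Type*} [NormedAddCommGroup E] [NormedSpace ℂ E]
    [FiniteDimensional ℂ E] [NormedAddCommGroup F] [NormedSpace ℂ F] [CompleteSpace F] {f : E → F}
    (hf : Differentiable ℂ f) (x : E) : HasStrictFDerivAt f (fderiv ℂ f x) x :=
  hasStrictFDerivAt_of_hasFDerivAt_of_continuousAt (.of_forall fun w => (hf w).hasFDerivAt)
    ((continuousOn_fderiv_of_differentiableOn isOpen_univ hf.differentiableOn).continuousAt
      Filter.univ_mem)

theorem exists_ball_norm_le_of_kernel {E F F' : Type*} [NormedAddCommGroup E] [NormedSpace ℂ E]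
    [FiniteDimensional ℂ E] [NormedAddCommGroup F] [NormedSpace ℂ F] [FiniteDimensional ℂ F]
    [NormedAddCommGroup F'] [NormedSpace ℂ F'] [CompleteSpace F'] {H : E × E → F'} {G : E → F}
    {G' : E →L[ℂ] F} {J : Set E} {y₀ : E} (hH : Differentiable ℂ H) (hH0 : ∀ y ∈ J, H (y, y) = 0)
    (hG : HasStrictFDerivAt G G' y₀) (hGJ : ∀ᶠ y in 𝓝 y₀, y ∈ J → G y = 0)
    (hker : ∀ e, G' e = 0 → HasDerivAt (fun s : ℂ => H (y₀, y₀ + s • e)) 0 0) {ε : ℝ}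
    (hε : 0 < ε) :
    ∃ r > 0, ∀ y ∈ ball y₀ r, ∀ y' ∈ ball y₀ r, y ∈ J → y' ∈ J →
      ‖H (y, y')‖ ≤ ε * ‖y' - y‖ := by
  set L := fderiv ℂ H (y₀, y₀)
  set Λ := L.comp (ContinuousLinearMap.inr ℂ E E)
  have h1 : LinearMap.ker (G' : E →ₗ[ℂ] F) ≤ LinearMap.ker (Λ : E →ₗ[ℂ] F') := fun e he => by
    have h2 : HasDerivAt (fun s : ℂ => (y₀, y₀ + s • e)) (0, e) 0 := by
      refine (hasDerivAt_const _ _).prodMk ?_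
      simpa using ((hasDerivAt_id (0 : ℂ)).smul_const e).const_add y₀
    have h3 : HasFDerivAt H L (y₀, y₀ + (0 : ℂ) • e) := by simpa using (hH (y₀, y₀)).hasFDerivAt
    exact (h3.comp_hasDerivAt 0 h2).unique (hker e he)
  obtain ⟨T, hT⟩ := LinearMap.exists_comp_eq_of_ker_le h1
  set T' := LinearMap.toContinuousLinearMap T
  have hT0 : 0 < ‖T'‖ + 1 := by positivity
  have h2 := (hH.hasStrictFDerivAt (y₀, y₀)).isLittleO.def (half_pos hε)
  have h3 := hG.isLittleO.def (div_pos (half_pos hε) hT0)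
  have h4 : Tendsto (fun p : E × E => ((p.1, p.2), (p.1, p.1))) (𝓝 (y₀, y₀))
      (𝓝 ((y₀, y₀), (y₀, y₀))) :=
    Continuous.tendsto' (by fun_prop) _ _ rfl
  have h5 : Tendsto (fun p : E × E => (p.2, p.1)) (𝓝 (y₀, y₀)) (𝓝 (y₀, y₀)) :=
    Continuous.tendsto' (by fun_prop) _ _ rfl
  have h6 := ((h4.eventually h2).and (h5.eventually h3)).and
    ((continuous_fst.tendsto' (y₀, y₀) y₀ rfl).eventually hGJ |>.and
      ((continuous_snd.tendsto' (y₀, y₀) y₀ rfl).eventually hGJ))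
  obtain ⟨r, hr, h⟩ := Metric.eventually_nhds_iff.1 h6
  refine ⟨r, hr, fun y hy y' hy' hyJ hyJ' => ?_⟩
  obtain ⟨⟨h7, h8⟩, h9, h10⟩ := h (y := (y, y')) (max_lt hy hy')
  simp only [hH0 y hyJ, h9 hyJ, h10 hyJ', sub_zero, zero_sub, norm_neg] at h7 h8
  have h11 : L ((y, y') - (y, y)) = T' (G' (y' - y)) := by
    rw [show (y, y') - (y, y) = ((0 : E), y' - y) by simp]
    exact (LinearMap.congr_fun hT (y' - y)).symm
  have h12 : ‖(y, y') - (y, y)‖ = ‖y' - y‖ := by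
    rw [show (y, y') - (y, y) = ((0 : E), y' - y) by simp, Prod.norm_mk, norm_zero,
      max_eq_right (norm_nonneg _)]
  rw [h11, h12] at h7
  have h13 : ‖T' (G' (y' - y))‖ ≤ ε / 2 * ‖y' - y‖ := by
    refine (T'.le_opNorm _).trans ((mul_le_mul (lt_add_one _).le h8 (norm_nonneg _) hT0.le).trans
      (le_of_eq ?_))
    field_simp
  have h14 := norm_add_le (H (y, y') - T' (G' (y' - y))) (T' (G' (y' - y)))
  rw [sub_add_cancel] at h14
  linarith

theorem exists_dist_le_of_local {E : Type*} [PseudoMetricSpace E] {J C : Set E} {P : E → E → Prop}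
    (h : ∀ y₀ ∈ J, ∃ r > 0, ∀ y ∈ ball y₀ r, ∀ y' ∈ ball y₀ r, y ∈ J → y' ∈ J →
      P y y') (hCJ : C ⊆ J) (hC : IsCompact C) :
    ∃ δ > 0, ∀ y ∈ C, ∀ y' ∈ C, dist y y' < δ → P y y' := by
  choose r hr h using h
  obtain ⟨δ, hδ, hL⟩ := lebesgue_number_lemma_of_metric hC
    (c := fun y₀ : J => ball y₀.1 (r y₀.1 y₀.2)) (fun _ => isOpen_ball) fun y hy =>
      mem_iUnion.2 ⟨⟨y, hCJ hy⟩, Metric.mem_ball_self (hr _ _)⟩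
  refine ⟨δ, hδ, fun y hy y' hy' hd => ?_⟩
  obtain ⟨y₀, hy₀⟩ := hL y hy
  exact h _ y₀.2 y (hy₀ (Metric.mem_ball_self hδ)) y' (hy₀ (by rwa [Metric.mem_ball, dist_comm]))
    (hCJ hy) (hCJ hy')

end Estimate

section GlobalSpray

variable {N m D n : ℕ} {z : Forms N m D} {X : Set (ProjSp N)}
  {ρ : Type} {σ : HSpr N m D ρ} {y : Tens N m D} {q : ProjSp N}

theorem HasDerivAt.tens_sub_tens {u u' : ℂ → ℂ^(N + 1)} {w : ℂ^(N + 1)}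
    {c : ℂ^m} (hu : HasDerivAt u w 0) (hu' : HasDerivAt u' w 0) (h : u 0 = u' 0) :
    HasDerivAt (fun s => (tens (u s) c - tens (u' s) c : Tens N m D)) 0 0 := by
  have h1 : Differentiable ℂ fun u : Fin (N + 1) → ℂ => (tens u c : Tens N m D) :=
    differentiable_pi.2 fun a =>
      ((PolyFun.prod _ fun i _ => .coord (a.1 i)).mul (.const _)).differentiable
  have h2 := (h1 (u 0)).hasFDerivAt.comp_hasDerivAt 0 hu
  have h3 := (h1 (u' 0)).hasFDerivAt.comp_hasDerivAt 0 hu'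
  rw [h] at h2
  simpa using h2.fun_sub h3

/-- The first-order solution of `pr z (σ (y, v)) = pr z y'` for `v`. -/
def lift₁ (z : Forms N m D)
    (R : Matrix ρ (Fin (N + 1) × Fin (N + 1)) ℂ) (y y' : Tens N m D) : ρ → ℂ :=
  R.mulVec fun a => ((1 - pr z y) * pr z y' * pr z y) a.1 a.2

theorem PolyFun.lift₁ {R : (Tens N m D) → Matrix ρ (Fin (N + 1) × Fin (N + 1)) ℂ}
    (hR : ∀ i j, PolyFun fun y => R y i j) (r : ρ) :
    PolyFun fun p : TIdx N m D ⊕ TIdx N m D → ℂ =>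
      lift₁ z (R fun a => p (inl a)) (fun a => p (inl a)) (fun a => p (inr a)) r := by
  refine .sum _ fun b _ => ((hR r b).comp fun _ => .coord _).mul
    (.matMul (.matMul (fun i j => ?_) fun i j => .pr (fun _ => .coord _) i j)
      (fun i j => .pr (fun _ => .coord _) i j) _ _)
  exact (PolyFun.const ((1 : Matrix (Fin (N + 1)) (Fin (N + 1)) ℂ) i j)).sub
    (.pr (fun _ => .coord _) i j)

theorem lift₁_self {R : Matrix ρ (Fin (N + 1) × Fin (N + 1)) ℂ} (hy : LiesOver z y q) :
    lift₁ z R y y = 0 := by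
  rw [lift₁, Matrix.sub_mul, hy.pr_mul_pr hy, Matrix.one_mul, sub_self, Matrix.zero_mul]
  exact Matrix.mulVec_zero R

variable [Fintype ρ] [DecidableEq ρ]

theorem IsHSpray.hasDerivAt_corr (hσ : IsHSpray X z σ) (hy : LiesOver z y q) (hq : q ∈ X)
    {g : ℂ^(N + 1) → ℂ^(N - n)} {L : ℂ^(N + 1) →L[ℂ] ℂ^(N - n)}
    (hg : HasFDerivAt g L q.rep) (hL : Surjective L)
    (hgX : ∀ᶠ w in 𝓝 q.rep, w ∈ projCone X → g w = 0) (hr : n ≤ (hD z σ y).rank)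
    {R : Matrix ρ (Fin (N + 1) × Fin (N + 1)) ℂ} (hR : hD z σ y * R * hD z σ y = hD z σ y)
    {e : Tens N m D} (h0 : lam z e = 0) (h1 : L ((pr z e).mulVec q.rep) = 0)
    (h2 : pr z y * pr z e + pr z e * pr z y = pr z e)
    (h3 : HasDerivAt (fun s : ℂ => ten (pr z (y + s • e)) (y + s • e) - (y + s • e)) 0 0) :
    HasDerivAt (fun s : ℂ => corr z (σ (elim y (lift₁ z R y (y + s • e))))
      (y + s • e - σ (elim y (lift₁ z R y (y + s • e)))) - (y + s • e)) 0 0 := by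
  obtain ⟨φ, hφ, -⟩ := hy.exists_pr
  obtain ⟨c, hc⟩ := hy.2
  obtain ⟨v, hv⟩ := (hσ.rank_eq hy hq hg hL hgX hr).2 _ h1
  have hPP := hy.pr_mul_pr hy
  set w := lift₁ z R y e with hw
  have h4 : (pr z y).mulVec ((pr z e).mulVec q.rep) = 0 := by
    have h5 := congrArg (fun A => A.mulVec q.rep) h2
    simp only [Matrix.add_mulVec, ← mulVec_mulVec, hy.pr_mulVec_rep] at h5
    exact add_eq_right.1 h5
  have h5 : (fun a => ((1 - pr z y) * pr z e * pr z y) a.1 a.2) = (hD z σ y).mulVec v := by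
    funext ⟨i, j⟩
    rw [hσ.hD_mulVec hy hφ, ← hv, h4, sub_zero]
    conv_lhs => rw [hφ, Matrix.mul_vecMulVec, ← mulVec_mulVec, Matrix.sub_mulVec, ← hφ, h4]
    simp [vecMulVec_apply]
  have h6 : contr q.rep ((hD z σ y).mulVec w) = (pr z e).mulVec q.rep := by
    rw [hw, lift₁, h5, mulVec_mulVec, mulVec_mulVec, hR, ← hv,
      h4, sub_zero]
  have h7 : ∀ s : ℂ, lift₁ z R y (y + s • e) = s • w := fun s => by
    rw [hw, lift₁, lift₁, ← mulVec_smul, pr_add, pr_smul, Matrix.mul_add, Matrix.sub_mul,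
      hPP, Matrix.one_mul, sub_self, zero_add, Matrix.mul_smul, smul_mul]
    rfl
  simp only [h7]
  set Y : ℂ → Tens N m D := fun s => σ (elim y (s • w)) with hY
  have hY0 : Y 0 = y := by rw [hY]; beta_reduce; rw [zero_smul, hσ.zero]
  have hl : HasDerivAt (fun s : ℂ => s • w) w 0 := by
    simpa using (hasDerivAt_id (0 : ℂ)).smul_const w
  have hl' : HasDerivAt (fun s : ℂ => y + s • e) e 0 := by
    simpa using ((hasDerivAt_id (0 : ℂ)).smul_const e).const_add y
  have h8 : HasDerivAt (fun s => (pr z (Y s)).mulVec q.rep) ((pr z e).mulVec q.rep) 0 := by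
    have h9 := hσ.hasFDerivAt hy
    rw [← zero_smul ℂ w] at h9
    exact (h9.comp_hasDerivAt 0 hl).congr_deriv h6
  have h9 : ∀ s : ℂ, (pr z (y + s • e)).mulVec q.rep = q.rep + s • (pr z e).mulVec q.rep :=
    fun s => by rw [pr_add, pr_smul, Matrix.add_mulVec, smul_mulVec, hy.pr_mulVec_rep]
  have h10 : HasDerivAt (fun s : ℂ => (pr z (y + s • e)).mulVec q.rep)
      ((pr z e).mulVec q.rep) 0 := by
    simp only [h9]
    simpa using ((hasDerivAt_id (0 : ℂ)).smul_const ((pr z e).mulVec q.rep)).const_add q.rep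
  have h11 := h8.tens_sub_tens (D := D) (c := c) h10 (by simp [hY0])
  have hdY : DifferentiableAt ℂ Y 0 := by
    have h12 : Differentiable ℂ fun v => σ (elim y v) := differentiable_pi.2 fun a =>
      ((hσ.poly a).comp fun b => .sumElim_inr y b).differentiable
    exact (h12 _).comp 0 hl.differentiableAt
  have hten : Differentiable ℂ fun T => ten (pr z T) e := differentiable_pi.2 fun a =>
    (PolyFun.ten (G := fun _ => e) (Q := pr z) (fun _ => .const _)
      (fun i j => .pr (fun a => .coord a) i j) a).differentiable
  have h12 : DifferentiableAt ℂ (fun s : ℂ => ten (pr z (Y s)) e - ten (pr z (y + s • e)) e) 0 :=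
    ((hten _).comp 0 hdY).fun_sub ((hten _).comp 0 hl'.differentiableAt)
  have h13 := ((hasDerivAt_id (0 : ℂ)).fun_smul h12.hasDerivAt).fun_add h11 |>.fun_add h3
  have h14 : ∀ s : ℂ, id s • (ten (pr z (Y s)) e - ten (pr z (y + s • e)) e) +
      (tens ((pr z (Y s)).mulVec q.rep) c - tens ((pr z (y + s • e)).mulVec q.rep) c) +
      (ten (pr z (y + s • e)) (y + s • e) - (y + s • e)) =
      ten (pr z (Y s)) (y + s • e) - (y + s • e) := fun s => by
    have h15 : ∀ A : Matrix (Fin (N + 1)) (Fin (N + 1)) ℂ,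
        ten A (y + s • e) = tens (A.mulVec q.rep) c + s • ten A e := fun A => by
      rw [ten_add, ← ten_tens, ← hc]
      congr 1
      funext a
      simp [ten, mul_sum, mul_left_comm]
    rw [h15, h15, id, smul_sub]
    abel
  simp only [h14] at h13
  simp only [id, hY0, zero_smul, add_zero, sub_self, smul_zero] at h13
  set lamL : (Tens N m D) →L[ℂ] ℂ := LinearMap.toContinuousLinearMap
    (IsLinearMap.mk' (lam z) ⟨fun _ _ => lam_add, fun _ _ => lam_smul _⟩)
  have h16 := h13.fun_sub ((lamL.hasFDerivAt.comp_hasDerivAt 0 h13).smul hdY.hasDerivAt)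
  refine (h16.congr_deriv ?_).congr_of_eventuallyEq (.of_forall fun s => ?_)
  · have h17 : ten (pr z y) y = y := hy.ten_pr hy
    simp [hY0, h17]
  · have h17 := liesOver_projT (hσ.mem y ⟨q, hq, hy⟩ (s • w))
    change LiesOver z (Y s) _ at h17
    change corr z (Y s) (y + s • e - Y s) - _ = (ten (pr z (Y s)) (y + s • e) - (y + s • e)) -
      lam z (ten (pr z (Y s)) (y + s • e) - (y + s • e)) • Y s
    rw [corr, ten_sub, h17.ten_pr h17, lam_sub, lam_sub, h17.1, lam_add, lam_smul, h0, hy.1]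
    simp only [sub_smul, one_smul, mul_zero, add_zero]
    abel

theorem IsHSpray.exists_ball (hs : IsSmoothOfDim X n) (hσ : IsHSpray X z σ)
    (hr : ∀ y ∈ jou X z, n ≤ (hD z σ y).rank)
    {R : (Tens N m D) → Matrix ρ (Fin (N + 1) × Fin (N + 1)) ℂ}
    (hR : ∀ i j, PolyFun fun y => R y i j)
    (hRD : ∀ y ∈ jou X z, hD z σ y * R y * hD z σ y = hD z σ y) {y₀ : Tens N m D}
    (hy₀ : y₀ ∈ jou X z) {ε : ℝ} (hε : 0 < ε) :
    ∃ r > 0, ∀ y ∈ ball y₀ r, ∀ y' ∈ ball y₀ r, y ∈ jou X z → y' ∈ jou X z →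
      ‖corr z (σ (elim y (lift₁ z (R y) y y'))) (y' - σ (elim y (lift₁ z (R y) y y'))) - y'‖
        ≤ ε * ‖y' - y‖ := by
  obtain ⟨q, hq, hy⟩ := id hy₀
  have hqX : q.rep ∈ projCone X := ⟨q.rep_nonzero, by rwa [q.mk_rep]⟩
  obtain ⟨g, L, hg, hL, hgX⟩ := hs.exists_hasStrictFDerivAt hqX
  have hc : ∀ a : TIdx N m D, PolyFun fun y : Tens N m D => y a := fun a => .coord a
  have hp : ∀ i j, PolyFun fun y => pr z y i j := fun i j => .pr hc i j
  set E : (Tens N m D) →L[ℂ] ℂ^(N + 1) := LinearMap.toContinuousLinearMap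
    (IsLinearMap.mk' (fun e => (pr z e).mulVec q.rep)
      ⟨fun _ _ => by rw [pr_add, Matrix.add_mulVec], fun _ _ => by rw [pr_smul, smul_mulVec]⟩)
  set G₁ : (Tens N m D) → Fin (N + 1) → ℂ^(N + 1) := fun y i j =>
    (pr z y * pr z y) i j - pr z y i j
  have hG₁ : Differentiable ℂ G₁ := differentiable_pi.2 fun i => differentiable_pi.2 fun j =>
    ((PolyFun.matMul hp hp i j).sub (hp i j)).differentiable
  set G₂ : (Tens N m D) → Tens N m D := fun y => ten (pr z y) y - y
  have hG₂ : Differentiable ℂ G₂ := differentiable_pi.2 fun a =>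
    ((PolyFun.ten hc hp a).sub (hc a)).differentiable
  set lamL : (Tens N m D) →L[ℂ] ℂ := LinearMap.toContinuousLinearMap
    (IsLinearMap.mk' (lam z) ⟨fun _ _ => lam_add, fun _ _ => lam_smul _⟩)
  have hEq : E y₀ = q.rep := hy.pr_mulVec_rep
  rw [← hEq] at hg
  have hG := (hg.comp y₀ E.hasStrictFDerivAt).prodMk ((hG₁.hasStrictFDerivAt y₀).prodMk
    ((hG₂.hasStrictFDerivAt y₀).prodMk (lamL.hasStrictFDerivAt.sub_const 1)))
  have hline : ∀ e, HasDerivAt (fun s : ℂ => y₀ + s • e) e 0 := fun e => by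
    simpa using ((hasDerivAt_id (0 : ℂ)).smul_const e).const_add y₀
  have hcurve : ∀ {F : Type} [NormedAddCommGroup F] [NormedSpace ℂ F]
      (G : (Tens N m D) → F) (hG : Differentiable ℂ G) (e : Tens N m D),
      HasDerivAt (fun s : ℂ => G (y₀ + s • e)) (fderiv ℂ G y₀ e) 0 := fun G hG e => by
    have h1 := (hG (y₀ + (0 : ℂ) • e)).hasFDerivAt.comp_hasDerivAt 0 (hline e)
    rwa [zero_smul, add_zero] at h1
  refine exists_ball_norm_le_of_kernel (F' := Tens N m D) (J := jou X z) (H := fun p =>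
    corr z (σ (elim p.1 (lift₁ z (R p.1) p.1 p.2)))
      (p.2 - σ (elim p.1 (lift₁ z (R p.1) p.1 p.2))) - p.2) ?_ ?_ hG ?_ ?_ hε
  · have h1 : Differentiable ℂ fun p : (Tens N m D) × (Tens N m D) =>
        elim p.1 p.2 := differentiable_pi.2 fun a => by
      rcases a with a | a
      exacts [by simpa using by fun_prop, by simpa using by fun_prop]
    have h2 : ∀ a : TIdx N m D, PolyFun fun p : TIdx N m D ⊕ TIdx N m D → ℂ =>
        σ (elim (fun a => p (inl a)) (_root_.lift₁ z (R fun a => p (inl a))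
          (fun a => p (inl a)) fun a => p (inr a))) a := fun a =>
      (hσ.poly a).comp fun b => .sumElim (fun _ => .coord _) (fun _ => .lift₁ hR _) b
    exact differentiable_pi.2 fun a => (((PolyFun.corr (z := z) h2 fun a =>
      (PolyFun.coord (inr a)).sub (h2 a)) a).sub (.coord (inr a))).differentiable.comp h1
  · rintro y ⟨q', -, hy'⟩
    simp only [lift₁_self hy', hσ.zero]
    rw [hy'.corr_sub hy', sub_self]
  · filter_upwards [hy.eventually_mem_projCone (X := X),
      E.continuous.continuousAt.eventually (hEq.symm ▸ hgX)] with y h1 h2 hyJ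
    have h3 := liesOver_projT hyJ
    have h4 : g (E y) = 0 := h2 (h1 hyJ)
    have h5 : G₁ y = 0 := by
      funext i j
      simp [G₁, h3.pr_mul_pr h3]
    have h6 : G₂ y = 0 := sub_eq_zero.2 (h3.ten_pr h3)
    have h7 : lamL y - 1 = 0 := sub_eq_zero.2 h3.1
    simp only [h4, h5, h6, h7]
    rfl
  · intro e he
    obtain ⟨h1, h2, h3, h4⟩ : L (E e) = 0 ∧ fderiv ℂ G₁ y₀ e = 0 ∧ fderiv ℂ G₂ y₀ e = 0 ∧
      lamL e = 0 := by simpa [Prod.ext_iff] using he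
    have h5 := hcurve G₁ hG₁ e
    have h6 := hcurve G₂ hG₂ e
    rw [h2] at h5
    rw [h3] at h6
    rw [hEq] at hg
    refine hσ.hasDerivAt_corr hy hq hg.hasFDerivAt hL hgX (hr y₀ hy₀) (hRD y₀ hy₀) h4 h1 ?_ h6
    have hPP := hy.pr_mul_pr hy
    ext i j
    have h7 := hasDerivAt_pi.1 (hasDerivAt_pi.1 h5 i) j
    have h8 : ∀ s : ℂ, G₁ (y₀ + s • e) i j = s * ((pr z y₀ * pr z e + pr z e * pr z y₀) i j -
        pr z e i j) + s ^ 2 * (pr z e * pr z e) i j := fun s => by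
      simp only [G₁, pr_add, pr_smul, Matrix.add_mul, Matrix.mul_add, hPP, smul_mul,
        Matrix.mul_smul, Matrix.add_apply, Matrix.smul_apply, smul_eq_mul]
      ring
    simp only [h8] at h7
    have h9 := (((hasDerivAt_id (0 : ℂ)).mul_const ((pr z y₀ * pr z e + pr z e * pr z y₀) i j -
      pr z e i j)).add (((hasDerivAt_id (0 : ℂ)).pow 2).mul_const ((pr z e * pr z e) i j))).unique h7
    simpa [sub_eq_zero] using h9

theorem exists_spray_star (hz : IsCutOut X z) (hs : IsSmoothOfDim X n)
    (hX : IsAlgebraicallyElliptic n X) :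
    ∃ (ρ : Type) (_ : Fintype ρ) (σ : TIdx N m D → MvPolynomial (TIdx N m D ⊕ ρ) ℂ)
      (w : ρ → MvPolynomial (TIdx N m D ⊕ TIdx N m D) ℂ),
      (∀ y ∈ jou X z, ∀ v, evalMap σ (elim y v) ∈ jou X z) ∧
      (∀ y ∈ jou X z, evalMap σ (elim y 0) = y) ∧
      (∀ y ∈ jou X z, evalMap w (elim y y) = 0) ∧
      ∀ C ⊆ jou X z, IsCompact C → ∃ δ > 0, ∀ y ∈ C, ∀ y' ∈ C, dist y y' < δ →
        dist (evalMap σ (elim y (evalMap w (elim y y')))) y' ≤ dist y y' / 4 := by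
  obtain ⟨ρ, _, _, σ, hσ, hr⟩ := exists_global_spray hz hX
  obtain ⟨R, hR, hRD⟩ := exists_generalised_inverse (isAffineVariety_jou hz)
    (n := n) (A := hD z σ) (fun i j => (hσ.exists_hD i.1 i.2).1 j) fun y ⟨q, hq, hy⟩ => by
      obtain ⟨g, L, hg, hL, hgX⟩ := hs.exists_hasStrictFDerivAt
        (x := q.rep) ⟨q.rep_nonzero, by rwa [q.mk_rep]⟩
      exact (hσ.rank_eq hy hq hg.hasFDerivAt hL hgX (hr y ⟨q, hq, hy⟩)).1
  have h1 : ∀ a : TIdx N m D, PolyFun fun p : TIdx N m D ⊕ (ρ ⊕ TIdx N m D) → ℂ =>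
      σ (elim (fun a => p (inl a)) fun r => p (inr (inl r))) a := fun a =>
    (hσ.poly a).comp fun b => .sumElim (fun _ => .coord _) (fun _ => .coord _) b
  have h2 : ∀ a : TIdx N m D, PolyFun fun p : TIdx N m D ⊕ TIdx N m D → ℂ =>
      σ (elim (fun a => p (inl a)) (lift₁ z (R fun a => p (inl a))
        (fun a => p (inl a)) fun a => p (inr a))) a := fun a =>
    (hσ.poly a).comp fun b => .sumElim (fun _ => .coord _) (fun _ => .lift₁ hR _) b
  obtain ⟨s, hs'⟩ := exists_evalMap_eq (β := TIdx N m D) (PolyFun.corr (z := z) h1 fun a =>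
    PolyFun.coord (inr (inr a)))
  obtain ⟨w, hw⟩ := exists_evalMap_eq (β := ρ ⊕ TIdx N m D) (PolyFun.sumElim (fun r => .lift₁ (z := z) hR r) fun a =>
    (PolyFun.coord (inr a)).sub (h2 a))
  refine ⟨ρ ⊕ TIdx N m D, inferInstance, s, w, fun y hy v => ?_, fun y hy => ?_,
    fun y ⟨q, hq, hy⟩ => ?_, fun C hCJ hC => ?_⟩
  · rw [hs']
    obtain ⟨q, hq, h⟩ := hσ.mem y hy fun r => v (inl r)
    exact ⟨q, hq, h.corr _⟩
  · rw [hs']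
    have h3 := hσ.zero y
    have h4 := liesOver_projT hy
    have h5 := h4.corr_sub h4
    rw [sub_self] at h5
    change corr z (σ (elim y 0)) 0 = y
    rw [h3, h5]
  · rw [hw]
    change elim (lift₁ z (R y) y y) (y - σ (elim y (lift₁ z (R y) y y))) = 0
    rw [lift₁_self hy, hσ.zero, sub_self]
    exact Sum.elim_zero_zero
  · obtain ⟨δ, hδ, h⟩ := exists_dist_le_of_local (fun y₀ hy₀ => hσ.exists_ball hs hr hR hRD hy₀
      (ε := 1 / 4) (by norm_num)) hCJ hC
    refine ⟨δ, hδ, fun y hy y' hy' hd => ?_⟩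
    have h3 := h y hy y' hy' hd
    rw [hs', hw, dist_eq_norm, dist_comm, dist_eq_norm]
    refine le_trans h3 (le_of_eq (by ring))

end GlobalSpray

section LocalLift

variable {M N m D : ℕ} {z : Forms N m D} {T : ℂ^M → Tens N m D}
  {q : ProjSp N} {X : Set (ProjSp N)} {S K : Set ℂ^M} {p : ℂ^M} {ψ ψ' : ℂ^M → ProjSp N}

open scoped ComplexOrder in
theorem star_dotProduct_ne_zero {v : ℂ^(N + 1)} (hv : v ≠ 0) : star v ⬝ᵥ v ≠ 0 :=
  dotProduct_star_self_eq_zero.not.2 hv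

/-- The orthogonal projection onto a line. -/
def oproj (q : ProjSp N) : Matrix (Fin (N + 1)) (Fin (N + 1)) ℂ :=
  (star q.rep ⬝ᵥ q.rep)⁻¹ • vecMulVec q.rep (star q.rep)

theorem oproj_mk {v : ℂ^(N + 1)} (hv : v ≠ 0) : oproj (mk ℂ v hv) =
    (star v ⬝ᵥ v)⁻¹ • vecMulVec v (star v) := by
  obtain ⟨a, ha, h⟩ := exists_rep_eq hv
  have h1 : star a ≠ 0 := star_ne_zero.2 ha
  ext i j
  simp only [oproj, h, star_smul, smul_dotProduct, dotProduct_smul, Matrix.smul_apply,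
    vecMulVec_apply, Pi.smul_apply, smul_eq_mul]
  field_simp

theorem continuous_oproj : Continuous (oproj : ProjSp N → _) := by
  refine (isQuotientMap_quot_mk (X := {v : Fin (N + 1) → ℂ // v ≠ 0})).continuous_iff.2 ?_
  have h1 : (oproj ∘ Quot.mk _ : {v : Fin (N + 1) → ℂ // v ≠ 0} → _) =
      fun v => (star v.1 ⬝ᵥ v.1)⁻¹ • vecMulVec v.1 (star v.1) :=
    funext fun v => oproj_mk v.2
  refine Continuous.congr ?_ (congrFun h1.symm)
  have h2 : Continuous fun v : {v : Fin (N + 1) → ℂ // v ≠ 0} => star v.1 :=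
    continuous_subtype_val.star
  exact ((h2.dotProduct continuous_subtype_val).inv₀ fun v => star_dotProduct_ne_zero v.2).smul
    (continuous_subtype_val.matrix_vecMulVec h2)

theorem oproj_mulVec {v : ℂ^(N + 1)} (hv : v ≠ 0) (w : ℂ^(N + 1)) :
    (oproj (mk ℂ v hv)).mulVec w = ((star v ⬝ᵥ w) / (star v ⬝ᵥ v)) • v := by
  rw [oproj_mk, smul_mulVec, Matrix.vecMulVec_mulVec, op_smul_eq_smul, smul_smul,
    div_eq_inv_mul]

theorem exists_ten_oproj (q : ProjSp N) (B : Tens N m D) :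
    ∃ c, ten (oproj q) B = tens q.rep c := by
  rw [oproj, ← Matrix.smul_vecMulVec, ten_vecMulVec, tens_smul]
  exact ⟨_, rfl⟩

theorem trace_oproj_mul_self (q : ProjSp N) : (oproj q * oproj q).trace = 1 := by
  have h : star q.rep ⬝ᵥ q.rep ≠ 0 := star_dotProduct_ne_zero q.rep_nonzero
  rw [oproj, smul_mul, Matrix.mul_smul, Matrix.vecMulVec_mul_vecMulVec, Matrix.trace_smul,
    Matrix.trace_smul, Matrix.trace_vecMulVec]
  simp only [smul_dotProduct, dotProduct_comm q.rep, smul_eq_mul]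
  field_simp

theorem HolOnS.polyFun {β : Type*} {h : ℂ^M → β → ℂ} {F : (β → ℂ) → ℂ} (hF : PolyFun F)
    (hh : ∀ i, HolOnS S p fun z => h z i) : HolOnS S p fun z => F (h z) := by
  obtain ⟨P, hP⟩ := hF
  simpa only [hP] using HolOnS.eval hh P

/-- `ψ` is holomorphic on `S` near `p`. -/
def HolProjAt (S : Set ℂ^M) (p : ℂ^M) (ψ : ℂ^M → ProjSp N) : Prop :=
  ∃ G : ℂ^M → ℂ^(N + 1), (∀ j, HolOnS S p fun z => G z j) ∧
    ∀ᶠ z in 𝓝[S] p, ∃ h : G z ≠ 0, ψ z = mk ℂ (G z) h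

theorem HolProjAt.exists_smul (hp : p ∈ S) (h1 : HolProjAt S p ψ)
    (h2 : HolProjAt S p ψ') (hT : ∀ a, HolOnS S p fun x => T x a)
    (hTψ : ∀ᶠ x in 𝓝[S] p, LiesOver z (T x) (ψ x)) :
    ∃ (κ : ℂ^M → ℂ) (R : ℂ^M → Tens N m D),
      (∀ᶠ x in 𝓝 p, x ∈ S → ContinuousWithinAt κ S x) ∧ (∀ a, HolOnS S p fun x => R x a) ∧
      ∀ᶠ x in 𝓝[S] p, ten (oproj (ψ' x)) (T x) = κ x • R x := by
  obtain ⟨G, hG, hGψ⟩ := h1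
  obtain ⟨G', hG', hGψ'⟩ := h2
  obtain ⟨j, hj⟩ := ne_iff.1 (hGψ.self_of_nhdsWithin hp).1
  have hj' : ∀ᶠ x in 𝓝[S] p, G x j ≠ 0 :=
    ((hG j).continuousWithinAt hp).eventually_ne (by simpa using hj)
  refine ⟨fun x => ((star (G' x) ⬝ᵥ G x) / (star (G' x) ⬝ᵥ G' x) / G x j) ^ (D + 1),
    fun x => tens (G' x) fun k => T x (fun _ => j, k), ?_, fun a => ?_, ?_⟩
  · filter_upwards [eventually_all.2 fun i => (hG i).eventually,
      eventually_all.2 fun i => (hG' i).eventually, eventually_nhdsWithin_iff.1 hj',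
      eventually_nhdsWithin_iff.1 hGψ'] with x a1 a2 a3 a4 hx
    have b1 : ContinuousWithinAt G S x := continuousWithinAt_pi.2 fun i =>
      (a1 i).continuousWithinAt hx
    have b2 : ContinuousWithinAt G' S x := continuousWithinAt_pi.2 fun i =>
      (a2 i).continuousWithinAt hx
    have b3 : ∀ {H : ℂ^M → ℂ^(N + 1)}, ContinuousWithinAt H S x →
        ContinuousWithinAt (fun x => star (G' x) ⬝ᵥ H x) S x := fun h =>
      tendsto_finsetSum _ fun i _ => ((continuousWithinAt_pi.1 b2 i).star).mul
        (continuousWithinAt_pi.1 h i)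
    exact (((b3 b1).div (b3 b2) (star_dotProduct_ne_zero (a4 hx).1)).div
      (continuousWithinAt_pi.1 b1 j) (a3 hx)).pow _
  · exact HolOnS.polyFun (h := fun x => elim (G' x) (T x))
      (F := fun y => (∏ i, y (.inl (a.1 i))) * y (.inr (fun _ => j, a.2)))
      ((PolyFun.prod _ fun _ _ => .coord _).mul (.coord _)) fun i => i.casesOn hG' hT
  · filter_upwards [hTψ, hGψ, hGψ', hj'] with x a1 ⟨b1, b2⟩ ⟨c1, c2⟩ a2
    rw [b2, liesOver_mk] at a1
    obtain ⟨-, c, hc⟩ := a1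
    have h3 : (fun k => T x (fun _ => j, k)) = (G x j) ^ (D + 1) • c := by
      funext k
      simp [hc, tens, mono]
    rw [h3, hc, c2, ten_tens, oproj_mulVec, tens_smul, tens_smul_right, tens_smul_right, smul_smul,
      ← mul_pow, div_mul_cancel₀ _ a2]

/-- `T` is a holomorphic lift of `ψ` on a neighbourhood of `p`. -/
def IsLiftAt (S : Set ℂ^M) (z : Forms N m D)
    (ψ : ℂ^M → ProjSp N) (T : ℂ^M → Tens N m D) (p : ℂ^M) : Prop :=
  (∀ a, HolOnS S p fun x => T x a) ∧ ∀ᶠ x in 𝓝[S] p, LiesOver z (T x) (ψ x)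

theorem HolOnS.lam (hT : ∀ a, HolOnS S p fun x => T x a) : HolOnS S p fun x => lam z (T x) :=
  HolOnS.polyFun (F := _root_.lam z) (PolyFun.lam fun a => .coord a) hT

theorem IsLiftAt.normalise (hp : p ∈ S) (h1 : HolProjAt S p ψ) (h2 : HolProjAt S p ψ')
    (hT : IsLiftAt S z ψ T p) (h0 : lam z (ten (oproj (ψ' p)) (T p)) ≠ 0) :
    IsLiftAt S z ψ' (fun x => (lam z (ten (oproj (ψ' x)) (T x)))⁻¹ • ten (oproj (ψ' x)) (T x)) p := by
  obtain ⟨κ, R, hκ, hR, e⟩ := h1.exists_smul hp h2 hT.1 hT.2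
  have e0 := e.self_of_nhdsWithin hp
  rw [e0, lam_smul] at h0
  have h3 : ∀ᶠ x in 𝓝[S] p, κ x ≠ 0 :=
    (hκ.self_of_nhds hp).eventually_ne (left_ne_zero_of_mul h0)
  have h4 := HolOnS.lam (z := z) hR
  have h5 : ∀ᶠ x in 𝓝[S] p, lam z (R x) ≠ 0 :=
    (h4.continuousWithinAt hp).eventually_ne (right_ne_zero_of_mul h0)
  refine ⟨fun a => ((h4.inv hp (right_ne_zero_of_mul h0)).fun_mul (hR a)).congr ?_, ?_⟩
  · filter_upwards [e, h3] with x a1 a2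
    simp only [a1, lam_smul, Pi.smul_apply, smul_eq_mul]
    field_simp
  · filter_upwards [e, h3, h5] with x a1 a2 a3
    refine ⟨by rw [lam_smul, a1, lam_smul]; exact inv_mul_cancel₀ (mul_ne_zero a2 a3), ?_⟩
    obtain ⟨c, hc⟩ := exists_ten_oproj (ψ' x) (T x)
    exact ⟨_ • c, by rw [hc, tens_smul_right]⟩

theorem ten_oproj_ne_zero {q q' : ProjSp N} {T : Tens N m D} (hT : LiesOver z T q)
    (h : (oproj q' * oproj q).trace ≠ 0) : ten (oproj q') T ≠ 0 := by
  obtain ⟨h1, c, rfl⟩ := hT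
  rw [ten_tens]
  intro h2
  have h3 : (oproj q').mulVec q.rep ≠ 0 := fun h3 => h <| by
    rw [oproj.eq_1 q, Matrix.mul_smul, Matrix.mul_vecMulVec, h3]
    simp
  obtain ⟨j, hj⟩ := ne_iff.1 h3
  have h4 : c = 0 := funext fun k => by
    have := congrFun h2 (fun _ => j, k)
    exact (by simpa [tens, mono] using this : _ ∨ _).resolve_left hj
  rw [h4, lam_tens] at h1
  simp at h1

end LocalLift

section Lifts

variable {M N m D n : ℕ} {z : Forms N m D} {T : ℂ^M → Tens N m D}
  {X : Set (ProjSp N)} {S K : Set ℂ^M} {ψ ψ' : ℂ^M → ProjSp N}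

theorem exists_lift_step (hS : IsAffineVariety S) (hK : IsCompact K) (hKc : PolyConvex K)
    (hKS : K ⊆ S) (hz : IsCutOut X z) (hX : ∀ p ∈ K, ψ' p ∈ X) (h1 : ∀ p ∈ K, HolProjAt S p ψ)
    (h2 : ∀ p ∈ K, HolProjAt S p ψ') (hT : ∀ p ∈ K, IsLiftAt S z ψ T p)
    (h0 : ∀ p ∈ K, (oproj (ψ' p) * oproj (ψ p)).trace ≠ 0) :
    ∃ T' : ℂ^M → Tens N m D, ∀ p ∈ K, IsLiftAt S z ψ' T' p := by
  have hSc := hS.isClosed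
  have hne : ∀ p ∈ K, ten (oproj (ψ' p)) (T p) ≠ 0 := fun p hp =>
    ten_oproj_ne_zero ((hT p hp).2.self_of_nhdsWithin (hKS hp)) (h0 p hp)
  obtain ⟨θ, hθ0, hθ⟩ := exists_mul_holOnS hS hK hKc
    (fun a x => ten (oproj (ψ' x)) (T x) a) (fun p hp => ne_iff.1 (hne p hp))
    (fun p hp => by
      obtain ⟨κ, R, hκ, hR, e⟩ := (h1 p hp).exists_smul (hKS hp) (h2 p hp) (hT p hp).1 (hT p hp).2
      filter_upwards [hκ, eventually_all.2 fun a => (hR a).eventually,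
        eventually_nhdsWithin_iff.1 (eventually_eventually_nhdsWithin.2 e)] with x a1 a2 a3 a
      by_cases hx : x ∈ S
      · refine ((a1 hx).mul ((a2 a).continuousWithinAt hx)).congr_of_eventuallyEq
          ((a3 hx).mono fun y hy => congrFun hy a) (congrFun ((a3 hx).self_of_nhdsWithin hx) a)
      · exact continuousWithinAt_of_notMem_closure (by rwa [hSc.closure_eq]))
    (fun p hp => by
      obtain ⟨κ, R, hκ, hR, e⟩ := (h1 p hp).exists_smul (hKS hp) (h2 p hp) (hT p hp).1 (hT p hp).2
      have b1 : κ p ≠ 0 := fun h => hne p hp <| by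
        rw [e.self_of_nhdsWithin (hKS hp), h, zero_smul]
      have b2 : ∀ᶠ x in 𝓝[S] p, κ x / κ p ∈ Complex.slitPlane :=
        ((hκ.self_of_nhds (hKS hp)).div_const _).eventually_mem <|
          Complex.isOpen_slitPlane.mem_nhds <| by simp [b1]
      refine ⟨fun x => -log (κ x / κ p), ?_, ?_⟩
      · filter_upwards [hκ, eventually_nhdsWithin_iff.1 b2] with x a1 a2
        by_cases hx : x ∈ S
        · exact (((a1 hx).div_const _).clog (a2 hx)).neg
        · exact continuousWithinAt_of_notMem_closure (by rwa [hSc.closure_eq])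
      · filter_upwards [eventually_all.2 fun a => (hR a).eventually,
          eventually_nhdsWithin_iff.1 (eventually_eventually_nhdsWithin.2 (e.and b2))] with x a1 a2 a
        by_cases hx : x ∈ S
        · refine ((holOnS_const (κ p)).fun_mul (a1 a)).congr ?_
          filter_upwards [a2 hx] with y ⟨c1, c2⟩
          have c3 := Complex.slitPlane_ne_zero c2
          rw [Complex.exp_neg, Complex.exp_log c3, c1, Pi.smul_apply, smul_eq_mul]
          have c4 : κ y ≠ 0 := fun h => c3 (by simp [h])
          field_simp
        · exact holOnS_of_notMem hSc hx)
  have hζ : ∀ p ∈ K, ∀ j : Fin m × Fin m, HolOnS S p fun x =>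
      ∑ α, z j.1 α * (θ x * ten (oproj (ψ' x)) (T x) (α, j.2)) := fun p hp j =>
    HolOnS.fun_sum fun α _ => (holOnS_const _).fun_mul (hθ p hp _)
  have hζe : ∀ x c, ten (oproj (ψ' x)) (T x) = tens (ψ' x).rep c → ∀ j : Fin m × Fin m,
      ∑ α, z j.1 α * (θ x * ten (oproj (ψ' x)) (T x) (α, j.2)) =
        θ x * (c j.2 * zform z j.1 (ψ' x).rep) := fun x c hc j => by
    simp only [hc, tens, zform, mul_sum]
    exact sum_congr rfl fun _ _ => by ring
  obtain ⟨B, hB⟩ := exists_poly_bezout hS hK hKc hKS hζ fun p hp => by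
    obtain ⟨c, hc⟩ := exists_ten_oproj (ψ' p) (T p)
    obtain ⟨s, -, hs⟩ := hz
    obtain ⟨k, hk⟩ := ((hs _ (ψ' p).rep_nonzero).1 (by rw [Projectivization.mk_rep]; exact hX p hp)).2
    have hc0 : c ≠ 0 := fun h => hne p hp <| by
      rw [hc, h]
      funext
      simp [tens]
    obtain ⟨l, hl⟩ := ne_iff.1 hc0
    exact ⟨(k, l), by rw [hζe p c hc]; exact mul_ne_zero (hθ0 p) (mul_ne_zero hl hk)⟩
  set μ : ℂ^M → ℂ := fun x => ∑ j, eval x (B j) *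
    ∑ α, z j.1 α * (θ x * ten (oproj (ψ' x)) (T x) (α, j.2)) with hμ
  have hμh : ∀ p ∈ K, HolOnS S p μ := fun p hp =>
    HolOnS.fun_sum fun j _ => (holAt_eval _ _).holOnS.fun_mul (hζ p hp j)
  refine ⟨fun x a => (μ x)⁻¹ * ∑ l, eval x (B (a.2, l)) *
    (θ x * ten (oproj (ψ' x)) (T x) (a.1, l)), fun p hp => ⟨fun a => ?_, ?_⟩⟩
  · exact ((hμh p hp).inv (hKS hp) (hB p hp)).fun_mul <|
      HolOnS.fun_sum fun j _ => (holAt_eval _ _).holOnS.fun_mul (hθ p hp _)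
  · filter_upwards [((hμh p hp).continuousWithinAt (hKS hp)).eventually_ne (hB p hp)] with x hx
    constructor
    · refine Eq.trans ?_ (inv_mul_cancel₀ hx)
      simp only [lam, hμ, Fintype.sum_prod_type, mul_sum]
      refine sum_congr rfl fun k _ => ?_
      rw [sum_comm]
      exact sum_congr rfl fun l _ => sum_congr rfl fun α _ => by ring
    · obtain ⟨c, hc⟩ := exists_ten_oproj (ψ' x) (T x)
      refine ⟨fun k => (μ x)⁻¹ * ∑ l, eval x (B (k, l)) * (θ x * c l), ?_⟩
      funext a
      simp only [hc, tens, mul_sum]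
      exact sum_congr rfl fun l _ => by ring

variable {φ : (Fin n → ℝ) → ℂ^M → ProjSp N}

theorem eventually_forall_ne {F : (Fin n → ℝ) → ℂ^M → ℂ} (hK : IsCompact K)
    (hF : ContinuousOn (fun q : (Fin n → ℝ) × ℂ^M => F q.1 q.2) (unitCube n ×ˢ K))
    {t : Fin n → ℝ} (ht : t ∈ unitCube n) (h0 : ∀ p ∈ K, F t p ≠ 0) :
    ∀ᶠ s in 𝓝 t, ∀ p ∈ K, s ∈ unitCube n → p ∈ K → F s p ≠ 0 :=
  hK.eventually_forall_of_forall_eventually fun p hp =>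
    (eventually_nhdsWithin_iff.1 ((hF (t, p) ⟨ht, hp⟩).eventually_ne (h0 p hp))).mono
      fun _ h h1 h2 => h ⟨h1, h2⟩

theorem _root_.ContinuousOn.const_left {A B Y : Type*} [TopologicalSpace A] [TopologicalSpace B]
    [TopologicalSpace Y] {F : A → B → Y} {s : Set A} {t : Set B}
    (h : ContinuousOn (fun q : A × B => F q.1 q.2) (s ×ˢ t)) {a : A} (ha : a ∈ s) :
    ContinuousOn (fun q : A × B => F a q.2) (s ×ˢ t) :=
  h.comp (f := fun q : A × B => (a, q.2)) (continuous_const.prodMk continuous_snd).continuousOn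
    fun _ hq => mk_mem_prod ha hq.2

theorem isPreconnected_unitCube (n : ℕ) : IsPreconnected (unitCube n) := by
  have h : unitCube n = Icc 0 1 := by
    ext t
    simp [unitCube, Pi.le_def, forall_and]
  rw [h]
  exact (convex_Icc 0 1).isPreconnected

theorem eventually_trace_ne_zero (hK : IsCompact K)
    (hφc : ContinuousOn (fun q : (Fin n → ℝ) × ℂ^M => φ q.1 q.2) (unitCube n ×ˢ K))
    {s : Fin n → ℝ} (hs : s ∈ unitCube n) : ∀ᶠ t in 𝓝 s, ∀ p ∈ K, t ∈ unitCube n → p ∈ K →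
      (oproj (φ t p) * oproj (φ s p)).trace ≠ 0 := by
  have h2 := hφc.const_left hs
  have h3 := continuous_oproj.comp_continuousOn hφc
  have h4 := continuous_oproj.comp_continuousOn h2
  have h5 : ContinuousOn (fun q : (Fin n → ℝ) × ℂ^M =>
    (oproj (φ q.1 q.2) * oproj (φ s q.2)).trace) (unitCube n ×ˢ K) := by
    exact (continuous_id.matrix_trace.comp_continuousOn (h3.mul h4))
  exact eventually_forall_ne (F := fun t p => (oproj (φ t p) * oproj (φ s p)).trace) hK h5
    hs fun p _ => (trace_oproj_mul_self _).trans_ne one_ne_zero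

theorem exists_lift (hS : IsAffineVariety S) (hK : IsCompact K) (hKc : PolyConvex K)
    (hKS : K ⊆ S) (hz : IsCutOut X z)
    (hφc : ContinuousOn (fun q : (Fin n → ℝ) × ℂ^M => φ q.1 q.2) (unitCube n ×ˢ K))
    (hφh : ∀ t ∈ unitCube n, ∀ p ∈ K, HolProjAt S p (φ t))
    (hφX : ∀ t ∈ unitCube n, ∀ p ∈ K, φ t p ∈ X) (hT : ∀ p ∈ K, IsLiftAt S z (φ 0) T p)
    {t : Fin n → ℝ} (ht : t ∈ unitCube n) :
    ∃ T : ℂ^M → Tens N m D, ∀ p ∈ K, IsLiftAt S z (φ t) T p := by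
  refine (isPreconnected_unitCube n).induction₂'
    (fun s t => (∃ T : ℂ^M → Tens N m D, ∀ p ∈ K,
    IsLiftAt S z (φ s) T p) → ∃ T : ℂ^M → Tens N m D, ∀ p ∈ K,
      IsLiftAt S z (φ t) T p) (fun s hs => ?_) (fun _ _ _ _ _ _ h1 h2 h => h2 (h1 h))
    (zero_mem_unitCube n) ht ⟨T, hT⟩
  filter_upwards [mem_nhdsWithin_of_mem_nhds (eventually_trace_ne_zero hK hφc hs),
    self_mem_nhdsWithin] with t h2 ht
  exact ⟨fun ⟨T, hT⟩ => exists_lift_step hS hK hKc hKS hz (hφX t ht) (hφh s hs) (hφh t ht) hT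
      fun p hp => h2 p hp ht hp, fun ⟨T, hT⟩ =>
    exists_lift_step hS hK hKc hKS hz (hφX s hs) (hφh t ht) (hφh s hs) hT fun p hp => by
      rw [Matrix.trace_mul_comm]
      exact h2 p hp ht hp⟩

end Lifts

section Family

variable {M N m D n : ℕ} {z : Forms N m D} {T : ℂ^M → Tens N m D}
  {X : Set (ProjSp N)} {S S' K : Set ℂ^M} {φ : (Fin n → ℝ) → ℂ^M → ProjSp N}

theorem ten_oproj_eq {q : ProjSp N} {B : Tens N m D} (h : LiesOver z B q) :
    ten (oproj q) B = B := by
  obtain ⟨-, c, rfl⟩ := h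
  have h1 := oproj_mulVec q.rep_nonzero q.rep
  rw [q.mk_rep, div_self (star_dotProduct_ne_zero q.rep_nonzero), one_smul] at h1
  rw [ten_tens, h1]

theorem continuousOn_ten_oproj {A : Type*} [TopologicalSpace A] {s : Set A} {ψ : A → ProjSp N}
    {B : A → Tens N m D} (hψ : ContinuousOn ψ s) (hB : ContinuousOn B s) :
    ContinuousOn (fun x => ten (oproj (ψ x)) (B x)) s := by
  have h1 := continuous_oproj.comp_continuousOn hψ
  refine continuousOn_pi.2 fun a => continuousOn_finsetSum _ fun β _ =>
    (continuousOn_finsetProd _ fun i _ => ?_).mul (continuousOn_pi.1 hB _)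
  exact continuousOn_pi.1 (continuousOn_pi.1 h1 _) _

theorem continuous_lam : Continuous (lam z) :=
  continuous_finsetSum _ fun _ _ => continuous_finsetSum _ fun _ _ =>
    continuous_const.mul (continuous_apply _)

theorem exists_finite_partition {C : Set (Fin n → ℝ)} (hC : IsCompact C)
    {V : (Fin n → ℝ) → Set (Fin n → ℝ)} (hV : ∀ x ∈ C, V x ∈ 𝓝 x) :
    ∃ (s : Finset (Fin n → ℝ)) (χ : s → (Fin n → ℝ) → ℝ), (∀ x ∈ s, x ∈ C) ∧
      (∀ i, Continuous (χ i)) ∧ (∀ i, tsupport (χ i) ⊆ V i) ∧ ∀ x ∈ C, ∑ i, χ i x = 1 := by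
  obtain ⟨s, hs, hc⟩ := hC.elim_nhds_subcover (fun x => interior (V x)) fun x hx =>
    interior_mem_nhds.2 (hV x hx)
  obtain ⟨χ, hχ⟩ := PartitionOfUnity.exists_isSubordinate hC.isClosed
    (fun i : s => interior (V i)) (fun i => isOpen_interior) (by simpa [iUnion_subtype] using hc)
  refine ⟨s, fun i => χ i, hs, fun i => (χ i).continuous,
    fun i => (hχ i).trans interior_subset, fun x hx => ?_⟩
  rw [← finsum_eq_sum_of_fintype]
  exact χ.sum_eq_one hx

theorem exists_lift_family (hKS : K ⊆ S) (hK : IsCompact K)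
    (hφc : ContinuousOn (fun q : (Fin n → ℝ) × ℂ^M => φ q.1 q.2) (unitCube n ×ˢ K))
    (hφh : ∀ t ∈ unitCube n, ∀ p ∈ K, HolProjAt S p (φ t))
    (hT : ∀ t ∈ unitCube n, ∃ T : ℂ^M → Tens N m D,
      ∀ p ∈ K, IsLiftAt S z (φ t) T p) :
    ∃ T : (Fin n → ℝ) → ℂ^M → Tens N m D,
      ContinuousOn (fun q : (Fin n → ℝ) × ℂ^M => T q.1 q.2) (unitCube n ×ˢ K) ∧
      ∀ t ∈ unitCube n, ∀ p ∈ K, IsLiftAt S z (φ t) (T t) p := by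
  choose! T hT using hT
  have hTc : ∀ s ∈ unitCube n, ContinuousOn
      (fun q : (Fin n → ℝ) × ℂ^M => T s q.2) (unitCube n ×ˢ K) := fun s hs =>
    ContinuousOn.comp (t := K) (g := T s) (fun p hp => continuousWithinAt_pi.2 fun a =>
      (((hT s hs p hp).1 a).continuousWithinAt (hKS hp)).mono hKS) continuousOn_snd
      fun q hq => hq.2
  have hR : ∀ s ∈ unitCube n, ContinuousOn (fun q : (Fin n → ℝ) × ℂ^M =>
      ten (oproj (φ q.1 q.2)) (T s q.2)) (unitCube n ×ˢ K) := fun s hs =>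
    continuousOn_ten_oproj hφc (hTc s hs)
  have hF : ∀ s ∈ unitCube n, ContinuousOn (fun q : (Fin n → ℝ) × ℂ^M =>
      lam z (ten (oproj (φ q.1 q.2)) (T s q.2))) (unitCube n ×ˢ K) := fun s hs =>
    continuous_lam.comp_continuousOn (hR s hs)
  obtain ⟨J, χ, hJ, hχ, hχV, hχ1⟩ := exists_finite_partition (isCompact_unitCube n)
    (V := fun s => {t | ∀ p ∈ K, t ∈ unitCube n → p ∈ K →
      lam z (ten (oproj (φ t p)) (T s p)) ≠ 0}) fun s hs =>
    eventually_forall_ne (F := fun t p => lam z (ten (oproj (φ t p)) (T s p))) hK (hF s hs) hs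
      fun p hp => by
        have h := (hT s hs p hp).2.self_of_nhdsWithin (hKS hp)
        rw [ten_oproj_eq h, h.1]
        exact one_ne_zero
  have hne : ∀ t ∈ unitCube n, ∀ i, χ i t ≠ 0 → ∀ p ∈ K,
      lam z (ten (oproj (φ t p)) (T i p)) ≠ 0 := fun t ht i hi p hp =>
    hχV i (subset_tsupport _ hi) p hp ht hp
  refine ⟨fun t x => ∑ i, ((χ i t : ℝ) : ℂ) • ((lam z (ten (oproj (φ t x)) (T i x)))⁻¹ •
    ten (oproj (φ t x)) (T i x)), continuousOn_finsetSum _ fun i _ => ?_,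
    fun t ht p hp => ?_⟩
  · rintro ⟨t, p⟩ ⟨ht, hp⟩
    by_cases h : t ∈ tsupport (χ i)
    · exact (Complex.continuous_ofReal.comp
        ((hχ i).comp continuous_fst)).continuousWithinAt.smul
        (((hF i (hJ i i.2) (t, p) ⟨ht, hp⟩).inv₀ (hχV i h p hp ht hp)).smul
          (hR i (hJ i i.2) (t, p) ⟨ht, hp⟩))
    · have h1 : ∀ᶠ q : (Fin n → ℝ) × ℂ^M in 𝓝 (t, p), χ i q.1 = 0 :=
        (continuous_fst.tendsto (t, p)).eventually (notMem_tsupport_iff_eventuallyEq.1 h)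
      refine (ContinuousAt.congr (f := fun _ => 0) continuousAt_const ?_).continuousWithinAt
      filter_upwards [h1] with q hq
      rw [hq, Complex.ofReal_zero, zero_smul]
  · have h1 : ∀ i, χ i t ≠ 0 → _ := fun i hi => (hT i (hJ i i.2) p hp).normalise (hKS hp)
      (hφh i (hJ i i.2) p hp) (hφh t ht p hp) (hne t ht i hi p hp)
    refine ⟨fun a => ?_, ?_⟩
    · simp only [Finset.sum_apply, Pi.smul_apply (_ : ℂ), smul_eq_mul]
      refine HolOnS.fun_sum fun i _ => ?_
      by_cases hi : χ i t = 0
      · simpa [hi] using holOnS_const 0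
      · exact (holOnS_const _).fun_mul ((h1 i hi).1 a)
    · have h2 : ∀ᶠ x in 𝓝[S] p, ∀ i, χ i t ≠ 0 → _ := eventually_all.2 fun i => by
        by_cases hi : χ i t = 0
        · exact Eventually.of_forall fun x h => absurd hi h
        · exact (h1 i hi).2.mono fun x hx _ => hx
      filter_upwards [h2] with x hx
      refine liesOver_sum _ (fun i _ => ?_) ?_
      · obtain ⟨c, hc⟩ := exists_ten_oproj (φ t x) (T i x)
        exact ⟨_ • c, by rw [hc, tens_smul_right]⟩
      · rw [← Complex.ofReal_one, ← hχ1 t ht, Complex.ofReal_sum]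
        refine sum_congr rfl fun i _ => ?_
        by_cases hi : χ i t = 0
        · rw [hi, Complex.ofReal_zero, zero_mul]
        · rw [(hx i hi).1, mul_one]

end Family

section TensorHomotopy

variable {M N m D n : ℕ} {z : Forms N m D}
  {X : Set (ProjSp N)} {S K : Set ℂ^M} {φ : (Fin n → ℝ) → ℂ^M → ProjSp N}

/-- A homotopy whose initial map has a polynomial lift can be lifted. -/
theorem exists_tensor_homotopy (hS : IsAffineVariety S) (hK : IsCompact K) (hKc : PolyConvex K)
    (hKS : K ⊆ S) (hz : IsCutOut X z)
    (hφc : ContinuousOn (fun q : (Fin n → ℝ) × ℂ^M => φ q.1 q.2) (unitCube n ×ˢ K))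
    (hφh : ∀ t ∈ unitCube n, ∀ p ∈ K, HolProjAt S p (φ t))
    (hφX : ∀ t ∈ unitCube n, ∀ p ∈ K, φ t p ∈ X) {G : ℂ^M → Tens N m D}
    (hG : ∀ a, PolyFun fun x => G x a) (hG0 : ∀ p ∈ K, ∀ᶠ x in 𝓝[S] p, LiesOver z (G x) (φ 0 x)) :
    ∃ g : (Fin n → ℝ) → ℂ^M → Tens N m D,
      ContinuousOn (fun q : (Fin n → ℝ) × ℂ^M => g q.1 q.2) (unitCube n ×ˢ K) ∧
      (∀ t ∈ unitCube n, ∀ p ∈ K, ∀ b, HolOnS S p fun x => g t x b) ∧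
      ∀ t ∈ unitCube n, ∀ p ∈ K, ∀ᶠ x in 𝓝[S] p, LiesOver z (g t x) (φ t x) ∧
        (LiesOver z (G x) (φ t x) → g t x = G x) := by
  obtain ⟨T, hTc, hT⟩ := exists_lift_family hKS hK hφc hφh fun t ht =>
    exists_lift hS hK hKc hKS hz hφc hφh hφX (T := G)
      (fun p hp => ⟨fun a => HolOnS.polyFun (hG a) holOnS_apply, hG0 p hp⟩) ht
  have hcorr : ∀ a, PolyFun fun y : TIdx N m D ⊕ TIdx N m D → ℂ =>
      corr z (fun a => y (.inl a)) (fun a => y (.inr a)) a := fun a =>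
    PolyFun.corr (fun a => .coord _) (fun a => .coord _) a
  refine ⟨fun t x => corr z (T t x) (G x - T t x), ?_, fun t ht p hp b => ?_,
    fun t ht p hp => (hT t ht p hp).2.mono fun x hx => ⟨hx.corr _, hx.corr_sub⟩⟩
  · have h1 : ContinuousOn (fun q : (Fin n → ℝ) × ℂ^M => G q.2) (unitCube n ×ˢ K) :=
      (continuous_pi fun a => (hG a).continuous.comp continuous_snd).continuousOn
    exact (continuous_pi fun a => (hcorr a).continuous).comp_continuousOn
      (hTc.sumElim (h1.sub hTc))
  · exact HolOnS.polyFun (h := fun x => elim (T t x) (G x - T t x)) (hcorr b)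
      fun i => i.casesOn (hT t ht p hp).1 fun a =>
        (HolOnS.polyFun (hG a) holOnS_apply).fun_sub ((hT t ht p hp).1 a)

theorem continuousAt_projMk {q : ProjSp N} {v : ℂ^(N + 1)} (hv : v ≠ 0) :
    ContinuousAt (fun v => @dite _ (v ≠ 0) (Classical.propDecidable _)
      (fun h => (mk ℂ v h : ProjSp N)) fun _ => q) v := by
  refine ContinuousOn.continuousAt (s := {v | v ≠ 0}) ?_ (isOpen_ne.mem_nhds hv)
  rw [continuousOn_iff_continuous_domRestrict]
  refine (continuous_quot_mk (r := (projectivizationSetoid ℂ ℂ^(N + 1)).r)).congr fun v => ?_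
  have h : v.1 ≠ 0 := v.2
  simp only [Set.domRestrict_apply, dif_pos h]
  rfl

theorem continuous_projT : Continuous fun T : jou X z => projT z T.1 := by
  refine continuous_iff_continuousAt.2 fun T => ?_
  obtain ⟨k, hk⟩ := (liesOver_projT T.2).exists_col
  have h1 : Continuous fun T : jou X z => fun i => pr z T.1 i k :=
    (continuous_pi fun i => (PolyFun.pr (G := fun T => T) (fun a => .coord a) i k).continuous).comp
      continuous_subtype_val
  have h2 : (fun i => pr z T.1 i k) ≠ 0 := fun h => hk (congrFun h k)
  refine (ContinuousAt.comp (f := fun T : jou X z => fun i => pr z T.1 i k)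
    (continuousAt_projMk (q := projT z T.1) h2) h1.continuousAt).congr ?_
  filter_upwards [h1.continuousAt.eventually_ne h2] with T' hT'
  exact (dif_pos hT').trans ((liesOver_projT T'.2).eq_mk_col hT').symm

end TensorHomotopy

theorem exists_forall_dist_lt {A B : Type*} [MetricSpace A] [t : TopologicalSpace B]
    (d : MetricSpace B) (hd : d.toPseudoMetricSpace.toUniformSpace.toTopologicalSpace = t)
    {P : A → B} (hP : Continuous P) {C : Set A} (hC : IsCompact C) {ε : ℝ} (hε : 0 < ε) :
    ∃ δ > 0, ∀ a ∈ C, ∀ b, dist a b < δ →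
      @dist _ d.toPseudoMetricSpace.toDist (P a) (P b) < ε := by
  subst hd
  obtain ⟨δ, hδ, h⟩ := Metric.mem_uniformity_dist.1
    (hC.uniformContinuousAt_of_continuousAt P (fun a _ => hP.continuousAt)
      (Metric.dist_mem_uniformity hε))
  exact ⟨δ, hδ, fun a ha b hab => h hab ha⟩

theorem exists_morphism_approx_rel {M N nX n : ℕ}
    (S : Set ℂ^M) (hS : IsAffineVariety S)
    (X : Set (ProjSp N)) (hX : IsAlgebraicManifold X nX)
    (hXell : IsAlgebraicallyElliptic nX X)
    (f : ↥S → ↥X) (hf : MorphismToProjOf S (fun p => (↑(f p) : ProjSp N)))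
    (K : Set ↥S) (hK : IsRungeCompactIn S K)
    (U : Set ↥S) (hU : IsOpen U) (hKU : K ⊆ U)
    (fam : (Fin n → ℝ) → ↥S → ↥X)
    (hfamcont : ContinuousOn (fun q : (Fin n → ℝ) × ↥S => fam q.1 q.2)
      (unitCube n ×ˢ U))
    (hfamhol : ∀ t ∈ unitCube n, HoloToProjOn S (fun p => (↑(fam t p) : ProjSp N)) U)
    (hfam0 : ∀ x ∈ U, fam 0 x = f x)
    (dX : MetricSpace ↥X)
    (hdX : dX.toPseudoMetricSpace.toUniformSpace.toTopologicalSpace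
      = (inferInstance : TopologicalSpace ↥X))
    (S' : Set ℂ^M) (hS' : IsAffineVariety S') (hSS : S' ⊆ S)
    (hfix : ∀ t ∈ unitCube n, ∀ x : ↥S, (↑x : ℂ^M) ∈ S' → x ∈ U → fam t x = f x)
    {ε : ℝ} (hε : 0 < ε) :
    ∃ F : ↥(cylinderVariety n S) → ↥X,
      MorphismToProjOf (cylinderVariety n S) (fun p => (↑(F p) : ProjSp N)) ∧
      (∀ x : ↥S, F (cylPt x 0) = f x) ∧
      (∀ x ∈ K, ∀ t ∈ unitCube n, @dist _ dX.toPseudoMetricSpace.toDist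
        (F (cylPt x (fun i => (t i : ℂ)))) (fam t x) < ε) ∧
      ∀ x : ↥S, (↑x : ℂ^M) ∈ S' → ∀ t : ℂ^n, F (cylPt x t) = f x := by
  obtain ⟨⟨Y, Z, hY, hZ, hXYZ⟩, hsm⟩ := hX
  obtain ⟨D, m, z, hz⟩ := exists_isCutOut hY hZ
  rw [← hXYZ] at hz
  obtain ⟨ρ, _, σ, w, hσX, hσ0, hw, hstar⟩ := exists_spray_star hz hsm hXell
  have hKc := polyConvex_of_isRungeCompactIn hS hK
  have hKv : IsCompact (Subtype.val '' K : Set ℂ^M) := hK.1.image continuous_subtype_val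
  have hKS : Subtype.val '' K ⊆ S := Subtype.coe_image_subset S K
  obtain ⟨G, hG, hGf⟩ := exists_polyLift hS hz hf fun p => (f p).2
  obtain ⟨f', hf'⟩ := exists_evalMap_eq hG
  obtain ⟨O, hO, rfl⟩ := isOpen_induced_iff.1 hU
  have hKO : ∀ p ∈ Subtype.val '' K, p ∈ O := by
    rintro _ ⟨p, hp, rfl⟩
    exact hKU hp
  set φ : (Fin n → ℝ) → ℂ^M → ProjSp N := fun t x =>
    @dite _ (x ∈ S) (Classical.propDecidable _) (fun h => (fam t ⟨x, h⟩ : ProjSp N))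
      fun _ => mk ℂ 1 one_ne_zero with hφ
  have hφe : ∀ t (x : S), φ t x = fam t x := fun t x => dif_pos x.2
  have hφX : ∀ t ∈ unitCube n, ∀ p ∈ Subtype.val '' K, φ t p ∈ X := by
    rintro t - _ ⟨p, -, rfl⟩
    rw [hφe]
    exact (fam t p).2
  have hφc : ContinuousOn (fun q : (Fin n → ℝ) × ℂ^M => φ q.1 q.2)
      (unitCube n ×ˢ (Subtype.val '' K)) := by
    rw [continuousOn_iff_continuous_domRestrict]
    have h1 : Continuous fun q : ↥(unitCube n ×ˢ (Subtype.val '' K : Set ℂ^M)) =>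
        (q.1.1, (⟨q.1.2, hKS q.2.2⟩ : S)) := by fun_prop
    refine (continuous_subtype_val.comp (hfamcont.comp_continuous h1 fun q =>
      ⟨q.2.1, hKO _ q.2.2⟩)).congr fun q => (hφe _ ⟨q.1.2, hKS q.2.2⟩).symm
  have hφh : ∀ t ∈ unitCube n, ∀ p ∈ Subtype.val '' K, HolProjAt S p (φ t) := by
    rintro t ht _ ⟨p, hp, rfl⟩
    obtain ⟨W, hW, hpW, -, H, hH, h⟩ := hfamhol t ht p (hKU hp)
    refine ⟨H, fun j => HolAt.holOnS ?_, ?_⟩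
    · filter_upwards [hW.mem_nhds hpW] with x hx
      exact differentiableAt_pi.1 (hH.differentiableAt (hW.mem_nhds hx)) j
    · filter_upwards [self_mem_nhdsWithin, mem_nhdsWithin_of_mem_nhds (hW.mem_nhds hpW)] with x h1 h2
      rw [hφe t ⟨x, h1⟩]
      exact h ⟨x, h1⟩ h2
  obtain ⟨g, hgc, hgh, hg⟩ := exists_tensor_homotopy hS hKv hKc hKS hz hφc hφh hφX hG
    fun p hp => by
      filter_upwards [self_mem_nhdsWithin,
        mem_nhdsWithin_of_mem_nhds (hO.mem_nhds (hKO p hp))] with x h1 h2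
      rw [hφe 0 ⟨x, h1⟩, hfam0 ⟨x, h1⟩ h2]
      exact hGf ⟨x, h1⟩
  have hgL : ∀ t ∈ unitCube n, ∀ x ∈ K, LiesOver z (g t x) (fam t x) := fun t ht x hx => by
    rw [← hφe]
    exact ((hg t ht x ⟨x, hx, rfl⟩).self_of_nhdsWithin x.2).1
  have hgX : ∀ t ∈ unitCube n, ∀ x ∈ K, g t x ∈ jou X z := fun t ht x hx =>
    ⟨_, (fam t x).2, hgL t ht x hx⟩
  obtain ⟨δ, hδ, hP⟩ := exists_forall_dist_lt dX hdX
    (P := fun T : jou X z => (⟨projT z T.1, projT_mem T.2⟩ : X))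
    (continuous_projT.subtype_mk _)
    (C := Subtype.val ⁻¹' ((fun q : (Fin n → ℝ) × ℂ^M => g q.1 q.2) ''
      (unitCube n ×ˢ (Subtype.val '' K))))
    ((isAffineVariety_jou hz).isClosed.isClosedEmbedding_subtypeVal.isCompact_preimage
      (((isCompact_unitCube n).prod hKv).image_of_continuousOn hgc)) hε
  obtain ⟨F, hFX, hF0, hFS, hFε⟩ := exists_poly_of_spray (isAffineVariety_jou hz).isClosed σ w hσX
    hσ0 hw hstar hS hS' hSS hKv hKc hKS f' (fun x hx => by
      rw [hf']
      exact ⟨_, (f ⟨x, hx⟩).2, hGf ⟨x, hx⟩⟩) g hgc hgh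
    (fun t ht x ⟨p, hp, hpx⟩ => hpx ▸ hgX t ht p hp)
    (fun x ⟨p, hp, hpx⟩ => by
      subst hpx
      rw [hf']
      refine ((hg 0 (zero_mem_unitCube n) p ⟨p, hp, rfl⟩).self_of_nhdsWithin p.2).2 ?_
      rw [hφe, hfam0 p (hKU hp)]
      exact hGf p)
    (fun t ht => eventually_nhdsSet_iff_forall.2 fun p hp => by
      filter_upwards [eventually_nhdsWithin_iff.1 (hg t ht p hp), hO.mem_nhds (hKO p hp)]
        with x h1 h2 h3
      rw [hf']
      refine (h1 (hSS h3)).2 ?_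
      rw [hφe t ⟨x, hSS h3⟩, hfix t ht ⟨x, hSS h3⟩ h3 h2]
      exact hGf ⟨x, hSS h3⟩) (half_pos hδ)
  have hcyl : ∀ p : ↥(cylinderVariety n S), evalMap F p.1 ∈ jou X z := fun p => by
    have h1 : elim (fun i => p.1 (.inl i)) (fun i => p.1 (.inr i)) = p.1 :=
      Sum.elim_comp_inl_inr p.1
    rw [← h1]
    exact hFX _ p.2 _
  have hFf : ∀ (x : S) (t : ℂ^n), evalMap F (elim x t) = evalMap f' x →
      (⟨projT z (evalMap F (cylPt x t).1), projT_mem (hcyl (cylPt x t))⟩ : X) = f x :=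
    fun x t h => Subtype.ext <| by
      have h1 := hGf x
      rw [← hf', ← h] at h1
      exact h1.projT_eq
  refine ⟨fun p => ⟨projT z (evalMap F p.1), projT_mem (hcyl p)⟩,
    morphism_projT (evalMap_polyFun F) fun p => liesOver_projT (hcyl p),
    fun x => hFf x 0 (hF0 x x.2), fun x hx t ht => ?_, fun x hx t => hFf x t (hFS x hx t)⟩
  have h1 := hP ⟨g t x, hgX t ht x hx⟩ ⟨(t, x), ⟨ht, x, hx, rfl⟩, rfl⟩
    ⟨evalMap F (cylPt x (toCx t)).1, hcyl _⟩ (by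
      rw [dist_comm]
      exact (hFε x ⟨x, hx, rfl⟩ t ht).trans_lt (half_lt_self hδ))
  rw [@dist_comm _ dX.toPseudoMetricSpace]
  have h2 : (⟨projT z (g t x), projT_mem (hgX t ht x hx)⟩ : X) = fam t x :=
    Subtype.ext (hgL t ht x hx).projT_eq
  rw [← h2]
  exact h1

/-- Let `Σ` be an affine algebraic variety and `X` an algebraically
elliptic (algebraic) manifold.  Given a morphism `f : Σ → X`, a compact holomorphically
convex set `K ⊆ Σ`, an open neighbourhood `U ⊇ K`, and a homotopy of holomorphic maps
`f_t : U → X` for `t ∈ [0,1]ⁿ` with `f_0 = f|_U`, there are morphisms `F : Σ × ℂⁿ → X` with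
`F(·,0) = f` such that `F(·,t)` approximates `f_t` as closely as desired uniformly on
`K × [0,1]ⁿ`.  If in addition the homotopy is fixed on a closed algebraic subvariety
`Σ' ⊆ Σ`, then `F` can be chosen with `F(x,t) = f(x)` for all `x ∈ Σ'` and `t ∈ ℂⁿ`. -/
theorem algebraic_homotopy_approximation {M N nX n : ℕ}
    (S : Set ℂ^M) (hS : IsAffineVariety S)
    (X : Set (ProjSp N)) (hX : IsAlgebraicManifold X nX)
    (hXell : IsAlgebraicallyElliptic nX X)
    (f : ↥S → ↥X) (hf : MorphismToProjOf S (fun p => (↑(f p) : ProjSp N)))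
    (K : Set ↥S) (hK : IsRungeCompactIn S K)
    (U : Set ↥S) (hU : IsOpen U) (hKU : K ⊆ U)
    (fam : (Fin n → ℝ) → ↥S → ↥X)
    (hfamcont : ContinuousOn (fun q : (Fin n → ℝ) × ↥S => fam q.1 q.2)
      (unitCube n ×ˢ U))
    (hfamhol : ∀ t ∈ unitCube n, HoloToProjOn S (fun p => (↑(fam t p) : ProjSp N)) U)
    (hfam0 : ∀ x ∈ U, fam 0 x = f x)
    (dX : MetricSpace ↥X)
    (hdX : dX.toPseudoMetricSpace.toUniformSpace.toTopologicalSpace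
      = (inferInstance : TopologicalSpace ↥X)) :
    (∀ ε : ℝ, 0 < ε →
      ∃ F : ↥(cylinderVariety n S) → ↥X,
        MorphismToProjOf (cylinderVariety n S) (fun p => (↑(F p) : ProjSp N)) ∧
        (∀ x : ↥S, F (cylPt x 0) = f x) ∧
        ∀ x ∈ K, ∀ t ∈ unitCube n,
          @dist _ dX.toPseudoMetricSpace.toDist
            (F (cylPt x (fun i => (t i : ℂ)))) (fam t x) < ε) ∧
    (∀ S' : Set ℂ^M, IsAffineVariety S' → S' ⊆ S →
      (∀ t ∈ unitCube n, ∀ x : ↥S, (↑x : ℂ^M) ∈ S' → x ∈ U → fam t x = f x) →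
      ∀ ε : ℝ, 0 < ε →
      ∃ F : ↥(cylinderVariety n S) → ↥X,
        MorphismToProjOf (cylinderVariety n S) (fun p => (↑(F p) : ProjSp N)) ∧
        (∀ x : ↥S, F (cylPt x 0) = f x) ∧
        (∀ x ∈ K, ∀ t ∈ unitCube n,
          @dist _ dX.toPseudoMetricSpace.toDist
            (F (cylPt x (fun i => (t i : ℂ)))) (fam t x) < ε) ∧
        ∀ x : ↥S, (↑x : ℂ^M) ∈ S' → ∀ t : ℂ^n, F (cylPt x t) = f x) := by
  have h := exists_morphism_approx_rel S hS X hX hXell f hf K hK U hU hKU fam hfamcont hfamhol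
    hfam0 dX hdX
  refine ⟨fun ε hε => ?_, fun S' hS' hSS hfix ε hε => h S' hS' hSS hfix hε⟩
  obtain ⟨F, h1, h2, h3, -⟩ := h ∅ ⟨{1}, by simp [AffZeroLocus]⟩
    (empty_subset S) (fun _ _ _ h => absurd h (notMem_empty _)) hε
  exact ⟨F, h1, h2, h3⟩
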